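/- Let 1 < p₁, p₂, q₁, q₂ ≤ ∞ and 1/2 < s₁, s₂ < ∞ with 1/p_i + 1/q_i = 1/s_i for i = 1, 2. Then there is a constant C, depending only on φ and the exponents, such that for every finite set Λ ⊆ ℤ² and all Schwartz functions f, g : ℝ² → ℂ: ‖ (Π⊗Π)_Λ(f,g) ‖_{L^{s₁}_x L^{s₂}_y} ≤ C · ‖f‖_{L^{p₁}_x L^{p₂}_y} · ‖g‖_{L^{q₁}_x L^{q₂}_y}, where (Π⊗Π)_Λ(f,g)(x,y) := Σ_{(k,l)∈Λ} ((f ∗ (φ_k ⊗ φ_l)) · (g ∗ (ψ_k ⊗ ψ_l))) ∗ (ψ_k ⊗ ψ_l)(x,y) is the (truncated) model biparameter paraproduct; here (u ⊗ v)(x,y) := u(x)v(y) and ∗ denotes convolution on ℝ². (This is the paper's mixed norm estimate Π ⊗ Π : L^{p₁}_x L^{p₂}_y × L^{q₁}_x L^{q₂}_y → L^{s₁}_x L^{s₂}_y for the model biparameter paraproduct.) -/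

import Mathlib

section

open MeasureTheory ENNReal NNReal

/-- Convolution on `ℝ²`: `(f ∗ g)(z) = ∫ f(t) g(z − t) dt`. -/
noncomputable def conv2 (f g : ℝ × ℝ → ℂ) : ℝ × ℝ → ℂ :=
  fun z => ∫ t : ℝ × ℝ, f t * g (z - t)

/-- The Fourier transform `f̂(ξ) = ∫ f(x) e^{−2πixξ} dx` on `ℝ`. -/
noncomputable def ft1 (f : ℝ → ℂ) (ξ : ℝ) : ℂ :=
  ∫ x, f x * Complex.exp (((-2) * Real.pi * x * ξ : ℝ) * Complex.I)

/-- The `L¹`-normalized dyadic dilation `u_k(x) = 2^k u(2^k x)`. -/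
noncomputable def dil (u : ℝ → ℂ) (k : ℤ) : ℝ → ℂ :=
  fun x => (2 : ℂ) ^ k * u ((2 : ℝ) ^ k * x)

/-- The function `ψ` with `ψ̂(ξ) = φ̂(ξ/2) − φ̂(ξ)`, i.e. `ψ(x) = 2φ(2x) − φ(x)`. -/
noncomputable def psiOf (φ : ℝ → ℂ) : ℝ → ℂ := fun x => 2 * φ (2 * x) - φ x

/-- Tensor product `(u ⊗ v)(x,y) = u(x) v(y)`. -/
def tens (u v : ℝ → ℂ) : ℝ × ℝ → ℂ := fun z => u z.1 * v z.2

/-- The truncated model biparameter paraproduct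
`(Π⊗Π)_Λ(f,g) = Σ_{(k,l)∈Λ} ((f ∗ (φ_k⊗φ_l))·(g ∗ (ψ_k⊗ψ_l))) ∗ (ψ_k⊗ψ_l)`. -/
noncomputable def biPara (φ : ℝ → ℂ) (Λ : Finset (ℤ × ℤ)) (f g : ℝ × ℝ → ℂ) :
    ℝ × ℝ → ℂ :=
  fun z => ∑ kl ∈ Λ,
    conv2 (fun w => conv2 f (tens (dil φ kl.1) (dil φ kl.2)) w *
        conv2 g (tens (dil (psiOf φ) kl.1) (dil (psiOf φ) kl.2)) w)
      (tens (dil (psiOf φ) kl.1) (dil (psiOf φ) kl.2)) z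

/-- The Lebesgue (quasi)norm with exponent `t ∈ (0, ∞]` of an `ℝ≥0∞`-valued function,
interpreted as the essential supremum when `t = ∞`. -/
noncomputable def LqNorm {X : Type*} [MeasurableSpace X] (μ : Measure X) (t : ℝ≥0∞)
    (φ : X → ℝ≥0∞) : ℝ≥0∞ :=
  if t = ∞ then essSup φ μ else (∫⁻ x, φ x ^ t.toReal ∂μ) ^ (1 / t.toReal)

/-- The mixed quasinorm `‖h‖_{L^{a}_x L^{b}_y}` of a function on `ℝ²`. -/
noncomputable def mixedNorm (a b : ℝ≥0∞) (h : ℝ × ℝ → ℂ) : ℝ≥0∞ :=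
  LqNorm volume a (fun x => LqNorm volume b (fun y => (‖h (x, y)‖₊ : ℝ≥0∞)))

end

namespace BiPara

open MeasureTheory ENNReal
open scoped ComplexConjugate NNReal
open Complex (I exp norm_real)
open ENNReal (ofReal)
open Finset (filter_subset measurable_sum mem_filter mul_sum sum_coe_sort sum_comm sum_congr sum_insert sum_le_sum)
open Function (Injective uncurry)
open Real (norm_of_nonneg pi)
open Set (Icc Ioi disjoint_left indicator_of_mem indicator_of_notMem mem_iUnion mem_ofPred_eq)

noncomputable section

variable {A x y ρ : ℝ} {k k₀ : ℤ} {η θ ψ : ℝ → ℂ} {f g F G H : ℝ → ℝ → ℂ}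
  {p q s t : ℝ≥0∞} {h : ℝ → ℝ≥0∞} {K : Finset ℤ}

variable {ι : Type*} [MeasurableSpace ι] {μ : Measure ι}

lemma mul_mono {a b c : ℝ≥0∞} (h : b ≤ c) : a * b ≤ a * c := mul_le_mul' le_rfl h

lemma mul_rpow {a b : ℝ≥0∞} {r : ℝ} (h : 0 ≤ r) : (a * b) ^ r = a ^ r * b ^ r :=
  mul_rpow_of_nonneg a b h

lemma lint_const_mul {r : ℝ≥0∞} {f : ι → ℝ≥0∞}
    (h : r ≠ ∞) : ∫⁻ x, r * f x ∂μ = r * ∫⁻ x, f x ∂μ := lintegral_const_mul' r f h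

lemma int_congr {F : Type*} [NormedAddCommGroup F] [NormedSpace ℝ F] {f g : ι → F} (h : ∀ x, f x = g x) : ∫ x, f x ∂μ = ∫ x, g x ∂μ := by
  simp only [h]

/-- The index of the dyadic interval of length `2^{-k}` containing `x`. -/
def dix (k : ℤ) (x : ℝ) : ℤ := ⌊(2 : ℝ) ^ k * x⌋

/-- The dyadic interval `[n 2^{-k}, (n+1) 2^{-k})`. -/
def cell (k n : ℤ) : Set ℝ := {x | dix k x = n}

/-- The union of a dyadic interval and its two neighbours of the same length. -/
def cell3 (k n : ℤ) : Set ℝ := {x | |dix k x - n| ≤ 1}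

lemma mem_cell {n : ℤ} : x ∈ cell k n ↔ dix k x = n := Iff.rfl

lemma mem_cell3 {n : ℤ} : x ∈ cell3 k n ↔ |dix k x - n| ≤ 1 := Iff.rfl

lemma measurable_dix (k : ℤ) : Measurable (dix k) :=
  Int.measurable_floor.comp (measurable_const.mul measurable_id)

lemma measurableSet_cell (k n : ℤ) : MeasurableSet (cell k n) :=
  measurable_dix k (measurableSet_singleton n)

lemma measurableSet_cell3 (k n : ℤ) : MeasurableSet (cell3 k n) :=
  measurable_dix k (MeasurableSet.of_discrete (s := {m : ℤ | |m - n| ≤ 1}))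

lemma cell_eq_Ico (k n : ℤ) :
    cell k n = Set.Ico ((n : ℝ) * 2 ^ (-k)) (((n : ℝ) + 1) * 2 ^ (-k)) := by
  ext x
  have h : (0 : ℝ) < 2 ^ k := by positivity
  simp only [mem_cell, dix, Int.floor_eq_iff, Set.mem_Ico, zpow_neg, ← div_eq_mul_inv]
  rw [div_le_iff₀ h, lt_div_iff₀ h, mul_comm x]

lemma two_zpow_ne_zero (k : ℤ) : (2 : ℝ≥0∞) ^ k ≠ 0 :=
  (zpow_pos (by norm_num) (by norm_num) k).ne'

lemma two_zpow_ne_top (k : ℤ) : (2 : ℝ≥0∞) ^ k ≠ ∞ :=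
  (zpow_lt_top (by norm_num) (by norm_num) k).ne

lemma ofReal_two_zpow (k : ℤ) : ofReal ((2 : ℝ) ^ k) = 2 ^ k := by
  rcases Int.eq_nat_or_neg k with ⟨n, rfl | rfl⟩
  · rw [zpow_natCast, zpow_natCast, ofReal_pow (by norm_num)]; norm_num
  · rw [_root_.zpow_neg, ENNReal.zpow_neg, zpow_natCast, zpow_natCast, ofReal_inv_of_pos (by positivity),
      ofReal_pow (by norm_num)]; norm_num

lemma two_zpow_mul_neg (k : ℤ) : (2 : ℝ≥0∞) ^ k * 2 ^ (-k) = 1 := by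
  rw [← ENNReal.zpow_add (by norm_num) (by norm_num)]; simp

lemma volume_cell (k n : ℤ) : volume (cell k n) = 2 ^ (-k) := by
  rw [cell_eq_Ico, Real.volume_Ico, ← ofReal_two_zpow]
  congr 1; ring

lemma cell_nonempty (k n : ℤ) : (cell k n).Nonempty := by
  rw [cell_eq_Ico, Set.nonempty_Ico]
  have h : (0 : ℝ) < 2 ^ (-k) := by positivity
  nlinarith

lemma dix_eq_div {k' : ℤ} (h : k' ≤ k) (x : ℝ) : dix k' x = dix k x / (2 ^ (k - k').toNat : ℕ) := by
  rw [dix, dix, ← Int.floor_div_natCast]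
  congr 1
  obtain ⟨m, rfl⟩ : ∃ m : ℕ, k = k' + m := ⟨(k - k').toNat, by omega⟩
  have : (k' + (m : ℤ) - k').toNat = m := by omega
  rw [this, zpow_add₀ (by norm_num)]
  field_simp
  simp

lemma dix_congr {k' : ℤ} (h : k' ≤ k) (hxy : dix k x = dix k y) : dix k' x = dix k' y := by
  rw [dix_eq_div h, dix_eq_div h, hxy]

lemma dix_near {k' : ℤ} (h : k' ≤ k) (hxy : |dix k x - dix k y| ≤ 1) :
    |dix k' x - dix k' y| ≤ 1 := by
  rw [dix_eq_div h, dix_eq_div h y]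
  generalize dix k x = a at *
  generalize dix k y = b at *
  have hN : (0 : ℤ) < ((2 ^ (k - k').toNat : ℕ) : ℤ) := by positivity
  generalize ((2 ^ (k - k').toNat : ℕ) : ℤ) = N at *
  rw [abs_le] at *
  have key : ∀ c : ℤ, (c + 1) / N ≤ c / N + 1 := fun c => by
    calc (c + 1) / N ≤ (c + N) / N := Int.ediv_le_ediv hN (by omega)
      _ = c / N + 1 := Int.add_ediv_of_dvd_right (dvd_refl N) |>.trans (by rw [Int.ediv_self hN.ne'])
  have h1 := key a
  have h2 := key b
  have h3 : a / N ≤ (b + 1) / N := Int.ediv_le_ediv hN (by omega)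
  have h4 : b / N ≤ (a + 1) / N := Int.ediv_le_ediv hN (by omega)
  omega

lemma cell_subset_cell3 (k n : ℤ) : cell k n ⊆ cell3 k n := fun x hx => by
  rw [mem_cell] at hx; simp [mem_cell3, hx]

lemma cell3_subset (k n : ℤ) : cell3 k n ⊆ cell k (n - 1) ∪ (cell k n ∪ cell k (n + 1)) := by
  intro x hx
  simp only [mem_cell3, abs_le, Set.mem_union, mem_cell] at *
  omega

lemma volume_cell3_le (k n : ℤ) : volume (cell3 k n) ≤ 3 * 2 ^ (-k) := by
  refine (measure_mono (cell3_subset k n)).trans ((measure_union_le _ _).trans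
    ((add_le_add le_rfl (measure_union_le _ _)).trans ?_))
  simp only [volume_cell]
  apply le_of_eq; ring

lemma abs_sub_sub_dix_lt : |(2 : ℝ) ^ k * x - 2 ^ k * y - (dix k x - dix k y)| < 1 := by
  have h1 := Int.floor_le ((2 : ℝ) ^ k * x)
  have h2 := Int.lt_floor_add_one ((2 : ℝ) ^ k * x)
  have h3 := Int.floor_le ((2 : ℝ) ^ k * y)
  have h4 := Int.lt_floor_add_one ((2 : ℝ) ^ k * y)
  rw [abs_lt, dix, dix]; constructor <;> linarith

lemma dix_dist : |(2 : ℝ) ^ k * x - 2 ^ k * y| < |(dix k x : ℝ) - dix k y| + 1 := by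
  linarith [abs_sub_sub_dix_lt (k := k) (x := x) (y := y), abs_sub_abs_le_abs_sub
    ((2 : ℝ) ^ k * x - 2 ^ k * y) (dix k x - dix k y)]

lemma abs_sub_dix_lt : |(dix k x : ℝ) - dix k y| < |(2 : ℝ) ^ k * x - 2 ^ k * y| + 1 := by
  linarith [abs_sub_sub_dix_lt (k := k) (x := x) (y := y), abs_sub_abs_le_abs_sub
    (dix k x - dix k y : ℝ) ((2 : ℝ) ^ k * x - 2 ^ k * y), abs_sub_comm (dix k x - dix k y : ℝ)
    ((2 : ℝ) ^ k * x - 2 ^ k * y)]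

/-- Maximal dyadic intervals of a family whose lengths are bounded above. -/
lemma exists_maximal_cells (S : ℤ → ℤ → Prop) (k₀ : ℤ) (h : ∀ k n, S k n → k₀ ≤ k) :
    ∃ Q : Set (ℤ × ℤ), (∀ q ∈ Q, S q.1 q.2) ∧ Q.PairwiseDisjoint (fun q => cell q.1 q.2) ∧
      (∀ k n, S k n → ∃ q ∈ Q, q.1 ≤ k ∧ cell k n ⊆ cell q.1 q.2) ∧
      (∀ q ∈ Q, ∀ k' < q.1, ∀ x ∈ cell q.1 q.2, ¬ S k' (dix k' x)) := by
  refine ⟨{q | S q.1 q.2 ∧ ∀ k' < q.1, ∀ x ∈ cell q.1 q.2, ¬ S k' (dix k' x)},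
    fun q hq => hq.1, ?_, ?_, fun q hq => hq.2⟩
  · rintro ⟨k, n⟩ ⟨h1, h2⟩ ⟨k', n'⟩ ⟨h1', h2'⟩ hne
    refine disjoint_left.2 fun x hx hx' => hne ?_
    simp only [mem_cell] at hx hx' h1 h1' h2 h2'
    have e : k = k' := by
      rcases lt_trichotomy k k' with hlt | heq | hlt
      · exact absurd (hx ▸ h1) (h2' k hlt x hx')
      · exact heq
      · exact absurd (hx' ▸ h1') (h2 k' hlt x hx)
    subst e
    rw [← hx, ← hx']
  · intro k n hS
    obtain ⟨x, hx⟩ := cell_nonempty k n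
    have hex : ∃ j, j ≤ k ∧ S j (dix j x) := ⟨k, le_rfl, by rw [mem_cell.1 hx]; exact hS⟩
    obtain ⟨j, ⟨hjk, hj⟩, hmin⟩ := Int.exists_least_of_bdd
      (P := fun j => j ≤ k ∧ S j (dix j x)) ⟨k₀, fun z hz => h _ _ hz.2⟩ hex
    refine ⟨(j, dix j x), ⟨hj, fun k' hk' y hy hS' => ?_⟩, hjk, fun y hy => ?_⟩
    · have e := dix_congr hk'.le (mem_cell.1 hy)
      rw [e] at hS'
      have := hmin k' ⟨by omega, hS'⟩
      omega
    · exact dix_congr hjk ((mem_cell.1 hy).trans (mem_cell.1 hx).symm)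

/-- Average of `h` over the dyadic interval of length `2^{-k}` containing `x`. -/
def avg1 (k : ℤ) (h : ℝ → ℝ≥0∞) (x : ℝ) : ℝ≥0∞ :=
  2 ^ k * ∫⁻ y in cell k (dix k x), h y

/-- Average over the tripled dyadic interval (up to the factor `3`). -/
def avg3 (k : ℤ) (h : ℝ → ℝ≥0∞) (x : ℝ) : ℝ≥0∞ :=
  2 ^ k * ∫⁻ y in cell3 k (dix k x), h y

/-- The dyadic maximal function. -/
def Md (h : ℝ → ℝ≥0∞) (x : ℝ) : ℝ≥0∞ := ⨆ k : ℤ, avg1 k h x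

/-- The maximal function over tripled dyadic intervals. -/
def MM (h : ℝ → ℝ≥0∞) (x : ℝ) : ℝ≥0∞ := ⨆ k : ℤ, avg3 k h x

lemma measurable_avg1 (k : ℤ) (h : ℝ → ℝ≥0∞) : Measurable (avg1 k h) :=
  (Measurable.of_discrete (f := fun n : ℤ => 2 ^ k * ∫⁻ y in cell k n, h y)).comp (measurable_dix k)

lemma measurable_avg3 (k : ℤ) (h : ℝ → ℝ≥0∞) : Measurable (avg3 k h) :=
  (Measurable.of_discrete (f := fun n : ℤ => 2 ^ k * ∫⁻ y in cell3 k n, h y)).comp (measurable_dix k)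

lemma measurable_Md (h : ℝ → ℝ≥0∞) : Measurable (Md h) := .iSup fun k => measurable_avg1 k h

lemma measurable_MM (h : ℝ → ℝ≥0∞) : Measurable (MM h) := .iSup fun k => measurable_avg3 k h

lemma avg3_le_MM (k : ℤ) (h : ℝ → ℝ≥0∞) (x : ℝ) : avg3 k h x ≤ MM h x := le_iSup (avg3 · h x) k

lemma avg1_le_Md (k : ℤ) (h : ℝ → ℝ≥0∞) (x : ℝ) : avg1 k h x ≤ Md h x := le_iSup (avg1 · h x) k

lemma Md_le_MM (h : ℝ → ℝ≥0∞) (x : ℝ) : Md h x ≤ MM h x :=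
  iSup_mono fun _ => mul_mono (lintegral_mono_set (cell_subset_cell3 _ _))

lemma MM_mono {h' : ℝ → ℝ≥0∞} (hh : h ≤ h') (x : ℝ) : MM h x ≤ MM h' x :=
  iSup_mono fun _ => mul_mono (lintegral_mono hh)

/-- Scales at which an integrable function has a large average are bounded below. -/
lemma exists_scale_bound {I σ : ℝ≥0∞} (hI : I ≠ ∞) (hl : σ ≠ 0) :
    ∃ k₀ : ℤ, ∀ k : ℤ, σ < 2 ^ k * I → k₀ ≤ k := by
  obtain ⟨n, hn⟩ := ENNReal.exists_nat_gt (div_ne_top hI hl)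
  refine ⟨-n, fun k hk => ?_⟩
  by_contra! hlt
  have hlam : σ ≠ ∞ := hk.ne_top
  have h1 : (2 : ℝ≥0∞) ^ k ≤ 2 ^ (-(n : ℤ)) := zpow_le_of_le (by norm_num) hlt.le
  have h2 : I ≤ n * σ := by
    rw [ENNReal.div_lt_iff (Or.inl hl) (Or.inl hlam)] at hn; exact hn.le
  have h3 : (n : ℝ≥0∞) ≤ 2 ^ (n : ℤ) := by
    rw [zpow_natCast]; exact_mod_cast Nat.lt_two_pow_self.le
  have : 2 ^ k * I ≤ σ := calc
    2 ^ k * I ≤ 2 ^ (-(n : ℤ)) * (2 ^ (n : ℤ) * σ) :=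
      mul_le_mul' h1 (h2.trans (mul_le_mul' h3 le_rfl))
    _ = σ := by rw [← mul_assoc, mul_comm (2 ^ (-(n : ℤ))), two_zpow_mul_neg, one_mul]
  exact absurd hk this.not_gt

lemma lintegral_biUnion_cells {Q : Set (ℤ × ℤ)} (hQ : Q.PairwiseDisjoint (fun q => cell q.1 q.2))
    (h : ℝ → ℝ≥0∞) : ∑' q : Q, ∫⁻ y in cell q.1.1 q.1.2, h y ≤ ∫⁻ y, h y := by
  rw [← lintegral_biUnion (Set.to_countable Q) (fun q _ => measurableSet_cell _ _) hQ]
  exact setLIntegral_le_lintegral _ _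

/-- Calderón–Zygmund selection: maximal cells where the average exceeds `σ`. -/
lemma exists_cz_cells (hfin : ∫⁻ y, h y ≠ ∞) {σ : ℝ≥0∞} (hl : σ ≠ 0) :
    ∃ Q : Set (ℤ × ℤ), (∀ q ∈ Q, σ < 2 ^ q.1 * ∫⁻ y in cell q.1 q.2, h y) ∧
      Q.PairwiseDisjoint (fun q => cell q.1 q.2) ∧ (∀ k n, σ < 2 ^ k * ∫⁻ y in cell k n, h y →
        ∃ q ∈ Q, q.1 ≤ k ∧ cell k n ⊆ cell q.1 q.2) ∧
      (∀ q ∈ Q, ∀ k' < q.1, ∀ x ∈ cell q.1 q.2, avg1 k' h x ≤ σ) := by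
  obtain ⟨k₀, hk₀⟩ := exists_scale_bound hfin hl
  obtain ⟨Q, h1, h2, h3, h4⟩ := exists_maximal_cells
    (fun k n => σ < 2 ^ k * ∫⁻ y in cell k n, h y) k₀ fun k n hk => hk₀ k
      (hk.trans_le (mul_mono (setLIntegral_le_lintegral _ _)))
  exact ⟨Q, h1, h2, h3, fun q hq k' hk' x hx => not_lt.1 (h4 q hq k' hk' x hx)⟩

lemma tsum_volume_cells_le {σ : ℝ≥0∞} {Q : Set (ℤ × ℤ)}
    (h1 : ∀ q ∈ Q, σ < 2 ^ q.1 * ∫⁻ y in cell q.1 q.2, h y)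
    (h2 : Q.PairwiseDisjoint (fun q => cell q.1 q.2)) :
    σ * ∑' q : Q, (2 : ℝ≥0∞) ^ (-q.1.1) ≤ ∫⁻ y, h y := by
  rw [← ENNReal.tsum_mul_left]
  refine (ENNReal.tsum_le_tsum fun q => ?_).trans (lintegral_biUnion_cells h2 h)
  calc σ * 2 ^ (-q.1.1) ≤ 2 ^ q.1.1 * (∫⁻ y in cell q.1.1 q.1.2, h y) * 2 ^ (-q.1.1) :=
        mul_le_mul' (h1 q.1 q.2).le le_rfl
    _ = _ := by rw [mul_right_comm, two_zpow_mul_neg, one_mul]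

lemma volume_MM_lt {σ : ℝ≥0∞} : σ * volume {x | σ < MM h x} ≤ 9 * ∫⁻ y, h y := by
  rcases eq_or_ne (∫⁻ y, h y) ∞ with hfin | hfin
  · simp [hfin]
  rcases eq_or_ne σ 0 with rfl | hl
  · simp
  rcases eq_or_ne σ ∞ with rfl | hlt
  · simp
  obtain ⟨Q, h1, h2, h3, -⟩ := exists_cz_cells hfin (σ := σ / 3)
    (ENNReal.div_ne_zero.2 ⟨hl, by norm_num⟩)
  have hsub : {x | σ < MM h x} ⊆ ⋃ q : Q, cell3 q.1.1 q.1.2 := by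
    intro x hx
    obtain ⟨k, hk⟩ := lt_iSup_iff.1 (show σ < MM h x from hx)
    set n := dix k x with hn
    have : ∃ m : ℤ, |n - m| ≤ 1 ∧ σ / 3 < 2 ^ k * ∫⁻ y in cell k m, h y := by
      by_contra! hcon
      have ha := hcon (n - 1) (by simp)
      have hb := hcon n (by simp)
      have hc := hcon (n + 1) (by simp)
      have : avg3 k h x ≤ σ := calc
        avg3 k h x ≤ 2 ^ k * ((∫⁻ y in cell k (n - 1), h y) +
            ((∫⁻ y in cell k n, h y) + ∫⁻ y in cell k (n + 1), h y)) := by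
          refine mul_mono ((lintegral_mono_set (cell3_subset k n)).trans ?_)
          exact (lintegral_union_le _ _ _).trans (add_le_add le_rfl (lintegral_union_le _ _ _))
        _ ≤ σ / 3 + (σ / 3 + σ / 3) := by
          rw [mul_add, mul_add]; gcongr
        _ = σ := by rw [← add_assoc, add_thirds]
      exact absurd hk this.not_gt
    obtain ⟨m, hm, hS⟩ := this
    obtain ⟨q, hq, hqk, hqs⟩ := h3 k m hS
    obtain ⟨z, hz⟩ := cell_nonempty k m
    refine mem_iUnion.2 ⟨⟨q, hq⟩, ?_⟩
    have e := mem_cell.1 (hqs hz)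
    rw [mem_cell3, ← e]
    exact dix_near hqk (by rw [mem_cell.1 hz, ← hn]; exact hm)
  have hsum := tsum_volume_cells_le h1 h2
  calc σ * volume {x | σ < MM h x}
      ≤ σ * ∑' q : Q, 3 * 2 ^ (-q.1.1) := by
        gcongr
        exact (measure_mono hsub).trans ((measure_iUnion_le _).trans
          (ENNReal.tsum_le_tsum fun q => volume_cell3_le _ _))
    _ = 9 * (σ / 3 * ∑' q : Q, 2 ^ (-q.1.1)) := by
        rw [ENNReal.tsum_mul_left, ← mul_assoc, ← mul_assoc]
        congr 1
        rw [ENNReal.div_eq_inv_mul, ← mul_assoc, mul_comm σ]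
        congr 1
        rw [show (9 : ℝ≥0∞) = 3 * 3 by norm_num, mul_assoc,
          ENNReal.mul_inv_cancel (by norm_num) (by norm_num), mul_one]
    _ ≤ _ := by gcongr

/-- The geometric series `∑ 2^{-iq}`. -/
def geo (q : ℝ) : ℝ≥0∞ := ∑' i : ℕ, ((2 : ℝ≥0∞) ^ (-(i : ℤ))) ^ q

lemma geo_ne_top {q : ℝ} (hq : 0 < q) : geo q ≠ ∞ := by
  have e : ∀ i : ℕ, ((2 : ℝ≥0∞) ^ (-(i : ℤ))) ^ q = ((2 : ℝ≥0∞)⁻¹ ^ q) ^ i := fun i => by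
    rw [ENNReal.zpow_neg, zpow_natCast, ENNReal.inv_pow, ← rpow_natCast,
      ← rpow_natCast, ← rpow_mul, ← rpow_mul, mul_comm]
  simp only [geo, e, tsum_geometric]
  refine inv_ne_top.2 (tsub_pos_of_lt ?_).ne'
  exact rpow_lt_one (by norm_num) hq

lemma two_zpow_add (a b : ℤ) : (2 : ℝ≥0∞) ^ (a + b) = 2 ^ a * 2 ^ b :=
  ENNReal.zpow_add (by norm_num) (by norm_num) a b

lemma tsum_le_geo (k₀ : ℤ) (q : ℝ) :
    ∑' k : ℤ, (if k ≤ k₀ then ((2 : ℝ≥0∞) ^ (k - k₀)) ^ q else 0) = geo q := by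
  have hinj : Injective (fun i : ℕ => k₀ - (i : ℤ)) := fun a b h => by simpa using h
  rw [geo, ← hinj.tsum_eq]
  · refine tsum_congr fun i => ?_
    simp only [sub_le_self_iff, Nat.cast_nonneg, if_true]
    congr 2; ring
  · intro k hk
    simp only [Function.mem_support, ne_eq, ite_eq_right_iff, Classical.not_imp] at hk
    exact ⟨(k₀ - k).toNat, by simp only; omega⟩

lemma tsum_ge_geo (k₀ : ℤ) (q : ℝ) :
    ∑' k : ℤ, (if k₀ ≤ k then ((2 : ℝ≥0∞) ^ (k₀ - k)) ^ q else 0) = geo q := by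
  rw [← tsum_le_geo (-k₀) q, ← (Equiv.neg ℤ).tsum_eq]
  simp [le_neg, sub_eq_add_neg, add_comm]

lemma rpow_le_tsum_layers (F : ℝ≥0∞) {p : ℝ} (hp : 0 < p) :
    F ^ p ≤ 2 ^ p * ∑' j : ℤ, ((2 : ℝ≥0∞) ^ j) ^ p * (if 2 ^ j < F then 1 else 0) := by
  rcases eq_or_ne F 0 with rfl | h0
  · simp [hp]
  rcases eq_or_ne F ∞ with rfl | ht
  · have hinj : Injective (fun i : ℕ => (i : ℤ)) := fun a b h => by simpa using h
    have h1 : ∑' j : ℤ, ((2 : ℝ≥0∞) ^ j) ^ p * (if (2 : ℝ≥0∞) ^ j < ∞ then 1 else 0) = ∞ := by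
      rw [eq_top_iff]
      calc (∞ : ℝ≥0∞) = ∑' _ : ℕ, (1 : ℝ≥0∞) := (tsum_const_eq_top_of_ne_zero one_ne_zero).symm
        _ ≤ ∑' i : ℕ, (((2 : ℝ≥0∞) ^ (i : ℤ)) ^ p * (if (2 : ℝ≥0∞) ^ (i : ℤ) < ∞ then 1 else 0)) := by
          refine ENNReal.tsum_le_tsum fun i => ?_
          rw [if_pos (two_zpow_ne_top _).lt_top, mul_one, zpow_natCast]
          exact one_le_rpow (one_le_pow₀ (by norm_num)) hp
        _ ≤ _ := tsum_comp_le_tsum_of_injective hinj _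
    rw [h1, mul_top (by simp [hp])]
    exact le_top
  · obtain ⟨j, hj1, hj2⟩ := ENNReal.exists_mem_Ioc_zpow h0 ht (y := 2) (by norm_num) (by norm_num)
    refine le_trans ?_ (mul_mono (ENNReal.le_tsum j))
    rw [if_pos hj1, mul_one, ← mul_rpow hp.le]
    refine rpow_le_rpow (hj2.trans ?_) hp.le
    rw [two_zpow_add, mul_comm, zpow_one]

lemma tsum_layers_le (F : ℝ≥0∞) {q : ℝ} (hq : 0 < q) :
    ∑' j : ℤ, ((2 : ℝ≥0∞) ^ j) ^ q * (if 2 ^ j < F then 1 else 0) ≤ geo q * F ^ q := by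
  rcases eq_or_ne F 0 with rfl | h0
  · simp
  have hgeo : geo q ≠ 0 := by
    refine ne_of_gt (lt_of_lt_of_le ?_ (ENNReal.le_tsum 0)); simp
  rcases eq_or_ne F ∞ with rfl | ht
  · rw [top_rpow_of_pos hq, mul_top hgeo]; exact le_top
  obtain ⟨j₀, hj1, hj2⟩ := ENNReal.exists_mem_Ioc_zpow h0 ht (y := 2) (by norm_num) (by norm_num)
  rw [← tsum_le_geo j₀ q, ← ENNReal.tsum_mul_right]
  refine ENNReal.tsum_le_tsum fun j => ?_
  by_cases hj : (2 : ℝ≥0∞) ^ j < F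
  · have hjj : j ≤ j₀ := by
      by_contra! hc
      have : (2 : ℝ≥0∞) ^ (j₀ + 1) ≤ 2 ^ j := zpow_le_of_le (by norm_num) (by omega)
      exact absurd (hj.trans_le hj2) this.not_gt
    rw [if_pos hj, if_pos hjj, mul_one, ← mul_rpow hq.le]
    refine rpow_le_rpow ?_ hq.le
    calc (2 : ℝ≥0∞) ^ j = 2 ^ (j - j₀) * 2 ^ j₀ := by rw [← two_zpow_add]; congr 1; ring
      _ ≤ _ := by gcongr
  · rw [if_neg hj, mul_zero]; exact zero_le

lemma lintegral_ite_lt {F : ι → ℝ≥0∞} (hF : Measurable F) (c : ℝ≥0∞) : ∫⁻ x, (if c < F x then 1 else 0) ∂μ = μ {x | c < F x} := by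
  rw [← lintegral_indicator_one (measurableSet_lt measurable_const hF)]
  refine lintegral_congr fun x => ?_
  simp [Set.indicator_apply]

lemma lintegral_layers {F : ι → ℝ≥0∞} (hF : Measurable F) (p : ℝ) :
    ∫⁻ x, ∑' j : ℤ, ((2 : ℝ≥0∞) ^ j) ^ p * (if 2 ^ j < F x then 1 else 0) ∂μ =
      ∑' j : ℤ, ((2 : ℝ≥0∞) ^ j) ^ p * μ {x | 2 ^ j < F x} := by
  have hm (j : ℤ) : Measurable fun x => (if (2 : ℝ≥0∞) ^ j < F x then (1 : ℝ≥0∞) else 0) :=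
    Measurable.ite (measurableSet_lt measurable_const hF) measurable_const measurable_const
  rw [lintegral_tsum fun j => ((hm j).const_mul _).aemeasurable]
  simp_rw [lintegral_const_mul _ (hm _), lintegral_ite_lt hF]

lemma lintegral_rpow_le_layers {F : ι → ℝ≥0∞} (hF : Measurable F) {p : ℝ} (hp : 0 < p) :
    ∫⁻ x, F x ^ p ∂μ ≤ 2 ^ p * ∑' j : ℤ, ((2 : ℝ≥0∞) ^ j) ^ p * μ {x | 2 ^ j < F x} := by
  refine (lintegral_mono fun x => rpow_le_tsum_layers (F x) hp).trans ?_
  rw [lint_const_mul (by finiteness), lintegral_layers hF]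

lemma layers_le_lintegral_rpow {F : ι → ℝ≥0∞} (hF : Measurable F) {p : ℝ} (hp : 0 < p) :
    ∑' j : ℤ, ((2 : ℝ≥0∞) ^ j) ^ p * μ {x | 2 ^ j < F x} ≤ geo p * ∫⁻ x, F x ^ p ∂μ := by
  rw [← lintegral_const_mul _ (hF.pow_const p), ← lintegral_layers hF]
  exact lintegral_mono fun x => tsum_layers_le (F x) hp

lemma MM_add_const_le {u : ℝ → ℝ≥0∞} {c : ℝ≥0∞} (hu : Measurable u) (hh : ∀ x, h x ≤ u x + c)
    (x : ℝ) : MM h x ≤ MM u x + 3 * c := by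
  refine iSup_le fun k => ?_
  calc avg3 k h x ≤ 2 ^ k * ∫⁻ y in cell3 k (dix k x), (u y + c) := by
        unfold avg3; gcongr; exact hh _
    _ = avg3 k u x + 2 ^ k * (c * volume (cell3 k (dix k x))) := by
        rw [lintegral_add_left hu, mul_add, setLIntegral_const, avg3]
    _ ≤ MM u x + 2 ^ k * (c * (3 * 2 ^ (-k))) := by
        gcongr
        · exact avg3_le_MM k u x
        · exact volume_cell3_le _ _
    _ = MM u x + 3 * c := by
        congr 1
        calc 2 ^ k * (c * (3 * (2 : ℝ≥0∞) ^ (-k))) = (2 ^ k * 2 ^ (-k)) * (3 * c) := by ring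
          _ = _ := by rw [two_zpow_mul_neg, one_mul]

lemma MM_le_essSup (h : ℝ → ℝ≥0∞) (x : ℝ) : MM h x ≤ 3 * essSup h volume := by
  refine iSup_le fun k => ?_
  calc avg3 k h x ≤ 2 ^ k * ∫⁻ _ in cell3 k (dix k x), essSup h volume := by
        unfold avg3
        gcongr 2 ^ k * ?_
        exact lintegral_mono_ae (ae_restrict_of_ae (ENNReal.ae_le_essSup h))
    _ ≤ 2 ^ k * (essSup h volume * (3 * 2 ^ (-k))) := by
        rw [setLIntegral_const]; gcongr; exact volume_cell3_le _ _
    _ = (2 ^ k * 2 ^ (-k)) * (3 * essSup h volume) := by ring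
    _ = _ := by rw [two_zpow_mul_neg, one_mul]

/-- The Hardy–Littlewood maximal theorem. -/
lemma lintegral_MM_rpow_le {p : ℝ} (hp : 1 < p) :
    ∃ C : ℝ≥0, ∀ h : ℝ → ℝ≥0∞, Measurable h → ∫⁻ x, MM h x ^ p ≤ C * ∫⁻ x, h x ^ p := by
  have hq : 0 < p - 1 := by linarith
  have hp0 : 0 < p := by linarith
  set C : ℝ≥0∞ := 2 ^ p * (18 * (((2 : ℝ≥0∞) ^ (3 : ℤ)) ^ (p - 1) * geo (p - 1))) with hC
  have hCt : C ≠ ∞ := by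
    rw [hC]
    have := geo_ne_top hq
    have h8 := two_zpow_ne_top 3
    finiteness
  refine ⟨C.toNNReal, fun h hm => ?_⟩
  rw [coe_toNNReal hCt]
  have hlev : ∀ j : ℤ, (2 : ℝ≥0∞) ^ j * volume {x | 2 ^ j < MM h x} ≤
      18 * ∫⁻ y, h y * (if 2 ^ (j - 3) < h y then 1 else 0) := by
    intro j
    set u : ℝ → ℝ≥0∞ := fun y => h y * (if 2 ^ (j - 3) < h y then 1 else 0) with hu
    have hum : Measurable u := hm.mul
      (Measurable.ite (measurableSet_lt measurable_const hm) measurable_const measurable_const)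
    have e3 : (2 : ℝ≥0∞) ^ j = 2 ^ (j - 1) + 4 * 2 ^ (j - 3) := by
      have a1 : (2 : ℝ≥0∞) ^ j = 2 ^ (j - 3) * 2 ^ 3 := by
        rw [← zpow_natCast, ← two_zpow_add]; congr 1; simp
      have a2 : (2 : ℝ≥0∞) ^ (j - 1) = 2 ^ (j - 3) * 2 ^ 2 := by
        rw [← zpow_natCast, ← two_zpow_add]; congr 1; simp; ring
      rw [a1, a2]; ring
    have hsub : {x | 2 ^ j < MM h x} ⊆ {x | 2 ^ (j - 1) < MM u x} := by
      intro x hx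
      have h1 : MM h x ≤ MM u x + 3 * 2 ^ (j - 3) := by
        refine MM_add_const_le hum (fun y => ?_) x
        simp only [hu]
        split_ifs with hy
        · simp
        · simpa using not_lt.1 hy
      simp only [mem_ofPred_eq] at hx ⊢
      by_contra! hcon
      refine absurd hx (not_lt.2 (h1.trans ((add_le_add hcon le_rfl).trans ?_)))
      rw [e3]; gcongr; norm_num
    calc (2 : ℝ≥0∞) ^ j * volume {x | 2 ^ j < MM h x}
        ≤ 2 * (2 ^ (j - 1) * volume {x | 2 ^ (j - 1) < MM u x}) := by
          rw [← mul_assoc]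
          refine mul_le_mul' (le_of_eq ?_) (measure_mono hsub)
          conv_lhs => rw [show j = 1 + (j - 1) by ring, two_zpow_add, zpow_one]
      _ ≤ 2 * (9 * ∫⁻ y, u y) := mul_mono volume_MM_lt
      _ = _ := by rw [← mul_assoc]; norm_num
  refine (lintegral_rpow_le_layers (measurable_MM h) hp0).trans ?_
  rw [hC, mul_assoc]
  gcongr
  have hmi : ∀ j : ℤ, Measurable fun y => h y * (if (2 : ℝ≥0∞) ^ (j - 3) < h y then (1 : ℝ≥0∞) else 0) :=
    fun j => hm.mul
      (Measurable.ite (measurableSet_lt measurable_const hm) measurable_const measurable_const)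
  calc ∑' j : ℤ, ((2 : ℝ≥0∞) ^ j) ^ p * volume {x | 2 ^ j < MM h x}
      ≤ ∑' j : ℤ, ((2 : ℝ≥0∞) ^ j) ^ (p - 1) *
          (18 * ∫⁻ y, h y * (if 2 ^ (j - 3) < h y then 1 else 0)) := by
        refine ENNReal.tsum_le_tsum fun j => ?_
        have : ((2 : ℝ≥0∞) ^ j) ^ p = ((2 : ℝ≥0∞) ^ j) ^ (p - 1) * 2 ^ j := by
          conv_lhs => rw [show p = (p - 1) + 1 by ring]
          rw [rpow_add _ _ (two_zpow_ne_zero j) (two_zpow_ne_top j), rpow_one]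
        rw [this, mul_assoc]
        exact mul_mono (hlev j)
    _ = 18 * ∫⁻ y, h y * ∑' j : ℤ, ((2 : ℝ≥0∞) ^ j) ^ (p - 1) *
          (if 2 ^ (j - 3) < h y then 1 else 0) := by
        simp_rw [← ENNReal.tsum_mul_left]
        rw [lintegral_tsum fun j => ?_, ← ENNReal.tsum_mul_left]
        · refine tsum_congr fun j => ?_
          rw [← mul_assoc, mul_comm _ (18 : ℝ≥0∞), mul_assoc, ← lintegral_const_mul _ (hmi j)]
          congr 2; ext y; ring
        · have := ((hmi j).const_mul (((2 : ℝ≥0∞) ^ j) ^ (p - 1))).aemeasurable (μ := volume)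
          convert this using 2; ring
    _ ≤ 18 * ∫⁻ y, (((2 : ℝ≥0∞) ^ (3 : ℤ)) ^ (p - 1) * geo (p - 1)) * h y ^ p := by
        refine mul_mono (lintegral_mono fun y => ?_)
        rw [← (Equiv.addRight (3 : ℤ)).tsum_eq]
        have : ∀ j : ℤ, ((2 : ℝ≥0∞) ^ (Equiv.addRight (3 : ℤ) j)) ^ (p - 1) *
            (if (2 : ℝ≥0∞) ^ (Equiv.addRight (3 : ℤ) j - 3) < h y then 1 else 0) =
            ((2 : ℝ≥0∞) ^ (3 : ℤ)) ^ (p - 1) *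
              (((2 : ℝ≥0∞) ^ j) ^ (p - 1) * (if 2 ^ j < h y then 1 else 0)) := fun j => by
          simp only [Equiv.coe_addRight, add_sub_cancel_right]
          rw [two_zpow_add, mul_rpow hq.le]; ring
        simp_rw [this]
        rw [ENNReal.tsum_mul_left]
        refine (mul_mono (mul_mono (tsum_layers_le _ hq))).trans ?_
        calc h y * (((2 : ℝ≥0∞) ^ (3 : ℤ)) ^ (p - 1) * (geo (p - 1) * h y ^ (p - 1)))
          _ = ((2 : ℝ≥0∞) ^ (3 : ℤ)) ^ (p - 1) * geo (p - 1) * (h y * h y ^ (p - 1)) := by ring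
          _ ≤ _ := by
              refine mul_mono (le_of_eq ?_)
              conv_rhs => rw [show p = 1 + (p - 1) by ring]
              rw [rpow_add_of_nonneg _ _ zero_le_one hq.le, rpow_one]
    _ = _ := by
        rw [lintegral_const_mul _ (hm.pow_const p)]; ring

lemma ae_le_Md (hm : Measurable h) (hfin : ∫⁻ y, h y ≠ ∞) : ∀ᵐ x, h x ≤ Md h x := by
  have key := (IsUnifLocDoublingMeasure.vitaliFamily (volume : Measure ℝ) 2).ae_tendsto_lintegral_div
    hm.aemeasurable hfin
  filter_upwards [key] with x hx
  set w : ℕ → ℝ := fun j => ((dix j x : ℝ) + 1 / 2) * 2 ^ (-(j : ℤ)) with hw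
  set δ : ℕ → ℝ := fun j => (1 / 2) * 2 ^ (-(j : ℤ)) with hδ
  have hδpos : ∀ j, 0 < δ j := fun j => by simp only [hδ]; positivity
  have hlim : Filter.Tendsto δ Filter.atTop (nhdsWithin 0 (Ioi 0)) := by
    refine tendsto_nhdsWithin_iff.2 ⟨?_, Filter.Eventually.of_forall hδpos⟩
    have := (tendsto_pow_atTop_nhds_zero_of_lt_one (r := (1 / 2 : ℝ)) (by norm_num)
      (by norm_num)).const_mul (1 / 2)
    simpa [hδ, zpow_neg, zpow_natCast] using this
  have hball : ∀ j, Metric.closedBall (w j) (δ j) =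
      Icc ((dix j x : ℝ) * 2 ^ (-(j : ℤ))) (((dix j x : ℝ) + 1) * 2 ^ (-(j : ℤ))) := fun j => by
    rw [Real.closedBall_eq_Icc]; congr 1 <;> simp only [hw, hδ] <;> ring
  have hxm : ∀ j : ℕ, x ∈ cell j (dix j x) := fun j => rfl
  have hmem : ∀ j, x ∈ Metric.closedBall (w j) (2 * δ j) := fun j => by
    refine Metric.closedBall_subset_closedBall (ε₁ := δ j) (by linarith [hδpos j]) ?_
    rw [hball]
    have := hxm j
    rw [cell_eq_Ico] at this
    exact Set.Ico_subset_Icc_self this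
  have ht := hx.comp (IsUnifLocDoublingMeasure.tendsto_closedBall_filterAt (volume : Measure ℝ)
    w δ hlim (.of_forall hmem))
  refine le_of_tendsto' ht fun j => ?_
  refine le_trans (le_of_eq ?_) (avg1_le_Md j h x)
  simp only [Function.comp, avg1]
  rw [hball, cell_eq_Ico, setLIntegral_congr Ico_ae_eq_Icc.symm, measure_congr Ico_ae_eq_Icc.symm,
    ← cell_eq_Ico, volume_cell, ENNReal.div_eq_inv_mul, ENNReal.zpow_neg, inv_inv]

/-- A good-`λ` inequality for functions of controlled dyadic oscillation. -/
lemma good_lambda {a G : ℝ → ℝ≥0∞} (ha : Measurable a) (hfin : ∫⁻ x, a x ≠ ∞)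
    (h : ∀ k n, ∃ (c : ℝ≥0∞) (e : ℝ → ℝ≥0∞), Measurable e ∧ (∀ x ∈ cell k n, a x ≤ c + e x ∧ c ≤ a x + e x) ∧ ∀ y ∈ cell k n, 2 ^ k * ∫⁻ x in cell k n, e x ≤ G y)
    {σ gam : ℝ≥0∞} (hl : σ ≠ 0) (hlt : σ ≠ ∞) (hg : gam ≤ 1) : volume {x | 4 * σ < Md a x} ≤
      volume {x | gam * σ < G x} + 9 * gam * volume {x | σ < Md a x} := by
  obtain ⟨Q, h1, h2, h3, h4⟩ := exists_cz_cells hfin hl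
  have hmd {b : ℝ≥0∞} (hb : 4 * σ < b) : σ < b := hb.trans_le' (by
    calc σ = 1 * σ := (one_mul _).symm
      _ ≤ 4 * σ := by gcongr; norm_num)
  have hQ : ∀ q : Q, volume ({x | 4 * σ < Md a x} ∩ cell q.1.1 q.1.2 ∩ {x | ¬ gam * σ < G x}) ≤
      9 * gam * 2 ^ (-q.1.1) := by
    rintro ⟨⟨k, n⟩, hq⟩
    by_cases hne : ∃ y ∈ cell k n, G y ≤ gam * σ
    swap
    · push Not at hne
      rw [show {x | 4 * σ < Md a x} ∩ cell k n ∩ {x | ¬ gam * σ < G x} = ∅ from ?_]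
      · simp
      · ext x
        simp only [Set.mem_inter_iff, mem_ofPred_eq, Set.mem_empty_iff_false, iff_false]
        rintro ⟨⟨-, hx⟩, hx'⟩
        exact hx' (hne x hx)
    obtain ⟨y, hy, hGy⟩ := hne
    obtain ⟨c, e, hem, hce, heG⟩ := h (k - 1) (dix (k - 1) y)
    set P := cell (k - 1) (dix (k - 1) y) with hP
    have hyP : y ∈ P := rfl
    have hsubP : cell k n ⊆ P := fun x hx =>
      dix_congr (by omega) ((mem_cell.1 hx).trans (mem_cell.1 hy).symm)
    have hea : 2 ^ (k - 1) * ∫⁻ x in P, e x ≤ gam * σ := (heG y hyP).trans hGy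
    have hc : c ≤ 2 * σ := by
      calc c = 2 ^ (k - 1) * ∫⁻ _ in P, c := by
            rw [setLIntegral_const, hP, volume_cell, mul_left_comm, two_zpow_mul_neg, mul_one]
        _ ≤ 2 ^ (k - 1) * ∫⁻ x in P, (a x + e x) :=
            mul_mono (setLIntegral_mono (ha.add hem) fun x hx => (hce x hx).2)
        _ = avg1 (k - 1) a y + 2 ^ (k - 1) * ∫⁻ x in P, e x := by
            rw [lintegral_add_left ha, mul_add]; rfl
        _ ≤ σ + gam * σ := add_le_add (h4 _ hq (k - 1) (by simp) y hy) hea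
        _ ≤ σ + 1 * σ := by gcongr
        _ = 2 * σ := by ring
    set u : ℝ → ℝ≥0∞ := P.indicator e with hu
    have hsub : {x | 4 * σ < Md a x} ∩ cell k n ∩ {x | ¬ gam * σ < G x} ⊆
        {x | 2 * σ < MM u x} := by
      rintro x ⟨⟨hx, hxQ⟩, -⟩
      obtain ⟨j, hj⟩ := lt_iSup_iff.1 (show 4 * σ < Md a x from hx)
      obtain ⟨q', hq', hjk, hss⟩ := h3 j _ (hmd hj)
      have hxx : x ∈ cell q'.1 q'.2 := hss rfl
      have hqq : q' = (k, n) := by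
        by_contra hne
        exact disjoint_left.1 (h2 hq' hq hne) hxx hxQ
      subst hqq
      have hav : avg1 j a x ≤ c + avg1 j u x := by
        calc avg1 j a x ≤ 2 ^ j * ∫⁻ y in cell j (dix j x), (c + u y) := by
              refine mul_mono (setLIntegral_mono
                (measurable_const.add (hem.indicator (measurableSet_cell _ _))) fun z hz => ?_)
              have hzP : z ∈ P := hsubP (hss hz)
              rw [hu, indicator_of_mem hzP]
              exact (hce z hzP).1
          _ = c + avg1 j u x := by
              rw [lintegral_add_left measurable_const, mul_add, setLIntegral_const, volume_cell,
                mul_left_comm, two_zpow_mul_neg, mul_one]; rfl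
      have : 4 * σ < 2 * σ + avg1 j u x := hj.trans_le (hav.trans (add_le_add hc le_rfl))
      rw [show (4 : ℝ≥0∞) * σ = 2 * σ + 2 * σ by ring] at this
      have := lt_of_add_lt_add_left this
      exact this.trans_le ((avg1_le_Md _ _ _).trans (Md_le_MM _ _))
    refine (measure_mono hsub).trans ?_
    have hw := volume_MM_lt (h := u) (σ := 2 * σ)
    rw [hu, lintegral_indicator (measurableSet_cell _ _)] at hw
    have he2 : ∫⁻ x in P, e x ≤ 2 ^ (1 - k) * (gam * σ) := by
      calc ∫⁻ x in P, e x = 2 ^ (1 - k) * (2 ^ (k - 1) * ∫⁻ x in P, e x) := by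
            rw [← mul_assoc, ← two_zpow_add]; simp
        _ ≤ _ := mul_mono hea
    have h2l : 2 * σ ≠ 0 := mul_ne_zero (by norm_num) hl
    have h2t : 2 * σ ≠ ∞ := mul_ne_top (by norm_num) hlt
    rw [← ENNReal.mul_le_mul_iff_right h2l h2t]
    refine hw.trans ((mul_mono he2).trans (le_of_eq ?_))
    rw [sub_eq_add_neg, two_zpow_add, zpow_one]; ring
  have hcover : {x | 4 * σ < Md a x} ⊆ {x | gam * σ < G x} ∪
      ⋃ q : Q, ({x | 4 * σ < Md a x} ∩ cell q.1.1 q.1.2 ∩ {x | ¬ gam * σ < G x}) := by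
    intro x hx
    by_cases hG : gam * σ < G x
    · exact Or.inl hG
    · obtain ⟨j, hj⟩ := lt_iSup_iff.1 (show 4 * σ < Md a x from hx)
      obtain ⟨q, hq, -, hss⟩ := h3 j _ (hmd hj)
      exact Or.inr (mem_iUnion.2 ⟨⟨q, hq⟩, ⟨hx, hss rfl⟩, hG⟩)
  have hunion : ∑' q : Q, (2 : ℝ≥0∞) ^ (-q.1.1) ≤ volume {x | σ < Md a x} := by
    calc ∑' q : Q, (2 : ℝ≥0∞) ^ (-q.1.1) = ∑' q : Q, volume (cell q.1.1 q.1.2) := by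
          simp only [volume_cell]
      _ = volume (⋃ q ∈ Q, cell q.1 q.2) :=
          (measure_biUnion (Set.to_countable Q) h2 fun q _ => measurableSet_cell _ _).symm
      _ ≤ _ := by
          refine measure_mono (Set.iUnion₂_subset fun q hq x hx => ?_)
          refine lt_of_lt_of_le ?_ (avg1_le_Md q.1 a x)
          rw [avg1, mem_cell.1 hx]
          exact h1 q hq
  calc volume {x | 4 * σ < Md a x}
      ≤ volume {x | gam * σ < G x} + ∑' q : Q, 9 * gam * 2 ^ (-q.1.1) := by
        refine (measure_mono hcover).trans ((measure_union_le _ _).trans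
          (add_le_add le_rfl ((measure_iUnion_le _).trans (ENNReal.tsum_le_tsum hQ))))
    _ ≤ _ := by
        rw [ENNReal.tsum_mul_left]
        exact add_le_add le_rfl (mul_mono hunion)

/-- The dyadic Fefferman–Stein inequality. -/
lemma fefferman_stein {t : ℝ} (ht : 1 < t) :
    ∃ C : ℝ≥0, ∀ a G : ℝ → ℝ≥0∞, Measurable a → Measurable G → ∫⁻ x, a x ≠ ∞ →
      (∀ k n, ∃ (c : ℝ≥0∞) (e : ℝ → ℝ≥0∞), Measurable e ∧
        (∀ x ∈ cell k n, a x ≤ c + e x ∧ c ≤ a x + e x) ∧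
        ∀ y ∈ cell k n, 2 ^ k * ∫⁻ x in cell k n, e x ≤ G y) →
      ∫⁻ x, a x ^ t ≤ C * ∫⁻ x, G x ^ t := by
  have ht0 : 0 < t := by linarith
  have ht1 : 0 < t - 1 := by linarith
  have h4t : (4 : ℝ≥0∞) ^ t ≠ ∞ := by finiteness
  have h40 : (4 : ℝ≥0∞) ^ t ≠ 0 := by simp
  set gam : ℝ≥0∞ := ((4 : ℝ≥0∞) ^ t * 18)⁻¹ with hgam
  have hgt : gam ≠ ∞ := inv_ne_top.2 (mul_ne_zero h40 (by norm_num))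
  have hg0 : gam ≠ 0 := ENNReal.inv_ne_zero.2 (mul_ne_top h4t (by norm_num))
  have hg1 : gam ≤ 1 := by
    rw [hgam, ENNReal.inv_le_one]
    calc (1 : ℝ≥0∞) ≤ 1 * 18 := by norm_num
      _ ≤ _ := by gcongr; exact one_le_rpow (by norm_num) ht0
  set C : ℝ≥0∞ := 2 ^ t * (2 * (4 ^ t * (geo t * (gam⁻¹) ^ t))) with hC
  have hCt : C ≠ ∞ := by
    have := geo_ne_top ht0
    have h1 : gam⁻¹ ≠ ∞ := inv_ne_top.2 hg0
    rw [hC]; finiteness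
  refine ⟨C.toNNReal, fun a G ha hG hfin h => ?_⟩
  rw [coe_toNNReal hCt]
  set V : ℤ → ℝ≥0∞ := fun j => ((2 : ℝ≥0∞) ^ j) ^ t * volume {x | 2 ^ j < Md a x} with hV
  set W : ℤ → ℝ≥0∞ := fun j => ((2 : ℝ≥0∞) ^ j) ^ t * volume {x | gam * 2 ^ j < G x} with hW
  have hrec : ∀ j, V (j + 2) ≤ 4 ^ t * W j + 2⁻¹ * V j := by
    intro j
    have e4 : (2 : ℝ≥0∞) ^ (j + 2) = 4 * 2 ^ j := by
      rw [two_zpow_add, mul_comm]; congr 1; norm_cast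
    have := good_lambda ha hfin h (two_zpow_ne_zero j) (two_zpow_ne_top j) hg1
    simp only [hV, hW]
    rw [e4, mul_rpow ht0.le, mul_assoc]
    refine (mul_mono (mul_mono this)).trans (le_of_eq ?_)
    have e9 : (4 : ℝ≥0∞) ^ t * (9 * gam) = 2⁻¹ := by
      rw [hgam, ENNReal.mul_inv (Or.inl h40) (Or.inl h4t), mul_left_comm, ← mul_assoc (4 ^ t),
        ENNReal.mul_inv_cancel h40 h4t, one_mul, show (18 : ℝ≥0∞) = 9 * 2 by norm_num,
        ENNReal.mul_inv (by norm_num) (by norm_num), ← mul_assoc,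
        ENNReal.mul_inv_cancel (by norm_num) (by norm_num), one_mul]
    rw [← e9]; ring
  have hWsum : ∑' j, W j ≤ geo t * (gam⁻¹) ^ t * ∫⁻ x, G x ^ t := by
    have := layers_le_lintegral_rpow (μ := volume) (hG.const_mul gam⁻¹) ht0
    simp_rw [mul_rpow ht0.le] at this
    rw [lintegral_const_mul _ (hG.pow_const t), ← mul_assoc] at this
    refine le_trans (le_of_eq (tsum_congr fun j => ?_)) this
    have e : {x | gam * 2 ^ j < G x} = {x | 2 ^ j < gam⁻¹ * G x} := by
      ext x
      simp only [mem_ofPred_eq]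
      rw [show gam⁻¹ * G x = G x / gam from ENNReal.div_eq_inv_mul.symm,
        ENNReal.lt_div_iff_mul_lt (Or.inl hg0) (Or.inl hgt), mul_comm]
    simp only [hW, e]
  have hX : ∀ R : ℤ, ∑' j : ℤ, (if j ≤ R then V j else 0) ≤ 2 * (4 ^ t * ∑' j, W j) := by
    intro R
    set X := ∑' j : ℤ, (if j ≤ R then V j else 0) with hXd
    have hXfin : X ≠ ∞ := by
      have : X ≤ (2 ^ R) ^ (t - 1) * (9 * ∫⁻ x, a x) * geo (t - 1) := by
        rw [← tsum_le_geo R, ← ENNReal.tsum_mul_left]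
        refine ENNReal.tsum_le_tsum fun j => ?_
        split_ifs with hj
        · have e1 : ((2 : ℝ≥0∞) ^ j) ^ t = ((2 : ℝ≥0∞) ^ j) ^ (t - 1) * 2 ^ j := by
            conv_lhs => rw [show t = (t - 1) + 1 by ring]
            rw [rpow_add _ _ (two_zpow_ne_zero j) (two_zpow_ne_top j), rpow_one]
          have e2 : ((2 : ℝ≥0∞) ^ j) ^ (t - 1) = (2 ^ R) ^ (t - 1) * (2 ^ (j - R)) ^ (t - 1) := by
            rw [← mul_rpow ht1.le, ← two_zpow_add]; congr 2; ring
          simp only [hV]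
          rw [e1, mul_assoc, e2]
          have e3 : (2 : ℝ≥0∞) ^ j * volume {x | 2 ^ j < Md a x} ≤ 9 * ∫⁻ x, a x :=
            (mul_mono (measure_mono fun x hx =>
              lt_of_lt_of_le hx (Md_le_MM a x))).trans volume_MM_lt
          calc _ ≤ (2 ^ R) ^ (t - 1) * (2 ^ (j - R)) ^ (t - 1) * (9 * ∫⁻ x, a x) :=
                mul_mono e3
            _ = _ := by ring
        · exact zero_le
      refine ne_top_of_le_ne_top ?_ this
      have := geo_ne_top ht1
      have := two_zpow_ne_top R
      finiteness
    have hle : X ≤ 4 ^ t * ∑' j, W j + 2⁻¹ * X := by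
      calc X = ∑' j : ℤ, (if j + 2 ≤ R then V (j + 2) else 0) := by
            rw [hXd, ← (Equiv.addRight (2 : ℤ)).tsum_eq]; rfl
        _ ≤ ∑' j : ℤ, (4 ^ t * W j + 2⁻¹ * (if j ≤ R then V j else 0)) := by
            refine ENNReal.tsum_le_tsum fun j => ?_
            split_ifs with h1 h2
            · exact hrec j
            · omega
            · exact zero_le
            · exact zero_le
        _ = _ := by rw [ENNReal.tsum_add, ENNReal.tsum_mul_left, ENNReal.tsum_mul_left]
    have hhalf : 2⁻¹ * X + 2⁻¹ * X = X := by
      rw [← add_mul, inv_two_add_inv_two, one_mul]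
    have h2 : 2⁻¹ * X ≤ 4 ^ t * ∑' j, W j := by
      have hne : 2⁻¹ * X ≠ ∞ := mul_ne_top (by norm_num) hXfin
      refine (ENNReal.add_le_add_iff_right hne).1 ?_
      rw [hhalf]; exact hle
    calc X = 2 * (2⁻¹ * X) := by
          rw [← mul_assoc, ENNReal.mul_inv_cancel (by norm_num) (by norm_num), one_mul]
      _ ≤ _ := by gcongr
  have hVsum : ∑' j, V j ≤ 2 * (4 ^ t * ∑' j, W j) := by
    rw [ENNReal.tsum_eq_iSup_sum]
    refine iSup_le fun s => ?_
    obtain ⟨R, hR⟩ := s.bddAbove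
    refine le_trans ?_ (hX R)
    calc ∑ j ∈ s, V j = ∑ j ∈ s, (if j ≤ R then V j else 0) :=
          sum_congr rfl fun j hj => by rw [if_pos (hR hj)]
      _ ≤ _ := ENNReal.sum_le_tsum s
  calc ∫⁻ x, a x ^ t ≤ ∫⁻ x, Md a x ^ t := by
        refine lintegral_mono_ae ?_
        filter_upwards [ae_le_Md ha hfin] with x hx
        exact rpow_le_rpow hx ht0.le
    _ ≤ 2 ^ t * ∑' j, V j := lintegral_rpow_le_layers (measurable_Md a) ht0
    _ ≤ 2 ^ t * (2 * (4 ^ t * (geo t * (gam⁻¹) ^ t * ∫⁻ x, G x ^ t))) :=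
        mul_mono (hVsum.trans (mul_mono (mul_mono hWsum)))
    _ = _ := by rw [hC]; ring

/-- The polynomial weight `(1 + |t|)^{-N}`. -/
def wt (N : ℕ) (t : ℝ) : ℝ := ((1 + |t|) ^ N)⁻¹

lemma wt_pos (N : ℕ) (t : ℝ) : 0 < wt N t := by unfold wt; positivity

lemma wt_nonneg (N : ℕ) (t : ℝ) : 0 ≤ wt N t := (wt_pos N t).le

lemma wt_le_one (N : ℕ) (t : ℝ) : wt N t ≤ 1 :=
  inv_le_one_of_one_le₀ (one_le_pow₀ (by linarith [abs_nonneg t]))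

lemma wt_anti {M N : ℕ} (h : M ≤ N) (t : ℝ) : wt N t ≤ wt M t :=
  inv_anti₀ (by positivity) (pow_le_pow_right₀ (by linarith [abs_nonneg t]) h)

lemma wt_add (M N : ℕ) (t : ℝ) : wt (M + N) t = wt M t * wt N t := by
  simp [wt, pow_add, mul_comm]

lemma wt_neg (N : ℕ) (t : ℝ) : wt N (-t) = wt N t := by simp [wt]

lemma wt_sub_comm (N : ℕ) (s t : ℝ) : wt N (s - t) = wt N (t - s) := by
  rw [← wt_neg, neg_sub]

lemma wt_shift (N : ℕ) (s t : ℝ) : wt N s ≤ (1 + |s - t|) ^ N * wt N t := by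
  unfold wt
  rw [← div_eq_mul_inv, le_div_iff₀ (by positivity), inv_mul_le_iff₀ (by positivity), ← mul_pow]
  refine pow_le_pow_left₀ (by positivity) ?_ N
  have : |t| ≤ |s| + |s - t| := by
    have := abs_sub_abs_le_abs_sub t s
    rw [abs_sub_comm] at this; linarith
  nlinarith [abs_nonneg s, abs_nonneg t, abs_nonneg (s - t), mul_nonneg (abs_nonneg s) (abs_nonneg (s - t))]

lemma wt_shift_le (N : ℕ) {s t : ℝ} (h : |s - t| ≤ 1) : wt N s ≤ 2 ^ N * wt N t :=
  (wt_shift N s t).trans (mul_le_mul_of_nonneg_right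
    (pow_le_pow_left₀ (by positivity) (by linarith) N) (wt_nonneg N t))

lemma wt_mono_abs (N : ℕ) {s t : ℝ} (h : |s| ≤ |t|) : wt N t ≤ wt N s :=
  inv_anti₀ (by positivity) (pow_le_pow_left₀ (by positivity) (by linarith) N)

lemma continuous_wt (N : ℕ) : Continuous (wt N) := by
  unfold wt
  exact Continuous.inv₀ (by fun_prop) fun x => by positivity

lemma measurable_wt (N : ℕ) : Measurable (wt N) := (continuous_wt N).measurable

lemma wt_two_le (t : ℝ) : wt 2 t ≤ (1 + t ^ 2)⁻¹ := by
  unfold wt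
  refine inv_anti₀ (by positivity) ?_
  nlinarith [abs_nonneg t, sq_abs t]

lemma integrable_wt {N : ℕ} (hN : 2 ≤ N) : Integrable (wt N) := by
  refine integrable_inv_one_add_sq.mono' (continuous_wt N).aestronglyMeasurable
    (.of_forall fun t => ?_)
  rw [norm_of_nonneg (wt_nonneg N t)]
  exact (wt_anti hN t).trans (wt_two_le t)

/-- Poisson-type average of `h` at scale `2^{-k}`. -/
def PP (N : ℕ) (k : ℤ) (h : ℝ → ℝ≥0∞) (x : ℝ) : ℝ≥0∞ :=
  ∫⁻ a, ofReal (2 ^ k * wt N (2 ^ k * (x - a))) * h a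

lemma PP_mono {N : ℕ} {h' : ℝ → ℝ≥0∞} (hh : ∀ a, h a ≤ h' a) (x : ℝ) : PP N k h x ≤ PP N k h' x := lintegral_mono fun a => mul_mono (hh a)

lemma PP_anti {M N : ℕ} (hMN : M ≤ N) (k : ℤ) (h : ℝ → ℝ≥0∞) (x : ℝ) : PP N k h x ≤ PP M k h x := by
  refine lintegral_mono fun a => mul_le_mul' (ofReal_le_ofReal ?_) le_rfl
  exact mul_le_mul_of_nonneg_left (wt_anti hMN _) (by positivity)

lemma measurable_PP {N : ℕ} (hh : Measurable h) : Measurable (PP N k h) := by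
  unfold PP
  refine Measurable.lintegral_prod_right' (f := fun p : ℝ × ℝ =>
    ofReal (2 ^ k * wt N (2 ^ k * (p.1 - p.2))) * h p.2) ?_
  have := measurable_wt N
  fun_prop

lemma PP_lintegral_const {N : ℕ} {c : ℝ≥0∞} (hc : c ≠ ∞) :
    PP N k (fun a => c * h a) x = c * PP N k h x := by
  unfold PP
  rw [← lint_const_mul hc]
  exact lintegral_congr fun a => by ring

lemma wt_two_le_layers (t : ℝ) : ofReal (wt 2 t) ≤
      ∑' j : ℕ, 4 * (2 : ℝ≥0∞) ^ (-2 * (j : ℤ)) * (if |t| ≤ 2 ^ j then 1 else 0) := by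
  rcases le_or_gt |t| 1 with h | h
  · refine le_trans ?_ (ENNReal.le_tsum 0)
    simp only [CharP.cast_eq_zero, mul_zero, zpow_zero, pow_zero, if_pos h, mul_one]
    exact (ofReal_le_ofReal (wt_le_one 2 t)).trans (by norm_num)
  · obtain ⟨j, hj1, hj2⟩ : ∃ j : ℕ, (2 : ℝ) ^ j < |t| ∧ |t| ≤ 2 ^ (j + 1) := by
      have hex : ∃ n : ℕ, |t| ≤ 2 ^ n := by
        obtain ⟨n, hn⟩ := pow_unbounded_of_one_lt |t| (one_lt_two : (1 : ℝ) < 2)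
        exact ⟨n, hn.le⟩
      classical
      have h0 : Nat.find hex ≠ 0 := fun h0 => by
        have := Nat.find_spec hex
        rw [h0, pow_zero] at this; linarith
      obtain ⟨m, hm⟩ := Nat.exists_eq_succ_of_ne_zero h0
      refine ⟨m, not_le.1 (Nat.find_min hex (by omega)), ?_⟩
      have := Nat.find_spec hex
      rwa [hm] at this
    refine le_trans ?_ (ENNReal.le_tsum (j + 1))
    rw [if_pos hj2, mul_one]
    have e : (4 : ℝ≥0∞) * 2 ^ (-2 * ((j + 1 : ℕ) : ℤ)) = ofReal (2 ^ (-2 * (j : ℤ))) := by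
      rw [ofReal_two_zpow, show (4 : ℝ≥0∞) = 2 ^ (2 : ℤ) by norm_cast, ← two_zpow_add]
      congr 1; push_cast; ring
    rw [e]
    refine ofReal_le_ofReal ?_
    rw [show (-2 * (j : ℤ)) = -((2 * j : ℕ) : ℤ) by push_cast; ring, zpow_neg, zpow_natCast, wt, pow_mul']
    refine inv_anti₀ (by positivity) ?_
    exact pow_le_pow_left₀ (by positivity) (by linarith) 2

lemma PP_two_le_MM (k : ℤ) (hm : Measurable h) (x : ℝ) : PP 2 k h x ≤ 8 * MM h x := by
  have hms : ∀ j : ℕ, MeasurableSet {a : ℝ | |(2 : ℝ) ^ k * (x - a)| ≤ 2 ^ j} := fun j =>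
    measurableSet_le (by fun_prop) measurable_const
  have hterm : ∀ j : ℕ, ∫⁻ a, 2 ^ k * (4 * (2 : ℝ≥0∞) ^ (-2 * (j : ℤ)) *
      (if |(2 : ℝ) ^ k * (x - a)| ≤ 2 ^ j then 1 else 0)) * h a ≤
      4 * ((2 : ℝ≥0∞) ^ (-(j : ℤ))) ^ (1 : ℝ) * MM h x := by
    intro j
    calc _ = ∫⁻ a, (2 ^ k * (4 * (2 : ℝ≥0∞) ^ (-2 * (j : ℤ)))) *
          ({a : ℝ | |(2 : ℝ) ^ k * (x - a)| ≤ 2 ^ j}.indicator h a) := by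
          refine lintegral_congr fun a => ?_
          by_cases ha : |(2 : ℝ) ^ k * (x - a)| ≤ 2 ^ j
          · rw [if_pos ha, indicator_of_mem (by exact ha)]; ring
          · rw [if_neg ha, indicator_of_notMem (by exact ha)]; ring
      _ = (2 ^ k * (4 * (2 : ℝ≥0∞) ^ (-2 * (j : ℤ)))) *
          ∫⁻ a in {a : ℝ | |(2 : ℝ) ^ k * (x - a)| ≤ 2 ^ j}, h a := by
          rw [lintegral_const_mul _ (hm.indicator (hms j)), lintegral_indicator (hms j)]
      _ ≤ (2 ^ k * (4 * (2 : ℝ≥0∞) ^ (-2 * (j : ℤ)))) *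
          ∫⁻ a in cell3 (k - j) (dix (k - j) x), h a := by
          refine mul_mono (lintegral_mono_set fun a ha => ?_)
          have ha' : |(2 : ℝ) ^ k * (x - a)| ≤ 2 ^ j := ha
          have h2 : |(2 : ℝ) ^ (k - j) * a - 2 ^ (k - j) * x| ≤ 1 := by
            rw [← mul_sub, zpow_sub₀ (by norm_num), zpow_natCast, div_mul_eq_mul_div, abs_div,
              abs_of_pos (show (0 : ℝ) < 2 ^ j by positivity), div_le_one (by positivity),
              ← abs_neg, ← mul_neg, neg_sub]
            exact ha'
          have h3 := abs_sub_dix_lt (k := k - j) (x := a) (y := x)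
          rw [mem_cell3]
          have h4 : |((dix (k - j) a - dix (k - j) x : ℤ) : ℝ)| < 2 := by push_cast; linarith
          have h5 : |dix (k - j) a - dix (k - j) x| < 2 := by exact_mod_cast h4
          omega
      _ = 4 * (2 : ℝ≥0∞) ^ (-(j : ℤ)) * avg3 (k - j) h x := by
          have e1 : (2 : ℝ≥0∞) ^ (k - j) = 2 ^ k * 2 ^ (-(j : ℤ)) := by
            rw [← two_zpow_add]; rfl
          have e2 : (2 : ℝ≥0∞) ^ (-2 * (j : ℤ)) = 2 ^ (-(j : ℤ)) * 2 ^ (-(j : ℤ)) := by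
            rw [← two_zpow_add]; congr 1; ring
          rw [avg3, e1, e2]
          ring
      _ ≤ _ := by rw [rpow_one]; exact mul_mono (avg3_le_MM _ _ _)
  calc PP 2 k h x ≤ ∫⁻ a, ∑' j : ℕ, 2 ^ k * (4 * (2 : ℝ≥0∞) ^ (-2 * (j : ℤ)) *
      (if |(2 : ℝ) ^ k * (x - a)| ≤ 2 ^ j then 1 else 0)) * h a := by
        refine lintegral_mono fun a => ?_
        simp only
        rw [ENNReal.tsum_mul_right, ENNReal.tsum_mul_left, ofReal_mul (by positivity),
          ofReal_two_zpow]
        exact mul_le_mul' (mul_mono (wt_two_le_layers _)) le_rfl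
    _ = ∑' j : ℕ, ∫⁻ a, 2 ^ k * (4 * (2 : ℝ≥0∞) ^ (-2 * (j : ℤ)) *
      (if |(2 : ℝ) ^ k * (x - a)| ≤ 2 ^ j then 1 else 0)) * h a := by
        refine lintegral_tsum fun j => (Measurable.aemeasurable ?_)
        exact ((measurable_const.mul (measurable_const.mul
          (Measurable.ite (hms j) measurable_const measurable_const)))).mul hm
    _ ≤ ∑' j : ℕ, 4 * ((2 : ℝ≥0∞) ^ (-(j : ℤ))) ^ (1 : ℝ) * MM h x := ENNReal.tsum_le_tsum hterm
    _ = 4 * geo 1 * MM h x := by rw [ENNReal.tsum_mul_right, ENNReal.tsum_mul_left, geo]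
    _ = 8 * MM h x := by
        have : geo 1 = 2 := by
          simp only [geo, rpow_one, ENNReal.zpow_neg, zpow_natCast, ENNReal.inv_pow,
            tsum_geometric, one_sub_inv_two, inv_inv]
        rw [this]; norm_num

lemma PP_le_MM {N : ℕ} (hN : 2 ≤ N) (k : ℤ) (hm : Measurable h) (x : ℝ) : PP N k h x ≤ 8 * MM h x := (PP_anti hN k h x).trans (PP_two_le_MM k hm x)

lemma PP_shift (N : ℕ) (k : ℤ) (h : ℝ → ℝ≥0∞) (x y : ℝ) :
    PP N k h x ≤ ofReal ((1 + |2 ^ k * (x - y)|) ^ N) * PP N k h y := by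
  unfold PP
  rw [← lint_const_mul ofReal_ne_top]
  refine lintegral_mono fun a => ?_
  rw [← mul_assoc, ← ofReal_mul (by positivity)]
  refine mul_le_mul' (ofReal_le_ofReal ?_) le_rfl
  have := wt_shift N (2 ^ k * (x - a)) (2 ^ k * (y - a))
  rw [show (2 : ℝ) ^ k * (x - a) - 2 ^ k * (y - a) = 2 ^ k * (x - y) by ring] at this
  calc (2 : ℝ) ^ k * wt N (2 ^ k * (x - a)) ≤ 2 ^ k * ((1 + |2 ^ k * (x - y)|) ^ N * wt N (2 ^ k * (y - a))) :=
        mul_le_mul_of_nonneg_left this (by positivity)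
    _ = _ := by ring

lemma PP_scale (N : ℕ) (hk : k₀ ≤ k) (h : ℝ → ℝ≥0∞) (x : ℝ) :
    PP N k h x ≤ 2 ^ (k - k₀) * PP N k₀ h x := by
  unfold PP
  rw [← lint_const_mul (two_zpow_ne_top _)]
  refine lintegral_mono fun a => ?_
  rw [← mul_assoc, ← ofReal_two_zpow, ← ofReal_mul (by positivity)]
  refine mul_le_mul' (ofReal_le_ofReal ?_) le_rfl
  rw [← mul_assoc, ← zpow_add₀ (by norm_num), sub_add_cancel]
  refine mul_le_mul_of_nonneg_left (wt_mono_abs N ?_) (by positivity)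
  rw [abs_mul, abs_mul, abs_of_pos (show (0 : ℝ) < 2 ^ k₀ by positivity),
    abs_of_pos (show (0 : ℝ) < 2 ^ k by positivity)]
  exact mul_le_mul_of_nonneg_right (zpow_le_zpow_right₀ (by norm_num) hk) (abs_nonneg _)

lemma PP_far (N m : ℕ) (hh : ∀ a, h a ≠ 0 → 1 ≤ |2 ^ k₀ * (x - a)|) :
    PP (N + m) k h x ≤ (2 ^ (k₀ - k)) ^ m * PP N k h x := by
  unfold PP
  rw [← lint_const_mul (by have := two_zpow_ne_top (k₀ - k); finiteness)]
  refine lintegral_mono fun a => ?_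
  rcases eq_or_ne (h a) 0 with h0 | h0
  · simp [h0]
  rw [← mul_assoc, ← ofReal_two_zpow, ← ofReal_pow (by positivity), ← ofReal_mul (by positivity)]
  refine mul_le_mul' (ofReal_le_ofReal ?_) le_rfl
  have h1 := hh a h0
  have h2 : wt m (2 ^ k * (x - a)) ≤ (2 ^ (k₀ - k)) ^ m := by
    unfold wt
    rw [← inv_inv ((2 : ℝ) ^ (k₀ - k)), inv_pow]
    refine inv_anti₀ (by positivity) (pow_le_pow_left₀ (by positivity) ?_ m)
    rw [← zpow_neg, neg_sub]
    have : |(2 : ℝ) ^ k * (x - a)| = 2 ^ (k - k₀) * |2 ^ k₀ * (x - a)| := by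
      rw [abs_mul, abs_mul, abs_of_pos (show (0 : ℝ) < 2 ^ k₀ by positivity),
        abs_of_pos (show (0 : ℝ) < 2 ^ k by positivity), ← mul_assoc,
        ← zpow_add₀ (by norm_num), sub_add_cancel]
    rw [this]
    have h3 : (0 : ℝ) < 2 ^ (k - k₀) := by positivity
    nlinarith
  rw [wt_add]
  calc (2 : ℝ) ^ k * (wt N (2 ^ k * (x - a)) * wt m (2 ^ k * (x - a)))
      ≤ 2 ^ k * (wt N (2 ^ k * (x - a)) * (2 ^ (k₀ - k)) ^ m) := by
        have := wt_nonneg N (2 ^ k * (x - a)); gcongr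
    _ = _ := by ring

/-- The left endpoint of the dyadic interval of length `2^{-(k+3)}` containing `a`. -/
def zz (k : ℤ) (a : ℝ) : ℝ := 2 ^ (-(k + 3)) * dix (k + 3) a

lemma measurable_zz (k : ℤ) : Measurable (zz k) := by
  unfold zz
  exact measurable_const.mul (measurable_from_top.comp (measurable_dix _))

lemma abs_sub_zz_le (k : ℤ) (a : ℝ) : |2 ^ k * (a - zz k a)| ≤ 1 := by
  have h1 : (2 : ℝ) ^ k * (a - zz k a) = 8⁻¹ * (2 ^ (k + 3) * a - dix (k + 3) a) := by
    have e : (2 : ℝ) ^ (k + 3) = 2 ^ k * 8 := by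
      rw [zpow_add₀ (by norm_num)]; norm_num
    have e0 : (2 : ℝ) ^ k ≠ 0 := by positivity
    rw [zz, zpow_neg, e]
    field_simp
  have h2 := Int.floor_le ((2 : ℝ) ^ (k + 3) * a)
  have h3 := Int.lt_floor_add_one ((2 : ℝ) ^ (k + 3) * a)
  rw [h1, abs_le]
  unfold dix
  constructor <;> linarith

lemma zz_congr {a b : ℝ} (h : dix (k + 3) a = dix (k + 3) b) : zz k a = zz k b := by
  rw [zz, zz, h]

/-- Size and smoothness bounds of a convolution kernel. -/
structure Ker (A : ℝ) (η : ℝ → ℂ) : Prop where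
  meas : Measurable η
  size : ∀ x, ‖η x‖ ≤ A * wt 16 x
  lip : ∀ x x', |x - x'| ≤ 1 → ‖η x - η x'‖ ≤ A * |x - x'| * wt 16 x

lemma Ker.nonneg (h : Ker A η) : 0 ≤ A := by
  have := (norm_nonneg _).trans (h.size 0)
  exact nonneg_of_mul_nonneg_left this (wt_pos 16 0)

lemma Ker.mono {B : ℝ} (h : Ker A η) (hAB : A ≤ B) : Ker B η where
  meas := h.meas
  size x := (h.size x).trans (mul_le_mul_of_nonneg_right hAB (wt_nonneg _ _))
  lip x x' hx := (h.lip x x' hx).trans (mul_le_mul_of_nonneg_right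
    (mul_le_mul_of_nonneg_right hAB (abs_nonneg _)) (wt_nonneg _ _))

/-- Reflected conjugate kernel. -/
def refl (η : ℝ → ℂ) : ℝ → ℂ := fun x => η (-x)

/-- Pointwise complex conjugate. -/
def cnj (η : ℝ → ℂ) : ℝ → ℂ := fun x => conj (η x)

lemma Ker.refl (h : Ker A η) : Ker A (refl η) where
  meas := h.meas.comp measurable_neg
  size x := by simpa [BiPara.refl, wt_neg] using h.size (-x)
  lip x x' hx := by
    have e : |-x - -x'| = |x - x'| := by rw [← abs_neg]; congr 1; ring
    have := h.lip (-x) (-x') (by rwa [e])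
    rwa [e, wt_neg] at this

lemma Ker.cnj (h : Ker A η) : Ker A (cnj η) where
  meas := Complex.continuous_conj.measurable.comp h.meas
  size x := by simpa [BiPara.cnj] using h.size x
  lip x x' hx := by
    have := h.lip x x' hx
    rwa [BiPara.cnj, BiPara.cnj, ← map_sub, RCLike.norm_conj]

lemma dil_refl (η : ℝ → ℂ) (k : ℤ) (x : ℝ) : dil (refl η) k x = dil η k (-x) := by
  simp [dil, refl]

lemma dil_cnj (η : ℝ → ℂ) (k : ℤ) (x : ℝ) : dil (cnj η) k x = conj (dil η k x) := by
  simp only [dil, cnj, map_mul, map_zpow₀, map_ofNat]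

lemma measurable_dil (h : Measurable η) (k : ℤ) : Measurable (dil η k) :=
  (h.comp (measurable_const_mul _)).const_mul _

lemma norm_dil (η : ℝ → ℂ) (k : ℤ) (x : ℝ) : ‖dil η k x‖ = 2 ^ k * ‖η (2 ^ k * x)‖ := by
  simp [dil]

lemma Ker.norm_dil_le (h : Ker A η) (k : ℤ) (x : ℝ) :
    ‖dil η k x‖ ≤ A * (2 ^ k * wt 16 (2 ^ k * x)) := by
  rw [norm_dil, mul_left_comm]
  exact mul_le_mul_of_nonneg_left (h.size _) (by positivity)

lemma Ker.norm_dil_sub_le (h : Ker A η) (k : ℤ) {x' : ℝ} (hx : |2 ^ k * (x - x')| ≤ 1) :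
    ‖dil η k x - dil η k x'‖ ≤ A * |2 ^ k * (x - x')| * (2 ^ k * wt 16 (2 ^ k * x)) := by
  have := h.lip (2 ^ k * x) (2 ^ k * x') (by rwa [← mul_sub])
  rw [← mul_sub] at this
  have e : dil η k x - dil η k x' = (2 : ℂ) ^ k * (η (2 ^ k * x) - η (2 ^ k * x')) := by
    simp only [dil]; ring
  rw [e, norm_mul, norm_zpow, Complex.norm_ofNat, mul_left_comm]
  exact mul_le_mul_of_nonneg_left this (by positivity)

/-- Functions with quadratic decay. -/
def Dec {E : Type*} [NormedAddCommGroup E] (u : ℝ → E) : Prop :=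
  StronglyMeasurable u ∧ ∃ C : ℝ, ∀ x, ‖u x‖ ≤ C * wt 2 x

section Dec
variable {E : Type*} [NormedAddCommGroup E] {F : Type*} [NormedAddCommGroup F]

lemma Dec.const_nonneg {u : ℝ → E} {C : ℝ} (h : ∀ x, ‖u x‖ ≤ C * wt 2 x) : 0 ≤ C :=
  nonneg_of_mul_nonneg_left ((norm_nonneg _).trans (h 0)) (wt_pos 2 0)

lemma Dec.integrable {u : ℝ → E} (h : Dec u) : Integrable u := by
  obtain ⟨hm, C, hC⟩ := h
  exact ((integrable_wt le_rfl).const_mul C).mono' hm.aestronglyMeasurable (.of_forall hC)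

lemma Dec.bounded {u : ℝ → E} (h : Dec u) : ∃ C : ℝ, 0 ≤ C ∧ ∀ x, ‖u x‖ ≤ C := by
  obtain ⟨hm, C, hC⟩ := h
  have h0 := Dec.const_nonneg hC
  exact ⟨C, h0, fun x => (hC x).trans (mul_le_of_le_one_right h0 (wt_le_one _ _))⟩

lemma Dec.measurable_enorm {u : ℝ → E} (h : Dec u) : Measurable fun x => ‖u x‖ₑ := h.1.enorm

lemma Dec.of_norm_le {u : ℝ → E} {v : ℝ → F} (h : Dec u) (hv : StronglyMeasurable v) {C : ℝ}
    (hC : ∀ x, ‖v x‖ ≤ C * ‖u x‖) : Dec v := by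
  obtain ⟨hm, D, hD⟩ := h
  refine ⟨hv, |C| * D, fun x => (hC x).trans ?_⟩
  rw [mul_assoc]
  exact mul_le_mul (le_abs_self C) (hD x) (norm_nonneg _) (abs_nonneg _)

lemma Dec.zero : Dec (fun _ => (0 : E)) :=
  ⟨stronglyMeasurable_const, 0, fun x => by simp⟩

lemma Dec.add {u v : ℝ → E} (hu : Dec u) (hv : Dec v) : Dec (fun x => u x + v x) := by
  obtain ⟨hm, C, hC⟩ := hu
  obtain ⟨hm', C', hC'⟩ := hv
  refine ⟨hm.add hm', C + C', fun x => (norm_add_le _ _).trans ?_⟩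
  rw [add_mul]; exact add_le_add (hC x) (hC' x)

lemma Dec.sum {ι : Type*} (s : Finset ι) {u : ι → ℝ → E} (h : ∀ i ∈ s, Dec (u i)) :
    Dec (fun x => ∑ i ∈ s, u i x) := by
  classical
  induction s using Finset.induction_on with
  | empty => simpa using Dec.zero
  | insert a s ha ih =>
    simp only [sum_insert ha]
    exact (h a (by simp)).add (ih fun i hi => h i (by simp [hi]))

lemma Dec.indicator {u : ℝ → E} (hu : Dec u) {S : Set ℝ} (hS : MeasurableSet S) :
    Dec (S.indicator u) :=
  hu.of_norm_le (hu.1.indicator hS) (C := 1) fun x => by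
    rw [one_mul]; exact norm_indicator_le_norm_self _ _

lemma Dec.lintegral_ne_top {u : ℝ → E} (h : Dec u) : ∫⁻ x, ‖u x‖ₑ ≠ ∞ := h.integrable.2.ne

variable [NormedSpace ℂ E] [NormedSpace ℂ F]

lemma Dec.clm {u : ℝ → E} (hu : Dec u) (m : E →L[ℂ] F) : Dec (fun x => m (u x)) :=
  hu.of_norm_le (m.continuous.comp_stronglyMeasurable hu.1) (C := ‖m‖) fun x => m.le_opNorm _

lemma Dec.smul_bdd {u : ℝ → E} (hu : Dec u) {c : ℝ → ℂ} (hc : Measurable c) {C : ℝ}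
    (hC : ∀ x, ‖c x‖ ≤ C) : Dec (fun x => c x • u x) :=
  hu.of_norm_le (hc.stronglyMeasurable.smul hu.1) (C := C) fun x => by
    rw [norm_smul]; exact mul_le_mul_of_nonneg_right (hC x) (norm_nonneg _)

lemma Dec.const_smul {u : ℝ → E} (hu : Dec u) (c : ℂ) : Dec (fun x => c • u x) :=
  hu.smul_bdd measurable_const (fun _ => le_rfl)

end Dec

/-- A family of integral kernels adapted to dyadic scales. -/
structure KerOp (A : ℝ) (κ : ℤ → ℝ → ℝ → ℂ) : Prop where
  nonneg : 0 ≤ A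
  meas : ∀ k, Measurable (uncurry (κ k))
  size : ∀ k x a, ‖κ k x a‖ ≤ A * (2 ^ k * wt 8 (2 ^ k * (x - a)))
  reg : ∀ k k₀ x x' a, k ≤ k₀ → dix k₀ x = dix k₀ x' →
    ‖κ k x a - κ k x' a‖ ≤ A * 2 ^ (k - k₀) * (2 ^ k * wt 8 (2 ^ k * (x - a)))

/-- The integral operator with kernel `κ`. -/
def op {E : Type*} [NormedAddCommGroup E] [NormedSpace ℂ E]
    (κ : ℝ → ℝ → ℂ) (u : ℝ → E) (x : ℝ) : E := ∫ a, κ x a • u a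

/-- The kernel of the synthesis operator. -/
def kS (η : ℝ → ℂ) (k : ℤ) (x a : ℝ) : ℂ := dil η k (x - zz k a)

/-- The kernel of the analysis operator. -/
def kA (η : ℝ → ℂ) (k : ℤ) (x a : ℝ) : ℂ := dil η k (zz k x - a)

lemma abs_dix_congr {x' : ℝ} (h : dix k₀ x = dix k₀ x') : |2 ^ k * (x - x')| ≤ 2 ^ (k - k₀) := by
  have h1 := dix_dist (k := k₀) (x := x) (y := x')
  rw [h] at h1
  simp only [sub_self, abs_zero, zero_add] at h1
  have e : (2 : ℝ) ^ k * (x - x') = 2 ^ (k - k₀) * (2 ^ k₀ * x - 2 ^ k₀ * x') := by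
    rw [← mul_sub, ← mul_assoc, ← zpow_add₀ (by norm_num), sub_add_cancel]
  have h3 : (0 : ℝ) < 2 ^ (k - k₀) := by positivity
  rw [e, abs_mul, abs_of_pos h3]
  exact mul_le_of_le_one_right h3.le h1.le

/-- Kernels `dil η k (x - z k a)` with `z k a` within `2^{-k}` of `a`. -/
lemma Ker.kerOp (h : Ker A η) {z : ℤ → ℝ → ℝ} (hz : ∀ k, Measurable (z k))
    (hz' : ∀ k a, |2 ^ k * (a - z k a)| ≤ 1) :
    KerOp (2 ^ 8 * A) (fun k x a => dil η k (x - z k a)) := by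
  have hw (k : ℤ) (x a : ℝ) := (wt_anti (show 8 ≤ 16 by norm_num) _).trans
    (wt_shift_le 8 (s := 2 ^ k * (x - z k a)) (t := 2 ^ k * (x - a))
    (by rw [← mul_sub]; simpa using hz' k a))
  have h0 := h.nonneg
  refine ⟨mul_nonneg (by norm_num) h0, fun k => (measurable_dil h.meas k).comp
    (measurable_fst.sub ((hz k).comp measurable_snd)), fun k x a => ?_, fun k k₀ x x' a hk hx => ?_⟩
  · refine (h.norm_dil_le k _).trans ?_
    calc A * (2 ^ k * wt 16 (2 ^ k * (x - z k a)))
        ≤ A * (2 ^ k * (2 ^ 8 * wt 8 (2 ^ k * (x - a)))) := by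
          have := hw k x a
          gcongr
      _ = _ := by ring
  · have h1 := abs_dix_congr (k := k) hx
    have h2 : (2 : ℝ) ^ (k - k₀) ≤ 1 := zpow_le_one_of_nonpos₀ (by norm_num) (by omega)
    have e : x - z k a - (x' - z k a) = x - x' := by ring
    have h3 := h.norm_dil_sub_le k (x := x - z k a) (x' := x' - z k a) (by
      rw [e]; exact h1.trans h2)
    refine h3.trans ?_
    rw [e]
    calc A * |2 ^ k * (x - x')| * (2 ^ k * wt 16 (2 ^ k * (x - z k a)))
        ≤ A * 2 ^ (k - k₀) * (2 ^ k * (2 ^ 8 * wt 8 (2 ^ k * (x - a)))) := by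
          have := hw k x a
          have := wt_nonneg 16 (2 ^ k * (x - z k a))
          gcongr
      _ = _ := by ring

lemma Ker.kS (h : Ker A η) : KerOp (2 ^ 8 * A) (kS η) :=
  h.kerOp measurable_zz abs_sub_zz_le

/-- Convolution kernels. -/
lemma Ker.kC (h : Ker A η) : KerOp (2 ^ 8 * A) (fun k x a => dil η k (x - a)) :=
  h.kerOp (z := fun _ a => a) (fun _ => measurable_id) (by simp)

lemma norm_kA_le (h : Ker A η) (k : ℤ) (x a : ℝ) :
    ‖kA η k x a‖ ≤ 2 ^ 8 * A * (2 ^ k * wt 8 (2 ^ k * (x - a))) := by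
  refine (h.norm_dil_le k _).trans ?_
  have := (wt_anti (show 8 ≤ 16 by norm_num) _).trans
    (wt_shift_le 8 (s := 2 ^ k * (zz k x - a)) (t := 2 ^ k * (x - a))
    (by rw [← mul_sub, abs_le]; have := abs_le.1 (abs_sub_zz_le k x)
        constructor <;> nlinarith))
  calc A * (2 ^ k * wt 16 (2 ^ k * (zz k x - a)))
      ≤ A * (2 ^ k * (2 ^ 8 * wt 8 (2 ^ k * (x - a)))) := by
        have := h.nonneg; gcongr
    _ = _ := by ring

lemma Ker.kA (h : Ker A η) : KerOp (2 ^ 20 * A) (kA η) where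
  nonneg := mul_nonneg (by norm_num) h.nonneg
  meas k := (measurable_dil h.meas k).comp
    (((measurable_zz k).comp measurable_fst).sub measurable_snd)
  size k x a := by
    refine (norm_kA_le h k x a).trans (mul_le_mul_of_nonneg_right ?_ ?_)
    · have := h.nonneg; nlinarith
    · have := wt_nonneg 8 (2 ^ k * (x - a)); positivity
  reg k k₀ x x' a hk hx := by
    rcases le_or_gt (k + 3) k₀ with h3 | h3
    · have : zz k x = zz k x' := zz_congr (dix_congr h3 hx)
      rw [BiPara.kA, BiPara.kA, this, sub_self, norm_zero]
      have := h.nonneg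
      have := wt_nonneg 8 (2 ^ k * (x - a))
      positivity
    · have h1 := norm_kA_le h k x a
      have h2 := norm_kA_le h k x' a
      have h5 := wt_shift_le 8 (s := 2 ^ k * (x' - a)) (t := 2 ^ k * (x - a)) (by
        rw [← mul_sub]
        have := abs_dix_congr (k := k) hx.symm
        have h2 : (2 : ℝ) ^ (k - k₀) ≤ 1 := zpow_le_one_of_nonpos₀ (by norm_num) (by omega)
        simpa using this.trans h2)
      have h4 : (1 : ℝ) ≤ 8 * 2 ^ (k - k₀) := by
        have : (2 : ℝ) ^ (-3 : ℤ) ≤ 2 ^ (k - k₀) := zpow_le_zpow_right₀ (by norm_num) (by omega)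
        norm_num at this; linarith
      have hA := h.nonneg
      have hw := wt_nonneg 8 (2 ^ k * (x - a))
      have hk0 : (0 : ℝ) < 2 ^ k := by positivity
      calc _ ≤ ‖BiPara.kA η k x a‖ + ‖BiPara.kA η k x' a‖ := norm_sub_le _ _
        _ ≤ 2 ^ 8 * A * (2 ^ k * wt 8 (2 ^ k * (x - a))) +
            2 ^ 8 * A * (2 ^ k * (2 ^ 8 * wt 8 (2 ^ k * (x - a)))) := by
            refine add_le_add h1 (h2.trans ?_); gcongr
        _ ≤ 2 ^ 17 * A * (2 ^ k * wt 8 (2 ^ k * (x - a))) * 1 := by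
            have : 0 ≤ A * (2 ^ k * wt 8 (2 ^ k * (x - a))) := by positivity
            nlinarith
        _ ≤ 2 ^ 17 * A * (2 ^ k * wt 8 (2 ^ k * (x - a))) * (8 * 2 ^ (k - k₀)) := by gcongr
        _ = _ := by ring

section Op
variable {E : Type*} [NormedAddCommGroup E] [NormedSpace ℂ E]

lemma op_integrable {κ : ℝ → ℝ → ℂ} (hκ : Measurable (uncurry κ)) {C : ℝ} (hC : ∀ a, ‖κ x a‖ ≤ C)
    {u : ℝ → E} (hu : Dec u) : Integrable fun a => κ x a • u a :=
  (hu.smul_bdd (hκ.comp (measurable_const.prodMk measurable_id)) hC).integrable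

lemma KerOp.norm_le {κ : ℤ → ℝ → ℝ → ℂ} (hκ : KerOp A κ) (k : ℤ) (x a : ℝ) :
    ‖κ k x a‖ ≤ A * 2 ^ k := by
  refine (hκ.size k x a).trans (mul_le_mul_of_nonneg_left ?_ hκ.nonneg)
  exact mul_le_of_le_one_right (by positivity) (wt_le_one _ _)

lemma KerOp.integrable {κ : ℤ → ℝ → ℝ → ℂ} (hκ : KerOp A κ) (k : ℤ) (x : ℝ) {u : ℝ → E} (hu : Dec u)
    : Integrable fun a => κ k x a • u a :=
  op_integrable (hκ.meas k) (hκ.norm_le k x) hu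

lemma KerOp.enorm_op_le {κ : ℤ → ℝ → ℝ → ℂ} (hκ : KerOp A κ) (k : ℤ) (u : ℝ → E) (x : ℝ) :
    ‖op (κ k) u x‖ₑ ≤ ofReal A * PP 8 k (fun a => ‖u a‖ₑ) x := by
  unfold op PP
  refine (enorm_integral_le_lintegral_enorm _).trans ?_
  rw [← lint_const_mul ofReal_ne_top]
  refine lintegral_mono fun a => ?_
  rw [enorm_smul, ← mul_assoc, ← ofReal_mul hκ.nonneg, ← ofReal_norm]
  exact mul_le_mul' (ofReal_le_ofReal (hκ.size k x a)) le_rfl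

lemma KerOp.enorm_op_sub_le {κ : ℤ → ℝ → ℝ → ℂ} (hκ : KerOp A κ) {u : ℝ → E} (hu : Dec u) {x' : ℝ}
    (hk : k ≤ k₀) (hx : dix k₀ x = dix k₀ x') : ‖op (κ k) u x - op (κ k) u x'‖ₑ ≤
      ofReal A * 2 ^ (k - k₀) * PP 8 k (fun a => ‖u a‖ₑ) x := by
  unfold op PP
  rw [← integral_sub (hκ.integrable k x hu) (hκ.integrable k x' hu)]
  refine (enorm_integral_le_lintegral_enorm _).trans ?_
  rw [← ofReal_two_zpow, ← ofReal_mul hκ.nonneg, ← lint_const_mul ofReal_ne_top]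
  refine lintegral_mono fun a => ?_
  rw [← sub_smul, enorm_smul, ← mul_assoc, ← ofReal_mul (by have := hκ.nonneg; positivity),
    ← ofReal_norm]
  exact mul_le_mul' (ofReal_le_ofReal (hκ.reg k k₀ x x' a hk hx)) le_rfl

lemma stronglyMeasurable_op {κ : ℝ → ℝ → ℂ} (hκ : Measurable (uncurry κ)) {u : ℝ → E}
    (hu : StronglyMeasurable u) : StronglyMeasurable (op κ u) := by
  unfold op
  exact StronglyMeasurable.integral_prod_right' (f := fun p : ℝ × ℝ => κ p.1 p.2 • u p.2)
    (hκ.stronglyMeasurable.smul (hu.comp_measurable measurable_snd))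

lemma PP_wt_le (k : ℤ) : ∃ C : ℝ≥0, ∀ x,
    PP 8 k (fun a => ofReal (wt 2 a)) x ≤ C * ofReal (wt 2 x) := by
  refine ⟨Real.toNNReal (max 1 ((2 : ℝ) ^ (-k)) ^ 2) *
    (∫⁻ t, ofReal (wt 6 t)).toNNReal, fun x => ?_⟩
  have hfin : ∫⁻ t, ofReal (wt 6 t) ≠ ∞ := by
    have := (integrable_wt (N := 6) (by norm_num)).2.ne
    simpa [HasFiniteIntegral, Real.enorm_of_nonneg (wt_nonneg 6 _)] using this
  have hbd : ∀ a, (2 : ℝ) ^ k * wt 8 (2 ^ k * (x - a)) * wt 2 a ≤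
      (max 1 ((2 : ℝ) ^ (-k)) ^ 2 * wt 2 x) * (2 ^ k * wt 6 (2 ^ k * (x - a))) := by
    intro a
    have h1 := wt_shift 2 a x
    have h2 : (1 + |a - x|) ^ 2 * wt 2 (2 ^ k * (x - a)) ≤ max 1 ((2 : ℝ) ^ (-k)) ^ 2 := by
      unfold wt
      rw [← div_eq_mul_inv, div_le_iff₀ (by positivity), ← mul_pow]
      refine pow_le_pow_left₀ (by positivity) ?_ 2
      have e : |a - x| = 2 ^ (-k) * |2 ^ k * (x - a)| := by
        rw [abs_mul, abs_of_pos (show (0 : ℝ) < 2 ^ k by positivity), ← mul_assoc,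
          ← zpow_add₀ (by norm_num), neg_add_cancel, zpow_zero, one_mul, abs_sub_comm]
      rw [e, mul_add, mul_one]
      exact add_le_add (le_max_left _ _)
        (mul_le_mul_of_nonneg_right (le_max_right _ _) (abs_nonneg _))
    rw [show (8 : ℕ) = 2 + 6 by norm_num, wt_add]
    have h3 := wt_nonneg 2 (2 ^ k * (x - a))
    have h4 := wt_nonneg 6 (2 ^ k * (x - a))
    calc (2 : ℝ) ^ k * (wt 2 (2 ^ k * (x - a)) * wt 6 (2 ^ k * (x - a))) * wt 2 a
        ≤ (2 : ℝ) ^ k * (wt 2 (2 ^ k * (x - a)) * wt 6 (2 ^ k * (x - a))) *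
          ((1 + |a - x|) ^ 2 * wt 2 x) := by gcongr
      _ = ((1 + |a - x|) ^ 2 * wt 2 (2 ^ k * (x - a))) *
          (wt 2 x * (2 ^ k * wt 6 (2 ^ k * (x - a)))) := by ring
      _ ≤ max 1 ((2 : ℝ) ^ (-k)) ^ 2 * (wt 2 x * (2 ^ k * wt 6 (2 ^ k * (x - a)))) := by
          have := wt_nonneg 2 x; gcongr
      _ = _ := by ring
  have hw := wt_nonneg 2 x
  have hmass : ∫⁻ a, ofReal (2 ^ k * wt 6 (2 ^ k * (x - a))) = ∫⁻ t, ofReal (wt 6 t) := by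
    have e1 : ∫⁻ a, ofReal (2 ^ k * wt 6 (2 ^ k * (x - a))) =
        ∫⁻ a, ofReal (2 ^ k * wt 6 (2 ^ k * a)) :=
      lintegral_sub_left_eq_self (fun a => ofReal (2 ^ k * wt 6 (2 ^ k * a))) x
    have hi : Integrable (fun a => (2 : ℝ) ^ k * wt 6 (2 ^ k * a)) :=
      ((integrable_wt (N := 6) (by norm_num)).comp_mul_left' (by positivity)).const_mul _
    rw [e1, ← ofReal_integral_eq_lintegral_ofReal hi
      (.of_forall fun a => by have := wt_nonneg 6 (2 ^ k * a); positivity),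
      ← ofReal_integral_eq_lintegral_ofReal (integrable_wt (by norm_num))
      (.of_forall fun a => wt_nonneg 6 a), integral_const_mul, Measure.integral_comp_mul_left]
    congr 1
    have h2 : (0 : ℝ) < 2 ^ k := by positivity
    rw [abs_of_pos (by positivity), smul_eq_mul, ← mul_assoc, mul_inv_cancel₀ h2.ne', one_mul]
  calc PP 8 k (fun a => ofReal (wt 2 a)) x
      ≤ ∫⁻ a, ofReal (max 1 ((2 : ℝ) ^ (-k)) ^ 2 * wt 2 x) *
        ofReal (2 ^ k * wt 6 (2 ^ k * (x - a))) := by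
        unfold PP
        refine lintegral_mono fun a => ?_
        rw [← ofReal_mul (by have := wt_nonneg 8 (2 ^ k * (x - a)); positivity),
          ← ofReal_mul (by positivity)]
        exact ofReal_le_ofReal (hbd a)
    _ = _ := by
        rw [lint_const_mul ofReal_ne_top, hmass,
          ofReal_mul (by positivity), coe_mul, coe_toNNReal hfin, ofReal]
        ring

lemma KerOp.dec_op {κ : ℤ → ℝ → ℝ → ℂ} (hκ : KerOp A κ) (k : ℤ) {u : ℝ → E} (hu : Dec u) :
    Dec (op (κ k) u) := by
  obtain ⟨C, hC⟩ := PP_wt_le k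
  obtain ⟨hm, D, hD⟩ := hu
  have hD0 := Dec.const_nonneg hD
  refine ⟨stronglyMeasurable_op (hκ.meas k) hm, A * D * C, fun x => ?_⟩
  have h0 := hκ.nonneg
  have hw := wt_nonneg 2 x
  rw [← ofReal_le_ofReal_iff (by positivity), ofReal_norm]
  calc ‖op (κ k) u x‖ₑ ≤ ofReal A * PP 8 k (fun a => ‖u a‖ₑ) x := hκ.enorm_op_le k u x
    _ ≤ ofReal A * PP 8 k (fun a => ofReal D * ofReal (wt 2 a)) x := by
        refine mul_mono (PP_mono (fun a => ?_) x)
        rw [← ofReal_mul hD0, ← ofReal_norm]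
        exact ofReal_le_ofReal (hD a)
    _ ≤ ofReal A * (ofReal D * (C * ofReal (wt 2 x))) := by
        rw [PP_lintegral_const ofReal_ne_top]
        exact mul_mono (mul_mono (hC x))
    _ = ofReal (A * D * C * wt 2 x) := by
        rw [ofReal_mul (by positivity), ofReal_mul (by positivity),
          ofReal_mul h0, ofReal_coe_nnreal]
        ring

end Op

/-- Almost orthogonality of the dilates of a kernel over the scales in `K`. -/
def Orth (ψ : ℝ → ℂ) (K : Finset ℤ) : Prop :=
  ∀ j ∈ K, ∀ k ∈ K, 2 ≤ |j - k| → ∀ z w : ℝ,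
    ∫ x, dil ψ k (x - z) * conj (dil ψ j (x - w)) = 0

lemma Orth.refl (h : Orth ψ K) : Orth (refl ψ) K := by
  intro j hj k hk hjk z w
  rw [← h j hj k hk hjk (-z) (-w), ← integral_neg_eq_self]
  refine int_congr fun x => ?_
  simp only [dil_refl]
  congr 2 <;> ring_nf

lemma Orth.cnj (h : Orth ψ K) : Orth (cnj ψ) K := by
  intro j hj k hk hjk z w
  have := h j hj k hk hjk z w
  rw [← map_zero (starRingEnd ℂ), ← this, ← integral_conj]
  refine int_congr fun x => ?_
  simp [dil_cnj]

lemma Orth.mono {L : Finset ℤ} (h : Orth ψ K) (hL : L ⊆ K) : Orth ψ L :=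
  fun j hj k hk => h j (hL hj) k (hL hk)

section
variable {E : Type*} [NormedAddCommGroup E] [InnerProductSpace ℂ E] [CompleteSpace E]

lemma Dec.integrable_inner {u v : ℝ → E} (hu : Dec u) (hv : Dec v) :
    Integrable fun x => inner ℂ (u x) (v x) := by
  obtain ⟨C, hC0, hC⟩ := hu.bounded
  refine (hv.integrable.norm.const_mul C).mono'
    (hu.1.inner hv.1).aestronglyMeasurable (.of_forall fun x => ?_)
  exact (norm_inner_le_norm _ _).trans (mul_le_mul_of_nonneg_right (hC x) (norm_nonneg _))

/-- Fubini for the bilinear form of an integral operator with bounded kernel. -/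
lemma inner_op_eq {κ : ℝ → ℝ → ℂ} (hκ : Measurable (uncurry κ)) {C : ℝ} (hC : ∀ x a, ‖κ x a‖ ≤ C)
    {u v : ℝ → E} (hu : Dec u) (hv : Dec v) : ∫ x, inner ℂ (v x) (op κ u x) =
      ∫ a, inner ℂ (op (fun a x => conj (κ x a)) v a) (u a) := by
  have hC0 : 0 ≤ C := (norm_nonneg _).trans (hC 0 0)
  have e1 : ∀ x, inner ℂ (v x) (op κ u x) = ∫ a, κ x a * inner ℂ (v x) (u a) := fun x => by
    rw [op, ← integral_inner (op_integrable hκ (hC x) hu)]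
    simp only [inner_smul_right]
  have e2 : ∀ a, inner ℂ (op (fun a x => conj (κ x a)) v a) (u a) =
      ∫ x, κ x a * inner ℂ (v x) (u a) := fun a => by
    have hi : Integrable fun x => conj (κ x a) • v x :=
      op_integrable (κ := fun a x => conj (κ x a)) (C := C)
        (Complex.continuous_conj.measurable.comp (hκ.comp measurable_swap)) (x := a)
        (fun x => by rw [RCLike.norm_conj]; exact hC x a) hv
    rw [op, ← inner_conj_symm, ← integral_inner hi, ← integral_conj]
    refine int_congr fun x => ?_
    simp only [inner_smul_right, map_mul, RingHomCompTriple.comp_apply, RingHom.id_apply,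
      inner_conj_symm]
  simp_rw [e1, e2]
  refine integral_integral_swap ?_
  refine ((hv.integrable.norm.mul_prod hu.integrable.norm).const_mul C).mono' ?_
    (.of_forall fun p => ?_)
  · exact (hκ.stronglyMeasurable.mul ((hv.1.comp_measurable measurable_fst).inner
      (hu.1.comp_measurable measurable_snd))).aestronglyMeasurable
  · simp only [uncurry]
    rw [norm_mul]
    exact mul_le_mul (hC _ _) (norm_inner_le_norm _ _) (norm_nonneg _) hC0

lemma op_op_eq_zero {κ κ' : ℝ → ℝ → ℂ} (hκ : Measurable (uncurry κ)) (hκ' : Measurable (uncurry κ'))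
    {C : ℝ} (hC : ∀ x a, ‖κ x a‖ ≤ C) {b : ℝ} (hi : Integrable (κ' b))
    (h0 : ∀ a, ∫ x, κ' b x * κ x a = 0) {u : ℝ → E} (hu : Dec u) : op κ' (op κ u) b = 0 := by
  have hC0 : 0 ≤ C := (norm_nonneg _).trans (hC 0 0)
  have e1 : ∀ x, κ' b x • op κ u x = ∫ a, (κ' b x * κ x a) • u a := fun x => by
    rw [op, ← integral_smul]; simp only [smul_smul]
  rw [op]
  simp_rw [e1]
  rw [integral_integral_swap]
  · simp_rw [integral_smul_const, h0, zero_smul, integral_zero]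
  · refine ((hi.norm.mul_prod hu.integrable.norm).const_mul C).mono' ?_ (.of_forall fun p => ?_)
    · refine StronglyMeasurable.aestronglyMeasurable (StronglyMeasurable.smul ?_
        (hu.1.comp_measurable measurable_snd))
      exact ((hκ'.comp (measurable_const.prodMk measurable_fst)).mul hκ).stronglyMeasurable
    · simp only [uncurry]
      rw [norm_smul, norm_mul, mul_comm ‖κ' b p.1‖, mul_assoc]
      exact mul_le_mul_of_nonneg_right (hC _ _) (by positivity)

lemma kS_adj (η : ℝ → ℂ) (k : ℤ) : (fun a x => conj (kS η k x a)) = kA (cnj (refl η)) k := by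
  funext a x
  rw [kS, kA, dil_cnj, dil_refl, neg_sub]

lemma kA_adj (η : ℝ → ℂ) (k : ℤ) : (fun a x => conj (kA η k x a)) = kS (cnj (refl η)) k := by
  funext a x
  rw [kS, kA, dil_cnj, dil_refl, neg_sub]

lemma Ker.integrable_kA (h : Ker A η) (k : ℤ) (b : ℝ) : Integrable (BiPara.kA η k b) := by
  have h2 : (2 : ℝ) ^ k ≠ 0 := by positivity
  have h1 : Integrable (fun x => A * (2 ^ k * wt 16 (2 ^ k * (zz k b - x)))) := by
    refine Integrable.const_mul (Integrable.const_mul ?_ _) _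
    exact ((integrable_wt (N := 16) (by norm_num)).comp_mul_left' h2).comp_sub_left (zz k b)
  refine h1.mono' ?_ (.of_forall fun x => h.norm_dil_le k _)
  exact ((measurable_dil h.meas k).comp (measurable_const.sub measurable_id)).aestronglyMeasurable

lemma inner_synth_eq_zero (hψ : Ker A ψ) (ho : Orth ψ K) {j : ℤ} (hj : j ∈ K) (hk : k ∈ K)
    (hjk : 2 ≤ |j - k|) {u v : ℝ → E} (hu : Dec u) (hv : Dec v) :
    ∫ x, inner ℂ (op (kS ψ k) v x) (op (kS ψ j) u x) = 0 := by
  have hS := hψ.kS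
  have hψ' : Ker A (cnj (refl ψ)) := hψ.refl.cnj
  rw [inner_op_eq (hS.meas j) (hS.norm_le j) hu (hS.dec_op k hv), kS_adj]
  refine integral_eq_zero_of_ae (.of_forall fun b => ?_)
  simp only [Pi.zero_apply]
  rw [op_op_eq_zero (hS.meas k) (hψ'.kA.meas j) (hS.norm_le k) (hψ'.integrable_kA j b) _ hv,
    inner_zero_left]
  intro a
  rw [← ho j hj k hk hjk (zz k a) (zz j b)]
  refine int_congr fun x => ?_
  simp only [kA, kS, dil_cnj, dil_refl, neg_sub]
  ring

lemma Dec.integrable_sq {u : ℝ → E} (hu : Dec u) : Integrable fun x => ‖u x‖ ^ 2 := by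
  obtain ⟨C, hC0, hC⟩ := hu.bounded
  refine (hu.integrable.norm.const_mul C).mono' (hu.1.norm.pow 2).aestronglyMeasurable
    (.of_forall fun x => ?_)
  rw [norm_of_nonneg (by positivity), sq]
  exact mul_le_mul_of_nonneg_right (hC x) (norm_nonneg _)

lemma Dec.lintegral_sq {u : ℝ → E} (hu : Dec u) :
    ∫⁻ x, ‖u x‖ₑ ^ (2 : ℝ) = ofReal (∫ x, ‖u x‖ ^ 2) := by
  rw [ofReal_integral_eq_lintegral_ofReal hu.integrable_sq (.of_forall fun x => by positivity)]
  refine lintegral_congr fun x => ?_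
  rw [ofReal_pow (norm_nonneg _), ofReal_norm]
  exact_mod_cast rpow_natCast _ 2

lemma Dec.integral_inner_self {u : ℝ → E} :
    ∫ x, inner ℂ (u x) (u x) = ((∫ x, ‖u x‖ ^ 2 : ℝ) : ℂ) := by
  rw [← integral_complex_ofReal]
  refine int_congr fun x => ?_
  simp only [inner_self_eq_norm_sq_to_K]
  push_cast; rfl

lemma integral_norm_sq_sum {s : Finset ℤ} {F : ℤ → ℝ → E} (hF : ∀ k ∈ s, Dec (F k))
    (h : ∀ j ∈ s, ∀ k ∈ s, j ≠ k → ∫ x, inner ℂ (F k x) (F j x) = 0) :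
    ∫ x, ‖∑ k ∈ s, F k x‖ ^ 2 = ∑ k ∈ s, ∫ x, ‖F k x‖ ^ 2 := by
  have h1 : ∀ x, (inner ℂ (∑ k ∈ s, F k x) (∑ k ∈ s, F k x) : ℂ) =
      ∑ k ∈ s, ∑ j ∈ s, inner ℂ (F k x) (F j x) := fun x => by
    rw [sum_inner]
    exact sum_congr rfl fun k _ => inner_sum _ _ _
  have h2 : ∫ x, (inner ℂ (∑ k ∈ s, F k x) (∑ k ∈ s, F k x) : ℂ) =
      ∑ k ∈ s, ∑ j ∈ s, ∫ x, inner ℂ (F k x) (F j x) := by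
    simp_rw [h1]
    rw [integral_finsetSum _ fun k hk => integrable_finsetSum _ fun j hj =>
      (hF k hk).integrable_inner (hF j hj)]
    exact sum_congr rfl fun k hk => integral_finsetSum _ fun j hj =>
      (hF k hk).integrable_inner (hF j hj)
  have h3 : ∀ k ∈ s, ∑ j ∈ s, ∫ x, (inner ℂ (F k x) (F j x) : ℂ) =
      ((∫ x, ‖F k x‖ ^ 2 : ℝ) : ℂ) := fun k hk => by
    rw [Finset.sum_eq_single_of_mem k hk fun j hj hjk => h j hj k hk hjk, Dec.integral_inner_self]
  rw [sum_congr rfl h3, Dec.integral_inner_self (u := fun x => ∑ k ∈ s, F k x)] at h2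
  exact_mod_cast h2

lemma lintegral_op_rpow_le {p : ℝ} (hp : 1 < p) (A : ℝ) : ∃ C : ℝ≥0,
    ∀ {E : Type} [NormedAddCommGroup E] [InnerProductSpace ℂ E] [CompleteSpace E]
    {κ : ℤ → ℝ → ℝ → ℂ}, KerOp A κ → ∀ (k : ℤ) {u : ℝ → E}, Dec u →
      ∫⁻ x, ‖op (κ k) u x‖ₑ ^ p ≤ C * ∫⁻ x, ‖u x‖ₑ ^ p := by
  obtain ⟨C, hC⟩ := lintegral_MM_rpow_le hp
  refine ⟨(Real.toNNReal A * 8) ^ p * C, fun {E} _ _ _ {κ} hκ k u hu => ?_⟩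
  have hp0 : 0 ≤ p := by linarith
  calc ∫⁻ x, ‖op (κ k) u x‖ₑ ^ p
      ≤ ∫⁻ x, ((Real.toNNReal A * 8 : ℝ≥0) ^ p : ℝ≥0) * MM (fun a => ‖u a‖ₑ) x ^ p := by
        refine lintegral_mono fun x => ?_
        rw [coe_rpow_of_nonneg _ hp0, ← mul_rpow hp0]
        refine rpow_le_rpow ((hκ.enorm_op_le k u x).trans ?_) hp0
        rw [coe_mul, mul_assoc]
        exact mul_mono (PP_le_MM (by norm_num) k hu.measurable_enorm x)
    _ = ((Real.toNNReal A * 8 : ℝ≥0) ^ p : ℝ≥0) * ∫⁻ x, MM (fun a => ‖u a‖ₑ) x ^ p :=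
        lint_const_mul coe_ne_top
    _ ≤ _ := by
        rw [coe_mul, mul_assoc]
        exact mul_mono (hC _ hu.measurable_enorm)

/-- An estimate holds in every Hilbert space, with one constant. -/
abbrev UnifE (A : ℝ) (P : ℝ≥0 → (E : Type) → [NormedAddCommGroup E] → [InnerProductSpace ℂ E] →
    (ℝ → ℂ) → Finset ℤ → Prop) : Prop :=
  ∃ C, ∀ {E : Type} [NormedAddCommGroup E] [InnerProductSpace ℂ E] [CompleteSpace E] {ψ : ℝ → ℂ},
    Ker A ψ → ∀ {K}, Orth ψ K → P C E ψ K

lemma synth_L2 (A : ℝ) : UnifE A fun C E _ _ ψ K => ∀ {w : ℤ → ℝ → E}, (∀ k ∈ K, Dec (w k)) →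
      ∫⁻ x, ‖∑ k ∈ K, op (kS ψ k) (w k) x‖ₑ ^ (2 : ℝ) ≤ C * ∑ k ∈ K, ∫⁻ x, ‖w k x‖ₑ ^ (2 : ℝ) := by
  obtain ⟨C, hC⟩ := lintegral_op_rpow_le (p := 2) (by norm_num) (2 ^ 8 * A)
  refine ⟨2 * C, fun {E} _ _ _ {ψ} hψ {K} ho {w} hw => ?_⟩
  have hS := hψ.kS
  have hF : ∀ k ∈ K, Dec (op (kS ψ k) (w k)) := fun k hk => hS.dec_op k (hw k hk)
  have hpar : ∀ s ⊆ K, (∀ j ∈ s, ∀ k ∈ s, j ≠ k → 2 ≤ |j - k|) →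
      ∫⁻ x, ‖∑ k ∈ s, op (kS ψ k) (w k) x‖ₑ ^ (2 : ℝ) ≤ C * ∑ k ∈ s, ∫⁻ x, ‖w k x‖ₑ ^ (2 : ℝ) := by
    intro s hs h2
    rw [(Dec.sum s fun k hk => hF k (hs hk)).lintegral_sq,
      integral_norm_sq_sum (fun k hk => hF k (hs hk)) fun j hj k hk hjk =>
        inner_synth_eq_zero hψ ho (hs hj) (hs hk) (h2 j hj k hk hjk) (hw j (hs hj)) (hw k (hs hk)),
      ofReal_sum_of_nonneg fun k _ => integral_nonneg fun x => by positivity,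
      mul_sum]
    refine sum_le_sum fun k hk => ?_
    rw [← (hF k (hs hk)).lintegral_sq]
    exact hC hS k (hw k (hs hk))
  have hsplit : ∀ x, ‖∑ k ∈ K, op (kS ψ k) (w k) x‖ₑ ^ (2 : ℝ) ≤
      2 * (‖∑ k ∈ K with Even k, op (kS ψ k) (w k) x‖ₑ ^ (2 : ℝ) +
        ‖∑ k ∈ K with ¬ Even k, op (kS ψ k) (w k) x‖ₑ ^ (2 : ℝ)) := fun x => by
    rw [← Finset.sum_filter_add_sum_filter_not K (fun k => Even k)]
    refine (rpow_le_rpow (enorm_add_le _ _) (by norm_num)).trans ?_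
    refine (rpow_add_le_mul_rpow_add_rpow _ _ (by norm_num)).trans (le_of_eq ?_)
    rw [show (2 : ℝ) - 1 = 1 by norm_num, rpow_one]
  calc _ ≤ ∫⁻ x, 2 * (‖∑ k ∈ K with Even k, op (kS ψ k) (w k) x‖ₑ ^ (2 : ℝ) +
        ‖∑ k ∈ K with ¬ Even k, op (kS ψ k) (w k) x‖ₑ ^ (2 : ℝ)) := lintegral_mono hsplit
    _ = 2 * ((∫⁻ x, ‖∑ k ∈ K with Even k, op (kS ψ k) (w k) x‖ₑ ^ (2 : ℝ)) +
        ∫⁻ x, ‖∑ k ∈ K with ¬ Even k, op (kS ψ k) (w k) x‖ₑ ^ (2 : ℝ)) := by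
        have hm : Measurable fun x => ‖∑ k ∈ K with Even k, op (kS ψ k) (w k) x‖ₑ ^ (2 : ℝ) :=
          (Dec.sum _ fun k hk => hF k (mem_filter.1 hk).1).measurable_enorm.pow_const _
        rw [lint_const_mul (by norm_num), lintegral_add_left hm]
    _ ≤ 2 * (C * (∑ k ∈ K with Even k, ∫⁻ x, ‖w k x‖ₑ ^ (2 : ℝ)) +
        C * ∑ k ∈ K with ¬ Even k, ∫⁻ x, ‖w k x‖ₑ ^ (2 : ℝ)) := by
        refine mul_mono (add_le_add (hpar _ (filter_subset _ _) ?_)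
          (hpar _ (filter_subset _ _) ?_))
        · intro j hj k hk hjk
          obtain ⟨a, ha⟩ := (mem_filter.1 hj).2
          obtain ⟨b, hb⟩ := (mem_filter.1 hk).2
          rw [le_abs']; omega
        · intro j hj k hk hjk
          obtain ⟨a, ha⟩ := Int.not_even_iff_odd.1 (mem_filter.1 hj).2
          obtain ⟨b, hb⟩ := Int.not_even_iff_odd.1 (mem_filter.1 hk).2
          rw [le_abs']; omega
    _ = _ := by
        rw [← mul_add, Finset.sum_filter_add_sum_filter_not]
        push_cast; ring

lemma ana_L2 (A : ℝ) : UnifE A fun C E _ _ ψ K => ∀ {g : ℝ → E}, Dec g →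
      ∑ k ∈ K, ∫⁻ x, ‖op (kA ψ k) g x‖ₑ ^ (2 : ℝ) ≤ C * ∫⁻ x, ‖g x‖ₑ ^ (2 : ℝ) := by
  obtain ⟨C, hC⟩ := synth_L2 A
  refine ⟨C, fun {E} _ _ _ {ψ} hψ {K} ho {g} hg => ?_⟩
  have hA := hψ.kA
  set V : ℤ → ℝ → E := fun k => op (kA ψ k) g with hV
  have hVd : ∀ k ∈ K, Dec (V k) := fun k _ => hA.dec_op k hg
  have hSd : Dec fun x => ∑ k ∈ K, op (kS (cnj (refl ψ)) k) (V k) x :=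
    Dec.sum K fun k hk => hψ.refl.cnj.kS.dec_op k (hVd k hk)
  have hb := hC hψ.refl.cnj ho.refl.cnj hVd
  set X := ∑ k ∈ K, ∫ x, ‖V k x‖ ^ 2 with hX
  set S := ∫ x, ‖∑ k ∈ K, op (kS (cnj (refl ψ)) k) (V k) x‖ ^ 2 with hS
  set G := ∫ x, ‖g x‖ ^ 2 with hG
  have hX0 : 0 ≤ X := Finset.sum_nonneg fun k _ => integral_nonneg fun x => by positivity
  have hG0 : 0 ≤ G := integral_nonneg fun x => by positivity
  have hXe : ∑ k ∈ K, ∫⁻ x, ‖V k x‖ₑ ^ (2 : ℝ) = ofReal X := by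
    rw [hX, ofReal_sum_of_nonneg fun k _ => integral_nonneg fun x => by positivity]
    exact sum_congr rfl fun k hk => (hVd k hk).lintegral_sq
  have hSX : S ≤ C * X := by
    rw [hSd.lintegral_sq, hXe, ← ofReal_coe_nnreal, ← ofReal_mul C.coe_nonneg] at hb
    exact (ofReal_le_ofReal_iff (mul_nonneg C.coe_nonneg hX0)).1 hb
  have hXS : X = ‖∫ x, inner ℂ (∑ k ∈ K, op (kS (cnj (refl ψ)) k) (V k) x) (g x)‖ := by
    have : ((X : ℝ) : ℂ) = ∫ x, inner ℂ (∑ k ∈ K, op (kS (cnj (refl ψ)) k) (V k) x) (g x) := by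
      simp_rw [sum_inner]
      rw [integral_finsetSum _ fun k hk =>
        (hψ.refl.cnj.kS.dec_op k (hVd k hk)).integrable_inner hg, hX]
      push_cast
      refine sum_congr rfl fun k hk => ?_
      rw [← kA_adj, ← inner_op_eq (hA.meas k) (hA.norm_le k) hg (hVd k hk), ← Dec.integral_inner_self]
    rw [← this, norm_real, norm_of_nonneg hX0]
  have hCS : X ^ 2 ≤ S * G := by
    have h1 : X ≤ ∫ x, ‖∑ k ∈ K, op (kS (cnj (refl ψ)) k) (V k) x‖ * ‖g x‖ := by
      rw [hXS]
      refine norm_integral_le_of_norm_le ?_ (.of_forall fun x =>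
        norm_inner_le_norm _ _)
      obtain ⟨D, _, hD⟩ := hSd.bounded
      refine (hg.integrable.norm.const_mul D).mono'
        (hSd.1.norm.mul hg.1.norm).aestronglyMeasurable (.of_forall fun x => ?_)
      rw [norm_mul, norm_norm, norm_norm]
      exact mul_le_mul_of_nonneg_right (hD x) (norm_nonneg _)
    have hm : ∀ {u : ℝ → E}, Dec u → MemLp (fun x => ‖u x‖) (ofReal 2) := fun {u} hu => by
      rw [show ofReal 2 = 2 by norm_num]
      exact (memLp_two_iff_integrable_sq hu.1.norm.aestronglyMeasurable).2 hu.integrable_sq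
    have h2 := integral_mul_le_Lp_mul_Lq_of_nonneg (μ := volume) Real.HolderConjugate.two_two
      (.of_forall fun x => norm_nonneg _) (.of_forall fun x => norm_nonneg _) (hm hSd) (hm hg)
    have hS0 : 0 ≤ S := integral_nonneg fun x => by positivity
    have h3 := h1.trans h2
    simp only [Real.rpow_two] at h3
    rw [← Real.sqrt_eq_rpow, ← Real.sqrt_eq_rpow] at h3
    calc X ^ 2 ≤ (√S * √G) ^ 2 := pow_le_pow_left₀ hX0 h3 2
      _ = S * G := by rw [mul_pow, Real.sq_sqrt hS0, Real.sq_sqrt hG0]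
  have hfin : X ≤ C * G := by
    rcases hX0.eq_or_lt with h | h
    · rw [← h]; exact mul_nonneg C.coe_nonneg hG0
    · have : X * X ≤ (C * G) * X := by
        calc X * X = X ^ 2 := by ring
          _ ≤ S * G := hCS
          _ ≤ (C * X) * G := mul_le_mul_of_nonneg_right hSX hG0
          _ = _ := by ring
      exact le_of_mul_le_mul_right this h
  rw [hXe, hg.lintegral_sq, ← ofReal_coe_nnreal, ← ofReal_mul C.coe_nonneg]
  exact ofReal_le_ofReal hfin

end

lemma sum_coarse_le (K : Finset ℤ) (k₀ : ℤ) (q : ℝ) :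
    ∑ k ∈ K with k < k₀, ((2 : ℝ≥0∞) ^ (k - k₀)) ^ q ≤ geo q := by
  rw [← tsum_le_geo k₀ q]
  refine le_trans (sum_le_sum fun k hk => ?_) (ENNReal.sum_le_tsum (K.filter (· < k₀)))
  rw [if_pos (mem_filter.1 hk).2.le]

lemma sum_fine_le (K : Finset ℤ) (k₀ : ℤ) (q : ℝ) :
    ∑ k ∈ K with ¬ k < k₀, ((2 : ℝ≥0∞) ^ (k₀ - k)) ^ q ≤ geo q := by
  rw [← tsum_ge_geo k₀ q]
  refine le_trans (sum_le_sum fun k hk => ?_) (ENNReal.sum_le_tsum (K.filter (¬ · < k₀)))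
  rw [if_pos (not_lt.1 (mem_filter.1 hk).2)]

lemma abs_le_one_of_dix (hk : k ≤ k₀) (hxy : dix k₀ x = dix k₀ y) : |(2 : ℝ) ^ k * (x - y)| ≤ 1 :=
  (abs_dix_congr hxy).trans (zpow_le_one_of_nonpos₀ (by norm_num) (by omega))

/-- Poisson averages at coarse scales are nearly constant on a cell. -/
lemma PP_coarse_shift (N : ℕ) (hk : k ≤ k₀) (hxy : dix k₀ x = dix k₀ y) (h : ℝ → ℝ≥0∞) :
    PP N k h x ≤ 2 ^ N * PP N k h y := by
  refine (PP_shift N k h x y).trans (mul_le_mul' ?_ le_rfl)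
  rw [← ofReal_ofNat, ← ofReal_pow (by norm_num)]
  exact ofReal_le_ofReal (pow_le_pow_left₀ (by positivity)
    (by have := abs_le_one_of_dix hk hxy; linarith) N)

lemma PP_coarse {N : ℕ} (hN : 2 ≤ N) (hk : k ≤ k₀) (hxy : dix k₀ x = dix k₀ y) (hm : Measurable h) :
    PP N k h x ≤ 2 ^ N * 8 * MM h y := by
  rw [mul_assoc]
  exact (PP_coarse_shift N hk hxy h).trans (mul_mono (PP_le_MM hN k hm y))

lemma one_le_of_notMem_cell3 {a : ℝ} (h : a ∉ cell3 k (dix k x)) : 1 ≤ |(2 : ℝ) ^ k * (x - a)| := by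
  rw [mem_cell3, not_le] at h
  have h1 := abs_sub_dix_lt (k := k) (x := a) (y := x)
  have h2 : (2 : ℝ) ≤ |(dix k a : ℝ) - dix k x| := by exact_mod_cast h
  rw [mul_sub, abs_sub_comm]; linarith

/-- Poisson averages at fine scales of functions supported away from a cell. -/
lemma PP_fine_far {N : ℕ} (hN : 2 ≤ N) (m : ℕ) (hk : k₀ ≤ k) (hxy : dix k₀ x = dix k₀ y)
    (hm : Measurable h) (hh : ∀ a ∈ cell3 k₀ (dix k₀ x), h a = 0) :
    PP (N + (m + 1)) k h x ≤ (2 ^ (k₀ - k)) ^ m * (2 ^ N * 8 * MM h y) := by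
  have h1 : PP (N + (m + 1)) k h x ≤ (2 ^ (k₀ - k)) ^ (m + 1) * PP N k h x :=
    PP_far N (m + 1) fun a ha => one_le_of_notMem_cell3 fun hc => ha (hh a hc)
  refine h1.trans ?_
  calc ((2 : ℝ≥0∞) ^ (k₀ - k)) ^ (m + 1) * PP N k h x
      ≤ (2 ^ (k₀ - k)) ^ (m + 1) * (2 ^ (k - k₀) * PP N k₀ h x) :=
        mul_mono (PP_scale N hk h x)
    _ = (2 ^ (k₀ - k)) ^ m * (2 ^ (k - k₀) * 2 ^ (-(k - k₀))) * PP N k₀ h x := by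
        rw [pow_succ, show -(k - k₀) = k₀ - k by ring]; ring
    _ ≤ _ := by
        rw [two_zpow_mul_neg, mul_one]
        exact mul_mono (PP_coarse hN le_rfl hxy hm)

lemma MM_indicator_le (h : ℝ → ℝ≥0∞) (S : Set ℝ) (x : ℝ) : MM (S.indicator h) x ≤ MM h x :=
  MM_mono (Set.indicator_le_self _ _) x

lemma setLIntegral_jensen_two (k n : ℤ) {F : ℝ → ℝ≥0∞} (hF : Measurable F) :
    2 ^ k * ∫⁻ x in cell k n, F x ≤ (2 ^ k * ∫⁻ x in cell k n, F x ^ (2 : ℝ)) ^ (1 / 2 : ℝ) := by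
  have h := lintegral_mul_le_Lp_mul_Lq (volume.restrict (cell k n))
    Real.HolderConjugate.two_two hF.aemeasurable (aemeasurable_const (b := (1 : ℝ≥0∞)))
  simp only [Pi.mul_apply, mul_one, one_rpow, lintegral_const, one_mul,
    Measure.restrict_apply_univ, volume_cell] at h
  calc _ ≤ 2 ^ k * ((∫⁻ x in cell k n, F x ^ (2 : ℝ)) ^ (1 / 2 : ℝ) * (2 ^ (-k)) ^ (1 / 2 : ℝ)) :=
        mul_mono h
    _ = ((2 ^ k) ^ (1 / 2 : ℝ) * (2 ^ k) ^ (1 / 2 : ℝ)) *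
        ((∫⁻ x in cell k n, F x ^ (2 : ℝ)) ^ (1 / 2 : ℝ) * (2 ^ (-k)) ^ (1 / 2 : ℝ)) := by
        congr 1
        rw [← rpow_add _ _ (two_zpow_ne_zero k) (two_zpow_ne_top k)]; norm_num
    _ = ((2 ^ k * 2 ^ (-k)) ^ (1 / 2 : ℝ)) * (2 ^ k * ∫⁻ x in cell k n, F x ^ (2 : ℝ)) ^ (1 / 2 : ℝ) := by
        rw [mul_rpow (by norm_num : (0 : ℝ) ≤ 1 / 2),
          mul_rpow (by norm_num : (0 : ℝ) ≤ 1 / 2)]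
        ring
    _ = _ := by rw [two_zpow_mul_neg, one_rpow, one_mul]

section
variable {E : Type*} [NormedAddCommGroup E] [NormedSpace ℂ E]

lemma KerOp.op_add {κ : ℤ → ℝ → ℝ → ℂ} (hκ : KerOp A κ) (k : ℤ) {u v : ℝ → E} (hu : Dec u)
    (hv : Dec v) (x : ℝ) : op (κ k) (fun a => u a + v a) x = op (κ k) u x + op (κ k) v x := by
  simp only [op, smul_add]
  exact integral_add (hκ.integrable k x hu) (hκ.integrable k x hv)

lemma enorm_le_add_sub (a c : E) : ‖a‖ₑ ≤ ‖c‖ₑ + ‖a - c‖ₑ := by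
  calc ‖a‖ₑ = ‖c + (a - c)‖ₑ := by rw [add_sub_cancel]
    _ ≤ _ := enorm_add_le _ _

lemma enorm_clm_le {E' : Type*} [NormedAddCommGroup E'] [NormedSpace ℂ E'] {m : E →L[ℂ] E'}
    (hm : ‖m‖ ≤ 1) (v : E) : ‖m v‖ₑ ≤ ‖v‖ₑ := by
  rw [← ofReal_norm, ← ofReal_norm]
  refine ofReal_le_ofReal ((m.le_opNorm v).trans ?_)
  exact mul_le_of_le_one_left (norm_nonneg _) hm

end

/-- Extrapolation of `L²` bounds for sums of operators to `L^q`, `q > 2`. -/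
lemma sum_op_rpow_le {q : ℝ} (hq : 2 < q) (A : ℝ) (B : ℝ≥0) : ∃ C : ℝ≥0,
    ∀ {E E' : Type} [NormedAddCommGroup E] [NormedSpace ℂ E] [NormedAddCommGroup E']
      [NormedSpace ℂ E'] {κ : ℤ → ℝ → ℝ → ℂ}, KerOp A κ → ∀ {K : Finset ℤ}
      {m : ℤ → E →L[ℂ] E'}, (∀ k, ‖m k‖ ≤ 1) →
      (∀ L ⊆ K, ∀ u : ℝ → E, Dec u → ∫⁻ x, ‖∑ k ∈ L, m k (op (κ k) u x)‖ₑ ^ (2 : ℝ) ≤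
        B * ∫⁻ x, ‖u x‖ₑ ^ (2 : ℝ)) → ∀ {u : ℝ → E}, Dec u →
      ∫⁻ x, ‖∑ k ∈ K, m k (op (κ k) u x)‖ₑ ^ q ≤ C * ∫⁻ x, ‖u x‖ₑ ^ q := by
  have hq0 : 0 < q := by linarith
  obtain ⟨C₀, hC₀⟩ := fefferman_stein (t := q) (by linarith)
  obtain ⟨C₁, hC₁⟩ := lintegral_MM_rpow_le (p := q) (by linarith)
  obtain ⟨C₂, hC₂⟩ := lintegral_MM_rpow_le (p := q / 2) (by linarith)
  have hg : geo 1 ≠ ∞ := geo_ne_top one_pos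
  set c₁ : ℝ≥0∞ := ofReal A * (2 ^ 8 * 8) * geo 1 + ofReal A * (2 ^ 6 * 8) * geo 1 with hc₁
  have hc₁t : c₁ ≠ ∞ := by finiteness
  set D : ℝ≥0∞ := C₀ * (2 ^ (q - 1) * (c₁ ^ q * C₁ + (B : ℝ≥0∞) ^ (q / 2) * C₂)) with hD
  have hDt : D ≠ ∞ := by finiteness
  refine ⟨D.toNNReal, fun {E E'} _ _ _ _ {κ} hκ {K m} hm hL2 {u} hu => ?_⟩
  rw [coe_toNNReal hDt]
  have hdec : ∀ {v : ℝ → E}, Dec v → ∀ L : Finset ℤ,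
      Dec fun x => ∑ k ∈ L, m k (op (κ k) v x) := fun {v} hv L =>
    Dec.sum L fun k _ => (hκ.dec_op k hv).clm (m k)
  set h : ℝ → ℝ≥0∞ := fun x => ‖u x‖ₑ with hh
  have hhm : Measurable h := hu.measurable_enorm
  set h2 : ℝ → ℝ≥0∞ := fun x => ‖u x‖ₑ ^ (2 : ℝ) with hh2
  have hh2m : Measurable h2 := hhm.pow_const _
  set G : ℝ → ℝ≥0∞ := fun y => c₁ * MM h y + (B * MM h2 y) ^ (1 / 2 : ℝ) with hG
  have hGm : Measurable G := ((measurable_MM h).const_mul _).add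
    (((measurable_MM h2).const_mul _).pow_const _)
  refine (hC₀ (fun x => ‖∑ k ∈ K, m k (op (κ k) u x)‖ₑ) G (hdec hu K).measurable_enorm hGm
    (hdec hu K).lintegral_ne_top fun k₀ n => ?_).trans ?_
  · obtain ⟨x₀, hx₀⟩ := cell_nonempty k₀ n
    set S := cell3 k₀ n with hS
    have hSm : MeasurableSet S := measurableSet_cell3 k₀ n
    set u₁ := S.indicator u with hu₁
    set u₂ := Sᶜ.indicator u with hu₂
    have hd₁ : Dec u₁ := hu.indicator hSm
    have hd₂ : Dec u₂ := hu.indicator hSm.compl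
    have hadd : ∀ k x, op (κ k) u x = op (κ k) u₁ x + op (κ k) u₂ x := fun k x => by
      rw [← hκ.op_add k hd₁ hd₂]
      congr 1; funext a
      exact (congrFun (Set.indicator_self_add_compl S u) a).symm
    have hnear := hdec hd₁ (K.filter (¬ · < k₀))
    refine ⟨‖∑ k ∈ K with k < k₀, m k (op (κ k) u x₀)‖ₑ, fun x =>
      (⨅ y ∈ cell k₀ n, c₁ * MM h y) + ‖∑ k ∈ K with ¬ k < k₀, m k (op (κ k) u₁ x)‖ₑ,
      measurable_const.add hnear.measurable_enorm, fun x hx => ?_, fun y hy => ?_⟩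
    · have key : ‖(∑ k ∈ K, m k (op (κ k) u x)) - ∑ k ∈ K with k < k₀, m k (op (κ k) u x₀)‖ₑ ≤
          (⨅ y ∈ cell k₀ n, c₁ * MM h y) + ‖∑ k ∈ K with ¬ k < k₀, m k (op (κ k) u₁ x)‖ₑ := by
        have e : (∑ k ∈ K, m k (op (κ k) u x)) - ∑ k ∈ K with k < k₀, m k (op (κ k) u x₀) =
            ((∑ k ∈ K with k < k₀, m k (op (κ k) u x - op (κ k) u x₀)) +
            ∑ k ∈ K with ¬ k < k₀, m k (op (κ k) u₂ x)) +
            ∑ k ∈ K with ¬ k < k₀, m k (op (κ k) u₁ x) := by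
          rw [← Finset.sum_filter_add_sum_filter_not K (fun k => k < k₀)]
          simp only [map_sub, Finset.sum_sub_distrib]
          rw [sum_congr (g := fun k => m k (op (κ k) u₁ x) + m k (op (κ k) u₂ x)) (s₁ := K.filter (¬ · < k₀)) rfl fun k _ => by
            rw [hadd k x, map_add], Finset.sum_add_distrib]
          abel
        rw [e]
        refine (enorm_add_le _ _).trans (add_le_add ?_ le_rfl)
        refine le_iInf₂ fun y hy => ?_
        have hxy : dix k₀ x = dix k₀ y := hx.trans hy.symm
        refine (enorm_add_le _ _).trans ?_
        rw [hc₁, add_mul]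
        refine add_le_add ?_ ?_
        · calc _ ≤ ∑ k ∈ K with k < k₀, ‖m k (op (κ k) u x - op (κ k) u x₀)‖ₑ := enorm_sum_le _ _
            _ ≤ ∑ k ∈ K with k < k₀, ofReal A * (2 ^ 8 * 8) * MM h y *
                ((2 : ℝ≥0∞) ^ (k - k₀)) ^ (1 : ℝ) := by
                refine sum_le_sum fun k hk => ?_
                have hkk : k ≤ k₀ := (mem_filter.1 hk).2.le
                refine (enorm_clm_le (hm k) _).trans ((hκ.enorm_op_sub_le hu hkk
                  (hx.trans hx₀.symm)).trans ?_)
                refine (mul_mono (PP_coarse (N := 8) (by norm_num) hkk hxy hhm)).trans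
                  (le_of_eq ?_)
                rw [rpow_one]; ring
            _ ≤ _ := by
                rw [← mul_sum]
                refine (mul_mono (sum_coarse_le K k₀ 1)).trans (le_of_eq ?_)
                ring
        · calc _ ≤ ∑ k ∈ K with ¬ k < k₀, ‖m k (op (κ k) u₂ x)‖ₑ := enorm_sum_le _ _
            _ ≤ ∑ k ∈ K with ¬ k < k₀, ofReal A * (2 ^ 6 * 8) * MM h y *
                ((2 : ℝ≥0∞) ^ (k₀ - k)) ^ (1 : ℝ) := by
                refine sum_le_sum fun k hk => ?_
                have hkk : k₀ ≤ k := not_lt.1 (mem_filter.1 hk).2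
                refine (enorm_clm_le (hm k) _).trans ((hκ.enorm_op_le k u₂ x).trans ?_)
                have hle : ∀ a, ‖u₂ a‖ₑ ≤ h a := fun a => by
                  rw [hu₂, enorm_indicator_eq_indicator_enorm]
                  exact Set.indicator_le_self _ _ a
                have := PP_fine_far (N := 6) (by norm_num) 1 hkk hxy hd₂.measurable_enorm
                  fun a ha => by
                    rw [hx] at ha
                    rw [hu₂, indicator_of_notMem (by simpa using ha), enorm_zero]
                refine (mul_mono (this.trans (mul_mono (mul_mono
                  (MM_mono hle y))))).trans (le_of_eq ?_)
                rw [rpow_one]; ring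
            _ ≤ _ := by
                rw [← mul_sum]
                refine (mul_mono (sum_fine_le K k₀ 1)).trans (le_of_eq ?_)
                ring
      refine ⟨(enorm_le_add_sub _ _).trans (add_le_add le_rfl key), (enorm_le_add_sub _ _).trans
        (add_le_add le_rfl ?_)⟩
      rw [← enorm_neg, neg_sub]
      exact key
    · rw [lintegral_add_left measurable_const, mul_add]
      refine add_le_add ?_ ?_
      · rw [setLIntegral_const, volume_cell, mul_left_comm, two_zpow_mul_neg, mul_one]
        exact iInf₂_le y hy
      · refine (setLIntegral_jensen_two k₀ n hnear.measurable_enorm).trans ?_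
        refine rpow_le_rpow ?_ (by norm_num)
        calc _ ≤ 2 ^ k₀ * (B * ∫⁻ x, ‖u₁ x‖ₑ ^ (2 : ℝ)) :=
              mul_mono ((setLIntegral_le_lintegral _ _).trans
                (hL2 _ (filter_subset _ _) u₁ hd₁))
          _ = B * avg3 k₀ h2 y := by
              rw [avg3, mem_cell.1 hy, ← lintegral_indicator hSm, mul_left_comm]
              congr 2
              refine lintegral_congr fun x => ?_
              rw [hu₁]
              by_cases hx : x ∈ S
              · simp [hx, hh2]
              · simp [hx]
          _ ≤ _ := mul_mono (avg3_le_MM _ _ _)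
  · rw [hD, mul_assoc]
    refine mul_mono ?_
    calc ∫⁻ x, G x ^ q ≤ ∫⁻ x, 2 ^ (q - 1) * (c₁ ^ q * MM h x ^ q +
          (B : ℝ≥0∞) ^ (q / 2) * MM h2 x ^ (q / 2)) := by
          refine lintegral_mono fun x => (rpow_add_le_mul_rpow_add_rpow _ _
            (by linarith)).trans (le_of_eq ?_)
          rw [mul_rpow hq0.le, ← rpow_mul,
            mul_rpow (by positivity), show 1 / 2 * q = q / 2 by ring]
      _ = 2 ^ (q - 1) * (c₁ ^ q * (∫⁻ x, MM h x ^ q) +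
          (B : ℝ≥0∞) ^ (q / 2) * ∫⁻ x, MM h2 x ^ (q / 2)) := by
          rw [lint_const_mul (by finiteness), lintegral_add_left
            (((measurable_MM h).pow_const _).const_mul _),
            lint_const_mul (by finiteness), lint_const_mul (by finiteness)]
      _ ≤ 2 ^ (q - 1) * (c₁ ^ q * (C₁ * ∫⁻ x, ‖u x‖ₑ ^ q) +
          (B : ℝ≥0∞) ^ (q / 2) * (C₂ * ∫⁻ x, ‖u x‖ₑ ^ q)) := by
          have h3 : ∫⁻ x, h2 x ^ (q / 2) = ∫⁻ x, ‖u x‖ₑ ^ q := lintegral_congr fun x => by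
            rw [hh2, ← rpow_mul, show 2 * (q / 2) = q by ring]
          have h4 := hC₂ h2 hh2m
          rw [h3] at h4
          exact mul_mono (add_le_add (mul_mono (hC₁ h hhm))
            (mul_mono h4))
      _ = _ := by ring

/-- Duality for `L^q` norms of vector-valued functions. -/
lemma lintegral_rpow_le_of_dual {X : Type*} [MeasurableSpace X] {μ : Measure X} {E : Type*}
    [NormedAddCommGroup E] [InnerProductSpace ℂ E] {q q' : ℝ} (hq : q.HolderConjugate q')
    {S : ℕ → Set X} (hS : ∀ n, MeasurableSet (S n)) (hSm : Monotone S) (hSU : ⋃ n, S n = Set.univ)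
    (hSf : ∀ n, μ (S n) ≠ ∞) {V : X → E} (hV : StronglyMeasurable V) {M : ℝ} (hM : ∀ x, ‖V x‖ ≤ M)
    {D : ℝ≥0∞}
    (h : ∀ n (H : X → E), StronglyMeasurable H → (∀ x ∉ S n, H x = 0) → (∃ C, ∀ x, ‖H x‖ ≤ C) → ‖∫ x, inner ℂ (H x) (V x) ∂μ‖ₑ ≤ D * (∫⁻ x, ‖H x‖ₑ ^ q' ∂μ) ^ (1 / q'))
    : ∫⁻ x, ‖V x‖ₑ ^ q ∂μ ≤ D ^ q := by
  have hq1 : 1 < q := hq.lt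
  have hq'0 : 0 < q' := hq.symm.pos
  have hq0 : 0 < q := hq.pos
  have key : ∀ n, ∫⁻ x in S n, ‖V x‖ₑ ^ q ∂μ ≤ D ^ q := by
    intro n
    set I := ∫⁻ x in S n, ‖V x‖ₑ ^ q ∂μ with hI
    have hMe : ∀ x, ‖V x‖ₑ ≤ ofReal M := fun x => by
      rw [← ofReal_norm]; exact ofReal_le_ofReal (hM x)
    have hIt : I ≠ ∞ := by
      refine ne_top_of_le_ne_top ?_ (setLIntegral_mono' (g := fun _ => ofReal M ^ q) (hS n)
        fun x _ => rpow_le_rpow (hMe x) hq0.le)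
      rw [setLIntegral_const]
      have := hSf n
      finiteness
    set H : X → E := (S n).indicator fun x => ((‖V x‖ ^ (q - 2) : ℝ) : ℂ) • V x with hH
    have hHn : ∀ x ∈ S n, ‖H x‖ = ‖V x‖ ^ (q - 1) := fun x hx => by
      rw [hH, indicator_of_mem hx, norm_smul, norm_real,
        norm_of_nonneg (by positivity)]
      rcases eq_or_ne (V x) 0 with h0 | h0
      · rw [h0]; simp [Real.zero_rpow (show q - 1 ≠ 0 by linarith)]
      · nth_rewrite 2 [← Real.rpow_one ‖V x‖]
        rw [← Real.rpow_add (norm_pos_iff.2 h0)]; congr 1; ring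
    have hHm : StronglyMeasurable H := by
      refine StronglyMeasurable.indicator (StronglyMeasurable.smul ?_ hV) (hS n)
      exact (Complex.measurable_ofReal.comp (hV.norm.measurable.pow_const _)).stronglyMeasurable
    have hH0 : ∀ x ∉ S n, H x = 0 := fun x hx => indicator_of_notMem hx _
    have hb := h n H hHm hH0 ⟨max 0 M ^ (q - 1), fun x => by
      by_cases hx : x ∈ S n
      · rw [hHn x hx]
        exact Real.rpow_le_rpow (norm_nonneg _) ((hM x).trans (le_max_right _ _)) (by linarith)
      · rw [hH0 x hx, norm_zero]; positivity⟩
    have e1 : ∫⁻ x, ‖H x‖ₑ ^ q' ∂μ = I := by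
      rw [hI, ← lintegral_indicator (hS n)]
      refine lintegral_congr fun x => ?_
      by_cases hx : x ∈ S n
      · rw [indicator_of_mem hx, ← ofReal_norm, hHn x hx,
          ← ofReal_rpow_of_nonneg (norm_nonneg _) (by linarith), ofReal_norm,
          ← rpow_mul, hq.sub_one_mul_conj]
      · rw [indicator_of_notMem hx, hH0 x hx, enorm_zero, zero_rpow_of_pos hq'0]
    have e2 : ‖∫ x, inner ℂ (H x) (V x) ∂μ‖ₑ = I := by
      have e3 : ∀ x, inner ℂ (H x) (V x) = (((S n).indicator (fun x => ‖V x‖ ^ q) x : ℝ) : ℂ) := by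
        intro x
        by_cases hx : x ∈ S n
        · rw [indicator_of_mem hx, hH, indicator_of_mem hx, inner_smul_left,
            inner_self_eq_norm_sq_to_K, Complex.conj_ofReal]
          change ((‖V x‖ ^ (q - 2) : ℝ) : ℂ) * ((‖V x‖ : ℝ) : ℂ) ^ 2 = _
          norm_cast
          rcases eq_or_ne (V x) 0 with h0 | h0
          · rw [h0]; simp [Real.zero_rpow hq0.ne']
          · rw [← Real.rpow_two, ← Real.rpow_add (norm_pos_iff.2 h0), sub_add_cancel]
        · rw [indicator_of_notMem hx, hH0 x hx, inner_zero_left]; simp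
      simp_rw [e3]
      rw [integral_complex_ofReal, ← ofReal_norm, norm_real, norm_of_nonneg
        (integral_nonneg fun x => Set.indicator_nonneg (fun _ _ => by positivity) x),
        integral_indicator (hS n), ofReal_integral_eq_lintegral_ofReal]
      · refine lintegral_congr fun x => ?_
        rw [← ofReal_norm, ofReal_rpow_of_nonneg (norm_nonneg _) hq0.le]
      · refine Measure.integrableOn_of_bounded (M := max 0 M ^ q) (hSf n)
          (hV.norm.measurable.pow_const _).aestronglyMeasurable (.of_forall fun x => ?_)
        rw [norm_of_nonneg (by positivity)]
        exact Real.rpow_le_rpow (norm_nonneg _) ((hM x).trans (le_max_right _ _)) hq0.le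
      · exact Filter.Eventually.of_forall fun x => by positivity
    rw [e1, e2] at hb
    rcases eq_or_ne I 0 with h0 | h0
    · rw [h0]; exact zero_le
    have hsplit : I = I ^ (1 / q) * I ^ (1 / q') := by
      rw [← rpow_add _ _ h0 hIt, one_div, one_div, hq.inv_add_inv_eq_one, rpow_one]
    nth_rewrite 1 [hsplit] at hb
    rw [ENNReal.mul_le_mul_iff_left (by simp [h0, hIt]) (by finiteness)] at hb
    have := rpow_le_rpow hb hq0.le
    rwa [← rpow_mul, one_div_mul_cancel hq0.ne', rpow_one] at this
  rw [← setLIntegral_univ, ← hSU, setLIntegral_iUnion_of_directed _ hSm.directed_le]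
  exact iSup_le key

section vec
variable {E : Type} [NormedAddCommGroup E] [InnerProductSpace ℂ E]

lemma enorm_rpow_two {F : Type*} [NormedAddCommGroup F] (v : F) :
    ‖v‖ₑ ^ (2 : ℝ) = ofReal (‖v‖ ^ 2) := by
  rw [← ofReal_norm, ofReal_rpow_of_nonneg (norm_nonneg _) (by norm_num), Real.rpow_two]

lemma enorm_rpow_two_eq {ι : Type*} [Fintype ι] (x : PiLp 2 (fun _ : ι => E)) :
    ‖x‖ₑ ^ (2 : ℝ) = ∑ i, ‖x i‖ₑ ^ (2 : ℝ) := by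
  rw [enorm_rpow_two, PiLp.norm_sq_eq_of_L2, ofReal_sum_of_nonneg fun i _ => by positivity]
  exact sum_congr rfl fun i _ => (enorm_rpow_two _).symm

lemma enorm_rpow_eq {F : Type*} [NormedAddCommGroup F] (v : F) (q : ℝ) :
    ‖v‖ₑ ^ q = (‖v‖ₑ ^ (2 : ℝ)) ^ (q / 2) := by
  rw [← rpow_mul]; congr 1; ring

/-- The embedding of a coordinate. -/
def emb (K : Finset ℤ) (k : ℤ) : E →L[ℂ] PiLp 2 (fun _ : K => E) :=
  LinearMap.mkContinuous {
      toFun := fun e => WithLp.toLp 2 fun i => if (i : ℤ) = k then e else 0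
      map_add' := fun a b => by ext i; by_cases h : (i : ℤ) = k <;> simp [h]
      map_smul' := fun c a => by ext i; by_cases h : (i : ℤ) = k <;> simp [h] } 1 fun e => by
    rw [one_mul, ← pow_le_pow_iff_left₀ (norm_nonneg _) (norm_nonneg _) two_ne_zero,
      PiLp.norm_sq_eq_of_L2]
    by_cases h : k ∈ K
    · rw [Finset.sum_eq_single (⟨k, h⟩ : K)]
      · simp
      · intro i _ hi
        have : (i : ℤ) ≠ k := fun hk => hi (Subtype.ext hk)
        simp [this]
      · simp
    · rw [Finset.sum_eq_zero]
      · positivity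
      · intro i _
        have : (i : ℤ) ≠ k := fun hk => h (hk ▸ i.2)
        simp [this]

lemma norm_emb_le (K : Finset ℤ) (k : ℤ) : ‖emb (E := E) K k‖ ≤ 1 :=
  LinearMap.mkContinuous_norm_le _ zero_le_one _

lemma emb_apply (K : Finset ℤ) (k : ℤ) (e : E) (i : K) :
    emb K k e i = if (i : ℤ) = k then e else 0 := rfl

lemma sum_emb_apply (K L : Finset ℤ) (v : ℤ → E) (i : K) :
    (∑ k ∈ L, emb K k (v k)) i = if (i : ℤ) ∈ L then v i else 0 := by
  simp only [WithLp.ofLp_sum, Finset.sum_apply, emb_apply, Finset.sum_ite_eq]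

lemma enorm_sum_emb {L : Finset ℤ} (hL : L ⊆ K) (v : ℤ → E) :
    ‖∑ k ∈ L, emb K k (v k)‖ₑ ^ (2 : ℝ) = ∑ k ∈ L, ‖v k‖ₑ ^ (2 : ℝ) := by
  rw [enorm_rpow_two_eq]
  simp only [sum_emb_apply]
  rw [sum_coe_sort K (fun i => ‖if i ∈ L then v i else 0‖ₑ ^ (2 : ℝ)), ← Finset.sum_subset hL]
  · exact sum_congr rfl fun k hk => by rw [if_pos hk]
  · intro k _ hk
    simp [hk]

/-- The projection to a coordinate. -/
def prj (K : Finset ℤ) (k : ℤ) : PiLp 2 (fun _ : K => E) →L[ℂ] E :=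
  if h : k ∈ K then PiLp.proj 2 (fun _ : K => E) ⟨k, h⟩ else 0

lemma prj_apply (h : k ∈ K) (x : PiLp 2 (fun _ : K => E)) : prj K k x = x ⟨k, h⟩ := by rw [prj, dif_pos h]; rfl

lemma norm_prj_le (K : Finset ℤ) (k : ℤ) : ‖prj (E := E) K k‖ ≤ 1 := by
  refine ContinuousLinearMap.opNorm_le_bound _ zero_le_one fun x => ?_
  rw [one_mul]
  by_cases h : k ∈ K
  · rw [prj_apply h]; exact PiLp.norm_apply_le x _
  · rw [prj, dif_neg h]; simp

lemma clm_op [CompleteSpace E] {F : Type*} [NormedAddCommGroup F] [InnerProductSpace ℂ F]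
    [CompleteSpace F] {κ : ℤ → ℝ → ℝ → ℂ} (hκ : KerOp A κ) (k : ℤ) {u : ℝ → E} (hu : Dec u)
    (m : E →L[ℂ] F) (x : ℝ) : m (op (κ k) u x) = op (κ k) (fun a => m (u a)) x := by
  unfold op
  rw [← m.integral_comp_comm (hκ.integrable k x hu)]
  simp

end vec

set_option maxHeartbeats 1000000 in
lemma synth_Lq {q : ℝ} (hq : 2 < q) (A : ℝ) : UnifE A fun C E _ _ ψ K =>
      ∀ {u : ℝ → PiLp 2 (fun _ : K => E)}, Dec u →
      ∫⁻ x, ‖∑ k ∈ K, op (kS ψ k) (fun a => prj K k (u a)) x‖ₑ ^ q ≤ C * ∫⁻ x, ‖u x‖ₑ ^ q := by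
  obtain ⟨B, hB⟩ := synth_L2 A
  obtain ⟨C, hC⟩ := sum_op_rpow_le hq (2 ^ 8 * A) B
  refine ⟨C, fun {E} _ _ _ {ψ} hψ {K} ho {u} hu => ?_⟩
  have h := hC (E := PiLp 2 (fun _ : K => E)) (E' := E) hψ.kS (K := K) (m := prj K) (norm_prj_le K) ?_ hu
  · simpa only [clm_op hψ.kS _ hu] using h
  · intro L hL v hv
    simp only [clm_op hψ.kS _ hv]
    refine (hB hψ (ho.mono hL) fun k _ => hv.clm (prj K k)).trans (mul_mono ?_)
    rw [← lintegral_finsetSum' _ fun k _ => ((hv.clm (prj K k)).measurable_enorm.pow_const _).aemeasurable]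
    refine lintegral_mono fun x => ?_
    rw [enorm_rpow_two_eq, Finset.univ_eq_attach]
    refine (Finset.sum_le_sum_of_subset hL).trans (le_of_eq ?_)
    rw [← Finset.sum_attach]
    exact sum_congr rfl fun k _ => by rw [prj_apply k.2]

set_option maxHeartbeats 1000000 in
/-- The square function estimate. -/
lemma ana_Lq {q : ℝ} (hq : 1 < q) (A : ℝ) : UnifE A fun C E _ _ ψ K => ∀ {g : ℝ → E}, Dec g →
      ∫⁻ x, (∑ k ∈ K, ‖op (kA ψ k) g x‖ₑ ^ (2 : ℝ)) ^ (q / 2) ≤ C * ∫⁻ x, ‖g x‖ₑ ^ q := by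
  rcases lt_trichotomy q 2 with h2 | rfl | h2
  · have hc : q.HolderConjugate q.conjExponent := Real.HolderConjugate.conjExponent hq
    have hq' : 2 < q.conjExponent := by
      rw [Real.conjExponent, lt_div_iff₀ (by linarith)]; linarith
    obtain ⟨C, hC⟩ := synth_Lq hq' A
    set q' := q.conjExponent with hqq
    have hq0 : 0 < q := by linarith
    have hq'0 : 0 < q' := by linarith
    refine ⟨(C ^ (1 / q')) ^ q, fun {E} _ _ _ {ψ} hψ {K} ho {g} hg => ?_⟩
    set V : ℝ → PiLp 2 (fun _ : K => E) := fun x => ∑ k ∈ K, emb K k (op (kA ψ k) g x) with hV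
    have hVd : Dec V := Dec.sum K fun k _ => (hψ.kA.dec_op k hg).clm (emb K k)
    obtain ⟨M, -, hM⟩ := hVd.bounded
    have hVe : ∀ x, (∑ k ∈ K, ‖op (kA ψ k) g x‖ₑ ^ (2 : ℝ)) ^ (q / 2) = ‖V x‖ₑ ^ q := fun x => by
      rw [enorm_rpow_eq (V x), hV, enorm_sum_emb subset_rfl]
    simp only [hVe]
    have := lintegral_rpow_le_of_dual (μ := volume) hc (S := fun n : ℕ => Icc (-(n : ℝ)) n)
      (fun n => measurableSet_Icc) (fun m n h => Set.Icc_subset_Icc (by simpa using h) (by simpa using h))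
      (by
        refine Set.eq_univ_of_forall fun x => mem_iUnion.2 ?_
        obtain ⟨n, hn⟩ := exists_nat_ge |x|
        exact ⟨n, abs_le.1 hn⟩)
      (fun n => by rw [Real.volume_Icc]; finiteness) hVd.1 hM
      (D := (C : ℝ≥0∞) ^ (1 / q') * (∫⁻ x, ‖g x‖ₑ ^ q) ^ (1 / q)) ?_
    · refine this.trans (le_of_eq ?_)
      rw [mul_rpow hq0.le, ← rpow_mul (∫⁻ x, ‖g x‖ₑ ^ q),
        one_div_mul_cancel hq0.ne', rpow_one, coe_rpow_of_nonneg _ hq0.le,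
        coe_rpow_of_nonneg _ (by positivity)]
    · rintro n H hH hH0 ⟨C', hC'⟩
      have hHd : Dec H := by
        refine ⟨hH, |C'| * (1 + n) ^ 2, fun x => ?_⟩
        by_cases hx : x ∈ Icc (-(n : ℝ)) n
        · have hx' : |x| ≤ n := abs_le.2 hx
          rw [mul_assoc]
          refine ((hC' x).trans (le_abs_self _)).trans (le_mul_of_one_le_right (abs_nonneg _) ?_)
          rw [wt, ← div_eq_mul_inv, one_le_div (by positivity)]
          gcongr
        · rw [hH0 x hx, norm_zero]
          have := wt_nonneg 2 x; positivity
      have hHk : ∀ k, Dec fun a => prj K k (H a) := fun k => hHd.clm (prj K k)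
      set W : ℝ → E := fun x => ∑ k ∈ K, op (kS (cnj (refl ψ)) k) (fun a => prj K k (H a)) x with hW
      have hWk : ∀ k, Dec (op (kS (cnj (refl ψ)) k) (fun a => prj K k (H a))) := fun k =>
        hψ.refl.cnj.kS.dec_op k (hHk k)
      have hWd : Dec W := Dec.sum K fun k _ => hWk k
      have e1 : ∫ x, inner ℂ (H x) (V x) = ∫ x, inner ℂ (W x) (g x) := by
        have hl : ∀ x, inner ℂ (H x) (V x) = ∑ k ∈ K, inner ℂ (prj K k (H x)) (op (kA ψ k) g x) := by
          intro x
          rw [PiLp.inner_apply, ← sum_coe_sort K]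
          refine sum_congr rfl fun i _ => ?_
          rw [prj_apply i.2, hV]
          simp only [sum_emb_apply, i.2, if_true]
        simp only [hl]
        simp_rw [hW, sum_inner]
        rw [integral_finsetSum _ fun k _ => (hHk k).integrable_inner (hψ.kA.dec_op k hg),
          integral_finsetSum _ fun k _ => (hWk k).integrable_inner hg]
        refine sum_congr rfl fun k _ => ?_
        rw [inner_op_eq (hψ.kA.meas k) (hψ.kA.norm_le k) hg (hHk k), kA_adj]
      rw [e1]
      calc ‖∫ x, inner ℂ (W x) (g x)‖ₑ ≤ ∫⁻ x, ‖W x‖ₑ * ‖g x‖ₑ := by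
            refine (enorm_integral_le_lintegral_enorm _).trans (lintegral_mono fun x => ?_)
            rw [← ofReal_norm, ← ofReal_norm, ← ofReal_norm, ← ofReal_mul (norm_nonneg _)]
            exact ofReal_le_ofReal (norm_inner_le_norm _ _)
        _ ≤ (∫⁻ x, ‖W x‖ₑ ^ q') ^ (1 / q') * (∫⁻ x, ‖g x‖ₑ ^ q) ^ (1 / q) :=
            lintegral_mul_le_Lp_mul_Lq volume hc.symm hWd.measurable_enorm.aemeasurable
              hg.measurable_enorm.aemeasurable
        _ ≤ (C * ∫⁻ x, ‖H x‖ₑ ^ q') ^ (1 / q') * (∫⁻ x, ‖g x‖ₑ ^ q) ^ (1 / q) :=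
            mul_le_mul' (rpow_le_rpow (hC hψ.refl.cnj ho.refl.cnj hHd) (by positivity)) le_rfl
        _ = _ := by
            rw [mul_rpow (by positivity)]; ring
  · obtain ⟨C, hC⟩ := ana_L2 A
    refine ⟨C, fun {E} _ _ _ {ψ} hψ {K} ho {g} hg => ?_⟩
    refine le_trans (le_of_eq ?_) (hC hψ ho hg)
    rw [div_self two_ne_zero, ← lintegral_finsetSum' _ fun k _ =>
      ((hψ.kA.dec_op k hg).measurable_enorm.pow_const _).aemeasurable]
    simp
  · obtain ⟨B, hB⟩ := ana_L2 A
    obtain ⟨C, hC⟩ := sum_op_rpow_le h2 (2 ^ 20 * A) B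
    refine ⟨C, fun {E} _ _ _ {ψ} hψ {K} ho {g} hg => ?_⟩
    refine le_trans (le_of_eq ?_) (hC (E := E) (E' := PiLp 2 (fun _ : K => E)) hψ.kA (K := K) (m := emb K) (norm_emb_le K) ?_ hg)
    · refine lintegral_congr fun x => ?_
      rw [enorm_rpow_eq, enorm_sum_emb subset_rfl]
    · intro L hL v hv
      refine le_trans (le_of_eq ?_) (hB hψ (ho.mono hL) hv)
      rw [← lintegral_finsetSum' _ fun k _ =>
        ((hψ.kA.dec_op k hv).measurable_enorm.pow_const _).aemeasurable]
      exact lintegral_congr fun x => enorm_sum_emb hL _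

lemma rpow_sum_le_sum_rpow {ι : Type*} (s : Finset ι) (f : ι → ℝ≥0∞) {p : ℝ} (hp : 0 < p)
    (hp1 : p ≤ 1) : (∑ i ∈ s, f i) ^ p ≤ ∑ i ∈ s, f i ^ p := by
  classical
  induction s using Finset.induction_on with
  | empty => simp [hp]
  | insert i s hi ih =>
    rw [sum_insert hi, sum_insert hi]
    exact (rpow_add_le_add_rpow _ _ hp.le hp1).trans (add_le_add le_rfl ih)

lemma rpow_tsum_le_tsum_rpow {ι : Type*} (f : ι → ℝ≥0∞) {p : ℝ} (hp : 0 < p) (hp1 : p ≤ 1) :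
    (∑' i, f i) ^ p ≤ ∑' i, f i ^ p := by
  have h : Filter.Tendsto (fun s : Finset ι => (∑ i ∈ s, f i) ^ p) Filter.atTop
      (nhds ((∑' i, f i) ^ p)) :=
    (continuous_rpow_const.tendsto _).comp ENNReal.summable.hasSum
  exact le_of_tendsto' h fun s =>
    (rpow_sum_le_sum_rpow s f hp hp1).trans (ENNReal.sum_le_tsum s)

lemma PP_one_le (k : ℤ) (x : ℝ) : PP 2 k (fun _ => 1) x ≤ 24 := by
  refine (PP_two_le_MM k measurable_const x).trans ?_
  refine (mul_mono (MM_le_essSup _ x)).trans (le_of_eq ?_)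
  rw [essSup_const _ (NeZero.ne _)]; norm_num

lemma PP_cell_le (N : ℕ) (k n : ℤ) {c : ℝ} (hc : c ∈ cell k n) (x : ℝ) :
    PP N k ((cell k n).indicator 1) x ≤ 2 ^ N * ofReal (wt N (2 ^ k * (x - c))) := by
  calc PP N k ((cell k n).indicator 1) x
      ≤ ∫⁻ a, (cell k n).indicator (fun _ => 2 ^ k * (2 ^ N * ofReal (wt N (2 ^ k * (x - c))))) a := by
        refine lintegral_mono fun a => ?_
        by_cases ha : a ∈ cell k n
        · simp only [indicator_of_mem ha, Pi.one_apply, mul_one]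
          rw [ofReal_mul (by positivity), ofReal_two_zpow]
          refine mul_mono ?_
          have h2 : (2 : ℝ≥0∞) ^ N = ofReal (2 ^ N) := by
            rw [ofReal_pow (by norm_num)]; norm_num
          rw [h2, ← ofReal_mul (by positivity)]
          refine ofReal_le_ofReal (wt_shift_le N ?_)
          have := abs_le_one_of_dix le_rfl (show dix k c = dix k a from hc.trans ha.symm)
          rwa [show (2 : ℝ) ^ k * (x - a) - 2 ^ k * (x - c) = 2 ^ k * (c - a) by ring]
        · simp [indicator_of_notMem ha]
    _ = _ := by
        rw [lintegral_indicator (measurableSet_cell k n), setLIntegral_const, volume_cell,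
          mul_right_comm, two_zpow_mul_neg, one_mul]

lemma lintegral_PP_cell_rpow_le {s : ℝ} (hs : 1 / 2 < s) (k n : ℤ) :
    ∫⁻ x, PP 6 k ((cell k n).indicator 1) x ^ s ≤ (2 ^ 6) ^ s * 24 * 2 ^ (-k) := by
  obtain ⟨c, hc⟩ := cell_nonempty k n
  have h0 : 0 < s := by linarith
  have hw : ∀ t : ℝ, ofReal (wt 6 t) ^ s ≤ ofReal (wt 2 t) := fun t => by
    rw [ofReal_rpow_of_nonneg (wt_nonneg _ _) h0.le]
    refine ofReal_le_ofReal ?_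
    have h1 : (1 : ℝ) ≤ 1 + |t| := by linarith [abs_nonneg t]
    have hp : (0 : ℝ) < 1 + |t| := by linarith
    rw [wt, wt, Real.inv_rpow (by positivity), ← Real.rpow_natCast, ← Real.rpow_mul hp.le,
      ← Real.rpow_natCast]
    refine inv_anti₀ (by positivity) (Real.rpow_le_rpow_of_exponent_le h1 ?_)
    push_cast; linarith
  calc ∫⁻ x, PP 6 k ((cell k n).indicator 1) x ^ s
      ≤ ∫⁻ x, (2 ^ 6) ^ s * (2 ^ (-k) * (ofReal (2 ^ k * wt 2 (2 ^ k * (c - x))) * 1)) := by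
        refine lintegral_mono fun x => ?_
        refine (rpow_le_rpow (PP_cell_le 6 k n hc x) h0.le).trans ?_
        rw [mul_rpow h0.le]
        refine mul_mono ((hw _).trans (le_of_eq ?_))
        rw [ofReal_mul (by positivity), ofReal_two_zpow, mul_one, ← mul_assoc,
          mul_comm ((2 : ℝ≥0∞) ^ (-k)), two_zpow_mul_neg, one_mul, mul_sub, mul_sub, wt_sub_comm]
    _ = (2 ^ 6) ^ s * (2 ^ (-k) * PP 2 k (fun _ => 1) c) := by
        rw [lint_const_mul (by finiteness), lint_const_mul (two_zpow_ne_top _)]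
        rfl
    _ ≤ (2 ^ 6) ^ s * (2 ^ (-k) * 24) := mul_mono (mul_mono (PP_one_le k c))
    _ = _ := by ring

lemma rpow_le_add_sq {F l : ℝ≥0∞} (hl : l ≠ 0) (hlt : l ≠ ∞) {s : ℝ} (h0 : 0 < s) (hs : s ≤ 2) :
    F ^ s ≤ l ^ s + l ^ (s - 2) * F ^ (2 : ℝ) := by
  rcases le_total F l with h | h
  · exact (rpow_le_rpow h h0.le).trans le_self_add
  · refine le_trans ?_ le_add_self
    by_cases hF : F = ∞
    · have : l ^ (s - 2) ≠ 0 := (rpow_pos (pos_iff_ne_zero.2 hl) hlt).ne'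
      rw [hF, top_rpow_of_pos two_pos, mul_top this]; exact le_top
    · have hF0 : F ≠ 0 := fun hF0 => hl (le_zero_iff.1 (hF0 ▸ h))
      calc F ^ s = F ^ (s - 2) * F ^ (2 : ℝ) := by rw [← rpow_add _ _ hF0 hF]; congr 1; ring
        _ ≤ _ := mul_le_mul' ?_ le_rfl
      rw [← neg_neg (s - 2), rpow_neg, rpow_neg l]
      exact ENNReal.inv_le_inv.2 (rpow_le_rpow h (by linarith))

lemma PP_tsum {ι : Type*} [Countable ι] (N : ℕ) (k : ℤ) {h : ι → ℝ → ℝ≥0∞}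
    (hh : ∀ i, Measurable (h i)) (x : ℝ) :
    PP N k (fun a => ∑' i, h i a) x = ∑' i, PP N k (h i) x := by
  unfold PP
  rw [← lintegral_tsum]
  · exact lintegral_congr fun a => ENNReal.tsum_mul_left.symm
  · intro i
    refine (Measurable.mul ?_ (hh i)).aemeasurable
    exact (measurable_const.mul ((measurable_wt N).comp (by fun_prop))).ennreal_ofReal

/-- Synthesis estimate on one level set. -/
lemma synth_level {s : ℝ} (hs : 1 / 2 < s) (hs1 : s ≤ 1) (A : ℝ) : UnifE A fun C E _ _ ψ K =>
      ∀ {v : ℤ → ℝ → E}, (∀ k ∈ K, Dec (v k)) → ∀ {Q : Set (ℤ × ℤ)} {l : ℝ≥0∞}, l ≠ 0 → l ≠ ∞ →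
      (∀ k ∈ K, ∀ x, v k x ≠ 0 → ∃ q ∈ Q, q.1 ≤ k + 3 ∧ x ∈ cell q.1 q.2) →
      (∀ k ∈ K, ∀ x, ‖v k x‖ₑ ≤ l) →
      (∑ k ∈ K, ∫⁻ x, ‖v k x‖ₑ ^ (2 : ℝ) ≤ 2 * l ^ (2 : ℝ) * ∑' q : Q, (2 : ℝ≥0∞) ^ (-q.1.1)) →
      ∫⁻ x, ‖∑ k ∈ K, op (kS ψ k) (v k) x‖ₑ ^ s ≤ C * l ^ s * ∑' q : Q, (2 : ℝ≥0∞) ^ (-q.1.1) := by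
  obtain ⟨B, hB⟩ := synth_L2 A
  have h0 : 0 < s := by linarith
  set c : ℝ≥0∞ := ofReal (2 ^ 8 * A) * geo 1 with hc
  have hct : c ≠ ∞ := mul_ne_top ofReal_ne_top (geo_ne_top one_pos)
  have hC : 24 + B * 2 + c ^ s * ((2 ^ 6) ^ s * 24 * 8) ≠ ∞ := by
    have := rpow_ne_top_of_nonneg h0.le hct
    finiteness
  refine ⟨(24 + B * 2 + c ^ s * ((2 ^ 6) ^ s * 24 * 8)).toNNReal,
    fun {E} _ _ _ {ψ} hψ {K} ho {v} hv {Q l} hl hlt hsupp hb h2 => ?_⟩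
  rw [coe_toNNReal hC]
  set V := ∑' q : Q, (2 : ℝ≥0∞) ^ (-q.1.1) with hV
  set F : ℝ → E := fun x => ∑ k ∈ K, op (kS ψ k) (v k) x with hF
  set n : Q → ℤ := fun q => dix (q.1.1 - 3) (cell_nonempty q.1.1 q.1.2).some with hn
  have hsub : ∀ q : Q, cell q.1.1 q.1.2 ⊆ cell (q.1.1 - 3) (n q) := fun q x hx => by
    rw [mem_cell, hn]
    refine dix_congr (k := q.1.1) (by omega) ?_
    rw [mem_cell.1 hx, mem_cell.1 (cell_nonempty q.1.1 q.1.2).some_mem]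
  set U : Set ℝ := ⋃ q : Q, cell3 (q.1.1 - 3) (n q) with hU
  have h8 : ∀ q : Q, (2 : ℝ≥0∞) ^ (-(q.1.1 - 3)) = 8 * 2 ^ (-q.1.1) := fun q => by
    rw [neg_sub, sub_eq_add_neg, two_zpow_add]; norm_num [zpow_ofNat]
  have hUm : MeasurableSet U := MeasurableSet.iUnion fun q => measurableSet_cell3 _ _
  have hUV : volume U ≤ 24 * V := by
    refine (measure_iUnion_le _).trans ?_
    rw [hV, ← ENNReal.tsum_mul_left]
    refine ENNReal.tsum_le_tsum fun q => (volume_cell3_le _ _).trans (le_of_eq ?_)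
    rw [h8]; ring
  have hVe : ∀ k ∈ K, Dec (op (kS ψ k) (v k)) := fun k hk => hψ.kS.dec_op k (hv k hk)
  have hFd : Dec F := Dec.sum K hVe
  have near : ∫⁻ x in U, ‖F x‖ₑ ^ s ≤ (24 + B * 2) * l ^ s * V := by
    calc ∫⁻ x in U, ‖F x‖ₑ ^ s ≤ ∫⁻ x in U, (l ^ s + l ^ (s - 2) * ‖F x‖ₑ ^ (2 : ℝ)) :=
          lintegral_mono fun x => rpow_le_add_sq hl hlt h0 (by linarith)
      _ ≤ l ^ s * (24 * V) + l ^ (s - 2) * (B * (2 * l ^ (2 : ℝ) * V)) := by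
          rw [lintegral_add_left measurable_const, setLIntegral_const,
            lintegral_const_mul _ (hFd.measurable_enorm.pow_const _)]
          refine add_le_add (mul_mono hUV) (mul_mono ?_)
          exact (setLIntegral_le_lintegral _ _).trans ((hB hψ ho hv).trans (mul_mono h2))
      _ = _ := by
          have : l ^ (s - 2) * l ^ (2 : ℝ) = l ^ s := by
            rw [← rpow_add _ _ hl hlt]; congr 1; ring
          rw [← this]; ring
  have far : ∫⁻ x in Uᶜ, ‖F x‖ₑ ^ s ≤ c ^ s * ((2 ^ 6) ^ s * 24 * 8) * l ^ s * V := by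
    have key : ∀ x ∈ Uᶜ, ‖F x‖ₑ ≤ c * l * ∑' q : Q,
        PP 6 (q.1.1 - 3) ((cell (q.1.1 - 3) (n q)).indicator 1) x := by
      intro x hx
      have hk : ∀ k ∈ K, ‖op (kS ψ k) (v k) x‖ₑ ≤ ofReal (2 ^ 8 * A) * (l * ∑' q : Q,
          (if ¬ k < q.1.1 - 3 then ((2 : ℝ≥0∞) ^ (q.1.1 - 3 - k)) ^ (1 : ℝ) else 0) *
            PP 6 (q.1.1 - 3) ((cell (q.1.1 - 3) (n q)).indicator 1) x) := by
        intro k hkK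
        refine (hψ.kS.enorm_op_le k (v k) x).trans (mul_mono ?_)
        calc PP 8 k (fun a => ‖v k a‖ₑ) x
            ≤ PP 8 k (fun a => l * ∑' q : Q, (if ¬ k < q.1.1 - 3 then
                (cell (q.1.1 - 3) (n q)).indicator 1 a else 0)) x := by
              refine PP_mono (fun a => ?_) x
              by_cases ha : v k a = 0
              · rw [ha, enorm_zero]; exact zero_le
              · obtain ⟨q, hq, hqk, haq⟩ := hsupp k hkK a ha
                refine (hb k hkK a).trans (le_mul_of_one_le_right' ?_)
                refine le_trans ?_ (ENNReal.le_tsum (⟨q, hq⟩ : Q))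
                rw [if_pos (by simp only; omega), indicator_of_mem (hsub ⟨q, hq⟩ haq)]; rfl
          _ = l * ∑' q : Q, PP 8 k (fun a => if ¬ k < q.1.1 - 3 then
                (cell (q.1.1 - 3) (n q)).indicator 1 a else 0) x := by
              rw [PP_lintegral_const hlt, PP_tsum]
              intro q
              split_ifs
              · exact measurable_const
              · exact measurable_one.indicator (measurableSet_cell _ _)
          _ ≤ _ := by
              refine mul_mono (ENNReal.tsum_le_tsum fun q => ?_)
              by_cases hkq : k < q.1.1 - 3
              · simp [hkq, PP]
              · simp only [hkq, not_false_eq_true, if_true, rpow_one]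
                have hk' : q.1.1 - 3 ≤ k := not_lt.1 hkq
                have hxq : x ∉ cell3 (q.1.1 - 3) (n q) := fun h => hx (mem_iUnion.2 ⟨q, h⟩)
                refine (PP_far 6 2 (k₀ := q.1.1 - 3) fun a ha => ?_).trans ?_
                · have ha' : a ∈ cell (q.1.1 - 3) (n q) := by
                    by_contra h; exact ha (indicator_of_notMem h _)
                  refine one_le_of_notMem_cell3 fun h => hxq ?_
                  rw [mem_cell3] at h ⊢
                  rw [mem_cell.1 ha', abs_sub_comm] at h
                  exact h
                · refine (mul_mono (PP_scale 6 hk' _ x)).trans (le_of_eq ?_)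
                  have e : (2 : ℝ≥0∞) ^ (q.1.1 - 3 - k) * 2 ^ (k - (q.1.1 - 3)) = 1 := by
                    rw [← two_zpow_add]; simp
                  rw [pow_two, mul_assoc, ← mul_assoc (_ ^ (q.1.1 - 3 - k)) (_ ^ (k - _)), e, one_mul]
      calc ‖F x‖ₑ ≤ ∑ k ∈ K, ‖op (kS ψ k) (v k) x‖ₑ := enorm_sum_le _ _
        _ ≤ _ := sum_le_sum hk
        _ = ofReal (2 ^ 8 * A) * (l * ∑' q : Q, (∑ k ∈ K,
            (if ¬ k < q.1.1 - 3 then ((2 : ℝ≥0∞) ^ (q.1.1 - 3 - k)) ^ (1 : ℝ) else 0)) *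
            PP 6 (q.1.1 - 3) ((cell (q.1.1 - 3) (n q)).indicator 1) x) := by
            rw [← mul_sum, ← mul_sum, ← Summable.tsum_finsetSum fun _ _ => ENNReal.summable]
            simp only [Finset.sum_mul]
        _ ≤ ofReal (2 ^ 8 * A) * (l * ∑' q : Q, geo 1 *
            PP 6 (q.1.1 - 3) ((cell (q.1.1 - 3) (n q)).indicator 1) x) := by
            refine mul_mono (mul_mono (ENNReal.tsum_le_tsum fun q =>
              mul_le_mul' ?_ le_rfl))
            rw [← Finset.sum_filter]
            exact sum_fine_le K _ 1
        _ = _ := by rw [ENNReal.tsum_mul_left, hc]; ring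
    calc ∫⁻ x in Uᶜ, ‖F x‖ₑ ^ s
        ≤ ∫⁻ x in Uᶜ, (c * l) ^ s * ∑' q : Q,
            PP 6 (q.1.1 - 3) ((cell (q.1.1 - 3) (n q)).indicator 1) x ^ s := by
          refine setLIntegral_mono' hUm.compl fun x hx => ?_
          refine (rpow_le_rpow (key x hx) h0.le).trans ?_
          rw [mul_rpow h0.le]
          exact mul_mono (rpow_tsum_le_tsum_rpow _ h0 hs1)
      _ ≤ ∫⁻ x, (c * l) ^ s * ∑' q : Q,
            PP 6 (q.1.1 - 3) ((cell (q.1.1 - 3) (n q)).indicator 1) x ^ s :=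
          setLIntegral_le_lintegral _ _
      _ = (c * l) ^ s * ∑' q : Q, ∫⁻ x,
            PP 6 (q.1.1 - 3) ((cell (q.1.1 - 3) (n q)).indicator 1) x ^ s := by
          have hm : ∀ q : Q, Measurable fun x =>
            PP 6 (q.1.1 - 3) ((cell (q.1.1 - 3) (n q)).indicator 1) x ^ s := fun q =>
            (measurable_PP (measurable_one.indicator (measurableSet_cell _ _))).pow_const _
          rw [lintegral_const_mul _ (Measurable.tsum hm), lintegral_tsum fun q => (hm q).aemeasurable]
      _ ≤ (c * l) ^ s * ∑' q : Q, (2 ^ 6) ^ s * 24 * 2 ^ (-(q.1.1 - 3)) :=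
          mul_mono (ENNReal.tsum_le_tsum fun q => lintegral_PP_cell_rpow_le hs _ _)
      _ = _ := by
          simp only [h8]
          rw [ENNReal.tsum_mul_left, ENNReal.tsum_mul_left, mul_rpow h0.le, hV]
          ring
  rw [← lintegral_add_compl _ hUm]
  refine (add_le_add near far).trans (le_of_eq ?_)
  ring

lemma iUnion_cell (k : ℤ) : ⋃ n : ℤ, cell k n = Set.univ :=
  Set.eq_univ_of_forall fun x => mem_iUnion.2 ⟨dix k x, rfl⟩

lemma lintegral_eq_tsum_cells (k : ℤ) (h : ℝ → ℝ≥0∞) :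
    ∫⁻ x, h x = ∑' n : ℤ, ∫⁻ x in cell k n, h x := by
  rw [← lintegral_iUnion (measurableSet_cell k), iUnion_cell, Measure.restrict_univ]
  exact fun m n hmn => disjoint_left.2 fun x hm hn => hmn (hm.symm.trans hn)

lemma lintegral_le_two_mul_of_density {g : ℝ → ℝ≥0∞} {S : Set ℝ} (hS : MeasurableSet S)
    (hg : ∀ x y, dix k x = dix k y → g x = g y)
    (h : ∀ x, g x ≠ 0 → 1 / 2 ≤ avg1 k (S.indicator 1) x) : ∫⁻ x, g x ≤ 2 * ∫⁻ x in S, g x := by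
  rw [← lintegral_indicator hS, lintegral_eq_tsum_cells k g, lintegral_eq_tsum_cells k,
    ← ENNReal.tsum_mul_left]
  refine ENNReal.tsum_le_tsum fun n => ?_
  obtain ⟨c, hc⟩ := cell_nonempty k n
  have hgc : ∀ x ∈ cell k n, g x = g c := fun x hx => hg x c (hx.trans hc.symm)
  by_cases h0 : g c = 0
  · rw [setLIntegral_congr_fun (measurableSet_cell k n) hgc, h0]; simp
  have hd := h c h0
  rw [avg1, hc] at hd
  calc ∫⁻ x in cell k n, g x = g c * 2 ^ (-k) := by
        rw [setLIntegral_congr_fun (measurableSet_cell k n) hgc, setLIntegral_const, volume_cell]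
    _ = 2 * (g c * ((1 / 2) * 2 ^ (-k))) := by
        rw [one_div, mul_left_comm (g c), ← mul_assoc 2, ENNReal.mul_inv_cancel two_ne_zero
          ofNat_ne_top, one_mul]
    _ ≤ 2 * (g c * ((2 ^ k * ∫⁻ y in cell k n, S.indicator 1 y) * 2 ^ (-k))) :=
        mul_mono (mul_mono (mul_le_mul' hd le_rfl))
    _ = 2 * (g c * ∫⁻ y in cell k n, S.indicator 1 y) := by
        rw [mul_right_comm (2 ^ k), two_zpow_mul_neg, one_mul]
    _ = 2 * ∫⁻ x in cell k n, S.indicator g x := by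
        rw [← lintegral_const_mul _ (measurable_one.indicator hS)]
        congr 1
        refine setLIntegral_congr_fun (measurableSet_cell k n) fun x hx => ?_
        by_cases hxS : x ∈ S
        · simp [hxS, hgc x hx]
        · simp [hxS]

/-- Constancy on the cells on which the sampling point is constant. -/
def CC {E : Type*} (k : ℤ) (w : ℝ → E) : Prop :=
  ∀ x y, dix (k + 3) x = dix (k + 3) y → w x = w y

lemma avg1_congr (h : dix k x = dix k y) (g : ℝ → ℝ≥0∞) : avg1 k g x = avg1 k g y := by rw [avg1, avg1, h]

lemma avg1_one (k : ℤ) (x : ℝ) : avg1 k (fun _ => 1) x = 1 := by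
  rw [avg1, setLIntegral_const, volume_cell, one_mul, two_zpow_mul_neg]

lemma avg1_indicator_eq_one {S : Set ℝ} (h : ∀ y, dix k y = dix k x → y ∈ S) :
    avg1 k (S.indicator 1) x = 1 := by
  rw [← avg1_one k x, avg1, avg1]
  congr 1
  exact setLIntegral_congr_fun (measurableSet_cell _ _) fun y hy => by
    rw [indicator_of_mem (h y hy)]; rfl

lemma avg1_add_compl (k : ℤ) {S : Set ℝ} (hS : MeasurableSet S) (x : ℝ) :
    avg1 k (S.indicator 1) x + avg1 k (Sᶜ.indicator 1) x = 1 := by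
  rw [← avg1_one k x, avg1, avg1, avg1, ← mul_add,
    ← lintegral_add_left (measurable_one.indicator hS)]
  congr 1
  refine lintegral_congr fun y => ?_
  have := congrFun (Set.indicator_self_add_compl S (1 : ℝ → ℝ≥0∞)) y
  exact this

/-- Vector valued square function bound for synthesis operators below `L¹`. -/
lemma synth_rpow_le {s : ℝ} (hs : 1 / 2 < s) (hs1 : s ≤ 1) (A : ℝ) : UnifE A fun C E _ _ ψ K =>
      ∀ {w : ℤ → ℝ → E}, (∀ k ∈ K, Dec (w k)) →
      (∀ k ∈ K, CC k (w k)) → ∫⁻ x, ‖∑ k ∈ K, op (kS ψ k) (w k) x‖ₑ ^ s ≤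
        C * ∫⁻ x, (∑ k ∈ K, ‖w k x‖ₑ ^ (2 : ℝ)) ^ (s / 2) := by
  obtain ⟨C, hC⟩ := synth_level hs hs1 A
  have h0 : 0 < s := by linarith
  have hg := geo_ne_top h0
  have hCt : (C : ℝ≥0∞) * 2 ^ s * 4 * geo s ≠ ∞ := by finiteness
  refine ⟨((C : ℝ≥0∞) * 2 ^ s * 4 * geo s).toNNReal, fun {E} _ _ _ {ψ} hψ {K} ho {w} hw hcc => ?_⟩
  rw [coe_toNNReal hCt]
  set W2 : ℝ → ℝ≥0∞ := fun x => ∑ k ∈ K, ‖w k x‖ₑ ^ (2 : ℝ) with hW2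
  have hW2m : Measurable W2 := Finset.measurable_fun_sum _ fun k hk =>
    (hw k hk).measurable_enorm.pow_const _
  set W : ℝ → ℝ≥0∞ := fun x => W2 x ^ (1 / 2 : ℝ) with hW
  have hWm : Measurable W := hW2m.pow_const _
  have hWs : ∀ x, W2 x ^ (s / 2) = W x ^ s := fun x => by
    rw [hW, ← rpow_mul]; congr 1; ring
  have hWsq : ∀ x, W x ^ (2 : ℝ) = W2 x := fun x => by
    rw [hW, ← rpow_mul]; norm_num
  have hwW : ∀ k ∈ K, ∀ x, ‖w k x‖ₑ ≤ W x := fun k hk x => by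
    have h1 : ‖w k x‖ₑ ^ (2 : ℝ) ≤ W2 x :=
      Finset.single_le_sum (f := fun k => ‖w k x‖ₑ ^ (2 : ℝ)) (fun _ _ => zero_le) hk
    calc ‖w k x‖ₑ = (‖w k x‖ₑ ^ (2 : ℝ)) ^ (1 / 2 : ℝ) := by rw [← rpow_mul]; norm_num
      _ ≤ _ := rpow_le_rpow h1 (by norm_num)
  have hWi : ∫⁻ x, W2 x ≠ ∞ := by
    rw [hW2, lintegral_finsetSum' _ fun k hk => ((hw k hk).measurable_enorm.pow_const _).aemeasurable]
    refine (sum_lt_top.2 fun k hk => ?_).ne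
    rw [(hw k hk).lintegral_sq]; exact ofReal_lt_top
  have hWb : ∃ N : ℤ, ∀ x, W x ≤ 2 ^ N := by
    choose! M hM0 hM using fun k hk => (hw k hk).bounded
    have hb : ∀ x, W2 x ≤ ∑ k ∈ K, ofReal (M k) ^ (2 : ℝ) := fun x =>
      sum_le_sum fun k hk => rpow_le_rpow
        (by rw [← ofReal_norm]; exact ofReal_le_ofReal (hM k hk x)) two_pos.le
    have ht : (∑ k ∈ K, ofReal (M k) ^ (2 : ℝ)) ^ (1 / 2 : ℝ) ≠ ∞ := by
      refine rpow_ne_top_of_nonneg (by norm_num) (sum_ne_top.2 fun k _ => ?_)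
      finiteness
    obtain ⟨n, hn⟩ := ENNReal.exists_nat_gt ht
    refine ⟨n, fun x => (rpow_le_rpow (hb x) (by norm_num)).trans (hn.le.trans ?_)⟩
    rw [zpow_natCast]
    exact_mod_cast (Nat.lt_two_pow_self (n := n)).le
  obtain ⟨N, hN⟩ := hWb
  set Om : ℤ → Set ℝ := fun j => {x | (2 : ℝ≥0∞) ^ j < W x} with hOm
  have hOmm : ∀ j, MeasurableSet (Om j) := fun j => measurableSet_lt measurable_const hWm
  have two_mono : ∀ {i j : ℤ}, i ≤ j → (2 : ℝ≥0∞) ^ i ≤ 2 ^ j := fun h =>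
    zpow_le_of_le (by norm_num) h
  have hOma : ∀ {i j : ℤ}, i ≤ j → Om j ⊆ Om i := fun h x hx => (two_mono h).trans_lt hx
  have hOmf : ∀ j, volume (Om j) ≠ ∞ := fun j => by
    have h1 : volume (Om j) ≤ (∫⁻ x, W2 x) / ((2 ^ j) ^ (2 : ℝ)) := by
      refine le_trans (measure_mono fun x hx => ?_) (meas_ge_le_lintegral_div hW2m.aemeasurable
        (rpow_pos (pos_iff_ne_zero.2 (two_zpow_ne_zero j)) (two_zpow_ne_top j)).ne'
        (rpow_ne_top_of_nonneg two_pos.le (two_zpow_ne_top j)))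
      rw [mem_ofPred_eq, ← hWsq]
      exact rpow_le_rpow (le_of_lt hx) two_pos.le
    refine ne_top_of_le_ne_top (div_ne_top hWi
      (rpow_pos (pos_iff_ne_zero.2 (two_zpow_ne_zero j)) (two_zpow_ne_top j)).ne') h1
  set D : ℤ → ℤ → Set ℝ := fun k j => {x | 1 / 2 ≤ avg1 (k + 3) ((Om j).indicator 1) x} with hD
  have hDm : ∀ k j, MeasurableSet (D k j) := fun k j =>
    measurableSet_le measurable_const (measurable_avg1 _ _)
  have hDa : ∀ k {i j : ℤ}, i ≤ j → D k j ⊆ D k i := fun k i j h x hx => by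
    rw [hD, mem_ofPred_eq] at hx ⊢
    refine hx.trans ?_
    unfold avg1
    refine mul_mono (lintegral_mono fun y => ?_)
    exact Set.indicator_le_indicator_of_subset (hOma h) (fun _ => zero_le) y
  have hDc : ∀ k j {x y : ℝ}, dix (k + 3) x = dix (k + 3) y → (x ∈ D k j ↔ y ∈ D k j) :=
    fun k j x y h => by rw [hD, mem_ofPred_eq, mem_ofPred_eq, avg1_congr h]
  set S : ℤ → ℤ → Set ℝ := fun k j => D k j \ D k (j + 1) with hS
  have hSm : ∀ k j, MeasurableSet (S k j) := fun k j => (hDm k j).diff (hDm k _)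
  have hSd : ∀ k, Pairwise (Function.onFun Disjoint (S k)) := fun k => by
    have : ∀ i j, i < j → Disjoint (S k i) (S k j) := fun i j hij =>
      disjoint_left.2 fun x hi hj => hi.2 (hDa k (by omega) hj.1)
    intro i j hij
    rcases lt_or_gt_of_ne hij with h | h
    · exact this i j h
    · exact (this j i h).symm
  have hSU : ∀ k ∈ K, ∀ x, w k x ≠ 0 → ∃ j, x ∈ S k j := fun k hk x hx => by
    have hne : ∃ j, x ∈ D k j := by
      obtain ⟨j, hj⟩ : ∃ j : ℤ, (2 : ℝ≥0∞) ^ j < ‖w k x‖ₑ := by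
        have hx0 : ‖w k x‖ₑ ≠ 0 := enorm_ne_zero.2 hx
        obtain ⟨n, hn⟩ := exists_inv_two_pow_lt hx0
        refine ⟨-(n : ℤ), ?_⟩
        rwa [ENNReal.zpow_neg, zpow_natCast, ENNReal.inv_pow]
      refine ⟨j, ?_⟩
      rw [hD, mem_ofPred_eq, avg1_indicator_eq_one]
      · norm_num
      · intro y hy
        have := hwW k hk y
        rw [hcc k hk y x hy] at this
        exact hj.trans_le this
    have hbd : ∀ j, x ∈ D k j → j ≤ N := fun j hj => by
      by_contra hlt
      have he : Om j = ∅ := Set.eq_empty_of_forall_notMem fun y hy =>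
        absurd (hN y) (not_le.2 ((two_mono (not_le.1 hlt).le).trans_lt hy))
      rw [hD, mem_ofPred_eq, he] at hj
      simp [avg1] at hj
    obtain ⟨j, hj, hmax⟩ := Int.exists_greatest_of_bdd ⟨N, hbd⟩ hne
    exact ⟨j, hj, fun h => absurd (hmax _ h) (by omega)⟩
  set v : ℤ → ℤ → ℝ → E := fun j k => (S k j).indicator (w k) with hv
  have hvd : ∀ j, ∀ k ∈ K, Dec (v j k) := fun j k hk => (hw k hk).indicator (hSm k j)
  have hvc : ∀ j, ∀ k ∈ K, CC k (v j k) := fun j k hk x y h => by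
    have e : x ∈ S k j ↔ y ∈ S k j := by
      rw [hS, Set.mem_sdiff, Set.mem_sdiff, hDc k j h, hDc k (j + 1) h]
    by_cases hy : y ∈ S k j
    · simp only [hv, indicator_of_mem hy, indicator_of_mem (e.2 hy), hcc k hk x y h]
    · simp only [hv, indicator_of_notMem hy, indicator_of_notMem (fun h => hy (e.1 h))]
  have hsum : ∀ x, HasSum (fun j => ∑ k ∈ K, op (kS ψ k) (v j k) x)
      (∑ k ∈ K, op (kS ψ k) (w k) x) := fun x => by
    refine hasSum_sum fun k hk => ?_
    have hi := hψ.kS.integrable k x (hw k hk)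
    have h1 := hasSum_integral_iUnion (hSm k) (hSd k) hi.integrableOn
    rw [setIntegral_eq_integral_of_forall_compl_eq_zero] at h1
    · have e : (fun j => op (kS ψ k) (v j k) x) = fun j => ∫ a in S k j, kS ψ k x a • w k a := by
        funext j
        rw [op, ← integral_indicator (hSm k j)]
        refine int_congr fun a => ?_
        simp only [hv]
        by_cases ha : a ∈ S k j <;> simp [ha]
      rw [e]
      exact h1
    · intro a ha
      by_cases hwa : w k a = 0
      · rw [hwa, smul_zero]
      · exact absurd (mem_iUnion.2 (hSU k hk a hwa)) ha
  have hlev : ∀ j, ∫⁻ x, ‖∑ k ∈ K, op (kS ψ k) (v j k) x‖ₑ ^ s ≤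
      C * 2 ^ s * 4 * (((2 : ℝ≥0∞) ^ j) ^ s * volume {x | 2 ^ j < W x}) := by
    intro j
    have hfin : ∫⁻ y, (Om j).indicator (1 : ℝ → ℝ≥0∞) y ≠ ∞ := by
      rw [lintegral_indicator_one (hOmm j)]; exact hOmf j
    obtain ⟨Q, hQ1, hQ2, hQ3, -⟩ := exists_cz_cells hfin (σ := 1 / 4) (by simp)
    have hV := tsum_volume_cells_le hQ1 hQ2
    rw [lintegral_indicator_one (hOmm j)] at hV
    set V := ∑' q : Q, (2 : ℝ≥0∞) ^ (-q.1.1) with hVdef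
    have hV4 : V ≤ 4 * volume (Om j) := by
      calc V = 4 * (1 / 4 * V) := by
            rw [← mul_assoc, one_div, ENNReal.mul_inv_cancel (by norm_num) (by norm_num), one_mul]
        _ ≤ _ := mul_mono hV
    have hsupp : ∀ k x, x ∈ D k j → ∃ q ∈ Q, q.1 ≤ k + 3 ∧ x ∈ cell q.1 q.2 := fun k x hx => by
      obtain ⟨q, hq, hqk, hsub⟩ := hQ3 (k + 3) (dix (k + 3) x)
        (lt_of_lt_of_le (ENNReal.div_lt_div_left (by norm_num) (by norm_num) (by norm_num)) hx)
      exact ⟨q, hq, hqk, hsub rfl⟩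
    have hb : ∀ k ∈ K, ∀ x, ‖v j k x‖ₑ ≤ 2 ^ (j + 1) := fun k hk x => by
      by_cases hx : x ∈ S k j
      · simp only [hv, indicator_of_mem hx]
        by_contra hlt
        refine hx.2 ?_
        rw [hD, mem_ofPred_eq, avg1_indicator_eq_one]
        · norm_num
        · intro y hy
          have := hwW k hk y
          rw [hcc k hk y x hy] at this
          exact (not_le.1 hlt).trans_le this
      · simp [hv, indicator_of_notMem hx]
    have hL2 : ∑ k ∈ K, ∫⁻ x, ‖v j k x‖ₑ ^ (2 : ℝ) ≤ 2 * (2 ^ (j + 1)) ^ (2 : ℝ) * V := by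
      have hc := (hOmm (j + 1)).compl
      calc ∑ k ∈ K, ∫⁻ x, ‖v j k x‖ₑ ^ (2 : ℝ)
          ≤ ∑ k ∈ K, 2 * ∫⁻ x in (Om (j + 1))ᶜ, ‖v j k x‖ₑ ^ (2 : ℝ) := by
            refine sum_le_sum fun k hk => lintegral_le_two_mul_of_density (k := k + 3) hc
              (fun x y h => by rw [hvc j k hk x y h]) fun x hx => ?_
            have hxS : x ∈ S k j := by
              by_contra h; exact hx (by simp [hv, indicator_of_notMem h])
            have h1 : avg1 (k + 3) ((Om (j + 1)).indicator 1) x < 1 / 2 := not_le.1 hxS.2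
            have h2 := avg1_add_compl (k + 3) (hOmm (j + 1)) x
            by_contra h3
            have h4 := ENNReal.add_lt_add h1 (not_le.1 h3)
            rw [h2, ENNReal.add_halves] at h4
            exact lt_irrefl _ h4
        _ = 2 * ∫⁻ x in (Om (j + 1))ᶜ, ∑ k ∈ K, ‖v j k x‖ₑ ^ (2 : ℝ) := by
            rw [← mul_sum, lintegral_finsetSum' _ fun k hk =>
              ((hvd j k hk).measurable_enorm.pow_const _).aemeasurable]
        _ ≤ 2 * ∫⁻ x in (Om (j + 1))ᶜ, (⋃ q : Q, cell q.1.1 q.1.2).indicator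
              (fun _ => (2 ^ (j + 1)) ^ (2 : ℝ)) x := by
            refine mul_mono (setLIntegral_mono' hc fun x hx => ?_)
            by_cases hxQ : x ∈ ⋃ q : Q, cell q.1.1 q.1.2
            · rw [indicator_of_mem hxQ]
              calc ∑ k ∈ K, ‖v j k x‖ₑ ^ (2 : ℝ) ≤ W2 x := by
                    refine sum_le_sum fun k _ => rpow_le_rpow ?_ two_pos.le
                    by_cases hxS : x ∈ S k j <;> simp [hv, hxS]
                _ = W x ^ (2 : ℝ) := (hWsq x).symm
                _ ≤ _ := rpow_le_rpow (not_lt.1 hx) two_pos.le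
            · rw [indicator_of_notMem hxQ]
              refine le_of_eq (Finset.sum_eq_zero fun k _ => ?_)
              have hxS : x ∉ S k j := fun hxS => by
                obtain ⟨q, hq, -, hxq⟩ := hsupp k x hxS.1
                exact hxQ (mem_iUnion.2 ⟨⟨q, hq⟩, hxq⟩)
              simp [hv, hxS]
        _ ≤ 2 * ∫⁻ x, (⋃ q : Q, cell q.1.1 q.1.2).indicator
              (fun _ => (2 ^ (j + 1)) ^ (2 : ℝ)) x :=
            mul_mono (setLIntegral_le_lintegral _ _)
        _ ≤ _ := by
            rw [lintegral_indicator_const (MeasurableSet.iUnion fun q => measurableSet_cell _ _),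
              mul_assoc]
            refine mul_mono (mul_mono ((measure_iUnion_le _).trans ?_))
            rw [hVdef]
            exact ENNReal.tsum_le_tsum fun q => (volume_cell _ _).le
    have hmain := hC hψ ho (hvd j) (Q := Q) (two_zpow_ne_zero (j + 1)) (two_zpow_ne_top (j + 1))
      (fun k _ x hx => hsupp k x (by
        by_contra h
        exact hx (by simp [hv, hS, h]))) hb hL2
    refine hmain.trans ((mul_mono hV4).trans (le_of_eq ?_))
    rw [two_zpow_add, zpow_one, mul_rpow h0.le, hOm]
    ring
  calc ∫⁻ x, ‖∑ k ∈ K, op (kS ψ k) (w k) x‖ₑ ^ s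
      ≤ ∫⁻ x, ∑' j : ℤ, ‖∑ k ∈ K, op (kS ψ k) (v j k) x‖ₑ ^ s := by
        refine lintegral_mono fun x => ?_
        refine le_trans (rpow_le_rpow ?_ h0.le) (rpow_tsum_le_tsum_rpow _ h0 hs1)
        rw [← (hsum x).tsum_eq]
        exact enorm_tsum_le_tsum_enorm
    _ = ∑' j : ℤ, ∫⁻ x, ‖∑ k ∈ K, op (kS ψ k) (v j k) x‖ₑ ^ s :=
        lintegral_tsum fun j => ((Dec.sum K fun k hk =>
          hψ.kS.dec_op k (hvd j k hk)).measurable_enorm.pow_const _).aemeasurable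
    _ ≤ ∑' j : ℤ, C * 2 ^ s * 4 * (((2 : ℝ≥0∞) ^ j) ^ s * volume {x | 2 ^ j < W x}) :=
        ENNReal.tsum_le_tsum hlev
    _ = C * 2 ^ s * 4 * ∑' j : ℤ, ((2 : ℝ≥0∞) ^ j) ^ s * volume {x | 2 ^ j < W x} :=
        ENNReal.tsum_mul_left
    _ ≤ C * 2 ^ s * 4 * (geo s * ∫⁻ x, W x ^ s) :=
        mul_mono (layers_le_lintegral_rpow hWm h0)
    _ = _ := by simp only [show ∀ x, (∑ k ∈ K, ‖w k x‖ₑ ^ (2 : ℝ)) ^ (s / 2) = W x ^ s from hWs]; ring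

/-- Jointly measurable functions of two variables with quadratic decay in each. -/
def Dec2 (F : ℝ → ℝ → ℂ) : Prop :=
  StronglyMeasurable (uncurry F) ∧ ∃ C : ℝ, ∀ x y, ‖F x y‖ ≤ C * (wt 2 x * wt 2 y)

lemma Dec2.exists_bound (h : Dec2 F) : ∃ C : ℝ, 0 ≤ C ∧ ∀ x y, ‖F x y‖ ≤ C * (wt 2 x * wt 2 y) := by
  obtain ⟨_, C, hC⟩ := h
  refine ⟨C, ?_, hC⟩
  by_contra hneg
  have h1 := (norm_nonneg _).trans (hC 0 0)
  have h2 : 0 < wt 2 0 * wt 2 0 := mul_pos (wt_pos _ _) (wt_pos _ _)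
  nlinarith

lemma Dec2.swap (h : Dec2 F) : Dec2 (fun x y => F y x) := by
  obtain ⟨hm, C, hC⟩ := h
  exact ⟨hm.comp_measurable measurable_swap, C, fun x y => by
    rw [mul_comm (wt 2 x)]; exact hC y x⟩

lemma Dec2.right (h : Dec2 F) (y : ℝ) : Dec (fun x => F x y) := by
  obtain ⟨C, hC0, hC⟩ := h.exists_bound
  refine ⟨h.1.comp_measurable measurable_prodMk_right, C, fun x => (hC x y).trans ?_⟩
  exact mul_le_mul_of_nonneg_left (mul_le_of_le_one_right (wt_nonneg _ _) (wt_le_one _ _)) hC0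

lemma Dec2.left (h : Dec2 F) (x : ℝ) : Dec (F x) := h.swap.right x

lemma Dec2.bounded (h : Dec2 F) : ∃ C : ℝ, 0 ≤ C ∧ ∀ x y, ‖F x y‖ ≤ C := by
  obtain ⟨C, hC0, hC⟩ := h.exists_bound
  refine ⟨C, hC0, fun x y => (hC x y).trans (mul_le_of_le_one_right hC0 ?_)⟩
  exact mul_le_one₀ (wt_le_one _ _) (wt_nonneg _ _) (wt_le_one _ _)

lemma Dec2.of_norm_le (h : Dec2 F) (hG : StronglyMeasurable (uncurry G)) {D : ℝ}
    (hD : ∀ x y, ‖G x y‖ ≤ D * ‖F x y‖) : Dec2 G := by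
  obtain ⟨C, hC0, hC⟩ := h.exists_bound
  refine ⟨hG, |D| * C, fun x y => ?_⟩
  calc ‖G x y‖ ≤ |D| * ‖F x y‖ :=
        (hD x y).trans (mul_le_mul_of_nonneg_right (le_abs_self D) (norm_nonneg _))
    _ ≤ |D| * (C * (wt 2 x * wt 2 y)) := mul_le_mul_of_nonneg_left (hC x y) (abs_nonneg _)
    _ = _ := by ring

lemma Dec2.zero : Dec2 (fun _ _ => 0) :=
  ⟨stronglyMeasurable_const, 0, fun x y => by simp⟩

lemma Dec2.add (hF : Dec2 F) (hG : Dec2 G) : Dec2 (fun x y => F x y + G x y) := by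
  obtain ⟨C, hC⟩ := hF.2
  obtain ⟨D, hD⟩ := hG.2
  refine ⟨hF.1.add hG.1, C + D, fun x y => (norm_add_le _ _).trans ?_⟩
  rw [add_mul]
  exact add_le_add (hC x y) (hD x y)

lemma Dec2.sum {ι : Type*} (s : Finset ι) {F : ι → ℝ → ℝ → ℂ} (h : ∀ i ∈ s, Dec2 (F i)) :
    Dec2 (fun x y => ∑ i ∈ s, F i x y) := by
  classical
  induction s using Finset.induction_on with
  | empty => simpa using Dec2.zero
  | insert a s ha ih =>
    simp_rw [sum_insert ha]
    exact (h a (by simp)).add (ih fun i hi => h i (by simp [hi]))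

lemma Dec2.const_mul (h : Dec2 F) (c : ℂ) : Dec2 (fun x y => c * F x y) :=
  h.of_norm_le (h.1.const_mul c) (D := ‖c‖) fun x y => (norm_mul _ _).le

lemma Dec2.sub (hF : Dec2 F) (hG : Dec2 G) : Dec2 (fun x y => F x y - G x y) := by
  have := hF.add (hG.const_mul (-1))
  simpa [sub_eq_add_neg] using this

lemma Dec2.mul (hF : Dec2 F) (hG : Dec2 G) : Dec2 (fun x y => F x y * G x y) := by
  obtain ⟨C, -, hC⟩ := hF.bounded
  exact hG.of_norm_le (hF.1.mul hG.1) (D := C) fun x y => by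
    rw [norm_mul]; exact mul_le_mul_of_nonneg_right (hC x y) (norm_nonneg _)

lemma Dec2.conj (hF : Dec2 F) : Dec2 (fun x y => conj (F x y)) :=
  hF.of_norm_le (Complex.continuous_conj.comp_stronglyMeasurable hF.1) (D := 1) fun x y => by
    rw [RCLike.norm_conj, one_mul]

lemma Dec2.integrable (hF : Dec2 F) : Integrable (uncurry F) := by
  obtain ⟨C, -, hC⟩ := hF.exists_bound
  exact (((integrable_wt le_rfl).mul_prod (integrable_wt le_rfl)).const_mul C).mono'
    hF.1.aestronglyMeasurable (.of_forall fun z => hC z.1 z.2)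

lemma Dec2.measurable_enorm (hF : Dec2 F) : Measurable (uncurry fun x y => ‖F x y‖ₑ) := hF.1.enorm

/-- The operator with kernel `κ` acting in the first variable. -/
def opx (κ : ℝ → ℝ → ℂ) (F : ℝ → ℝ → ℂ) (x y : ℝ) : ℂ := op κ (fun a => F a y) x

/-- The operator with kernel `κ` acting in the second variable. -/
def opy (κ : ℝ → ℝ → ℂ) (F : ℝ → ℝ → ℂ) (x y : ℝ) : ℂ := op κ (F x) y

section

variable {A A' : ℝ} {κ κ' : ℤ → ℝ → ℝ → ℂ}

lemma stronglyMeasurable_opx {κ : ℝ → ℝ → ℂ} (hκ : Measurable (uncurry κ))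
    (hF : StronglyMeasurable (uncurry F)) : StronglyMeasurable (uncurry (opx κ F)) := by
  have h : StronglyMeasurable fun p : (ℝ × ℝ) × ℝ => κ p.1.1 p.2 • F p.2 p.1.2 :=
    (hκ.comp ((measurable_fst.comp measurable_fst).prodMk measurable_snd)).stronglyMeasurable.smul
      (hF.comp_measurable (measurable_snd.prodMk (measurable_snd.comp measurable_fst)))
  exact h.integral_prod_right

lemma Dec2.opx (hκ : KerOp A κ) (k : ℤ) (hF : Dec2 F) : Dec2 (opx (κ k) F) := by
  obtain ⟨C, hC⟩ := PP_wt_le k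
  obtain ⟨D, hD0, hD⟩ := hF.exists_bound
  refine ⟨stronglyMeasurable_opx (hκ.meas k) hF.1, A * D * C, fun x y => ?_⟩
  have h0 := hκ.nonneg
  have hw := wt_nonneg 2 x
  have hw' := wt_nonneg 2 y
  rw [← ofReal_le_ofReal_iff (by positivity), ofReal_norm]
  calc ‖op (κ k) (fun a => F a y) x‖ₑ
      ≤ ofReal A * PP 8 k (fun a => ‖F a y‖ₑ) x := hκ.enorm_op_le k _ x
    _ ≤ ofReal A *
          PP 8 k (fun a => ofReal (D * wt 2 y) * ofReal (wt 2 a)) x := by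
        refine mul_mono (PP_mono (fun a => ?_) x)
        rw [← ofReal_mul (by positivity), ← ofReal_norm]
        exact ofReal_le_ofReal ((hD a y).trans (le_of_eq (by ring)))
    _ ≤ ofReal A * (ofReal (D * wt 2 y) * (C * ofReal (wt 2 x))) := by
        rw [PP_lintegral_const ofReal_ne_top]
        exact mul_mono (mul_mono (hC x))
    _ = ofReal (A * D * C * (wt 2 x * wt 2 y)) := by
        rw [← ofReal_coe_nnreal, ← ofReal_mul (by positivity),
          ← ofReal_mul (by positivity), ← ofReal_mul (by positivity)]
        congr 1; ring

lemma Dec2.opy (hκ : KerOp A κ) (k : ℤ) (hF : Dec2 F) : Dec2 (opy (κ k) F) := (hF.swap.opx hκ k).swap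

lemma opx_opy_comm (hκ : KerOp A κ) (hκ' : KerOp A' κ') (k l : ℤ) (hF : Dec2 F) :
    opx (κ k) (opy (κ' l) F) = opy (κ' l) (opx (κ k) F) := by
  funext x y
  simp only [opx, opy, op, smul_eq_mul]
  have hi : Integrable (uncurry fun a b => κ k x a * (κ' l y b * F a b)) := by
    have hm : Measurable (κ k x) := (hκ.meas k).comp measurable_prodMk_left
    have hm' : Measurable (κ' l y) := (hκ'.meas l).comp measurable_prodMk_left
    refine (hF.integrable.norm.const_mul ((A * 2 ^ k) * (A' * 2 ^ l))).mono'
      ((hm.comp measurable_fst).stronglyMeasurable.mul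
        ((hm'.comp measurable_snd).stronglyMeasurable.mul hF.1)).aestronglyMeasurable
      (.of_forall fun z => ?_)
    simp only [uncurry, norm_mul]
    rw [mul_assoc]
    have h1 := hκ.norm_le k x z.1
    have h2 := hκ'.norm_le l y z.2
    have h3 := hκ.nonneg
    gcongr
  calc ∫ a, κ k x a * ∫ b, κ' l y b * F a b
      = ∫ a, ∫ b, κ k x a * (κ' l y b * F a b) := by simp_rw [← integral_const_mul]
    _ = ∫ b, ∫ a, κ k x a * (κ' l y b * F a b) := integral_integral_swap hi
    _ = ∫ b, κ' l y b * ∫ a, κ k x a * F a b := by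
        simp_rw [← integral_const_mul]
        congr 1; funext b; congr 1; funext a; ring

lemma KerOp.op_sum {E : Type*} [NormedAddCommGroup E] [NormedSpace ℂ E] (hκ : KerOp A κ) (k : ℤ)
    {ι : Type*} (s : Finset ι) {u : ι → ℝ → E} (hu : ∀ i ∈ s, Dec (u i)) (x : ℝ) :
    op (κ k) (fun a => ∑ i ∈ s, u i a) x = ∑ i ∈ s, op (κ k) (u i) x := by
  simp only [op, Finset.smul_sum]
  exact integral_finsetSum s fun i hi => hκ.integrable k x (hu i hi)

/-- The integral pairing on the plane. -/
def pair2 (H F : ℝ → ℝ → ℂ) : ℂ := ∫ z : ℝ × ℝ, inner ℂ (H z.1 z.2) (F z.1 z.2)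

lemma Dec2.integrable_inner (hH : Dec2 H) (hF : Dec2 F) :
    Integrable fun z : ℝ × ℝ => inner ℂ (H z.1 z.2) (F z.1 z.2) := by
  have := (hF.mul hH.conj).integrable
  simpa [RCLike.inner_apply, Function.uncurry_def] using this

lemma pair2_swap (H F : ℝ → ℝ → ℂ) : pair2 (fun x y => H y x) (fun x y => F y x) = pair2 H F :=
  integral_prod_swap (μ := (volume : Measure ℝ)) (ν := volume)
    (fun z : ℝ × ℝ => (inner ℂ (H z.1 z.2) (F z.1 z.2) : ℂ))

lemma pair2_opx (hκ : KerOp A κ) (hκ' : KerOp A' κ') (k : ℤ)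
    (hadj : (fun a x => conj (κ k x a)) = κ' k) (hH : Dec2 H) (hF : Dec2 F) :
    pair2 H (opx (κ k) F) = pair2 (opx (κ' k) H) F := by
  have h1 := integral_prod_symm _ (hH.integrable_inner (hF.opx hκ k))
  have h2 := integral_prod_symm _ ((hH.opx hκ' k).integrable_inner hF)
  refine h1.trans (Eq.trans ?_ h2.symm)
  refine int_congr fun y => ?_
  have h := inner_op_eq (hκ.meas k) (C := A * 2 ^ k) (hκ.norm_le k) (hF.right y) (hH.right y)
  rw [hadj] at h
  exact h

lemma pair2_opy (hκ : KerOp A κ) (hκ' : KerOp A' κ') (k : ℤ)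
    (hadj : (fun a x => conj (κ k x a)) = κ' k) (hH : Dec2 H) (hF : Dec2 F) :
    pair2 H (opy (κ k) F) = pair2 (opy (κ' k) H) F := by
  have := pair2_opx hκ hκ' k hadj hH.swap hF.swap
  rw [← pair2_swap, ← pair2_swap (opy (κ' k) H)]
  exact this

lemma pair2_sum {ι : Type*} (s : Finset ι) {F : ι → ℝ → ℝ → ℂ} (hH : Dec2 H)
    (hF : ∀ i ∈ s, Dec2 (F i)) :
    pair2 H (fun x y => ∑ i ∈ s, F i x y) = ∑ i ∈ s, pair2 H (F i) := by
  simp only [pair2, inner_sum]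
  exact integral_finsetSum s fun i hi => hH.integrable_inner (hF i hi)

end

/-- Analysis operator in both variables. -/
def ana (η θ : ℝ → ℂ) (k l : ℤ) (F : ℝ → ℝ → ℂ) : ℝ → ℝ → ℂ :=
  opy (kA θ l) (opx (kA η k) F)

/-- Synthesis operator in both variables. -/
def syn (η θ : ℝ → ℂ) (k l : ℤ) (F : ℝ → ℝ → ℂ) : ℝ → ℝ → ℂ :=
  opx (kS η k) (opy (kS θ l) F)

lemma Dec2.ana (hη : Ker A η) (hθ : Ker A θ) (k l : ℤ) (hF : Dec2 F) : Dec2 (ana η θ k l F) := (hF.opx hη.kA k).opy hθ.kA l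

lemma Dec2.syn (hη : Ker A η) (hθ : Ker A θ) (k l : ℤ) (hF : Dec2 F) : Dec2 (syn η θ k l F) := (hF.opy hθ.kS l).opx hη.kS k

lemma pair2_syn (hη : Ker A η) (hθ : Ker A θ) (k l : ℤ) (hH : Dec2 H) (hF : Dec2 F) :
    pair2 H (syn η θ k l F) = pair2 (ana (cnj (refl η)) (cnj (refl θ)) k l H) F := by
  rw [syn, pair2_opx hη.kS hη.refl.cnj.kA k (kS_adj η k) hH (hF.opy hθ.kS l),
    pair2_opy hθ.kS hθ.refl.cnj.kA l (kS_adj θ l) (hH.opx hη.refl.cnj.kA k) hF, ana]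

/-- A one-parameter paraproduct system: an averaging kernel, two cancellative kernels, and a
finite set of scales. -/
structure Sys where
  phi : ℝ → ℂ
  psi : ℝ → ℂ
  psi' : ℝ → ℂ
  K : Finset ℤ

variable {X Y : Sys} {σ : ℤ → ℤ → ℂ} {κ : ℤ → ℝ → ℝ → ℂ}

/-- Uniform kernel bounds and orthogonality for a system. -/
structure Sys.Ok (A : ℝ) (X : Sys) : Prop where
  phi : Ker A X.phi
  psi : Ker A X.psi
  psi' : Ker A X.psi'
  orth : Orth X.psi X.K
  orth' : Orth X.psi' X.K

/-- The product of the two analysis components of the biparameter paraproduct. -/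
def mid (X Y : Sys) (σ : ℤ → ℤ → ℂ) (f g : ℝ → ℝ → ℂ) (k l : ℤ) : ℝ → ℝ → ℂ :=
  fun a b => σ k l * (ana X.phi Y.phi k l f a b * ana X.psi Y.psi k l g a b)

/-- The sampled biparameter paraproduct attached to two systems. -/
def TT (X Y : Sys) (σ : ℤ → ℤ → ℂ) (f g : ℝ → ℝ → ℂ) : ℝ → ℝ → ℂ :=
  fun x y => ∑ k ∈ X.K, ∑ l ∈ Y.K, syn X.psi' Y.psi' k l (mid X Y σ f g k l) x y

lemma Dec2.mid (hX : X.Ok A) (hY : Y.Ok A) (σ : ℤ → ℤ → ℂ) (hf : Dec2 f) (hg : Dec2 g) (k l : ℤ) :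
    Dec2 (mid X Y σ f g k l) :=
  ((hf.ana hX.phi hY.phi k l).mul (hg.ana hX.psi hY.psi k l)).const_mul _

lemma Dec2.TT (hX : X.Ok A) (hY : Y.Ok A) (σ : ℤ → ℤ → ℂ) (hf : Dec2 f) (hg : Dec2 g) :
    Dec2 (TT X Y σ f g) :=
  Dec2.sum _ fun k _ => Dec2.sum _ fun l _ => (Dec2.mid hX hY σ hf hg k l).syn hX.psi' hY.psi' k l

lemma pair2_TT (hX : X.Ok A) (hY : Y.Ok A) (σ : ℤ → ℤ → ℂ) (hf : Dec2 f) (hg : Dec2 g)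
    (hH : Dec2 H) : pair2 H (TT X Y σ f g) = ∑ k ∈ X.K, ∑ l ∈ Y.K,
      pair2 (ana (cnj (refl X.psi')) (cnj (refl Y.psi')) k l H) (mid X Y σ f g k l) := by
  have hm := fun k l => Dec2.mid hX hY σ hf hg k l
  have hs := fun k l => (hm k l).syn hX.psi' hY.psi' k l
  unfold TT
  rw [pair2_sum _ hH fun k _ => Dec2.sum _ fun l _ => hs k l]
  refine sum_congr rfl fun k _ => ?_
  rw [pair2_sum _ hH fun l _ => hs k l]
  exact sum_congr rfl fun l _ => pair2_syn hX.psi' hY.psi' k l hH (hm k l)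

/-- An estimate for `TT` holds for all admissible data, with one constant. -/
abbrev Unif (A : ℝ) (P : ℝ≥0 → Sys → Sys → (ℤ → ℤ → ℂ) → (ℝ → ℝ → ℂ) → (ℝ → ℝ → ℂ) → Prop) : Prop :=
  ∃ C, ∀ {X Y : Sys}, X.Ok A → Y.Ok A → ∀ {σ : ℤ → ℤ → ℂ}, (∀ k l, ‖σ k l‖ ≤ 1) →
    ∀ {f g : ℝ → ℝ → ℂ}, Dec2 f → Dec2 g → P C X Y σ f g

section LqNorm

variable {X : Type*} [MeasurableSpace X] {μ : Measure X}

lemma LqNorm_top (F : X → ℝ≥0∞) : LqNorm μ ∞ F = essSup F μ := if_pos rfl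

lemma LqNorm_of_ne_top (ht : t ≠ ∞) (F : X → ℝ≥0∞) :
    LqNorm μ t F = (∫⁻ x, F x ^ t.toReal ∂μ) ^ (1 / t.toReal) := if_neg ht

lemma LqNorm_rpow (h0 : t ≠ 0) (ht : t ≠ ∞) (F : X → ℝ≥0∞) :
    LqNorm μ t F ^ t.toReal = ∫⁻ x, F x ^ t.toReal ∂μ := by
  rw [LqNorm_of_ne_top ht, ← rpow_mul,
    one_div_mul_cancel (toReal_pos h0 ht).ne', rpow_one]

lemma LqNorm_ofReal {t : ℝ} (ht : 0 < t) (F : X → ℝ≥0∞) :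
    LqNorm μ (ofReal t) F = (∫⁻ x, F x ^ t ∂μ) ^ (1 / t) := by
  rw [LqNorm_of_ne_top ofReal_ne_top, toReal_ofReal ht.le]

lemma LqNorm_one (F : X → ℝ≥0∞) : LqNorm μ 1 F = ∫⁻ x, F x ∂μ := by
  rw [LqNorm_of_ne_top one_ne_top]
  simp

lemma LqNorm_mono_ae {F G : X → ℝ≥0∞} (h : ∀ᵐ x ∂μ, F x ≤ G x) : LqNorm μ t F ≤ LqNorm μ t G := by
  by_cases ht : t = ∞
  · subst ht
    rw [LqNorm_top, LqNorm_top]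
    exact essSup_mono_ae h
  · rw [LqNorm_of_ne_top ht, LqNorm_of_ne_top ht]
    refine rpow_le_rpow (lintegral_mono_ae ?_) (by positivity)
    filter_upwards [h] with x hx
    exact rpow_le_rpow hx toReal_nonneg

lemma LqNorm_mono {F G : X → ℝ≥0∞} (h : ∀ x, F x ≤ G x) : LqNorm μ t F ≤ LqNorm μ t G := LqNorm_mono_ae (.of_forall h)

lemma LqNorm_const_mul (h0 : t ≠ 0) {c : ℝ≥0∞} (hc : c ≠ ∞) (F : X → ℝ≥0∞) :
    LqNorm μ t (fun x => c * F x) = c * LqNorm μ t F := by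
  by_cases ht : t = ∞
  · subst ht
    rw [LqNorm_top, LqNorm_top, essSup_const_mul]
  · have hp := toReal_pos h0 ht
    rw [LqNorm_of_ne_top ht, LqNorm_of_ne_top ht]
    simp_rw [mul_rpow hp.le]
    rw [lint_const_mul (rpow_ne_top_of_nonneg hp.le hc),
      mul_rpow (by positivity), ← rpow_mul,
      mul_one_div_cancel hp.ne', rpow_one]

/-- A bound for integrals of powers, with a finite constant, as a bound for norms. -/
lemma LqNorm_le_of_lintegral (ht : t ≠ ∞) {F G : X → ℝ≥0∞} {C : ℝ≥0∞}
    (h : ∫⁻ x, F x ^ t.toReal ∂μ ≤ C * ∫⁻ x, G x ^ t.toReal ∂μ) :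
    LqNorm μ t F ≤ C ^ (1 / t.toReal) * LqNorm μ t G := by
  rw [LqNorm_of_ne_top ht, LqNorm_of_ne_top ht, ← mul_rpow (by positivity)]
  exact rpow_le_rpow h (by positivity)

lemma LqNorm_mul_le_top (hs0 : s ≠ 0) (hst : s ≠ ∞) {F G : X → ℝ≥0∞} (hG : AEMeasurable G μ) :
    LqNorm μ s (fun x => F x * G x) ≤ LqNorm μ ∞ F * LqNorm μ s G := by
  have hp := toReal_pos hs0 hst
  rw [LqNorm_top, LqNorm_of_ne_top hst, LqNorm_of_ne_top hst]
  have h1 : ∫⁻ x, (F x * G x) ^ s.toReal ∂μ ≤ ∫⁻ x, essSup F μ ^ s.toReal * G x ^ s.toReal ∂μ := by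
    refine lintegral_mono_ae ?_
    filter_upwards [ENNReal.ae_le_essSup F] with x hx
    rw [← mul_rpow hp.le]
    exact rpow_le_rpow (mul_le_mul' hx le_rfl) hp.le
  rw [lintegral_const_mul'' _ (hG.pow_const _)] at h1
  refine (rpow_le_rpow h1 (by positivity)).trans (le_of_eq ?_)
  rw [mul_rpow (by positivity), ← rpow_mul,
    mul_one_div_cancel hp.ne', rpow_one]

/-- The relation between exponents in Hölder's inequality, in terms of real numbers. -/
lemma holder_toReal (hs : s⁻¹ = p⁻¹ + q⁻¹) (hs0 : s ≠ 0) (hp : p ≠ ∞) (hq : q ≠ ∞) :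
    0 < p.toReal ∧ 0 < q.toReal ∧ 0 < s.toReal ∧ 1 / s.toReal = 1 / p.toReal + 1 / q.toReal := by
  have hsi : s⁻¹ ≠ ∞ := inv_ne_top.2 hs0
  have hpi : p⁻¹ ≠ ∞ := fun h => hsi (by rw [hs, h]; simp)
  have hqi : q⁻¹ ≠ ∞ := fun h => hsi (by rw [hs, h]; simp)
  have hs1 : s ≠ ∞ := by
    rintro rfl
    have : p⁻¹ = 0 := by
      have : p⁻¹ + q⁻¹ = 0 := by rw [← hs]; simp
      exact (add_eq_zero.1 this).1
    exact hp (ENNReal.inv_eq_zero.1 this)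
  refine ⟨toReal_pos (inv_ne_top.1 hpi) hp,
    toReal_pos (inv_ne_top.1 hqi) hq, toReal_pos hs0 hs1, ?_⟩
  rw [one_div, one_div, one_div, ← toReal_inv, ← toReal_inv, ← toReal_inv, hs, toReal_add hpi hqi]

/-- Hölder's inequality. -/
lemma LqNorm_mul_le (hs : s⁻¹ = p⁻¹ + q⁻¹) (hs0 : s ≠ 0) (hst : s ≠ ∞) {F G : X → ℝ≥0∞}
    (hF : AEMeasurable F μ) (hG : AEMeasurable G μ) :
    LqNorm μ s (fun x => F x * G x) ≤ LqNorm μ p F * LqNorm μ q G := by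
  by_cases hp : p = ∞
  · subst hp
    have hq : q = s := by simpa using hs.symm
    subst hq
    exact LqNorm_mul_le_top hs0 hst hG
  by_cases hq : q = ∞
  · subst hq
    have hp : p = s := by simpa using hs.symm
    subst hp
    simp_rw [mul_comm (F _)]
    rw [mul_comm]
    exact LqNorm_mul_le_top hs0 hst hF
  obtain ⟨h1, h2, h3, h4⟩ := holder_toReal hs hs0 hp hq
  rw [LqNorm_of_ne_top hst, LqNorm_of_ne_top hp, LqNorm_of_ne_top hq]
  refine lintegral_Lp_mul_le_Lq_mul_Lr h3 ?_ h4 μ hF hG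
  have : 1 / p.toReal < 1 / s.toReal := by
    rw [h4]
    have : 0 < 1 / q.toReal := by positivity
    linarith
  exact (one_div_lt_one_div h1 h3).1 this

end LqNorm

lemma measurable_avg3_param (k : ℤ) {h : ℝ → ℝ → ℝ≥0∞} (hh : Measurable (uncurry h)) :
    Measurable fun p : ℝ × ℝ => avg3 k (fun a => h a p.2) p.1 := by
  have h1 : Measurable fun p : ℤ × ℝ => ∫⁻ a in cell3 k p.1, h a p.2 := by
    refine measurable_from_prod_countable_right fun n => ?_
    exact Measurable.lintegral_prod_left' (μ := volume.restrict (cell3 k n)) hh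
  have h2 : Measurable fun p : ℝ × ℝ => (dix k p.1, p.2) :=
    ((measurable_dix k).comp measurable_fst).prodMk measurable_snd
  unfold avg3
  exact (h1.comp h2).const_mul _

lemma measurable_MM_param {h : ℝ → ℝ → ℝ≥0∞} (hh : Measurable (uncurry h)) :
    Measurable fun p : ℝ × ℝ => MM (fun a => h a p.2) p.1 :=
  Measurable.iSup fun k => measurable_avg3_param k hh

lemma measurable_slice {f : ℝ × ℝ → ℝ≥0∞} (hf : Measurable f) (x : ℝ) :
    Measurable fun b => f (x, b) := hf.comp measurable_prodMk_left

lemma measurable_MM_slice {h : ℝ → ℝ → ℝ≥0∞} (hh : Measurable (uncurry h)) (x : ℝ) :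
    Measurable fun b => MM (fun a => h a b) x :=
  measurable_slice (measurable_MM_param hh) x

/-- The iterated maximal function. -/
def M2 (h : ℝ → ℝ → ℝ≥0∞) (x y : ℝ) : ℝ≥0∞ := MM (fun b => MM (fun a => h a b) x) y

lemma measurable_M2 {h : ℝ → ℝ → ℝ≥0∞} (hh : Measurable (uncurry h)) :
    Measurable (fun z : ℝ × ℝ => M2 h z.1 z.2) := by
  have h1 : Measurable (uncurry fun b x => MM (fun a => h a b) x) := by
    have := (measurable_MM_param hh).comp measurable_swap
    exact this
  have h2 := (measurable_MM_param h1).comp measurable_swap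
  simp only [M2]
  exact h2

lemma lintegral_plane {F : ℝ → ℝ → ℝ≥0∞} (hF : Measurable fun z : ℝ × ℝ => F z.1 z.2) :
    ∫⁻ z : ℝ × ℝ, F z.1 z.2 = ∫⁻ x, ∫⁻ y, F x y :=
  lintegral_prod (μ := (volume : Measure ℝ)) (ν := volume) _ hF.aemeasurable

lemma lintegral_plane_symm {F : ℝ → ℝ → ℝ≥0∞} (hF : Measurable fun z : ℝ × ℝ => F z.1 z.2) :
    ∫⁻ z : ℝ × ℝ, F z.1 z.2 = ∫⁻ y, ∫⁻ x, F x y :=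
  lintegral_prod_symm (μ := (volume : Measure ℝ)) (ν := volume) _ hF.aemeasurable

/-- A one-variable bound applied in each of the two variables. -/
lemma lintegral_plane_le {F G H : ℝ → ℝ → ℝ≥0∞} (hF : Measurable fun z : ℝ × ℝ => F z.1 z.2)
    (hG : Measurable fun z : ℝ × ℝ => G z.1 z.2) (hH : Measurable fun z : ℝ × ℝ => H z.1 z.2)
    {C D : ℝ≥0} (h1 : ∀ x, ∫⁻ y, F x y ≤ C * ∫⁻ y, G x y) (h2 : ∀ y, ∫⁻ x, G x y ≤ D * ∫⁻ x, H x y)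
    : ∫⁻ z : ℝ × ℝ, F z.1 z.2 ≤ (C * D : ℝ≥0) * ∫⁻ z : ℝ × ℝ, H z.1 z.2 := by
  calc ∫⁻ z : ℝ × ℝ, F z.1 z.2 = ∫⁻ x, ∫⁻ y, F x y := lintegral_plane hF
    _ ≤ ∫⁻ x, C * ∫⁻ y, G x y := lintegral_mono h1
    _ = C * ∫⁻ z : ℝ × ℝ, G z.1 z.2 := by
        rw [lint_const_mul coe_ne_top, lintegral_plane hG]
    _ = C * ∫⁻ y, ∫⁻ x, G x y := by rw [lintegral_plane_symm hG]
    _ ≤ C * ∫⁻ y, D * ∫⁻ x, H x y := mul_mono (lintegral_mono h2)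
    _ = _ := by
        rw [lint_const_mul coe_ne_top, ← lintegral_plane_symm hH, coe_mul, mul_assoc]

lemma lintegral_M2_rpow_le {p : ℝ} (hp : 1 < p) : ∃ C : ℝ≥0, ∀ h : ℝ → ℝ → ℝ≥0∞,
    Measurable (uncurry h) → ∫⁻ z : ℝ × ℝ, M2 h z.1 z.2 ^ p ≤ C * ∫⁻ z : ℝ × ℝ, h z.1 z.2 ^ p := by
  obtain ⟨C, hC⟩ := lintegral_MM_rpow_le hp
  refine ⟨C * C, fun h hh => ?_⟩
  have hm : Measurable fun z : ℝ × ℝ => MM (fun a => h a z.2) z.1 := measurable_MM_param hh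
  exact lintegral_plane_le (F := fun x y => M2 h x y ^ p)
    (G := fun x b => MM (fun a => h a b) x ^ p) (H := fun x y => h x y ^ p)
    ((measurable_M2 hh).pow_const p) (hm.pow_const p) (hh.pow_const p)
    (fun x => hC (fun b => MM (fun a => h a b) x) (measurable_MM_slice hh x))
    (fun b => hC (fun a => h a b) (hh.comp measurable_prodMk_right))

lemma M2_le_essSup (h : ℝ → ℝ → ℝ≥0∞) (x y : ℝ) :
    M2 h x y ≤ 9 * essSup (fun z : ℝ × ℝ => h z.1 z.2) volume := by
  set c := essSup (fun z : ℝ × ℝ => h z.1 z.2) volume with hc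
  have h0 : ∀ᵐ z : ℝ × ℝ, h z.1 z.2 ≤ c := ENNReal.ae_le_essSup _
  have h1 : ∀ᵐ z : ℝ × ℝ ∂((volume : Measure ℝ).prod volume), h z.2 z.1 ≤ c :=
    (Measure.measurePreserving_swap (μ := (volume : Measure ℝ)) (ν := volume)).quasiMeasurePreserving.ae
      h0
  have h2 := Measure.ae_ae_of_ae_prod h1
  refine (MM_le_essSup _ y).trans ?_
  have h3 : essSup (fun b => MM (fun a => h a b) x) volume ≤ 3 * c := by
    refine essSup_le_of_ae_le _ ?_
    filter_upwards [h2] with b hb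
    exact (MM_le_essSup _ x).trans (mul_mono (essSup_le_of_ae_le _ hb))
  exact (mul_mono h3).trans (le_of_eq (by rw [← mul_assoc]; norm_num))

lemma LqNorm_M2_le (hp : 1 < p) : ∃ C : ℝ≥0, ∀ h : ℝ → ℝ → ℝ≥0∞,
    Measurable (uncurry h) → LqNorm volume p (fun z : ℝ × ℝ => M2 h z.1 z.2) ≤
      C * LqNorm volume p (fun z : ℝ × ℝ => h z.1 z.2) := by
  by_cases ht : p = ∞
  · subst ht
    refine ⟨9, fun h _ => ?_⟩
    rw [LqNorm_top, LqNorm_top]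
    exact essSup_le_of_ae_le _ (.of_forall fun z => M2_le_essSup h z.1 z.2)
  · have hp1 : 1 < p.toReal := by
      rw [← toReal_one]
      exact (toReal_lt_toReal one_ne_top ht).2 hp
    obtain ⟨C, hC⟩ := lintegral_M2_rpow_le hp1
    refine ⟨C ^ (1 / p.toReal), fun h hh => ?_⟩
    rw [coe_rpow_of_nonneg _ (by positivity)]
    exact LqNorm_le_of_lintegral ht (hC h hh)

lemma enorm_ana_le (hη : Ker A η) (hθ : Ker A θ) (k l : ℤ) (hF : Dec2 F) (x y : ℝ) :
    ‖ana η θ k l F x y‖ₑ ≤ (ofReal (2 ^ 20 * A) * 8) ^ 2 * M2 (fun a b => ‖F a b‖ₑ) x y := by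
  set c := ofReal (2 ^ 20 * A) with hc
  have hm := hF.measurable_enorm
  have h1 : ∀ b, ‖opx (kA η k) F x b‖ₑ ≤ c * 8 * MM (fun a => ‖F a b‖ₑ) x := fun b => by
    refine (hη.kA.enorm_op_le k _ x).trans ?_
    rw [mul_assoc]
    exact mul_mono (PP_le_MM (by norm_num) k (hm.comp measurable_prodMk_right) x)
  calc ‖ana η θ k l F x y‖ₑ ≤ c * PP 8 l (fun b => ‖opx (kA η k) F x b‖ₑ) y :=
        hθ.kA.enorm_op_le l _ y
    _ ≤ c * PP 8 l (fun b => c * 8 * MM (fun a => ‖F a b‖ₑ) x) y :=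
        mul_mono (PP_mono h1 y)
    _ = c * (c * 8 * PP 8 l (fun b => MM (fun a => ‖F a b‖ₑ) x) y) := by
        rw [PP_lintegral_const (by finiteness)]
    _ ≤ c * (c * 8 * (8 * M2 (fun a b => ‖F a b‖ₑ) x y)) :=
        mul_mono (mul_mono (PP_le_MM (by norm_num) l
          (measurable_MM_slice hm x) y))
    _ = _ := by ring

lemma lintegral_plane_le_swap {F G H : ℝ → ℝ → ℝ≥0∞} (hF : Measurable fun z : ℝ × ℝ => F z.1 z.2)
    (hG : Measurable fun z : ℝ × ℝ => G z.1 z.2) (hH : Measurable fun z : ℝ × ℝ => H z.1 z.2)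
    {C D : ℝ≥0} (h1 : ∀ y, ∫⁻ x, F x y ≤ C * ∫⁻ x, G x y) (h2 : ∀ x, ∫⁻ y, G x y ≤ D * ∫⁻ y, H x y)
    : ∫⁻ z : ℝ × ℝ, F z.1 z.2 ≤ (C * D : ℝ≥0) * ∫⁻ z : ℝ × ℝ, H z.1 z.2 := by
  have h := lintegral_plane_le (F := fun x y => F y x) (G := fun x y => G y x)
    (H := fun x y => H y x) (hF.comp measurable_swap) (hG.comp measurable_swap)
    (hH.comp measurable_swap) h1 h2
  rwa [lintegral_plane (F := fun x y => F y x) (hF.comp measurable_swap), ← lintegral_plane_symm hF,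
    lintegral_plane (F := fun x y => H y x) (hH.comp measurable_swap), ← lintegral_plane_symm hH] at h

/-- Scalar functions indexed by `K` as one function with values in a Hilbert space. -/
def vec (K : Finset ℤ) (v : ℤ → ℂ) : PiLp 2 (fun _ : K => ℂ) := ∑ k ∈ K, emb K k (v k)

lemma enorm_vec (K : Finset ℤ) (v : ℤ → ℂ) : ‖vec K v‖ₑ ^ (2 : ℝ) = ∑ k ∈ K, ‖v k‖ₑ ^ (2 : ℝ) := enorm_sum_emb (Finset.Subset.refl K) v

lemma Dec.vec {u : ℤ → ℝ → ℂ} (hu : ∀ k ∈ K, Dec (u k)) : Dec fun a => vec K fun k => u k a :=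
  Dec.sum K (u := fun k a => emb K k (u k a)) fun k hk => (hu k hk).clm (emb K k)

lemma op_vec (hκ : KerOp A κ) (l : ℤ) {u : ℤ → ℝ → ℂ} (hu : ∀ k ∈ K, Dec (u k)) (x : ℝ) :
    op (κ l) (fun a => vec K fun k => u k a) x = vec K fun k => op (κ l) (u k) x := by
  unfold vec
  rw [hκ.op_sum l K (u := fun k a => emb K k (u k a)) fun k hk => (hu k hk).clm (emb K k)]
  exact sum_congr rfl fun k hk => (clm_op hκ l (hu k hk) (emb K k) x).symm

lemma sum_vec (K L : Finset ℤ) (v : ℤ → ℤ → ℂ) :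
    ∑ l ∈ L, vec K (fun k => v k l) = vec K fun k => ∑ l ∈ L, v k l := by
  unfold vec
  rw [sum_comm]
  exact sum_congr rfl fun k _ => (map_sum (emb K k) _ _).symm

lemma measurable_sum_sq {ι : Type*} (s : Finset ι) {F : ι → ℝ → ℝ → ℂ} (hF : ∀ i, Dec2 (F i)) :
    Measurable fun z : ℝ × ℝ => ∑ i ∈ s, ‖F i z.1 z.2‖ₑ ^ (2 : ℝ) :=
  Finset.measurable_fun_sum s fun i _ => (hF i).measurable_enorm.pow_const 2

lemma measurable_sum_sum_sq (K L : Finset ℤ) {F : ℤ → ℤ → ℝ → ℝ → ℂ} (hF : ∀ k l, Dec2 (F k l)) :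
    Measurable fun z : ℝ × ℝ => ∑ k ∈ K, ∑ l ∈ L, ‖F k l z.1 z.2‖ₑ ^ (2 : ℝ) :=
  Finset.measurable_fun_sum K fun k _ => measurable_sum_sq L (hF k)

set_option maxHeartbeats 1000000 in
/-- The biparameter square function estimate. -/
lemma ana2_Lq {q : ℝ} (hq : 1 < q) (A : ℝ) : ∃ C : ℝ≥0, ∀ {η θ : ℝ → ℂ}, Ker A η → Ker A θ →
    ∀ {K L : Finset ℤ}, Orth η K → Orth θ L → ∀ {g : ℝ → ℝ → ℂ}, Dec2 g →
      ∫⁻ z : ℝ × ℝ, (∑ k ∈ K, ∑ l ∈ L, ‖ana η θ k l g z.1 z.2‖ₑ ^ (2 : ℝ)) ^ (q / 2) ≤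
        C * ∫⁻ z : ℝ × ℝ, ‖g z.1 z.2‖ₑ ^ q := by
  obtain ⟨C, hC⟩ := ana_Lq hq A
  refine ⟨C * C, fun {η θ} hη hθ {K L} hK hL {g} hg => ?_⟩
  have hx := fun k => hg.opx hη.kA k
  refine lintegral_plane_le
    (F := fun x y => (∑ k ∈ K, ∑ l ∈ L, ‖ana η θ k l g x y‖ₑ ^ (2 : ℝ)) ^ (q / 2))
    (G := fun x y => (∑ k ∈ K, ‖opx (kA η k) g x y‖ₑ ^ (2 : ℝ)) ^ (q / 2))
    (H := fun x y => ‖g x y‖ₑ ^ q)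
    ((measurable_sum_sum_sq K L fun k l => hg.ana hη hθ k l).pow_const _)
    ((measurable_sum_sq K hx).pow_const _) (hg.measurable_enorm.pow_const q) (fun x => ?_)
    (fun y => hC hη hK (hg.right y))
  have hd : ∀ k ∈ K, Dec (opx (kA η k) g x) := fun k _ => (hx k).left x
  have h := hC (E := PiLp 2 (fun _ : K => ℂ)) hθ hL (Dec.vec hd)
  have e1 : ∀ y, ∑ l ∈ L, ‖op (kA θ l) (fun b => vec K fun k => opx (kA η k) g x b) y‖ₑ ^ (2 : ℝ) =
      ∑ k ∈ K, ∑ l ∈ L, ‖ana η θ k l g x y‖ₑ ^ (2 : ℝ) := fun y => by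
    rw [sum_comm]
    refine sum_congr rfl fun l _ => ?_
    rw [op_vec hθ.kA l hd y, enorm_vec]
    rfl
  have e2 : ∀ y, ‖vec K fun k => opx (kA η k) g x y‖ₑ ^ q =
      (∑ k ∈ K, ‖opx (kA η k) g x y‖ₑ ^ (2 : ℝ)) ^ (q / 2) := fun y => by
    rw [enorm_rpow_eq, enorm_vec]
  simp_rw [e1, e2] at h
  exact h

set_option maxHeartbeats 1000000 in
/-- The biparameter synthesis estimate for small exponents. -/
lemma syn2_rpow_le {s : ℝ} (hs : 1 / 2 < s) (hs1 : s ≤ 1) (A : ℝ) : ∃ C : ℝ≥0,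
    ∀ {η θ : ℝ → ℂ}, Ker A η → Ker A θ → ∀ {K L : Finset ℤ}, Orth η K → Orth θ L →
      ∀ {W : ℤ → ℤ → ℝ → ℝ → ℂ}, (∀ k l, Dec2 (W k l)) → (∀ k l, CC k (W k l)) →
        (∀ k l x, CC l (W k l x)) →
        ∫⁻ z : ℝ × ℝ, ‖∑ k ∈ K, ∑ l ∈ L, syn η θ k l (W k l) z.1 z.2‖ₑ ^ s ≤
          C * ∫⁻ z : ℝ × ℝ, (∑ k ∈ K, ∑ l ∈ L, ‖W k l z.1 z.2‖ₑ ^ (2 : ℝ)) ^ (s / 2) := by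
  obtain ⟨C, hC⟩ := synth_rpow_le hs hs1 A
  refine ⟨C * C, fun {η θ} hη hθ {K L} hK hL {W} hW hWx hWy => ?_⟩
  have hy := fun k l => (hW k l).opy hθ.kS l
  have hys : ∀ k, Dec2 fun x y => ∑ l ∈ L, opy (kS θ l) (W k l) x y := fun k =>
    Dec2.sum L fun l _ => hy k l
  refine lintegral_plane_le_swap (F := fun x y => ‖∑ k ∈ K, ∑ l ∈ L, syn η θ k l (W k l) x y‖ₑ ^ s)
    (G := fun x y => (∑ k ∈ K, ‖∑ l ∈ L, opy (kS θ l) (W k l) x y‖ₑ ^ (2 : ℝ)) ^ (s / 2))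
    (H := fun x y => (∑ k ∈ K, ∑ l ∈ L, ‖W k l x y‖ₑ ^ (2 : ℝ)) ^ (s / 2))
    ((Dec2.sum K fun k _ => Dec2.sum L fun l _ =>
      (hW k l).syn hη hθ k l).measurable_enorm.pow_const s)
    ((measurable_sum_sq K hys).pow_const _)
    ((measurable_sum_sum_sq K L hW).pow_const _) (fun y => ?_) (fun x => ?_)
  · have h := hC hη hK (w := fun k a => ∑ l ∈ L, opy (kS θ l) (W k l) a y)
      (fun k _ => (hys k).right y) (fun k _ a b hab => by
        refine sum_congr rfl fun l _ => ?_
        simp only [opy, hWx k l a b hab])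
    have e1 : ∀ x, ∑ k ∈ K, op (kS η k) (fun a => ∑ l ∈ L, opy (kS θ l) (W k l) a y) x =
        ∑ k ∈ K, ∑ l ∈ L, syn η θ k l (W k l) x y := fun x => by
      refine sum_congr rfl fun k _ => ?_
      rw [hη.kS.op_sum k L (u := fun l a => opy (kS θ l) (W k l) a y) fun l _ => (hy k l).right y]
      rfl
    simp_rw [e1] at h
    exact h
  · have hd : ∀ l, ∀ k ∈ K, Dec (W k l x) := fun l k _ => (hW k l).left x
    have h := hC (E := PiLp 2 (fun _ : K => ℂ)) hθ hL
      (w := fun l b => vec K fun k => W k l x b) (fun l _ => Dec.vec (hd l)) (fun l _ a b hab => by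
        have : ∀ k, W k l x a = W k l x b := fun k => hWy k l x a b hab
        simp only [this])
    have e1 : ∀ y, ‖∑ l ∈ L, op (kS θ l) (fun b => vec K fun k => W k l x b) y‖ₑ ^ s =
        (∑ k ∈ K, ‖∑ l ∈ L, opy (kS θ l) (W k l) x y‖ₑ ^ (2 : ℝ)) ^ (s / 2) := fun y => by
      rw [sum_congr rfl fun l _ => op_vec hθ.kS l (hd l) y, sum_vec, enorm_rpow_eq, enorm_vec]
      rfl
    have e2 : ∀ y, ∑ l ∈ L, ‖vec K fun k => W k l x y‖ₑ ^ (2 : ℝ) =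
        ∑ k ∈ K, ∑ l ∈ L, ‖W k l x y‖ₑ ^ (2 : ℝ) := fun y => by
      rw [sum_comm]
      exact sum_congr rfl fun l _ => enorm_vec _ _
    simp_rw [e1, e2] at h
    exact h

/-- The mixed Lebesgue norm of the modulus of a function on the plane, with equal exponents. -/
def nrm2 (p : ℝ≥0∞) (F : ℝ → ℝ → ℂ) : ℝ≥0∞ :=
  LqNorm volume p fun z : ℝ × ℝ => ‖F z.1 z.2‖ₑ

lemma dec2_of_support {H : ℝ × ℝ → ℂ} (hm : StronglyMeasurable H) {n : ℕ}
    (hs : ∀ z ∉ Icc (-(n : ℝ)) n ×ˢ Icc (-(n : ℝ)) n, H z = 0) {C : ℝ} (hC : ∀ z, ‖H z‖ ≤ C) :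
    Dec2 (fun x y => H (x, y)) := by
  have hC0 : 0 ≤ C := (norm_nonneg _).trans (hC 0)
  refine ⟨hm, C * ((wt 2 n)⁻¹ * (wt 2 n)⁻¹), fun x y => ?_⟩
  have hn := wt_pos 2 n
  by_cases hz : ((x, y) : ℝ × ℝ) ∈ Icc (-(n : ℝ)) n ×ˢ Icc (-(n : ℝ)) n
  · obtain ⟨hx, hy⟩ := hz
    have h1 : ∀ t ∈ Icc (-(n : ℝ)) n, 1 ≤ (wt 2 n)⁻¹ * wt 2 t := fun t ht => by
      rw [inv_mul_eq_div, one_le_div hn]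
      refine wt_mono_abs 2 ?_
      rw [Nat.abs_cast]
      exact abs_le.2 ht
    calc ‖H (x, y)‖ ≤ C * 1 := by rw [mul_one]; exact hC _
      _ ≤ C * (((wt 2 n)⁻¹ * wt 2 x) * ((wt 2 n)⁻¹ * wt 2 y)) :=
          mul_le_mul_of_nonneg_left (one_le_mul_of_one_le_of_one_le (h1 x hx) (h1 y hy)) hC0
      _ = _ := by ring
  · show ‖H (x, y)‖ ≤ _
    rw [hs _ hz, norm_zero]
    have := wt_nonneg 2 x
    have := wt_nonneg 2 y
    positivity

lemma one_inv_eq_of_holder (hst : s ≠ ∞) {s' : ℝ} (h : s.toReal.HolderConjugate s') :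
    (1 : ℝ≥0∞)⁻¹ = s⁻¹ + (ofReal s')⁻¹ := by
  have h1 : s = ofReal s.toReal := (ofReal_toReal hst).symm
  have h2 := h.pos
  have h3 := h.symm.pos
  rw [h1, ← ofReal_inv_of_pos h2, ← ofReal_inv_of_pos h3,
    ← ofReal_add (by positivity) (by positivity), h.inv_add_inv_eq_one]
  simp

lemma nrm2_le_of_dual (hst : s ≠ ∞) {s' : ℝ} (h : s.toReal.HolderConjugate s') {V : ℝ → ℝ → ℂ}
    (hV : Dec2 V) {D : ℝ≥0∞} (hD : ∀ H, Dec2 H → ‖pair2 H V‖ₑ ≤ D * nrm2 (ofReal s') H) :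
    nrm2 s V ≤ D := by
  obtain ⟨M, -, hM⟩ := hV.bounded
  have hs' := h.symm.pos
  have hS : ∀ n : ℕ, MeasurableSet (Icc (-(n : ℝ)) n ×ˢ Icc (-(n : ℝ)) n) := fun n =>
    measurableSet_Icc.prod measurableSet_Icc
  have key := lintegral_rpow_le_of_dual (μ := (volume : Measure (ℝ × ℝ))) (E := ℂ) h hS
    (fun m n hmn => by
      have : (m : ℝ) ≤ n := by exact_mod_cast hmn
      exact Set.prod_mono (Set.Icc_subset_Icc (by linarith) this)
        (Set.Icc_subset_Icc (by linarith) this))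
    (by
      refine Set.eq_univ_of_forall fun z => mem_iUnion.2 ?_
      obtain ⟨n, hn⟩ := exists_nat_ge (max |z.1| |z.2|)
      exact ⟨n, abs_le.1 ((le_max_left _ _).trans hn), abs_le.1 ((le_max_right _ _).trans hn)⟩)
    (fun n => by
      have e : (volume : Measure (ℝ × ℝ)) = (volume : Measure ℝ).prod volume := rfl
      rw [e, Measure.prod_prod, Real.volume_Icc]
      finiteness)
    (V := fun z => V z.1 z.2) hV.1 (fun z => hM z.1 z.2) (D := D)
    (fun n H hH hs ⟨C, hC⟩ => by
      have := hD (fun x y => H (x, y)) (dec2_of_support hH hs hC)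
      rw [nrm2, LqNorm_ofReal hs'] at this
      exact this)
  rw [nrm2, LqNorm_of_ne_top hst]
  calc _ ≤ (D ^ s.toReal) ^ (1 / s.toReal) := rpow_le_rpow key (by have := h.pos; positivity)
    _ = D := by rw [← rpow_mul, mul_one_div_cancel h.pos.ne', rpow_one]

/-- The biparameter square function. -/
def sqf (η θ : ℝ → ℂ) (K L : Finset ℤ) (g : ℝ → ℝ → ℂ) (z : ℝ × ℝ) : ℝ≥0∞ :=
  (∑ k ∈ K, ∑ l ∈ L, ‖ana η θ k l g z.1 z.2‖ₑ ^ (2 : ℝ)) ^ (1 / 2 : ℝ)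

lemma measurable_sqf (hη : Ker A η) (hθ : Ker A θ) (K L : Finset ℤ) (hg : Dec2 g) :
    Measurable (sqf η θ K L g) :=
  (measurable_sum_sum_sq K L fun k l => hg.ana hη hθ k l).pow_const _

lemma one_lt_toReal (hq : 1 < q) (ht : q ≠ ∞) : 1 < q.toReal := by
  rw [← toReal_one]
  exact (toReal_lt_toReal one_ne_top ht).2 hq

lemma LqNorm_sqf_le (hq : 1 < q) (hqt : q ≠ ∞) (A : ℝ) : ∃ C : ℝ≥0,
    ∀ {η θ : ℝ → ℂ}, Ker A η → Ker A θ → ∀ {K L : Finset ℤ}, Orth η K → Orth θ L →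
      ∀ {g : ℝ → ℝ → ℂ}, Dec2 g → LqNorm volume q (sqf η θ K L g) ≤ C * nrm2 q g := by
  obtain ⟨C, hC⟩ := ana2_Lq (one_lt_toReal hq hqt) A
  refine ⟨C ^ (1 / q.toReal), fun {η θ} hη hθ {K L} hK hL {g} hg => ?_⟩
  rw [coe_rpow_of_nonneg _ (by positivity)]
  refine LqNorm_le_of_lintegral hqt ?_
  refine le_trans (le_of_eq ?_) (hC hη hθ hK hL hg)
  refine lintegral_congr fun z => ?_
  rw [sqf, ← rpow_mul]
  congr 1; ring

lemma nrm2_M2_le (hp : 1 < p) : ∃ C : ℝ≥0, ∀ f : ℝ → ℝ → ℂ, Dec2 f →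
    LqNorm volume p (fun z : ℝ × ℝ => M2 (fun a b => ‖f a b‖ₑ) z.1 z.2) ≤ C * nrm2 p f := by
  obtain ⟨C, hC⟩ := LqNorm_M2_le hp
  exact ⟨C, fun f hf => hC _ hf.measurable_enorm⟩

lemma enorm_mid_le (hX : X.Ok A) (hY : Y.Ok A) (hl : ∀ k l, ‖σ k l‖ ≤ 1) (hf : Dec2 f)
    (g : ℝ → ℝ → ℂ) (k l : ℤ) (x y : ℝ) :
    ‖mid X Y σ f g k l x y‖ₑ ≤ (ofReal (2 ^ 20 * A) * 8) ^ 2 *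
      M2 (fun a b => ‖f a b‖ₑ) x y * ‖ana X.psi Y.psi k l g x y‖ₑ := by
  rw [mid, enorm_mul, enorm_mul]
  have h1 : ‖σ k l‖ₑ ≤ 1 := by
    rw [← ofReal_norm]
    exact ofReal_le_one.2 (hl k l)
  calc _ ≤ 1 * (_ * _) := mul_le_mul' h1 (mul_le_mul' (enorm_ana_le hX.phi hY.phi k l hf x y) le_rfl)
    _ = _ := one_mul _

lemma cc_mid_left (X Y : Sys) (σ : ℤ → ℤ → ℂ) (f g : ℝ → ℝ → ℂ) (k l : ℤ) :
    CC k (mid X Y σ f g k l) := fun x x' h => by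
  funext y
  simp only [mid, ana, opy, opx, op, kA, zz_congr h]

lemma cc_mid_right (X Y : Sys) (σ : ℤ → ℤ → ℂ) (f g : ℝ → ℝ → ℂ) (k l : ℤ) (x : ℝ) :
    CC l (mid X Y σ f g k l x) := fun y y' h => by
  simp only [mid, ana, opy, op, kA, zz_congr h]

lemma half_lt_toReal (hs : s⁻¹ = p⁻¹ + q⁻¹) (hp : 1 < p) (hq : 1 < q) (hst : s ≠ ∞) :
    1 / 2 < s.toReal := by
  have hs0 : s ≠ 0 := by
    rintro rfl
    rw [ENNReal.inv_zero] at hs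
    rcases add_eq_top.1 hs.symm with h | h
    · exact (zero_lt_one.trans hp).ne' (inv_eq_top.1 h)
    · exact (zero_lt_one.trans hq).ne' (inv_eq_top.1 h)
  have h1 : s⁻¹ < 2 := by
    rw [hs, ← one_add_one_eq_two]
    exact ENNReal.add_lt_add (ENNReal.inv_lt_one.2 hp) (ENNReal.inv_lt_one.2 hq)
  have h2 : 2⁻¹ < s := by rwa [inv_lt_iff_inv_lt]
  have h3 := (toReal_lt_toReal (by simp) hst).2 h2
  simpa using h3

/-- The bound for small target exponents. -/
lemma diag_small (hs : s⁻¹ = p⁻¹ + q⁻¹) (hp : 1 < p) (hq : 1 < q) (hqt : q ≠ ∞) (hs1 : s ≤ 1)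
    (A : ℝ) : Unif A fun C X Y σ f g => nrm2 s (TT X Y σ f g) ≤ C * (nrm2 p f * nrm2 q g) := by
  have hst : s ≠ ∞ := (hs1.trans_lt one_lt_top).ne
  have hs2 := half_lt_toReal hs hp hq hst
  have hs0 : 0 < s.toReal := by linarith
  have hs0' : s ≠ 0 := by rintro rfl; simp at hs0
  have hs3 : s.toReal ≤ 1 := by
    rw [← toReal_one]
    exact toReal_mono one_ne_top hs1
  obtain ⟨C₁, h₁⟩ := syn2_rpow_le hs2 hs3 A
  obtain ⟨C₂, h₂⟩ := nrm2_M2_le hp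
  obtain ⟨C₃, h₃⟩ := LqNorm_sqf_le hq hqt A
  set c : ℝ≥0 := (Real.toNNReal (2 ^ 20 * A) * 8) ^ 2 with hc
  refine ⟨C₁ ^ (1 / s.toReal) * (c * (C₂ * C₃)), fun {X Y} hX hY {σ} hl {f g} hf hg => ?_⟩
  have e1 : nrm2 s (TT X Y σ f g) ≤ (C₁ : ℝ≥0∞) ^ (1 / s.toReal) *
      LqNorm volume s (fun z : ℝ × ℝ => c * (M2 (fun a b => ‖f a b‖ₑ) z.1 z.2 *
        sqf X.psi Y.psi X.K Y.K g z)) := by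
    refine LqNorm_le_of_lintegral hst ?_
    refine (h₁ hX.psi' hY.psi' hX.orth' hY.orth' (Dec2.mid hX hY σ hf hg)
      (cc_mid_left X Y σ f g) (cc_mid_right X Y σ f g)).trans ?_
    refine mul_mono (lintegral_mono fun z => ?_)
    have e2 : s.toReal / 2 = 1 / 2 * s.toReal := by ring
    simp only
    rw [e2, rpow_mul]
    refine rpow_le_rpow ?_ hs0.le
    set m := (c : ℝ≥0∞) * M2 (fun a b => ‖f a b‖ₑ) z.1 z.2 with hm
    calc (∑ k ∈ X.K, ∑ l ∈ Y.K, ‖mid X Y σ f g k l z.1 z.2‖ₑ ^ (2 : ℝ)) ^ (1 / 2 : ℝ)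
        ≤ (∑ k ∈ X.K, ∑ l ∈ Y.K,
            m ^ (2 : ℝ) * ‖ana X.psi Y.psi k l g z.1 z.2‖ₑ ^ (2 : ℝ)) ^ (1 / 2 : ℝ) := by
          refine rpow_le_rpow (sum_le_sum fun k _ => sum_le_sum fun l _ => ?_) (by norm_num)
          rw [← mul_rpow (by norm_num)]
          exact rpow_le_rpow (enorm_mid_le hX hY hl hf g k l z.1 z.2) (by norm_num)
      _ = m * sqf X.psi Y.psi X.K Y.K g z := by
          simp_rw [← mul_sum]
          rw [mul_rpow (by norm_num), ← rpow_mul, sqf]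
          norm_num
      _ = _ := mul_assoc _ _ _
  refine e1.trans ?_
  rw [LqNorm_const_mul hs0' coe_ne_top, coe_mul, coe_rpow_of_nonneg _ (by positivity), mul_assoc]
  refine mul_mono ?_
  rw [coe_mul, mul_assoc]
  refine mul_mono ?_
  refine (LqNorm_mul_le hs hs0' hst (measurable_M2 hf.measurable_enorm).aemeasurable
    (measurable_sqf hX.psi hY.psi X.K Y.K hg).aemeasurable).trans ?_
  refine (mul_le_mul' (h₂ f hf) (h₃ hX.psi hY.psi hX.orth hY.orth hg)).trans (le_of_eq ?_)
  rw [coe_mul]; ring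

lemma sum_sum_mul_le_sqf (K L : Finset ℤ) (u v : ℤ → ℤ → ℝ≥0∞) :
    ∑ k ∈ K, ∑ l ∈ L, u k l * v k l ≤ (∑ k ∈ K, ∑ l ∈ L, u k l ^ (2 : ℝ)) ^ (1 / 2 : ℝ) *
      (∑ k ∈ K, ∑ l ∈ L, v k l ^ (2 : ℝ)) ^ (1 / 2 : ℝ) := by
  have h := inner_le_Lp_mul_Lq (K ×ˢ L) (fun i => u i.1 i.2) (fun i => v i.1 i.2)
    (p := 2) (q := 2) Real.HolderConjugate.two_two
  simpa only [Finset.sum_product] using h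

lemma enorm_pair2_le (H F : ℝ → ℝ → ℂ) :
    ‖pair2 H F‖ₑ ≤ ∫⁻ z : ℝ × ℝ, ‖H z.1 z.2‖ₑ * ‖F z.1 z.2‖ₑ := by
  refine (enorm_integral_le_lintegral_enorm _).trans (lintegral_mono fun z => ?_)
  rw [← enorm_mul, ← ofReal_norm, ← ofReal_norm, norm_mul]
  exact ofReal_le_ofReal (norm_inner_le_norm _ _)

lemma exists_holder (h : 1 < s) (ht : s ≠ ∞) : ∃ r, s.toReal.HolderConjugate r ∧ 1 < ofReal r := by
  have hc := Real.HolderConjugate.conjExponent (one_lt_toReal h ht)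
  exact ⟨_, hc, one_lt_ofReal.2 hc.symm.lt⟩

lemma diag_dual (hs : s⁻¹ = p⁻¹ + q⁻¹) (hp : 1 < p) (hq : 1 < q) (hqt : q ≠ ∞) (hs1 : 1 < s)
    (hst : s ≠ ∞) (A : ℝ) : Unif A fun C X Y σ f g =>
    nrm2 s (TT X Y σ f g) ≤ C * (nrm2 p f * nrm2 q g) := by
  obtain ⟨s', hc, hs'1⟩ := exists_holder hs1 hst
  obtain ⟨C₂, h₂⟩ := nrm2_M2_le hp
  obtain ⟨C₃, h₃⟩ := LqNorm_sqf_le hq hqt A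
  obtain ⟨C₄, h₄⟩ := LqNorm_sqf_le hs'1 ofReal_ne_top A
  set c : ℝ≥0 := (Real.toNNReal (2 ^ 20 * A) * 8) ^ 2 with hcc
  refine ⟨c * (C₂ * C₃ * C₄), fun {X Y} hX hY {σ} hl {f g} hf hg => ?_⟩
  refine nrm2_le_of_dual hst hc (hf.TT hX hY σ hg) fun H hH => ?_
  set F : ℝ × ℝ → ℝ≥0∞ := fun z => M2 (fun a b => ‖f a b‖ₑ) z.1 z.2 with hF
  set G := sqf X.psi Y.psi X.K Y.K g with hG
  set S := sqf (cnj (refl X.psi')) (cnj (refl Y.psi')) X.K Y.K H with hS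
  have mF : Measurable F := measurable_M2 hf.measurable_enorm
  have mG : Measurable G := measurable_sqf hX.psi hY.psi _ _ hg
  have mS : Measurable S := measurable_sqf hX.psi'.refl.cnj hY.psi'.refl.cnj _ _ hH
  have e1 : ‖pair2 H (TT X Y σ f g)‖ₑ ≤ c * ∫⁻ z, F z * G z * S z := by
    rw [pair2_TT hX hY σ hf hg hH]
    calc _ ≤ ∑ k ∈ X.K, ∑ l ∈ Y.K, ∫⁻ z : ℝ × ℝ,
          ‖ana (cnj (refl X.psi')) (cnj (refl Y.psi')) k l H z.1 z.2‖ₑ *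
            ‖mid X Y σ f g k l z.1 z.2‖ₑ :=
          (enorm_sum_le _ _).trans (sum_le_sum fun k _ =>
            (enorm_sum_le _ _).trans (sum_le_sum fun l _ => enorm_pair2_le _ _))
      _ = ∫⁻ z : ℝ × ℝ, ∑ k ∈ X.K, ∑ l ∈ Y.K,
          ‖ana (cnj (refl X.psi')) (cnj (refl Y.psi')) k l H z.1 z.2‖ₑ *
            ‖mid X Y σ f g k l z.1 z.2‖ₑ := by
          have hm : ∀ k l, Measurable fun z : ℝ × ℝ =>
              ‖ana (cnj (refl X.psi')) (cnj (refl Y.psi')) k l H z.1 z.2‖ₑ *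
                ‖mid X Y σ f g k l z.1 z.2‖ₑ := fun k l =>
            (hH.ana hX.psi'.refl.cnj hY.psi'.refl.cnj k l).measurable_enorm.mul
              (Dec2.mid hX hY σ hf hg k l).measurable_enorm
          rw [lintegral_finsetSum _ fun k _ => measurable_sum _ fun l _ => hm k l]
          exact sum_congr rfl fun k _ => (lintegral_finsetSum _ fun l _ => hm k l).symm
      _ ≤ ∫⁻ z, c * (F z * G z * S z) := by
          refine lintegral_mono fun z => ?_
          calc _ ≤ ∑ k ∈ X.K, ∑ l ∈ Y.K, (c * F z) *
                (‖ana X.psi Y.psi k l g z.1 z.2‖ₑ *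
                  ‖ana (cnj (refl X.psi')) (cnj (refl Y.psi')) k l H z.1 z.2‖ₑ) := by
                refine sum_le_sum fun k _ => sum_le_sum fun l _ => ?_
                rw [mul_comm, ← mul_assoc]
                exact mul_le_mul' (enorm_mid_le hX hY hl hf g k l z.1 z.2) le_rfl
            _ = c * F z * ∑ k ∈ X.K, ∑ l ∈ Y.K, (‖ana X.psi Y.psi k l g z.1 z.2‖ₑ *
                  ‖ana (cnj (refl X.psi')) (cnj (refl Y.psi')) k l H z.1 z.2‖ₑ) := by
                simp_rw [mul_sum]
            _ ≤ c * F z * (G z * S z) := mul_mono (sum_sum_mul_le_sqf _ _ _ _)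
            _ = _ := by ring
      _ = _ := lintegral_const_mul _ ((mF.mul mG).mul mS)
  refine e1.trans ?_
  have e2 : ∫⁻ z, F z * G z * S z ≤ LqNorm volume s (fun z => F z * G z) *
      LqNorm volume (ofReal s') S := by
    rw [← LqNorm_one]
    exact LqNorm_mul_le (one_inv_eq_of_holder hst hc) one_ne_zero one_ne_top
      (mF.mul mG).aemeasurable mS.aemeasurable
  have hs0 : s ≠ 0 := (zero_lt_one.trans hs1).ne'
  have e3 := LqNorm_mul_le (μ := volume) hs hs0 hst mF.aemeasurable mG.aemeasurable
  calc (c : ℝ≥0∞) * ∫⁻ z, F z * G z * S z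
      ≤ c * (((C₂ * nrm2 p f) * (C₃ * nrm2 q g)) * (C₄ * nrm2 (ofReal s') H)) := by
        refine mul_mono (e2.trans (mul_le_mul' (e3.trans ?_) ?_))
        · exact mul_le_mul' (h₂ f hf) (h₃ hX.psi hY.psi hX.orth hY.orth hg)
        · exact h₄ hX.psi'.refl.cnj hY.psi'.refl.cnj hX.orth'.refl.cnj hY.orth'.refl.cnj hH
    _ = _ := by push_cast; ring

lemma cnj_refl_cnj_refl (η : ℝ → ℂ) : cnj (refl (cnj (refl η))) = η := by
  funext x
  simp [cnj, refl]

/-- The system of the transposed operator. -/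
def Sys.adj (X : Sys) : Sys := ⟨cnj X.phi, cnj (refl X.psi'), cnj (refl X.psi), X.K⟩

lemma Sys.Ok.adj (h : X.Ok A) : X.adj.Ok A :=
  ⟨h.phi.cnj, h.psi'.refl.cnj, h.psi.refl.cnj, h.orth'.refl.cnj, h.orth.refl.cnj⟩

lemma op_conj (η : ℝ → ℂ) (k : ℤ) (u : ℝ → ℂ) (x : ℝ) :
    op (kA (cnj η) k) (fun a => conj (u a)) x = conj (op (kA η k) u x) := by
  unfold op
  rw [← integral_conj]
  refine int_congr fun a => ?_
  simp [kA, dil_cnj]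

lemma ana_conj (η θ : ℝ → ℂ) (k l : ℤ) (f : ℝ → ℝ → ℂ) (x y : ℝ) :
    ana (cnj η) (cnj θ) k l (fun a b => conj (f a b)) x y = conj (ana η θ k l f x y) := by
  have e : opx (kA (cnj η) k) (fun a b => conj (f a b)) =
      fun a b => conj (opx (kA η k) f a b) := by
    funext a b
    exact op_conj η k (fun a => f a b) a
  show op (kA (cnj θ) l) (opx (kA (cnj η) k) (fun a b => conj (f a b)) x) y = _
  rw [e]
  exact op_conj θ l _ y

lemma pair2_TT_adj (hX : X.Ok A) (hY : Y.Ok A) (σ : ℤ → ℤ → ℂ) (hf : Dec2 f) (hg : Dec2 g)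
    (hH : Dec2 H) : pair2 H (TT X Y σ f g) = conj (pair2 g (TT X.adj Y.adj
      (fun k l => conj (σ k l)) (fun a b => conj (f a b)) H)) := by
  rw [pair2_TT hX hY σ hf hg hH, pair2_TT hX.adj hY.adj _ hf.conj hH hg, map_sum]
  refine sum_congr rfl fun k _ => ?_
  rw [map_sum]
  refine sum_congr rfl fun l _ => ?_
  simp only [Sys.adj, cnj_refl_cnj_refl]
  unfold pair2
  rw [← integral_conj]
  refine int_congr fun z => ?_
  simp only [mid, ana_conj, RCLike.inner_apply, map_mul, Complex.conj_conj]
  ring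

lemma nrm2_conj (p : ℝ≥0∞) (f : ℝ → ℝ → ℂ) : nrm2 p (fun a b => conj (f a b)) = nrm2 p f := by
  simp [nrm2]

lemma diag_top (hs1 : 1 < s) (hst : s ≠ ∞) (A : ℝ) : Unif A fun C X Y σ f g =>
    nrm2 s (TT X Y σ f g) ≤ C * (nrm2 s f * nrm2 ∞ g) := by
  obtain ⟨s', hc, hs'1⟩ := exists_holder hs1 hst
  obtain ⟨C, hC⟩ := diag_small (one_inv_eq_of_holder hst hc) hs1 hs'1 ofReal_ne_top le_rfl A
  refine ⟨C, fun {X Y} hX hY {σ} hl {f g} hf hg => ?_⟩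
  refine nrm2_le_of_dual hst hc (hf.TT hX hY σ hg) fun H hH => ?_
  rw [pair2_TT_adj hX hY σ hf hg hH, RCLike.enorm_conj]
  refine (enorm_pair2_le _ _).trans ?_
  have hT := hf.conj.TT hX.adj hY.adj (fun k l => conj (σ k l)) hH
  have e1 := hC hX.adj hY.adj (σ := fun k l => conj (σ k l))
    (fun k l => by rw [RCLike.norm_conj]; exact hl k l) hf.conj hH
  have e2 := LqNorm_mul_le_top (μ := volume) one_ne_zero one_ne_top
    (F := fun z : ℝ × ℝ => ‖g z.1 z.2‖ₑ) hT.measurable_enorm.aemeasurable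
  rw [LqNorm_one] at e2
  refine e2.trans ?_
  simp only [nrm2_conj] at e1
  calc _ ≤ nrm2 ∞ g * (C * (nrm2 s f * nrm2 (ofReal s') H)) := mul_mono e1
    _ = _ := by ring

/-- The unmixed bound for the discretised biparameter paraproduct. -/
lemma diag (hs : s⁻¹ = p⁻¹ + q⁻¹) (hp : 1 < p) (hq : 1 < q) (hst : s ≠ ∞) (A : ℝ) : Unif A fun C X Y σ f g =>
    nrm2 s (TT X Y σ f g) ≤ C * (nrm2 p f * nrm2 q g) := by
  by_cases hqt : q = ∞
  · subst hqt
    rw [inv_top, add_zero, _root_.inv_inj] at hs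
    subst hs
    exact diag_top hp hst A
  · rcases le_or_gt s 1 with h | h
    · exact diag_small hs hp hq hqt h A
    · exact diag_dual hs hp hq hqt h hst A

lemma abs_wt_sub_le {x' : ℝ} (h : |x - x'| ≤ 1) :
    |wt 16 x - wt 16 x'| ≤ 2 ^ 19 * |x - x'| * wt 16 x := by
  have ha : (1 : ℝ) ≤ 1 + |x| := by linarith [abs_nonneg x]
  have hb : (1 : ℝ) ≤ 1 + |x'| := by linarith [abs_nonneg x']
  have hab : |(1 + |x'|) - (1 + |x|)| ≤ |x - x'| := by
    rw [abs_sub_comm x x']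
    have := abs_abs_sub_abs_le_abs_sub x' x
    simpa using this
  set a := 1 + |x|
  set b := 1 + |x'|
  have hmax : max |b| |a| ≤ 2 * b := by
    rw [abs_of_pos (by linarith), abs_of_pos (by linarith)]
    refine max_le (by linarith) ?_
    have := (abs_le.1 (hab.trans h)).1
    linarith
  have h1 : |b ^ 16 - a ^ 16| ≤ |x - x'| * 16 * (2 * b) ^ 15 := by
    refine (abs_pow_sub_pow_le b a 16).trans ?_
    push_cast
    gcongr
  have ha0 : (0 : ℝ) < a ^ 16 := by positivity
  have hb0 : (0 : ℝ) < b ^ 16 := by positivity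
  have e : wt 16 x - wt 16 x' = (b ^ 16 - a ^ 16) / (a ^ 16 * b ^ 16) := by
    show (a ^ 16)⁻¹ - (b ^ 16)⁻¹ = _
    field_simp
  rw [e, abs_div, abs_of_pos (mul_pos ha0 hb0)]
  show _ ≤ 2 ^ 19 * |x - x'| * (a ^ 16)⁻¹
  rw [div_le_iff₀ (mul_pos ha0 hb0)]
  have e2 : 2 ^ 19 * |x - x'| * (a ^ 16)⁻¹ * (a ^ 16 * b ^ 16) = 2 ^ 19 * |x - x'| * b ^ 16 := by
    field_simp
  rw [e2]
  refine h1.trans ?_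
  have : b ^ 15 ≤ b ^ 16 := pow_le_pow_right₀ hb (by norm_num)
  have h3 : |x - x'| * 16 * (2 * b) ^ 15 = 2 ^ 19 * |x - x'| * b ^ 15 := by ring
  rw [h3]
  gcongr

lemma ker_wt : Ker (2 ^ 19) fun x => (wt 16 x : ℂ) where
  meas := Complex.measurable_ofReal.comp (measurable_wt 16)
  size x := by
    rw [norm_real, norm_of_nonneg (wt_nonneg _ _)]
    have := wt_nonneg 16 x
    linarith
  lip x x' h := by
    rw [← Complex.ofReal_sub, norm_real]
    exact abs_wt_sub_le h

lemma dec_wt : Dec fun x => (wt 2 x : ℂ) :=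
  ⟨(Complex.measurable_ofReal.comp (measurable_wt 2)).stronglyMeasurable, 1, fun x => by
    rw [norm_real, norm_of_nonneg (wt_nonneg _ _), one_mul]⟩

/-- Real and strictly positive functions. -/
def Pos (u : ℝ → ℂ) : Prop := ∀ x, ∃ r : ℝ, 0 < r ∧ u x = r

lemma Pos.op (hκ : KerOp A κ) (k : ℤ) (hp : ∀ x, Pos (κ k x)) {u : ℝ → ℂ} (hu : Dec u) (hu' : Pos u)
    : Pos (op (κ k) u) := by
  intro x
  choose r hr hr' using hp x
  choose s hs hs' using hu'
  have e : ∀ a, κ k x a • u a = ((r a * s a : ℝ) : ℂ) := fun a => by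
    rw [hr', hs', smul_eq_mul, Complex.ofReal_mul]
  have hi : Integrable fun a => r a * s a := by
    have := (hκ.integrable k x hu).re
    refine this.congr (.of_forall fun a => ?_)
    simp only [e]
    simp
  refine ⟨∫ a, r a * s a, ?_, ?_⟩
  · rw [integral_pos_iff_support_of_nonneg (fun a => (mul_pos (hr a) (hs a)).le) hi]
    have : (Function.support fun a => r a * s a) = Set.univ :=
      Set.eq_univ_of_forall fun a => (mul_pos (hr a) (hs a)).ne'
    rw [this]
    simp
  · show ∫ a, κ k x a • u a = _
    refine Eq.trans (int_congr e) ?_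
    exact integral_ofReal

lemma Pos.mul {u v : ℝ → ℂ} (hu : Pos u) (hv : Pos v) : Pos fun x => u x * v x := fun x => by
  obtain ⟨r, hr, h1⟩ := hu x
  obtain ⟨s, hs, h2⟩ := hv x
  exact ⟨r * s, mul_pos hr hs, by show u x * v x = _; rw [h1, h2, Complex.ofReal_mul]⟩

/-- The discretised one parameter paraproduct. -/
def BB (Y : Sys) (μ : ℤ → ℂ) (u v : ℝ → ℂ) (y : ℝ) : ℂ :=
  ∑ l ∈ Y.K, op (kS Y.psi' l) (fun b => μ l * (op (kA Y.phi l) u b * op (kA Y.psi l) v b)) y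

lemma Dec.mul {u v : ℝ → ℂ} (hu : Dec u) (hv : Dec v) : Dec fun x => u x * v x := by
  obtain ⟨C, -, hC⟩ := hu.bounded
  exact hv.smul_bdd hu.1.measurable hC

lemma dec_BB_aux (hY : Y.Ok A) (μ : ℤ → ℂ) {u v : ℝ → ℂ} (hu : Dec u) (hv : Dec v) (l : ℤ) :
    Dec fun b => μ l * (op (kA Y.phi l) u b * op (kA Y.psi l) v b) :=
  ((hY.phi.kA.dec_op l hu).mul (hY.psi.kA.dec_op l hv)).const_smul (μ l)

lemma dec_BB (hY : Y.Ok A) (μ : ℤ → ℂ) {u v : ℝ → ℂ} (hu : Dec u) (hv : Dec v) : Dec (BB Y μ u v) :=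
  Dec.sum _ fun l _ => hY.psi'.kS.dec_op l (dec_BB_aux hY μ hu hv l)

/-- A one element system with positive kernels. -/
def posSys : Sys := ⟨fun x => wt 16 x, fun x => wt 16 x, fun x => wt 16 x, {0}⟩

lemma posSys_ok : posSys.Ok (2 ^ 19) :=
  ⟨ker_wt, ker_wt, ker_wt, by
    intro j hj k hk h
    simp only [posSys, Finset.mem_singleton] at hj hk
    simp [hj, hk] at h, by
    intro j hj k hk h
    simp only [posSys, Finset.mem_singleton] at hj hk
    simp [hj, hk] at h⟩

lemma Sys.Ok.mono {B : ℝ} (h : X.Ok A) (hAB : A ≤ B) : X.Ok B :=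
  ⟨h.phi.mono hAB, h.psi.mono hAB, h.psi'.mono hAB, h.orth, h.orth'⟩

lemma dec2_tens {u v : ℝ → ℂ} (hu : Dec u) (hv : Dec v) : Dec2 fun x y => u x * v y := by
  obtain ⟨hu1, C, hC⟩ := hu
  obtain ⟨hv1, D, hD⟩ := hv
  refine ⟨(hu1.comp_measurable measurable_fst).mul (hv1.comp_measurable measurable_snd), C * D,
    fun x y => ?_⟩
  rw [norm_mul]
  calc _ ≤ (C * wt 2 x) * (D * wt 2 y) :=
        mul_le_mul (hC x) (hD y) (norm_nonneg _) ((norm_nonneg _).trans (hC x))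
    _ = _ := by ring

lemma opx_tens (κ : ℝ → ℝ → ℂ) (u v : ℝ → ℂ) :
    opx κ (fun x y => u x * v y) = fun x y => op κ u x * v y := by
  funext x y
  simp only [opx, op, smul_eq_mul]
  rw [← integral_mul_const]
  exact int_congr fun a => by ring

lemma opy_tens (κ : ℝ → ℝ → ℂ) (u v : ℝ → ℂ) :
    opy κ (fun x y => u x * v y) = fun x y => u x * op κ v y := by
  funext x y
  simp only [opy, op, smul_eq_mul]
  rw [← integral_const_mul]
  exact int_congr fun a => by ring

def posPi : ℝ → ℂ := op (kS posSys.psi' 0) fun a =>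
  op (kA posSys.phi 0) (fun x => (wt 2 x : ℂ)) a * op (kA posSys.psi 0) (fun x => (wt 2 x : ℂ)) a

lemma kA_pos (k : ℤ) (x : ℝ) : Pos (kA (fun x => (wt 16 x : ℂ)) k x) := fun a =>
  ⟨2 ^ k * wt 16 (2 ^ k * (zz k x - a)), mul_pos (by positivity) (wt_pos _ _), by
    simp [kA, dil]⟩

lemma kS_pos (k : ℤ) (x : ℝ) : Pos (kS (fun x => (wt 16 x : ℂ)) k x) := fun a =>
  ⟨2 ^ k * wt 16 (2 ^ k * (x - zz k a)), mul_pos (by positivity) (wt_pos _ _), by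
    simp [kS, dil]⟩

lemma pos_wt : Pos fun x => (wt 2 x : ℂ) := fun x => ⟨wt 2 x, wt_pos _ _, rfl⟩

lemma dec_posPi_aux : Dec fun a => op (kA posSys.phi 0) (fun x => (wt 2 x : ℂ)) a *
      op (kA posSys.psi 0) (fun x => (wt 2 x : ℂ)) a :=
  (ker_wt.kA.dec_op 0 dec_wt).mul (ker_wt.kA.dec_op 0 dec_wt)

lemma dec_posPi : Dec posPi := ker_wt.kS.dec_op 0 dec_posPi_aux

lemma pos_posPi : Pos posPi :=
  Pos.op ker_wt.kS 0 (kS_pos 0) dec_posPi_aux ((Pos.op ker_wt.kA 0 (kA_pos 0) dec_wt pos_wt).mul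
      (Pos.op ker_wt.kA 0 (kA_pos 0) dec_wt pos_wt))

lemma TT_tens (Y : Sys) (μ : ℤ → ℂ) (u v : ℝ → ℂ) :
    TT posSys Y (fun _ l => μ l) (fun x y => (wt 2 x : ℂ) * u y) (fun x y => (wt 2 x : ℂ) * v y) =
      fun x y => posPi x * BB Y μ u v y := by
  funext x y
  have e : ∀ l, mid posSys Y (fun _ l => μ l) (fun x y => (wt 2 x : ℂ) * u y)
      (fun x y => (wt 2 x : ℂ) * v y) 0 l = fun a b =>
        (op (kA posSys.phi 0) (fun x => (wt 2 x : ℂ)) a *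
          op (kA posSys.psi 0) (fun x => (wt 2 x : ℂ)) a) *
        (μ l * (op (kA Y.phi l) u b * op (kA Y.psi l) v b)) := fun l => by
    funext a b
    unfold mid ana
    rw [opx_tens, opx_tens, opy_tens, opy_tens]
    ring
  unfold TT
  have hK : posSys.K = {0} := rfl
  rw [hK, Finset.sum_singleton, BB, mul_sum]
  refine sum_congr rfl fun l _ => ?_
  rw [e, syn, opy_tens, opx_tens, posPi]

lemma LqNorm_tens_le (hp : 1 < p) : ∃ C : ℝ≥0, ∀ u : ℝ → ℂ, Dec u →
    nrm2 p (fun x y => (wt 2 x : ℂ) * u y) ≤ C * LqNorm volume p fun y => ‖u y‖ₑ := by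
  have h1 : ∀ x, ‖(wt 2 x : ℂ)‖ₑ = ofReal (wt 2 x) := fun x => by
    rw [← ofReal_norm, norm_real, norm_of_nonneg (wt_nonneg _ _)]
  by_cases hpt : p = ∞
  · subst hpt
    refine ⟨1, fun u hu => ?_⟩
    rw [nrm2, LqNorm_top, LqNorm_top, coe_one, one_mul]
    refine essSup_le_of_ae_le _ ?_
    have h2 : ∀ᵐ z : ℝ × ℝ, ‖u z.2‖ₑ ≤ essSup (fun y => ‖u y‖ₑ) volume :=
      (Measure.quasiMeasurePreserving_snd (μ := (volume : Measure ℝ))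
        (ν := (volume : Measure ℝ))).ae (ENNReal.ae_le_essSup _)
    filter_upwards [h2] with z hz
    rw [enorm_mul, h1]
    refine (mul_le_mul' (ofReal_le_one.2 (wt_le_one _ _)) hz).trans (one_mul _).le
  · have hp1 := one_lt_toReal hp hpt
    have hI : ∫⁻ x, ofReal (wt 2 x) ^ p.toReal ≠ ∞ := by
      have h3 : ∫⁻ x, ofReal (wt 2 x) ≠ ∞ := by
        have := (integrable_wt (le_refl 2)).lintegral_lt_top
        exact this.ne
      refine ne_top_of_le_ne_top h3 (lintegral_mono fun x => ?_)
      calc _ ≤ ofReal (wt 2 x) ^ (1 : ℝ) :=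
            rpow_le_rpow_of_exponent_ge (ofReal_le_one.2 (wt_le_one _ _)) hp1.le
        _ = _ := rpow_one _
    refine ⟨(∫⁻ x, ofReal (wt 2 x) ^ p.toReal).toNNReal ^ (1 / p.toReal), fun u hu => ?_⟩
    rw [nrm2, LqNorm_of_ne_top hpt, LqNorm_of_ne_top hpt,
      coe_rpow_of_nonneg _ (by positivity), coe_toNNReal hI,
      ← mul_rpow (by positivity)]
    refine rpow_le_rpow (le_of_eq ?_) (by positivity)
    rw [← lintegral_prod_mul ((measurable_wt 2).ennreal_ofReal.pow_const _).aemeasurable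
      (hu.measurable_enorm.pow_const _).aemeasurable]
    refine lintegral_congr fun z => ?_
    rw [enorm_mul, h1, mul_rpow (by positivity)]

lemma LqNorm_posPi_mul (hst : s ≠ ∞) {w : ℝ → ℂ} (hw : Dec w) : nrm2 s (fun x y => posPi x * w y) =
      LqNorm volume s (fun x => ‖posPi x‖ₑ) * LqNorm volume s fun y => ‖w y‖ₑ := by
  rw [nrm2, LqNorm_of_ne_top hst, LqNorm_of_ne_top hst, LqNorm_of_ne_top hst,
    ← mul_rpow (by positivity),
    ← lintegral_prod_mul (dec_posPi.measurable_enorm.pow_const _).aemeasurable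
      (hw.measurable_enorm.pow_const _).aemeasurable]
  congr 1
  refine lintegral_congr fun z => ?_
  rw [enorm_mul, mul_rpow (by positivity)]

lemma LqNorm_posPi_ne_zero (h0 : s ≠ 0) (hst : s ≠ ∞) :
    LqNorm volume s (fun x => ‖posPi x‖ₑ) ≠ 0 := by
  have hs := toReal_pos h0 hst
  intro h
  rw [LqNorm_of_ne_top hst, rpow_eq_zero_iff_of_pos (by positivity),
    lintegral_eq_zero_iff (dec_posPi.measurable_enorm.pow_const _)] at h
  obtain ⟨x, hx⟩ := h.exists
  simp only [Pi.zero_apply] at hx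
  rw [rpow_eq_zero_iff_of_pos hs, enorm_eq_zero] at hx
  obtain ⟨r, hr, h⟩ := pos_posPi x
  rw [h] at hx
  exact hr.ne' (by exact_mod_cast hx)

lemma BB_le (hs : s⁻¹ = p⁻¹ + q⁻¹) (hp : 1 < p) (hq : 1 < q) (hst : s ≠ ∞) (A : ℝ) :
    ∃ C : ℝ≥0, ∀ {Y : Sys}, Y.Ok A → ∀ {μ : ℤ → ℂ}, (∀ l, ‖μ l‖ ≤ 1) →
      ∀ {u v : ℝ → ℂ}, Dec u → Dec v → LqNorm volume s (fun y => ‖BB Y μ u v y‖ₑ) ≤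
        C * ((LqNorm volume p fun y => ‖u y‖ₑ) * LqNorm volume q fun y => ‖v y‖ₑ) := by
  have hs0 : s ≠ 0 := by
    have := half_lt_toReal hs hp hq hst
    rintro rfl
    norm_num at this
  obtain ⟨C, hC⟩ := diag hs hp hq hst (max A (2 ^ 19))
  obtain ⟨D, hD⟩ := LqNorm_tens_le hp
  obtain ⟨E, hE⟩ := LqNorm_tens_le hq
  set c := min (LqNorm volume s fun x => ‖posPi x‖ₑ) 1 with hc
  have hc0 : c ≠ 0 := by
    rw [hc]
    intro h
    rcases min_eq_iff.1 h with h | h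
    · exact LqNorm_posPi_ne_zero hs0 hst h.1
    · exact one_ne_zero h.1
  have hct : c ≠ ∞ := ne_top_of_le_ne_top one_ne_top (min_le_right _ _)
  refine ⟨(c⁻¹).toNNReal * (C * (D * E)), fun {Y} hY {μ} hμ {u v} hu hv => ?_⟩
  have e1 := hC (posSys_ok.mono (le_max_right A _)) (hY.mono (le_max_left _ _))
    (σ := fun _ l => μ l) (fun _ l => hμ l) (dec2_tens dec_wt hu) (dec2_tens dec_wt hv)
  simp only [TT_tens, LqNorm_posPi_mul hst (dec_BB hY μ hu hv)] at e1
  have e2 : c * LqNorm volume s (fun y => ‖BB Y μ u v y‖ₑ) ≤ C * ((D * LqNorm volume p fun y =>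
      ‖u y‖ₑ) * (E * LqNorm volume q fun y => ‖v y‖ₑ)) :=
    (mul_le_mul' (min_le_left _ _) le_rfl).trans
      (e1.trans (mul_mono (mul_le_mul' (hD u hu) (hE v hv))))
  calc LqNorm volume s (fun y => ‖BB Y μ u v y‖ₑ)
      = c⁻¹ * (c * LqNorm volume s (fun y => ‖BB Y μ u v y‖ₑ)) := by
        rw [← mul_assoc, ENNReal.inv_mul_cancel hc0 hct, one_mul]
    _ ≤ c⁻¹ * _ := mul_mono e2
    _ = _ := by
        push_cast
        rw [coe_toNNReal (inv_ne_top.2 hc0)]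
        ring

lemma lintegral_Lp_finset_sum_le {X : Type*} [MeasurableSpace X] {μ : Measure X} {ι : Type*}
    (S : Finset ι) {t : ℝ} (ht : 1 ≤ t) {w : ι → X → ℝ≥0∞} (hw : ∀ i, Measurable (w i)) :
    (∫⁻ y, (∑ i ∈ S, w i y) ^ t ∂μ) ^ (1 / t) ≤ ∑ i ∈ S, (∫⁻ y, w i y ^ t ∂μ) ^ (1 / t) := by
  classical
  have h0 : 0 < t := by linarith
  induction S using Finset.induction_on with
  | empty => simp [zero_rpow_of_pos h0, h0]
  | insert i S hi ih =>
    simp only [sum_insert hi]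
    refine le_trans ?_ (add_le_add_right ih _)
    exact lintegral_Lp_add_le (f := w i) (g := fun y => ∑ j ∈ S, w j y)
      (hw i).aemeasurable (measurable_sum S fun j _ => hw j).aemeasurable ht

lemma lintegral_Lp_tsum_le {X : Type*} [MeasurableSpace X] {μ : Measure X} {ι : Type*} [Countable ι]
    {t : ℝ} (ht : 1 ≤ t) {w : ι → X → ℝ≥0∞} (hw : ∀ i, Measurable (w i)) :
    (∫⁻ y, (∑' i, w i y) ^ t ∂μ) ^ (1 / t) ≤ ∑' i, (∫⁻ y, w i y ^ t ∂μ) ^ (1 / t) := by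
  classical
  have h0 : 0 < t := by linarith
  have e : ∀ y, (∑' i, w i y) ^ t = ⨆ S : Finset ι, (∑ i ∈ S, w i y) ^ t := fun y => by
    rw [ENNReal.tsum_eq_iSup_sum]
    exact (orderIsoRpow t h0).map_iSup _
  have hmono : Monotone fun (S : Finset ι) (y : X) => (∑ i ∈ S, w i y) ^ t := fun S S' h y =>
    rpow_le_rpow (Finset.sum_le_sum_of_subset h) h0.le
  simp only [e]
  rw [lintegral_iSup_directed (fun S => ((measurable_sum S fun j _ => hw j).pow_const
    t).aemeasurable) hmono.directed_le, ← le_rpow_inv_iff (by positivity)]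
  refine iSup_le fun S => ?_
  rw [le_rpow_inv_iff (by positivity)]
  exact (lintegral_Lp_finset_sum_le S ht hw).trans (ENNReal.sum_le_tsum S)

/-- A power of the Lebesgue quasinorm which is countably subadditive for small exponents. -/
def qn (s : ℝ≥0∞) (ρ : ℝ) (w : ℝ → ℝ≥0∞) : ℝ≥0∞ := LqNorm volume s w ^ ρ

section qn
variable {s : ℝ≥0∞} {ρ : ℝ}

lemma qn_eq (hst : s ≠ ∞) (w : ℝ → ℝ≥0∞) : qn s ρ w = (∫⁻ y, w y ^ s.toReal) ^ (ρ / s.toReal) := by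
  rw [qn, LqNorm_of_ne_top hst, ← rpow_mul]
  congr 1
  ring

lemma qn_mono (h0 : 0 ≤ ρ) {w w' : ℝ → ℝ≥0∞} (h : ∀ y, w y ≤ w' y) : qn s ρ w ≤ qn s ρ w' :=
  rpow_le_rpow (LqNorm_mono h) h0

lemma qn_const_mul (h0 : 0 ≤ ρ) (hs : s ≠ 0) {c : ℝ≥0∞} (hc : c ≠ ∞) (w : ℝ → ℝ≥0∞) :
    qn s ρ (fun y => c * w y) = c ^ ρ * qn s ρ w := by
  rw [qn, LqNorm_const_mul hs hc, mul_rpow h0, qn]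

lemma qn_tsum_le (hst : s ≠ ∞) (h0 : 0 < ρ) (h1 : ρ ≤ 1) (hs : ρ ≤ s.toReal) {ι : Type*}
    [Countable ι] {w : ι → ℝ → ℝ≥0∞} (hw : ∀ i, Measurable (w i)) :
    qn s ρ (fun y => ∑' i, w i y) ≤ ∑' i, qn s ρ (w i) := by
  have hs0 : 0 < s.toReal := h0.trans_le hs
  have e : ∀ v : ℝ → ℝ≥0∞, qn s ρ v =
      (∫⁻ y, (v y ^ ρ) ^ (s.toReal / ρ)) ^ (1 / (s.toReal / ρ)) := fun v => by
    rw [qn_eq hst, one_div_div]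
    simp only [← rpow_mul]
    rw [mul_div_cancel₀ _ h0.ne']
  simp only [e]
  refine le_trans ?_ (lintegral_Lp_tsum_le ((one_le_div h0).2 hs) fun i => (hw i).pow_const ρ)
  refine rpow_le_rpow (lintegral_mono fun y => ?_) (by positivity)
  exact rpow_le_rpow (rpow_tsum_le_tsum_rpow _ h0 h1) (by positivity)

lemma qn_sum_le (hst : s ≠ ∞) (h0 : 0 < ρ) (h1 : ρ ≤ 1) (hs : ρ ≤ s.toReal) {ι : Type*}
    (S : Finset ι) {w : ι → ℝ → ℝ≥0∞} (hw : ∀ i ∈ S, Measurable (w i)) :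
    qn s ρ (fun y => ∑ i ∈ S, w i y) ≤ ∑ i ∈ S, qn s ρ (w i) := by
  have := qn_tsum_le hst h0 h1 hs (ι := S) (w := fun i => w i) fun i => hw i i.2
  simp only [tsum_fintype] at this
  have e1 : (fun y => ∑ i ∈ S, w i y) = fun y => ∑ i : S, w i y := by
    funext y
    exact (sum_coe_sort S fun i => w i y).symm
  rw [← sum_coe_sort S, e1]
  exact this

lemma qn_add_le (hst : s ≠ ∞) (h0 : 0 < ρ) (h1 : ρ ≤ 1) (hs : ρ ≤ s.toReal) {v w : ℝ → ℝ≥0∞}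
    (hv : Measurable v) (hw : Measurable w) :
    qn s ρ (fun y => v y + w y) ≤ qn s ρ v + qn s ρ w := by
  have := qn_sum_le hst h0 h1 hs (S := Finset.univ) (w := fun b : Bool => if b then v else w)
    (by rintro (_ | _) _ <;> simpa)
  simpa using this

end qn

lemma measurable_LqNorm_slice (p : ℝ≥0∞) {F : ℝ → ℝ → ℝ≥0∞} (hF : Measurable (uncurry F)) :
    Measurable fun x => LqNorm volume p (F x) := by
  by_cases hp : p = ∞
  · subst hp
    simp only [LqNorm_top]
    refine measurable_of_Iic fun c => ?_
    have e : (fun x => essSup (F x) volume) ⁻¹' Set.Iic c =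
        {x | volume (Prod.mk x ⁻¹' {z | c < uncurry F z}) = 0} := by
      ext x
      simp only [Set.mem_preimage, Set.mem_Iic, mem_ofPred_eq]
      constructor
      · intro h
        have h2 := ENNReal.ae_le_essSup (μ := volume) (F x)
        refine measure_mono_null ?_ (ae_iff.1 h2)
        intro y hy
        simp only [Set.mem_preimage, mem_ofPred_eq, Function.uncurry_apply_pair] at hy ⊢
        exact not_le.2 (h.trans_lt hy)
      · intro h
        refine essSup_le_of_ae_le _ (ae_iff.2 ?_)
        refine measure_mono_null ?_ h
        intro y hy
        simpa using hy
    rw [e]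
    exact (measurable_measure_prodMk_left (measurableSet_lt measurable_const hF))
      (measurableSet_singleton 0)
  · simp only [LqNorm_of_ne_top hp]
    exact (Measurable.lintegral_prod_right' (f := fun z : ℝ × ℝ => F z.1 z.2 ^ p.toReal)
      (hF.pow_const _)).pow_const _

/-- Minkowski's integral inequality. -/
lemma LqNorm_lintegral_le (hp : 1 < p) {F : ℝ → ℝ → ℝ≥0∞} (hF : Measurable (uncurry F))
    (hfin : p ≠ ∞ → ∫⁻ y, (∫⁻ t, F t y) ^ p.toReal ≠ ∞) :
    LqNorm volume p (fun y => ∫⁻ t, F t y) ≤ ∫⁻ t, LqNorm volume p (F t) := by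
  by_cases hpt : p = ∞
  · subst hpt
    simp only [LqNorm_top]
    refine essSup_le_of_ae_le _ ?_
    have hm := measurable_LqNorm_slice ∞ hF
    simp only [LqNorm_top] at hm
    have hs : MeasurableSet {z : ℝ × ℝ | F z.1 z.2 ≤ essSup (F z.1) volume} :=
      measurableSet_le hF (hm.comp measurable_fst)
    have h1 : ∀ᵐ t : ℝ, ∀ᵐ y : ℝ, F t y ≤ essSup (F t) volume :=
      Filter.Eventually.of_forall fun t => ENNReal.ae_le_essSup _
    have h2 : ∀ᵐ y : ℝ, ∀ᵐ t : ℝ, F t y ≤ essSup (F t) volume :=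
      (Measure.ae_ae_comm (p := fun t y => F t y ≤ essSup (F t) volume) hs).1 h1
    filter_upwards [h2] with y hy
    exact lintegral_mono_ae hy
  · have hp1 := one_lt_toReal hp hpt
    have hp0 : 0 < p.toReal := by linarith
    simp only [LqNorm_of_ne_top hpt]
    set q := p.toReal with hq
    have hc : q.HolderConjugate (q / (q - 1)) := Real.HolderConjugate.conjExponent hp1
    have hF' : ∀ y, Measurable fun t => F t y := fun y => hF.comp measurable_prodMk_right
    have hS : Measurable fun y => ∫⁻ t, F t y := hF.lintegral_prod_left'
    set S := fun y => ∫⁻ t, F t y with hSdef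
    set I := ∫⁻ y, S y ^ q with hI
    have hI' := hfin hpt
    have e1 : I = ∫⁻ t, ∫⁻ y, F t y * S y ^ (q - 1) := by
      rw [lintegral_lintegral_swap (hF.mul ((hS.comp measurable_snd).pow_const _)).aemeasurable]
      refine lintegral_congr fun y => ?_
      rw [lintegral_mul_const _ (hF' y)]
      show S y ^ q = S y * S y ^ (q - 1)
      conv_rhs => rw [← rpow_one (S y)]
      rw [← rpow_mul, one_mul, ← rpow_add_of_nonneg _ _ (by positivity)
        (by linarith)]
      congr 1
      ring
    have hJt : I ^ (1 / (q / (q - 1))) ≠ ∞ := rpow_ne_top_of_nonneg (by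
      rw [one_div_div]; exact div_nonneg (by linarith) hp0.le) hI'
    have e5 : ∫⁻ y, (S y ^ (q - 1)) ^ (q / (q - 1)) = I := lintegral_congr fun y => by
      rw [← rpow_mul, mul_div_cancel₀ _ (by linarith : q - 1 ≠ 0)]
    have e2 : I ≤ (∫⁻ t, (∫⁻ y, F t y ^ q) ^ (1 / q)) * I ^ (1 / (q / (q - 1))) := by
      rw [← lintegral_mul_const' _ _ hJt]
      refine e1.le.trans (lintegral_mono fun t => ?_)
      have e6 := lintegral_mul_le_Lp_mul_Lq volume hc (f := F t)
          (measurable_slice hF t).aemeasurable (hS.pow_const (q - 1)).aemeasurable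
      rw [e5] at e6
      exact e6
    by_cases hI0 : I = 0
    · rw [hI0, zero_rpow_of_pos (by positivity)]
      exact zero_le
    have e3 : I = I ^ (1 / q) * I ^ (1 / (q / (q - 1))) := by
      rw [← rpow_add _ _ hI0 hI']
      have : 1 / q + 1 / (q / (q - 1)) = 1 := by
        field_simp
        ring
      rw [this, rpow_one]
    have hJ0 : I ^ (1 / (q / (q - 1))) ≠ 0 := by
      intro h
      rw [h, mul_zero] at e3
      exact hI0 e3
    have e4 : I ^ (1 / q) * I ^ (1 / (q / (q - 1))) ≤
      (∫⁻ t, (∫⁻ y, F t y ^ q) ^ (1 / q)) * I ^ (1 / (q / (q - 1))) := e3.symm.le.trans e2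
    exact (ENNReal.mul_le_mul_iff_left hJ0 hJt).1 e4

/-- The inner Lebesgue norm of a function of two variables. -/
def hn (p : ℝ≥0∞) (F : ℝ → ℝ → ℂ) (x : ℝ) : ℝ≥0∞ :=
  LqNorm volume p fun y => ‖F x y‖ₑ

lemma Dec2.measurable_hn (hF : Dec2 F) (p : ℝ≥0∞) : Measurable (hn p F) :=
  measurable_LqNorm_slice p hF.measurable_enorm

lemma lintegral_wt_rpow_ne_top {q : ℝ} (hq : 1 ≤ q) : ∫⁻ x, ofReal (wt 2 x) ^ q ≠ ∞ := by
  have h3 : ∫⁻ x, ofReal (wt 2 x) ≠ ∞ := (integrable_wt (le_refl 2)).lintegral_lt_top.ne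
  refine ne_top_of_le_ne_top h3 (lintegral_mono fun x => ?_)
  calc _ ≤ ofReal (wt 2 x) ^ (1 : ℝ) :=
        rpow_le_rpow_of_exponent_ge (ofReal_le_one.2 (wt_le_one _ _)) hq
    _ = _ := rpow_one _

lemma LqNorm_wt_ne_top (hp : 1 < p) : LqNorm volume p (fun x => ofReal (wt 2 x)) ≠ ∞ := by
  by_cases hpt : p = ∞
  · subst hpt
    rw [LqNorm_top]
    refine ne_top_of_le_ne_top one_ne_top (essSup_le_of_ae_le _
      (.of_forall fun x => ofReal_le_one.2 (wt_le_one _ _)))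
  · rw [LqNorm_of_ne_top hpt]
    exact rpow_ne_top_of_nonneg (by positivity) (lintegral_wt_rpow_ne_top (one_lt_toReal hp hpt).le)

lemma Dec2.enorm_le (hF : Dec2 F) : ∃ C : ℝ≥0, ∀ x y,
    ‖F x y‖ₑ ≤ C * (ofReal (wt 2 x) * ofReal (wt 2 y)) := by
  obtain ⟨C, h0, hC⟩ := hF.exists_bound
  refine ⟨C.toNNReal, fun x y => ?_⟩
  rw [← ofReal_norm, ← ofReal_mul (wt_nonneg _ _)]
  show _ ≤ ofReal C * _
  rw [← ofReal_mul h0]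
  exact ofReal_le_ofReal (hC x y)

lemma Dec2.hn_le (hp : 1 < p) (hF : Dec2 F) : ∃ C : ℝ≥0, ∀ x, hn p F x ≤ C * ofReal (wt 2 x) := by
  obtain ⟨C, hC⟩ := hF.enorm_le
  have hp0 : p ≠ 0 := (zero_lt_one.trans hp).ne'
  refine ⟨C * (LqNorm volume p fun x => ofReal (wt 2 x)).toNNReal, fun x => ?_⟩
  rw [coe_mul, coe_toNNReal (LqNorm_wt_ne_top hp)]
  calc hn p F x ≤ LqNorm volume p fun y => (C * ofReal (wt 2 x)) * ofReal (wt 2 y) :=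
        LqNorm_mono fun y => (hC x y).trans_eq (by ring)
    _ = _ := by
      rw [LqNorm_const_mul hp0 (by finiteness)]
      ring

lemma Dec2.lintegral_hn_rpow_ne_top (hp : 1 < p) (hF : Dec2 F) {r : ℝ} (hr : 1 ≤ r) :
    ∫⁻ x, hn p F x ^ r ≠ ∞ := by
  obtain ⟨C, hC⟩ := hF.hn_le hp
  have h0 : 0 ≤ r := by linarith
  have : ∫⁻ x, hn p F x ^ r ≤ (C : ℝ≥0∞) ^ r * ∫⁻ x, ofReal (wt 2 x) ^ r := by
    rw [← lint_const_mul (by finiteness)]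
    refine lintegral_mono fun x => ?_
    rw [← mul_rpow h0]
    exact rpow_le_rpow (hC x) h0
  exact ne_top_of_le_ne_top (mul_ne_top (by finiteness) (lintegral_wt_rpow_ne_top hr)) this

lemma Dec2.lintegral_hn_ne_top (hp : 1 < p) (hF : Dec2 F) : ∫⁻ x, hn p F x ≠ ∞ := by
  simpa using hF.lintegral_hn_rpow_ne_top hp (r := 1) le_rfl

lemma hn_opx_le (hp : 1 < p) {κ : ℝ → ℝ → ℂ} (hκ : Measurable (κ x)) {M : ℝ≥0}
    (hM : ∀ t, ‖κ x t‖ₑ ≤ M) (hF : Dec2 F) : hn p (opx κ F) x ≤ ∫⁻ t, ‖κ x t‖ₑ * hn p F t := by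
  have hp0 : p ≠ 0 := (zero_lt_one.trans hp).ne'
  obtain ⟨C, hC⟩ := hF.enorm_le
  have h1 : ∀ y, ‖opx κ F x y‖ₑ ≤ ∫⁻ t, ‖κ x t‖ₑ * ‖F t y‖ₑ := fun y => by
    refine (enorm_integral_le_lintegral_enorm _).trans (lintegral_mono fun t => ?_)
    rw [enorm_smul]
  have hm : Measurable (uncurry fun t y => ‖κ x t‖ₑ * ‖F t y‖ₑ) :=
    (hκ.enorm.comp measurable_fst).mul hF.measurable_enorm
  have h2 : ∀ y, ∫⁻ t, ‖κ x t‖ₑ * ‖F t y‖ₑ ≤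
      (M * C * ∫⁻ t, ofReal (wt 2 t)) * ofReal (wt 2 y) := fun y => by
    rw [mul_right_comm, ← lint_const_mul (by finiteness)]
    refine lintegral_mono fun t => ?_
    refine (mul_le_mul' (hM t) (hC t y)).trans_eq ?_
    ring
  have hfin : ∫⁻ t, ofReal (wt 2 t) ≠ ∞ := (integrable_wt (le_refl 2)).lintegral_lt_top.ne
  refine (LqNorm_mono h1).trans ((LqNorm_lintegral_le hp hm fun hpt => ?_).trans_eq ?_)
  · have hp1 := one_lt_toReal hp hpt
    have : ∫⁻ y, (∫⁻ t, ‖κ x t‖ₑ * ‖F t y‖ₑ) ^ p.toReal ≤ (M * C * ∫⁻ t, ofReal (wt 2 t)) ^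
        p.toReal * ∫⁻ y, ofReal (wt 2 y) ^ p.toReal := by
      rw [← lint_const_mul (rpow_ne_top_of_nonneg (by linarith) (by finiteness))]
      refine lintegral_mono fun y => ?_
      rw [← mul_rpow (by linarith)]
      exact rpow_le_rpow (h2 y) (by linarith)
    exact ne_top_of_le_ne_top (mul_ne_top (rpow_ne_top_of_nonneg (by linarith)
        (by finiteness)) (lintegral_wt_rpow_ne_top hp1.le)) this
  · refine lintegral_congr fun t => ?_
    rw [LqNorm_const_mul hp0 (ne_top_of_le_ne_top coe_ne_top (hM t)), hn]

/-- The part of the biparameter paraproduct at a fixed scale of the first variable. -/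
def UU (X Y : Sys) (σ : ℤ → ℤ → ℂ) (f g : ℝ → ℝ → ℂ) (k : ℤ) (x y : ℝ) : ℂ :=
  op (kS X.psi' k) (fun a => BB Y (σ k) (opx (kA X.phi k) f a) (opx (kA X.psi k) g a) y) x

section UU
variable {A : ℝ} {X Y : Sys} (hX : X.Ok A) (hY : Y.Ok A) (σ : ℤ → ℤ → ℂ)
  {f g : ℝ → ℝ → ℂ} (hf : Dec2 f) (hg : Dec2 g)
include hX hY hf hg

lemma dec2_BB (k : ℤ) :
    Dec2 fun a y => BB Y (σ k) (opx (kA X.phi k) f a) (opx (kA X.psi k) g a) y :=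
  Dec2.sum Y.K fun l _ => (Dec2.mid hX hY σ hf hg k l).opy hY.psi'.kS l

lemma Dec2.UU (k : ℤ) : Dec2 (UU X Y σ f g k) :=
  (dec2_BB hX hY σ hf hg k).opx hX.psi'.kS k

lemma TT_eq_sum (x y : ℝ) : TT X Y σ f g x y = ∑ k ∈ X.K, BiPara.UU X Y σ f g k x y := by
  refine sum_congr rfl fun k _ => ?_
  exact (hX.psi'.kS.op_sum k Y.K (u := fun l a => opy (kS Y.psi' l) (BiPara.mid X Y σ f g k l) a y)
    (fun l _ => ((Dec2.mid hX hY σ hf hg k l).opy hY.psi'.kS l).right y) x).symm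

end UU

lemma wt_zz_le (k : ℤ) (x a : ℝ) :
    wt 16 (2 ^ k * (x - zz k a)) ≤ 2 ^ 16 * wt 16 (2 ^ k * (x - a)) := wt_shift_le 16 (by
  rw [← mul_sub, show x - zz k a - (x - a) = a - zz k a by ring]
  exact abs_sub_zz_le k a)

lemma norm_kS_le (h : Ker A η) (k : ℤ) (x a : ℝ) :
    ‖kS η k x a‖ ≤ 2 ^ 16 * A * (2 ^ k * wt 16 (2 ^ k * (x - a))) := by
  refine (h.norm_dil_le k (x - zz k a)).trans ?_
  calc _ ≤ A * (2 ^ k * (2 ^ 16 * wt 16 (2 ^ k * (x - a)))) :=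
        mul_le_mul_of_nonneg_left (mul_le_mul_of_nonneg_left (wt_zz_le k x a) (by positivity)) h.nonneg
    _ = _ := by ring

lemma norm_kS_sub_le (h : Ker A η) (hk : k ≤ k₀) {x' : ℝ} (hx : dix k₀ x = dix k₀ x') (a : ℝ) :
    ‖kS η k x a - kS η k x' a‖ ≤ 2 ^ 16 * A * 2 ^ (k - k₀) * (2 ^ k * wt 16 (2 ^ k * (x - a))) := by
  have h2 := abs_dix_congr (k := k) hx
  have h3 : (2 : ℝ) ^ (k - k₀) ≤ 1 := zpow_le_one_of_nonpos₀ (by norm_num) (by linarith)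
  have h4 : x - zz k a - (x' - zz k a) = x - x' := by ring
  have h0 := h.norm_dil_sub_le k (x := x - zz k a) (x' := x' - zz k a)
    (by rw [h4]; exact h2.trans h3)
  rw [h4] at h0
  refine h0.trans ?_
  have hw := wt_nonneg 16 (2 ^ k * (x - zz k a))
  calc _ ≤ A * 2 ^ (k - k₀) * (2 ^ k * (2 ^ 16 * wt 16 (2 ^ k * (x - a)))) := by
        refine mul_le_mul (mul_le_mul_of_nonneg_left h2 h.nonneg)
          (mul_le_mul_of_nonneg_left (wt_zz_le k x a) (by positivity)) (by positivity)
          (mul_nonneg h.nonneg (by positivity))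
    _ = _ := by ring

/-- Synthesis at one scale is controlled in the quasinorm by an averaging of the quasinorm. -/
lemma qn_synth_le (hst : s ≠ ∞) (h0 : 0 < ρ) (h1 : ρ ≤ 1) (hs : ρ ≤ s.toReal) (k : ℤ)
    {W : ℝ → ℝ → ℂ} (hW : ∀ a, Measurable (W a))
    (hWc : ∀ a b, dix (k + 3) a = dix (k + 3) b → W a = W b) {κ : ℝ → ℂ}
    (hκ : ∀ a b, dix (k + 3) a = dix (k + 3) b → κ a = κ b) {D : ℝ≥0∞} (hDt : D ≠ ∞) {w : ℝ → ℝ≥0∞}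
    (hκw : ∀ a, ‖κ a‖ₑ ≤ D * (2 ^ k * w a)) : qn s ρ (fun y => ‖∫ a, κ a * W a y‖ₑ) ≤
      8 * D ^ ρ * ∫⁻ a, 2 ^ k * w a ^ ρ * qn s ρ fun y => ‖W a y‖ₑ := by
  have hs0 : s ≠ 0 := by
    rintro rfl
    simp at hs
    linarith
  set c : ℤ → ℝ := fun n => 2 ^ (-(k + 3)) * n with hc
  have hcc : ∀ n, dix (k + 3) (c n) = n := fun n => by
    have : (2 : ℝ) ^ (k + 3) * (2 ^ (-(k + 3)) * n) = n := by
      rw [← mul_assoc, ← zpow_add₀ two_ne_zero]; simp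
    show ⌊(2 : ℝ) ^ (k + 3) * (2 ^ (-(k + 3)) * n)⌋ = n
    rw [this, Int.floor_intCast]
  have e1 : ∀ y, ‖∫ a, κ a * W a y‖ₑ ≤
      ∑' n : ℤ, (2 ^ (-(k + 3)) * ‖κ (c n)‖ₑ) * ‖W (c n) y‖ₑ := fun y => by
    refine (enorm_integral_le_lintegral_enorm _).trans ?_
    rw [lintegral_eq_tsum_cells (k + 3)]
    refine ENNReal.tsum_le_tsum fun n => ?_
    rw [setLIntegral_congr_fun (measurableSet_cell (k + 3) n)
      (g := fun _ => ‖κ (c n)‖ₑ * ‖W (c n) y‖ₑ)]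
    · rw [setLIntegral_const, volume_cell]
      exact le_of_eq (by ring)
    · intro a ha
      have : dix (k + 3) a = dix (k + 3) (c n) := by rw [hcc]; exact ha
      simp only [enorm_mul]
      rw [hκ _ _ this, hWc _ _ this]
  refine (qn_mono h0.le e1).trans ((qn_tsum_le hst h0 h1 hs fun n =>
    ((hW _).enorm.const_mul _)).trans ?_)
  rw [← lint_const_mul (by finiteness), lintegral_eq_tsum_cells (k + 3)]
  refine ENNReal.tsum_le_tsum fun n => ?_
  rw [qn_const_mul h0.le hs0 (by finiteness)]
  have hle : ∀ a ∈ cell (k + 3) n, 2 ^ (k + 3) * ((2 ^ (-(k + 3)) * ‖κ (c n)‖ₑ) ^ ρ *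
      qn s ρ fun y => ‖W (c n) y‖ₑ) ≤ 8 * D ^ ρ * (2 ^ k * w a ^ ρ * qn s ρ fun y => ‖W a y‖ₑ) := by
    intro a ha
    have : dix (k + 3) (c n) = dix (k + 3) a := by rw [hcc]; exact ha.symm
    rw [hκ _ _ this, hWc _ _ this]
    have e2 : (2 ^ (-(k + 3)) * ‖κ a‖ₑ : ℝ≥0∞) ≤ D * w a := by
      refine (mul_mono (hκw a)).trans ?_
      calc (2 ^ (-(k + 3)) * (D * (2 ^ k * w a)) : ℝ≥0∞)
          = (2 ^ (-(k + 3)) * 2 ^ k) * (D * w a) := by ring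
        _ ≤ 1 * (D * w a) := by
          refine mul_le_mul' ?_ le_rfl
          rw [← two_zpow_add]
          calc (2 : ℝ≥0∞) ^ (-(k + 3) + k) ≤ 2 ^ (0 : ℤ) :=
                zpow_le_of_le (by norm_num) (by linarith)
            _ = 1 := zpow_zero _
        _ = _ := one_mul _
    calc _ ≤ 2 ^ (k + 3) * ((D * w a) ^ ρ * qn s ρ fun y => ‖W a y‖ₑ) :=
          mul_mono (mul_le_mul' (rpow_le_rpow e2 h0.le) le_rfl)
      _ = _ := by
        rw [mul_rpow h0.le, two_zpow_add]
        have : (2 : ℝ≥0∞) ^ (3 : ℤ) = 8 := by norm_cast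
        rw [this]
        ring
  calc _ = ∫⁻ _ in cell (k + 3) n, 2 ^ (k + 3) * ((2 ^ (-(k + 3)) * ‖κ (c n)‖ₑ) ^ ρ *
        qn s ρ fun y => ‖W (c n) y‖ₑ) := by
        rw [setLIntegral_const, volume_cell, mul_right_comm, two_zpow_mul_neg, one_mul]
    _ ≤ _ := setLIntegral_mono' (measurableSet_cell _ _) hle

/-- Admissible inner exponents together with an auxiliary subadditivity exponent. -/
structure Expo (s p q : ℝ≥0∞) (ρ : ℝ) : Prop where
  holder : s⁻¹ = p⁻¹ + q⁻¹
  hp : 1 < p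
  hq : 1 < q
  hst : s ≠ ∞
  half : 1 / 2 < ρ
  le_one : ρ < 1
  le_s : ρ ≤ s.toReal

lemma Expo.pos (h : Expo s p q ρ) : 0 < ρ := by linarith [h.half]

lemma Expo.s_ne_zero (h : Expo s p q ρ) : s ≠ 0 := by
  rintro rfl
  have := h.le_s
  simp at this
  linarith [h.pos]

lemma PP_eq (N : ℕ) (k : ℤ) (h : ℝ → ℝ≥0∞) (x : ℝ) :
    PP N k h x = ∫⁻ a, 2 ^ k * ofReal (wt N (2 ^ k * (x - a))) * h a := by
  refine lintegral_congr fun a => ?_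
  rw [ofReal_mul (by positivity), ofReal_two_zpow]

lemma wt_mul_self_rpow_le (N : ℕ) (t : ℝ) (h : 1 ≤ 2 * ρ) : ofReal (wt N t * wt N t) ^ ρ ≤ ofReal (wt N t) := by
  rw [ofReal_mul (wt_nonneg _ _), ← pow_two, ← rpow_natCast, ← rpow_mul]
  refine (rpow_le_rpow_of_exponent_ge (ofReal_le_one.2 (wt_le_one _ _)) (z := 1) ?_).trans_eq (rpow_one _)
  push_cast
  linarith

lemma wt_rpow_mul_le (h : 1 / 2 < ρ) (t : ℝ) : ofReal (wt 16 t) ^ ρ *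
      (ofReal ((1 + |t|) ^ 6) * ofReal ((1 + |t|) ^ 6)) ^ ρ ≤ ofReal (wt 2 t) := by
  have h0 : 0 ≤ ρ := by linarith
  rw [← mul_rpow h0, ← ofReal_mul (by positivity), ← ofReal_mul (wt_nonneg _ _)]
  have e : wt 16 t * ((1 + |t|) ^ 6 * (1 + |t|) ^ 6) = wt 2 t * wt 2 t := by
    have : 0 < 1 + |t| := by positivity
    unfold wt
    field_simp
  exact e ▸ wt_mul_self_rpow_le 2 t (by linarith)

lemma opx_congr_zz {a b : ℝ} (h : dix (k + 3) a = dix (k + 3) b) (F : ℝ → ℝ → ℂ) :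
    opx (kA η k) F a = opx (kA η k) F b := by
  funext y
  simp only [opx, op, kA, zz_congr h]

lemma piece_le (hE : Expo s p q ρ) (A : ℝ) : Unif A fun C X Y σ f g =>
    ∀ {k : ℤ} {h₁ h₂ : ℝ → ℝ≥0∞}, (∀ a, hn p (opx (kA X.phi k) f) a ≤ PP 6 k h₁ a) →
    (∀ a, hn q (opx (kA X.psi k) g) a ≤ PP 6 k h₂ a) → ∀ {x : ℝ} {κ : ℝ → ℂ},
    (∀ a b, dix (k + 3) a = dix (k + 3) b → κ a = κ b) → ∀ {D : ℝ≥0∞}, D ≠ ∞ →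
    (∀ a, ‖κ a‖ₑ ≤ D * (2 ^ k * ofReal (wt 16 (2 ^ k * (x - a))))) → qn s ρ (fun y => ‖∫ a, κ a *
      BB Y (σ k) (opx (kA X.phi k) f a) (opx (kA X.psi k) g a) y‖ₑ) ≤
      C * D ^ ρ * (PP 6 k h₁ x * PP 6 k h₂ x) ^ ρ := by
  obtain ⟨C, hC⟩ := BB_le hE.holder hE.hp hE.hq hE.hst A
  have h0 := hE.pos
  refine ⟨8 * C ^ ρ * 24, fun {X Y} hX hY {σ} hlam {f g} hf hg {k h₁ h₂} H₁ H₂ {x κ} hκ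
    {D} hD hκD => ?_⟩
  have hd := dec2_BB hX hY σ hf hg k
  refine (qn_synth_le hE.hst h0 hE.le_one.le hE.le_s k (W := fun a y =>
    BB Y (σ k) (opx (kA X.phi k) f a) (opx (kA X.psi k) g a) y)
    (fun a => (hd.left a).1.measurable)
    (fun a b hab => by simp only [opx_congr_zz hab]) hκ hD hκD).trans ?_
  have key : ∀ a, 2 ^ k * ofReal (wt 16 (2 ^ k * (x - a))) ^ ρ * qn s ρ (fun y =>
      ‖BB Y (σ k) (opx (kA X.phi k) f a) (opx (kA X.psi k) g a) y‖ₑ) ≤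
      ((C : ℝ≥0∞) ^ ρ * (PP 6 k h₁ x * PP 6 k h₂ x) ^ ρ) *
        (2 ^ k * ofReal (wt 2 (2 ^ k * (x - a))) * 1) := by
    intro a
    set E := ofReal ((1 + |2 ^ k * (x - a)|) ^ 6) with hEd
    have e0 : |2 ^ k * (a - x)| = |2 ^ k * (x - a)| := by
      rw [← abs_neg]; congr 1; ring
    have e1 : hn p (opx (kA X.phi k) f) a ≤ E * PP 6 k h₁ x :=
      (H₁ a).trans (by simpa only [e0] using PP_shift 6 k h₁ a x)
    have e2 : hn q (opx (kA X.psi k) g) a ≤ E * PP 6 k h₂ x :=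
      (H₂ a).trans (by simpa only [e0] using PP_shift 6 k h₂ a x)
    have e3 : qn s ρ (fun y =>
        ‖BB Y (σ k) (opx (kA X.phi k) f a) (opx (kA X.psi k) g a) y‖ₑ) ≤
        (C * ((E * PP 6 k h₁ x) * (E * PP 6 k h₂ x))) ^ ρ :=
      rpow_le_rpow ((hC hY (hlam k) ((hf.opx hX.phi.kA k).left a)
        ((hg.opx hX.psi.kA k).left a)).trans (mul_mono (mul_le_mul' e1 e2))) h0.le
    have e4 : (C * ((E * PP 6 k h₁ x) * (E * PP 6 k h₂ x))) ^ ρ =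
        (C : ℝ≥0∞) ^ ρ * (PP 6 k h₁ x * PP 6 k h₂ x) ^ ρ * (E * E) ^ ρ := by
      simp only [← mul_rpow h0.le]
      congr 1
      ring
    rw [e4] at e3
    calc _ ≤ 2 ^ k * ofReal (wt 16 (2 ^ k * (x - a))) ^ ρ *
          ((C : ℝ≥0∞) ^ ρ * (PP 6 k h₁ x * PP 6 k h₂ x) ^ ρ * (E * E) ^ ρ) :=
          mul_mono e3
      _ = ((C : ℝ≥0∞) ^ ρ * (PP 6 k h₁ x * PP 6 k h₂ x) ^ ρ) *
        (2 ^ k * (ofReal (wt 16 (2 ^ k * (x - a))) ^ ρ * (E * E) ^ ρ)) := by ring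
      _ ≤ _ := by
        rw [mul_one]
        exact mul_mono (mul_mono (wt_rpow_mul_le hE.half _))
  refine (mul_mono (lintegral_mono key)).trans ?_
  have hm : Measurable fun a => 2 ^ k * ofReal (wt 2 (2 ^ k * (x - a))) * 1 :=
    (((measurable_wt 2).comp ((measurable_const.sub measurable_id).const_mul _)).ennreal_ofReal.const_mul
      _).mul_const _
  rw [lintegral_const_mul _ hm, ← PP_eq 2 k (fun _ => 1) x]
  refine (mul_mono (mul_mono (PP_one_le k x))).trans (le_of_eq ?_)
  rw [coe_mul, coe_mul, coe_rpow_of_nonneg _ h0.le]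
  push_cast
  ring

/-- Pointwise control of one scale, and of its oscillation on finer intervals. -/
lemma UU_le (hE : Expo s p q ρ) (A : ℝ) : Unif A fun C X Y σ f g => ∀ {k : ℤ} {h₁ h₂ : ℝ → ℝ≥0∞},
    (∀ a, hn p (opx (kA X.phi k) f) a ≤ PP 6 k h₁ a) →
    (∀ a, hn q (opx (kA X.psi k) g) a ≤ PP 6 k h₂ a) → ∀ x,
    qn s ρ (fun y => ‖UU X Y σ f g k x y‖ₑ) ≤ C * (PP 6 k h₁ x * PP 6 k h₂ x) ^ ρ ∧
    ∀ {k₀ : ℤ}, k ≤ k₀ → ∀ {x' : ℝ}, dix k₀ x = dix k₀ x' →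
      qn s ρ (fun y => ‖UU X Y σ f g k x y - UU X Y σ f g k x' y‖ₑ) ≤
        C * (2 ^ (k - k₀)) ^ ρ * (PP 6 k h₁ x * PP 6 k h₂ x) ^ ρ := by
  obtain ⟨C, hC⟩ := piece_le hE A
  have h0 := hE.pos
  refine ⟨C * (2 ^ 16 * A).toNNReal ^ ρ, fun {X Y} hX hY {σ} hlam {f g} hf hg {k h₁ h₂} H₁ H₂ x =>
    ⟨?_, fun {k₀} hk {x'} hx => ?_⟩⟩
  · have hA := hX.psi'.nonneg
    have e := hC hX hY hlam hf hg H₁ H₂ (x := x) (κ := fun a => kS X.psi' k x a)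
      (fun a b hab => by simp only [kS, zz_congr hab]) (D := ofReal (2 ^ 16 * A))
      ofReal_ne_top (fun a => by
        rw [← ofReal_norm, ← ofReal_two_zpow, ← ofReal_mul (by positivity),
          ← ofReal_mul (by positivity)]
        exact ofReal_le_ofReal (norm_kS_le hX.psi' k x a))
    rw [coe_mul, coe_rpow_of_nonneg _ h0.le]
    exact e
  · have hA := hX.psi'.nonneg
    have e := hC hX hY hlam hf hg H₁ H₂ (x := x) (κ := fun a => kS X.psi' k x a - kS X.psi' k x' a)
      (fun a b hab => by simp only [kS, zz_congr hab]) (D := ofReal (2 ^ 16 * A) * 2 ^ (k - k₀))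
      (by finiteness) (fun a => by
        rw [← ofReal_norm, ← ofReal_two_zpow, ← ofReal_two_zpow, ← ofReal_mul (by positivity),
          ← ofReal_mul (by positivity), ← ofReal_mul (by positivity)]
        exact ofReal_le_ofReal (norm_kS_sub_le hX.psi' hk hx a))
    rw [mul_rpow h0.le] at e
    rw [coe_mul, coe_rpow_of_nonneg _ h0.le]
    have e5 : ∀ y, UU X Y σ f g k x y - UU X Y σ f g k x' y =
        ∫ a, (kS X.psi' k x a - kS X.psi' k x' a) *
          BB Y (σ k) (opx (kA X.phi k) f a) (opx (kA X.psi k) g a) y := fun y => by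
      have hd := (dec2_BB hX hY σ hf hg k).right y
      rw [UU, UU, op, op, ← integral_sub (hX.psi'.kS.integrable k x hd)
        (hX.psi'.kS.integrable k x' hd)]
      refine int_congr fun a => ?_
      simp only [smul_eq_mul]
      ring
    simp only [e5]
    refine e.trans (le_of_eq ?_)
    show (C : ℝ≥0∞) * (ofReal (2 ^ 16 * A) ^ ρ * _) * _ = _ * ofReal (2 ^ 16 * A) ^ ρ * _ * _
    ring

lemma hn_ana_le (hp : 1 < p) (hη : Ker A η) (hF : Dec2 F) (k : ℤ) (x : ℝ) :
    hn p (opx (kA η k) F) x ≤ PP 6 k (fun a => ofReal (2 ^ 20 * A) * hn p F a) x := by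
  have hA := hη.nonneg
  refine (hn_opx_le hp (M := (2 ^ 20 * A * 2 ^ k).toNNReal)
    ((hη.kA.meas k).comp measurable_prodMk_left) (fun t => ?_) hF).trans ?_
  · rw [← ofReal_norm]
    exact ofReal_le_ofReal (hη.kA.norm_le k x t)
  · refine lintegral_mono fun t => ?_
    have h1 : ‖kA η k x t‖ₑ ≤ ofReal (2 ^ k * wt 6 (2 ^ k * (x - t))) * ofReal (2 ^ 20 * A) := by
      rw [← ofReal_norm, ← ofReal_mul (mul_nonneg (by positivity) (wt_nonneg _ _))]
      refine ofReal_le_ofReal ((hη.kA.size k x t).trans ?_)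
      rw [mul_comm]
      refine mul_le_mul_of_nonneg_right (mul_le_mul_of_nonneg_left (wt_anti (by norm_num) _)
        (by positivity)) (by positivity)
    refine (mul_le_mul' h1 le_rfl).trans (le_of_eq (by ring))

/-- The left endpoint of a dyadic interval. -/
def lep (q : ℤ × ℤ) : ℝ := 2 ^ (-q.1) * q.2

lemma dix_lep (q : ℤ × ℤ) : dix q.1 (lep q) = q.2 := by
  show ⌊(2 : ℝ) ^ q.1 * (2 ^ (-q.1) * q.2)⌋ = q.2
  rw [← mul_assoc, ← zpow_add₀ two_ne_zero]
  simp

lemma one_le_of_far {q : ℤ × ℤ} {t : ℝ} (hx : x ∉ cell3 q.1 q.2) (ht : t ∈ cell q.1 q.2) :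
    1 ≤ |(2 : ℝ) ^ q.1 * (x - t)| := by
  have := one_le_of_notMem_cell3 (k := q.1) (x := t) (a := x) (by rwa [mem_cell.1 ht])
  rwa [← abs_neg, show -((2 : ℝ) ^ q.1 * (t - x)) = 2 ^ q.1 * (x - t) by ring] at this

lemma wt_far_le {q : ℤ × ℤ} {t : ℝ} (hx : x ∉ cell3 q.1 q.2) (ht : t ∈ cell q.1 q.2) (k : ℤ) :
    wt 6 (2 ^ k * (x - t)) ≤ 2 ^ 6 * wt 6 (2 ^ k * (x - lep q)) := by
  have h1 := one_le_of_far hx ht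
  have h2 : |(2 : ℝ) ^ q.1 * (t - lep q)| ≤ 1 := by
    have := abs_dix_congr (k := q.1) (k₀ := q.1) (x := t) (x' := lep q) (by rw [dix_lep]; exact ht)
    simpa using this
  have hp : (0 : ℝ) < 2 ^ q.1 := by positivity
  have h3 : |x - lep q| ≤ 2 * |x - t| := by
    have h4 : |(2 : ℝ) ^ q.1 * (x - lep q)| ≤ 2 * |(2 : ℝ) ^ q.1 * (x - t)| := by
      have : (2 : ℝ) ^ q.1 * (x - lep q) = 2 ^ q.1 * (x - t) + 2 ^ q.1 * (t - lep q) := by ring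
      rw [this]
      exact (abs_add_le _ _).trans (by linarith)
    rw [abs_mul, abs_mul, abs_of_pos hp] at h4
    nlinarith
  have h5 : 1 + |(2 : ℝ) ^ k * (x - lep q)| ≤ 2 * (1 + |2 ^ k * (x - t)|) := by
    have hk : (0 : ℝ) < 2 ^ k := by positivity
    rw [abs_mul, abs_mul, abs_of_pos hk]
    nlinarith
  have h6 : (1 + |(2 : ℝ) ^ k * (x - lep q)|) ^ 6 ≤ 2 ^ 6 * (1 + |2 ^ k * (x - t)|) ^ 6 := by
    rw [← mul_pow]
    exact pow_le_pow_left₀ (by positivity) h5 6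
  unfold wt
  rw [← div_eq_mul_inv, inv_eq_one_div, div_le_div_iff₀ (by positivity) (by positivity)]
  linarith

lemma PP_far_cell {q : ℤ × ℤ} (hx : x ∉ cell3 q.1 q.2) (k : ℤ) {J : ℝ≥0∞}
    (hJ : ∫⁻ t in cell q.1 q.2, h t ≤ J) : PP 6 k ((cell q.1 q.2).indicator h) x ≤
      64 * (2 ^ k * J) * ofReal (wt 6 (2 ^ k * (x - lep q))) := by
  have e : ∀ t, 2 ^ k * ofReal (wt 6 (2 ^ k * (x - t))) * (cell q.1 q.2).indicator h t ≤
      (2 ^ k * (64 * ofReal (wt 6 (2 ^ k * (x - lep q))))) * (cell q.1 q.2).indicator h t := by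
    intro t
    by_cases ht : t ∈ cell q.1 q.2
    · refine mul_le_mul' (mul_mono ?_) le_rfl
      refine (ofReal_le_ofReal (wt_far_le hx ht k)).trans_eq ?_
      rw [ofReal_mul (by positivity)]
      norm_num
    · simp [ht]
  rw [PP_eq]
  refine (lintegral_mono e).trans ?_
  rw [lint_const_mul (by finiteness [two_zpow_ne_top k]),
    lintegral_indicator (measurableSet_cell _ _)]
  exact (mul_mono hJ).trans_eq (by ring)

lemma lintegral_wt_two_scaled_le (k : ℤ) (c : ℝ) :
    ∫⁻ x, ofReal (wt 2 (2 ^ k * (x - c))) ≤ 24 * 2 ^ (-k) := by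
  have h := PP_one_le k c
  rw [PP_eq] at h
  have e : ∀ x, 2 ^ k * ofReal (wt 2 (2 ^ k * (c - x))) * 1 =
      2 ^ k * ofReal (wt 2 (2 ^ k * (x - c))) := fun x => by
    rw [mul_one, ← wt_neg 2 (2 ^ k * (c - x))]
    congr 3
    ring_nf
  simp only [e] at h
  rw [lint_const_mul (two_zpow_ne_top k)] at h
  calc _ = (2 ^ k * 2 ^ (-k)) * ∫⁻ x, ofReal (wt 2 (2 ^ k * (x - c))) := by
        rw [two_zpow_mul_neg, one_mul]
    _ = 2 ^ (-k) * (2 ^ k * ∫⁻ x, ofReal (wt 2 (2 ^ k * (x - c)))) := by ring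
    _ ≤ 2 ^ (-k) * 24 := mul_mono h
    _ = _ := mul_comm _ _

lemma lintegral_PP_far_le (h0 : 1 / 2 < ρ) (q : ℤ × ℤ) (k : ℤ) {J : ℝ≥0∞}
    (hJ : ∫⁻ t in cell q.1 q.2, h t ≤ J) :
    ∫⁻ x in (cell3 q.1 q.2)ᶜ, PP 6 k ((cell q.1 q.2).indicator h) x ^ ρ ≤
      (64 * (2 ^ k * J)) ^ ρ * (min 1 (2 ^ (q.1 - k)) * (24 * 2 ^ (-k))) := by
  have hρ : 0 ≤ ρ := by linarith
  have e : ∀ x ∈ (cell3 q.1 q.2)ᶜ, PP 6 k ((cell q.1 q.2).indicator h) x ^ ρ ≤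
      ((64 * (2 ^ k * J)) ^ ρ * min 1 (2 ^ (q.1 - k))) * ofReal (wt 2 (2 ^ k * (x - lep q))) := by
    intro x hx
    refine (rpow_le_rpow (PP_far_cell hx k hJ) hρ).trans ?_
    rw [mul_rpow hρ, mul_assoc]
    refine mul_mono ?_
    set u := 2 ^ k * (x - lep q)
    have h1 : ofReal (wt 6 u) ^ ρ ≤ ofReal (wt 1 u) * ofReal (wt 2 u) := by
      rw [← ofReal_mul (wt_nonneg _ _), ← wt_add, show 6 = 3 + 3 from rfl, wt_add]
      exact wt_mul_self_rpow_le 3 u (by linarith)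
    refine h1.trans (mul_le_mul' (le_min (ofReal_le_one.2 (wt_le_one _ _)) ?_) le_rfl)
    rw [← ofReal_two_zpow]
    refine ofReal_le_ofReal ?_
    have h2 := one_le_of_far hx (mem_cell.2 (dix_lep q))
    have h3 : (2 : ℝ) ^ (k - q.1) ≤ |u| := by
      have e3 : u = 2 ^ (k - q.1) * (2 ^ q.1 * (x - lep q)) := by
        rw [← mul_assoc, ← zpow_add₀ two_ne_zero, sub_add_cancel]
      rw [e3, abs_mul, abs_of_pos (by positivity : (0 : ℝ) < 2 ^ (k - q.1))]
      exact le_mul_of_one_le_right (by positivity) h2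
    have e4 : (2 : ℝ) ^ (q.1 - k) = (2 ^ (k - q.1))⁻¹ := by rw [← _root_.zpow_neg, neg_sub]
    rw [e4, wt, pow_one]
    exact inv_anti₀ (by positivity) (by linarith)
  refine (setLIntegral_mono' (measurableSet_cell3 _ _).compl e).trans ?_
  refine (setLIntegral_le_lintegral _ _).trans ?_
  have hm : Measurable fun x => ofReal (wt 2 (2 ^ k * (x - lep q))) :=
    ((measurable_wt 2).comp ((measurable_id.sub measurable_const).const_mul _)).ennreal_ofReal
  rw [lintegral_const_mul _ hm, mul_assoc]
  exact mul_mono (mul_mono (lintegral_wt_two_scaled_le k _))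

/-- The tail of the bad part: one interval, all scales. -/
lemma lintegral_PP_far_le_geo (h0 : 1 / 2 < ρ) (q : ℤ × ℤ) (k : ℤ) {L : ℝ≥0∞}
    (hJ : ∫⁻ t in cell q.1 q.2, h t ≤ L * 2 ^ (-q.1))
    (hJ' : k ≤ q.1 → ∫⁻ t in cell q.1 q.2, h t ≤ 2 ^ (k - q.1) * (L * 2 ^ (-q.1))) :
    ∫⁻ x in (cell3 q.1 q.2)ᶜ, PP 6 k ((cell q.1 q.2).indicator h) x ^ ρ ≤
      24 * (64 * L) ^ ρ * 2 ^ (-q.1) * ((if k ≤ q.1 then (2 ^ (k - q.1)) ^ (2 * ρ - 1) else 0) +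
        if q.1 ≤ k then (2 ^ (q.1 - k)) ^ (2 - ρ) else 0) := by
  have hρ : 0 ≤ ρ := by linarith
  have ekq : ∀ j : ℤ, (2 : ℝ≥0∞) ^ (-k) = (2 ^ (k - j)) ^ (-1 : ℝ) * 2 ^ (-j) := fun j => by
    rw [rpow_neg_one, ← ENNReal.zpow_neg, ← two_zpow_add]
    congr 1
    ring
  have hn0 : (2 : ℝ≥0∞) ^ (k - q.1) ≠ 0 := two_zpow_ne_zero _
  have hnt : (2 : ℝ≥0∞) ^ (k - q.1) ≠ ∞ := two_zpow_ne_top _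
  rcases le_total k q.1 with hk | hk
  · refine (lintegral_PP_far_le h0 q k (hJ' hk)).trans ?_
    rw [if_pos hk]
    have e1 : (64 * (2 ^ k * (2 ^ (k - q.1) * (L * 2 ^ (-q.1)))) : ℝ≥0∞) =
        (64 * L) * (2 ^ (k - q.1) * 2 ^ (k - q.1)) := by
      rw [show (2 : ℝ≥0∞) ^ (k - q.1) = 2 ^ k * 2 ^ (-q.1) by rw [← two_zpow_add]; rfl]
      ring
    calc _ ≤ (64 * (2 ^ k * (2 ^ (k - q.1) * (L * 2 ^ (-q.1)))) : ℝ≥0∞) ^ ρ *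
          (1 * (24 * 2 ^ (-k))) := mul_mono (mul_le_mul' (min_le_left _ _) le_rfl)
      _ = 24 * (64 * L) ^ ρ * 2 ^ (-q.1) * (2 ^ (k - q.1)) ^ (2 * ρ - 1) := by
        rw [e1, mul_rpow_of_nonneg (64 * (L : ℝ≥0∞)) _ hρ, ekq q.1,
          mul_rpow_of_nonneg (2 ^ (k - q.1)) _ hρ,
          show 2 * ρ - 1 = ρ + ρ + (-1 : ℝ) by ring, rpow_add _ _ hn0 hnt,
          rpow_add _ _ hn0 hnt]
        ring
      _ ≤ _ := mul_mono le_self_add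
  · refine (lintegral_PP_far_le h0 q k hJ).trans ?_
    rw [if_pos hk]
    have e1 : (64 * (2 ^ k * (L * 2 ^ (-q.1))) : ℝ≥0∞) = (64 * L) * 2 ^ (k - q.1) := by
      rw [show (2 : ℝ≥0∞) ^ (k - q.1) = 2 ^ k * 2 ^ (-q.1) by rw [← two_zpow_add]; rfl]
      ring
    have e2 : (2 : ℝ≥0∞) ^ (q.1 - k) = (2 ^ (k - q.1)) ^ (-1 : ℝ) := by
      rw [rpow_neg_one, ← ENNReal.zpow_neg, neg_sub]
    calc _ ≤ (64 * (2 ^ k * (L * 2 ^ (-q.1))) : ℝ≥0∞) ^ ρ *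
          (2 ^ (q.1 - k) * (24 * 2 ^ (-k))) :=
          mul_mono (mul_le_mul' (min_le_right _ _) le_rfl)
      _ = 24 * (64 * L) ^ ρ * 2 ^ (-q.1) * (2 ^ (q.1 - k)) ^ (2 - ρ) := by
        rw [e1, mul_rpow hρ, ekq q.1, e2, ← rpow_mul,
          show -1 * (2 - ρ) = ρ + (-1 : ℝ) + (-1 : ℝ) by ring, rpow_add _ _ hn0 hnt,
          rpow_add _ _ hn0 hnt]
        ring
      _ ≤ _ := mul_mono le_add_self

lemma bad_tail_le (h0 : 1 / 2 < ρ) (h1 : ρ < 1) : ∃ C : ℝ≥0,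
    ∀ {Q : Set (ℤ × ℤ)} {L : ℝ≥0∞} {h : ℤ → ℝ → ℝ≥0∞}, (∀ k, Measurable (h k)) →
    (∀ k t, h k t ≠ 0 → ∃ q ∈ Q, t ∈ cell q.1 q.2) →
    (∀ k, ∀ q ∈ Q, ∫⁻ t in cell q.1 q.2, h k t ≤ L * 2 ^ (-q.1)) →
    (∀ k, ∀ q ∈ Q, k ≤ q.1 → ∫⁻ t in cell q.1 q.2, h k t ≤ 2 ^ (k - q.1) * (L * 2 ^ (-q.1))) →
    ∀ (K : Finset ℤ), ∫⁻ x in (⋃ q ∈ Q, cell3 q.1 q.2)ᶜ, ∑ k ∈ K, PP 6 k (h k) x ^ ρ ≤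
      C * L ^ ρ * ∑' q : Q, (2 : ℝ≥0∞) ^ (-q.1.1) := by
  have hρ : 0 < ρ := by linarith
  have hg : geo (2 * ρ - 1) + geo (2 - ρ) ≠ ∞ :=
    add_ne_top.2 ⟨geo_ne_top (by linarith), geo_ne_top (by linarith)⟩
  refine ⟨24 * 64 ^ ρ * (geo (2 * ρ - 1) + geo (2 - ρ)).toNNReal,
    fun {Q L h} hm hsupp hJ hJ' K => ?_⟩
  have e1 : ∀ k x, PP 6 k (h k) x ^ ρ ≤
      ∑' q : Q, PP 6 k ((cell q.1.1 q.1.2).indicator (h k)) x ^ ρ := by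
    intro k x
    refine le_trans (rpow_le_rpow ?_ hρ.le) (rpow_tsum_le_tsum_rpow _ hρ h1.le)
    rw [← PP_tsum]
    · refine PP_mono (fun t => ?_) x
      by_cases ht : h k t = 0
      · rw [ht]; exact zero_le
      · obtain ⟨q, hq, htq⟩ := hsupp k t ht
        refine le_trans ?_ (ENNReal.le_tsum (⟨q, hq⟩ : Q))
        rw [indicator_of_mem htq]
    · exact fun q => (hm k).indicator (measurableSet_cell _ _)
  calc _ ≤ ∫⁻ x in (⋃ q ∈ Q, cell3 q.1 q.2)ᶜ, ∑ k ∈ K,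
        ∑' q : Q, PP 6 k ((cell q.1.1 q.1.2).indicator (h k)) x ^ ρ :=
        lintegral_mono fun x => sum_le_sum fun k _ => e1 k x
    _ = ∑ k ∈ K, ∑' q : Q, ∫⁻ x in (⋃ q ∈ Q, cell3 q.1 q.2)ᶜ,
        PP 6 k ((cell q.1.1 q.1.2).indicator (h k)) x ^ ρ := by
      have hmm : ∀ k (q : Q), Measurable fun x =>
          PP 6 k ((cell q.1.1 q.1.2).indicator (h k)) x ^ ρ := fun k q =>
        (measurable_PP ((hm k).indicator (measurableSet_cell _ _))).pow_const _
      rw [lintegral_finsetSum _ fun k _ => Measurable.tsum (hmm k)]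
      refine sum_congr rfl fun k _ => ?_
      rw [lintegral_tsum fun q => (hmm k q).aemeasurable]
    _ ≤ ∑ k ∈ K, ∑' q : Q, 24 * (64 * L) ^ ρ * 2 ^ (-q.1.1) *
        ((if k ≤ q.1.1 then (2 ^ (k - q.1.1)) ^ (2 * ρ - 1) else 0) +
        if q.1.1 ≤ k then (2 ^ (q.1.1 - k)) ^ (2 - ρ) else 0) := by
      refine sum_le_sum fun k _ => ENNReal.tsum_le_tsum fun q => ?_
      refine (lintegral_mono_set (Set.compl_subset_compl.2 ?_)).trans
        (lintegral_PP_far_le_geo h0 q.1 k (hJ k q.1 q.2) (hJ' k q.1 q.2))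
      exact Set.subset_biUnion_of_mem (u := fun q : ℤ × ℤ => cell3 q.1 q.2) q.2
    _ ≤ ∑' k : ℤ, ∑' q : Q, 24 * (64 * L) ^ ρ * 2 ^ (-q.1.1) *
        ((if k ≤ q.1.1 then (2 ^ (k - q.1.1)) ^ (2 * ρ - 1) else 0) +
        if q.1.1 ≤ k then (2 ^ (q.1.1 - k)) ^ (2 - ρ) else 0) := ENNReal.sum_le_tsum K
    _ = _ := by
      rw [ENNReal.tsum_comm]
      simp only [ENNReal.tsum_mul_left, ENNReal.tsum_mul_right, ENNReal.tsum_add, tsum_le_geo,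
        tsum_ge_geo]
      push_cast
      rw [coe_toNNReal hg, coe_rpow_of_nonneg _ hρ.le, mul_rpow hρ.le]
      push_cast
      ring

/-- The kernel of the averaging operator over the intervals of `Q`. -/
def avgK (Q : Set (ℤ × ℤ)) (x t : ℝ) : ℝ≥0∞ :=
  ∑' q : Q, (cell q.1.1 q.1.2).indicator 1 x * (cell q.1.1 q.1.2).indicator (fun _ => 2 ^ q.1.1) t

lemma measurable_avgK (Q : Set (ℤ × ℤ)) : Measurable (uncurry (avgK Q)) :=
  Measurable.tsum fun q =>
    ((measurable_one.indicator (measurableSet_cell _ _)).comp measurable_fst).mul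
      ((measurable_const.indicator (measurableSet_cell _ _)).comp measurable_snd)

lemma avgK_comm (Q : Set (ℤ × ℤ)) (x t : ℝ) : avgK Q x t = avgK Q t x := by
  refine tsum_congr fun q => ?_
  by_cases hx : x ∈ cell q.1.1 q.1.2 <;> by_cases ht : t ∈ cell q.1.1 q.1.2 <;> simp [hx, ht]

lemma avgK_of_notMem {Q : Set (ℤ × ℤ)} (hx : ∀ q ∈ Q, x ∉ cell q.1 q.2) (t : ℝ) :
    avgK Q x t = 0 := by
  refine ENNReal.tsum_eq_zero.2 fun q => ?_
  simp [hx q.1 q.2]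

section

variable {Q : Set (ℤ × ℤ)} (hd : Q.PairwiseDisjoint fun q => cell q.1 q.2)
include hd

lemma avgK_of_mem {q : ℤ × ℤ} (hq : q ∈ Q) (hx : x ∈ cell q.1 q.2) :
    avgK Q x = (cell q.1 q.2).indicator fun _ => 2 ^ q.1 := by
  funext t
  refine (tsum_eq_single (⟨q, hq⟩ : Q) fun q' hne => ?_).trans (by simp [hx])
  have h : x ∉ cell q'.1.1 q'.1.2 := fun h =>
    disjoint_left.1 (hd q'.2 hq fun e => hne (Subtype.ext e)) h hx
  simp [h]

lemma lintegral_avgK_mul {q : ℤ × ℤ} (hq : q ∈ Q) (hx : x ∈ cell q.1 q.2) (h : ℝ → ℝ≥0∞) :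
    ∫⁻ t, avgK Q x t * h t = 2 ^ q.1 * ∫⁻ t in cell q.1 q.2, h t := by
  rw [avgK_of_mem hd hq hx, ← lint_const_mul (two_zpow_ne_top _),
    ← lintegral_indicator (measurableSet_cell _ _)]
  refine lintegral_congr fun t => ?_
  by_cases ht : t ∈ cell q.1 q.2 <;> simp [ht]

lemma avgK_ne_top (x t : ℝ) : avgK Q x t ≠ ∞ := by
  by_cases hx : ∃ q ∈ Q, x ∈ cell q.1 q.2
  · obtain ⟨q, hq, hx⟩ := hx
    rw [avgK_of_mem hd hq hx]
    by_cases ht : t ∈ cell q.1 q.2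
    · rw [indicator_of_mem ht]; exact two_zpow_ne_top _
    · rw [indicator_of_notMem ht]; exact zero_ne_top
  · push Not at hx
    rw [avgK_of_notMem hx]; exact zero_ne_top

lemma lintegral_avgK_eq_one {q : ℤ × ℤ} (hq : q ∈ Q) (hx : x ∈ cell q.1 q.2) :
    ∫⁻ t, avgK Q x t = 1 := by
  have := lintegral_avgK_mul hd hq hx 1
  simp only [Pi.one_apply, mul_one, lintegral_one, Measure.restrict_apply, MeasurableSet.univ,
    Set.univ_inter, volume_cell] at this
  rw [this, two_zpow_mul_neg]

lemma lintegral_avgK_le_one (x : ℝ) : ∫⁻ t, avgK Q x t ≤ 1 := by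
  by_cases hx : ∃ q ∈ Q, x ∈ cell q.1 q.2
  · obtain ⟨q, hq, hx⟩ := hx
    exact (lintegral_avgK_eq_one hd hq hx).le
  · push Not at hx
    simp [avgK_of_notMem hx]

end

/-- The complex-valued version of `avgK`. -/
def avgC (Q : Set (ℤ × ℤ)) (x t : ℝ) : ℂ := ((avgK Q x t).toReal : ℂ)

lemma measurable_avgC (Q : Set (ℤ × ℤ)) : Measurable (uncurry (avgC Q)) :=
  Complex.measurable_ofReal.comp (measurable_avgK Q).ennreal_toReal

lemma enorm_avgC {Q : Set (ℤ × ℤ)} (hd : Q.PairwiseDisjoint fun q => cell q.1 q.2) (x t : ℝ) :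
    ‖avgC Q x t‖ₑ = avgK Q x t := by
  rw [avgC, ← ofReal_norm, norm_real, norm_of_nonneg toReal_nonneg,
    ofReal_toReal (avgK_ne_top hd x t)]

/-- The union of the intervals of `Q`. -/
def cup (Q : Set (ℤ × ℤ)) : Set ℝ := ⋃ q ∈ Q, cell q.1 q.2

lemma mem_cup {Q : Set (ℤ × ℤ)} : x ∈ cup Q ↔ ∃ q ∈ Q, x ∈ cell q.1 q.2 := by
  simp [cup]

lemma measurableSet_cup (Q : Set (ℤ × ℤ)) : MeasurableSet (cup Q) :=
  MeasurableSet.biUnion Q.to_countable fun q _ => measurableSet_cell q.1 q.2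

/-- The average of `F` over the intervals of `Q`, in the first variable. -/
def goodPart (Q : Set (ℤ × ℤ)) (F : ℝ → ℝ → ℂ) (x y : ℝ) : ℂ :=
  (cup Q)ᶜ.indicator (fun x => F x y) x + opx (avgC Q) F x y

section

variable {Q : Set (ℤ × ℤ)} (hd : Q.PairwiseDisjoint fun q => cell q.1 q.2)
include hd

lemma dec2_opx_avgC (hk : ∀ q ∈ Q, k₀ ≤ q.1) (hF : Dec2 F) : Dec2 (opx (avgC Q) F) := by
  obtain ⟨C, hC0, hC⟩ := hF.exists_bound
  refine ⟨stronglyMeasurable_opx (measurable_avgC Q) hF.1, C * (1 + 2 ^ (-k₀)) ^ 2, fun x y => ?_⟩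
  have hw := wt_nonneg 2 x
  have hw' := wt_nonneg 2 y
  rw [← ofReal_le_ofReal_iff (by positivity), ofReal_norm]
  refine (enorm_integral_le_lintegral_enorm _).trans ?_
  refine (lintegral_mono (g := fun t => ofReal
    (C * (1 + 2 ^ (-k₀)) ^ 2 * (wt 2 x * wt 2 y)) * avgK Q x t) fun t => ?_).trans ?_
  · show ‖avgC Q x t • F t y‖ₑ ≤ _
    rw [enorm_smul, enorm_avgC hd, mul_comm]
    by_cases h0 : avgK Q x t = 0
    · simp [h0]
    refine mul_le_mul' ?_ le_rfl
    obtain ⟨q, hq, hx, ht⟩ : ∃ q ∈ Q, x ∈ cell q.1 q.2 ∧ t ∈ cell q.1 q.2 := by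
      by_contra hcon
      push Not at hcon
      refine h0 (ENNReal.tsum_eq_zero.2 fun q => ?_)
      by_cases hx : x ∈ cell q.1.1 q.1.2
      · simp [hcon q.1 q.2 hx]
      · simp [hx]
    rw [← ofReal_norm]
    refine ofReal_le_ofReal ((hC t y).trans ?_)
    have h1 : |t - x| ≤ 2 ^ (-k₀) := by
      have := abs_dix_congr (k := 0) ((mem_cell.1 ht).trans (mem_cell.1 hx).symm)
      rw [zpow_zero, one_mul] at this
      refine this.trans (zpow_le_zpow_right₀ (by norm_num) ?_)
      linarith [hk q hq]
    have h2 : wt 2 t ≤ (1 + 2 ^ (-k₀)) ^ 2 * wt 2 x := (wt_shift 2 t x).trans (by gcongr)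
    calc C * (wt 2 t * wt 2 y) ≤ C * (((1 + 2 ^ (-k₀)) ^ 2 * wt 2 x) * wt 2 y) := by gcongr
      _ = _ := by ring
  · rw [lint_const_mul ofReal_ne_top]
    exact (mul_mono (lintegral_avgK_le_one hd x)).trans (mul_one _).le

lemma dec2_goodPart (hk : ∀ q ∈ Q, k₀ ≤ q.1) (hF : Dec2 F) : Dec2 (goodPart Q F) := by
  refine Dec2.add (hF.of_norm_le (D := 1) ?_ fun x y => ?_) (dec2_opx_avgC hd hk hF)
  · have : (uncurry fun x y => (cup Q)ᶜ.indicator (fun x => F x y) x) =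
        (Prod.fst ⁻¹' (cup Q)ᶜ).indicator (uncurry F) := by
      funext ⟨x, y⟩; rfl
    rw [this]
    exact hF.1.indicator (measurable_fst (measurableSet_cup Q).compl)
  · rw [one_mul]; exact norm_indicator_le_norm_self _ _

lemma hn_goodPart_le (hp : 1 < p) (hF : Dec2 F) {q : ℤ × ℤ} (hq : q ∈ Q) (hx : x ∈ cell q.1 q.2) :
    hn p (goodPart Q F) x ≤ 2 ^ q.1 * ∫⁻ t in cell q.1 q.2, hn p F t := by
  have e : goodPart Q F x = opx (avgC Q) F x := by
    funext y
    rw [goodPart, indicator_of_notMem, zero_add]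
    simpa using mem_cup.2 ⟨q, hq, hx⟩
  rw [hn, e, ← lintegral_avgK_mul hd hq hx]
  have h2 : ((2 ^ q.1 : ℝ≥0∞).toNNReal : ℝ≥0∞) = 2 ^ q.1 := coe_toNNReal (two_zpow_ne_top _)
  refine (hn_opx_le hp ((measurable_avgC Q).comp measurable_prodMk_left)
    (M := (2 ^ q.1 : ℝ≥0∞).toNNReal) (fun t => ?_) hF).trans ?_
  · rw [enorm_avgC hd, avgK_of_mem hd hq hx, h2]
    exact Set.indicator_le_self' (fun _ _ => by simp) _
  · simp only [enorm_avgC hd]; exact le_rfl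

omit hd in
lemma hn_goodPart_of_notMem (p : ℝ≥0∞) (F : ℝ → ℝ → ℂ) (hx : x ∉ cup Q) :
    hn p (goodPart Q F) x = hn p F x := by
  have : goodPart Q F x = F x := by
    funext y
    have h1 : ∀ t, avgC Q x t = 0 := fun t => by
      rw [avgC, avgK_of_notMem (fun q hq h => hx (mem_cup.2 ⟨q, hq, h⟩))]; simp
    have h2 : opx (avgC Q) F x y = 0 := by
      show ∫ t, avgC Q x t • F t y = 0
      simp [h1]
    rw [goodPart, h2, add_zero, indicator_of_mem (by simpa using hx)]
  rw [hn, this, hn]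

end

lemma enorm_kA_sub_le (hη : Ker A η) (k : ℤ) {q : ℤ × ℤ} {t : ℝ} (ht : t ∈ cell q.1 q.2)
    (hx : x ∈ cell q.1 q.2) (z : ℝ) :
    ‖kA η k z t - kA η k z x‖ₑ ≤ ofReal (2 ^ 8 * A) * min 1 (2 ^ (k - q.1)) *
      (2 ^ k * ofReal (wt 6 (2 ^ k * (z - t))) + 2 ^ k * ofReal (wt 6 (2 ^ k * (z - x)))) := by
  have hA := hη.nonneg
  have hz := abs_le.1 (abs_sub_zz_le k z)
  have h16 : wt 16 (2 ^ k * (zz k z - t)) ≤ 2 ^ 8 * wt 6 (2 ^ k * (z - t)) :=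
    (wt_anti (show 8 ≤ 16 by norm_num) _).trans ((wt_shift_le 8 (s := 2 ^ k * (zz k z - t))
      (t := 2 ^ k * (z - t)) (by rw [← mul_sub, abs_le]; constructor <;> nlinarith)).trans
      (mul_le_mul_of_nonneg_left (wt_anti (by norm_num) _) (by norm_num)))
  have key : ∀ c : ℝ, 0 ≤ c → ‖kA η k z t - kA η k z x‖ ≤ 2 ^ 8 * A * c *
      (2 ^ k * wt 6 (2 ^ k * (z - t)) + 2 ^ k * wt 6 (2 ^ k * (z - x))) →
      ‖kA η k z t - kA η k z x‖ₑ ≤ ofReal (2 ^ 8 * A) * ofReal c *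
      (2 ^ k * ofReal (wt 6 (2 ^ k * (z - t))) +
        2 ^ k * ofReal (wt 6 (2 ^ k * (z - x)))) := fun c hc h => by
    have h1 := wt_nonneg 6 (2 ^ k * (z - t))
    have h2 := wt_nonneg 6 (2 ^ k * (z - x))
    rw [← ofReal_norm, ← ofReal_two_zpow, ← ofReal_mul (by positivity),
      ← ofReal_mul (by positivity), ← ofReal_mul (by positivity),
      ← ofReal_add (by positivity) (by positivity), ← ofReal_mul (by positivity)]
    exact ofReal_le_ofReal h
  rcases le_total k q.1 with hk | hk
  · have e1 : (2 : ℝ) ^ (k - q.1) ≤ 1 := zpow_le_one_of_nonpos₀ (by norm_num) (by omega)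
    rw [min_eq_right (by rw [← ofReal_two_zpow]; exact ofReal_le_one.2 e1),
      ← ofReal_two_zpow (k - q.1)]
    refine key _ (by positivity) ?_
    have h1 := abs_dix_congr (k := k) ((mem_cell.1 ht).trans (mem_cell.1 hx).symm)
    have e2 : zz k z - t - (zz k z - x) = -(t - x) := by ring
    have h2 := hη.norm_dil_sub_le k (x := zz k z - t) (x' := zz k z - x) (by
      rw [e2, mul_neg, abs_neg]; exact h1.trans e1)
    rw [e2, mul_neg, abs_neg] at h2
    refine h2.trans ?_
    have hw := wt_nonneg 16 (2 ^ k * (zz k z - t))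
    have hw' := wt_nonneg 6 (2 ^ k * (z - x))
    calc A * |2 ^ k * (t - x)| * (2 ^ k * wt 16 (2 ^ k * (zz k z - t)))
        ≤ A * 2 ^ (k - q.1) * (2 ^ k * (2 ^ 8 * wt 6 (2 ^ k * (z - t)))) := by gcongr
      _ = 2 ^ 8 * A * 2 ^ (k - q.1) * (2 ^ k * wt 6 (2 ^ k * (z - t)) + 0) := by ring
      _ ≤ _ := by gcongr; positivity
  · rw [min_eq_left (by
      rw [← ofReal_two_zpow, one_le_ofReal]
      exact one_le_zpow₀ (by norm_num) (by omega)), ← ofReal_one]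
    refine key 1 zero_le_one ?_
    have h1 : ∀ a, ‖kA η k z a‖ ≤ 2 ^ 8 * A * (2 ^ k * wt 6 (2 ^ k * (z - a))) := fun a =>
      (norm_kA_le hη k z a).trans (by gcongr; exact wt_anti (by norm_num) _)
    refine (norm_sub_le _ _).trans ((add_le_add (h1 t) (h1 x)).trans (le_of_eq ?_))
    ring

/-- The gain of the bad part at the scale `k`. -/
def gain (Q : Set (ℤ × ℤ)) (k : ℤ) (t : ℝ) : ℝ≥0∞ :=
  ∑' q : Q, (cell q.1.1 q.1.2).indicator (fun _ => min 1 (2 ^ (k - q.1.1))) t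

lemma measurable_gain (Q : Set (ℤ × ℤ)) (k : ℤ) : Measurable (gain Q k) :=
  Measurable.tsum fun _ => measurable_const.indicator (measurableSet_cell _ _)

/-- The majorant of the bad part. -/
def badH (Q : Set (ℤ × ℤ)) (k : ℤ) (h : ℝ → ℝ≥0∞) (t : ℝ) : ℝ≥0∞ :=
  gain Q k t * (h t + ∫⁻ s, avgK Q t s * h s)

lemma measurable_badH (Q : Set (ℤ × ℤ)) (k : ℤ) (hm : Measurable h) : Measurable (badH Q k h) :=
  (measurable_gain Q k).mul (hm.add
    ((measurable_avgK Q).mul (hm.comp measurable_snd)).lintegral_prod_right)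

lemma badH_ne_zero {Q : Set (ℤ × ℤ)} {t : ℝ} (h0 : badH Q k h t ≠ 0) :
    ∃ q ∈ Q, t ∈ cell q.1 q.2 := by
  by_contra hcon
  push Not at hcon
  refine h0 (mul_eq_zero_of_left (ENNReal.tsum_eq_zero.2 fun q => ?_) _)
  exact indicator_of_notMem (hcon q.1 q.2) _

section

variable {Q : Set (ℤ × ℤ)} (hd : Q.PairwiseDisjoint fun q => cell q.1 q.2)
include hd

lemma gain_of_mem (k : ℤ) {q : ℤ × ℤ} (hq : q ∈ Q) {t : ℝ} (ht : t ∈ cell q.1 q.2) :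
    gain Q k t = min 1 (2 ^ (k - q.1)) := by
  refine (tsum_eq_single (⟨q, hq⟩ : Q) fun q' hne => ?_).trans (by simp [ht])
  exact indicator_of_notMem (fun h =>
    disjoint_left.1 (hd q'.2 hq fun e => hne (Subtype.ext e)) h ht) _

lemma setLIntegral_badH (k : ℤ) (hm : Measurable h) {q : ℤ × ℤ} (hq : q ∈ Q) :
    ∫⁻ t in cell q.1 q.2, badH Q k h t =
      min 1 (2 ^ (k - q.1)) * (2 * ∫⁻ t in cell q.1 q.2, h t) := by
  rw [setLIntegral_congr_fun (g := fun t => min 1 (2 ^ (k - q.1)) *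
    (h t + 2 ^ q.1 * ∫⁻ s in cell q.1 q.2, h s)) (measurableSet_cell _ _) fun t ht => ?_]
  · rw [lintegral_const_mul _ (hm.add_const _), lintegral_add_left hm, lintegral_const,
      Measure.restrict_apply MeasurableSet.univ, Set.univ_inter, volume_cell, mul_right_comm,
      two_zpow_mul_neg, one_mul, two_mul]
  · show badH Q k h t = _
    rw [badH, gain_of_mem hd k hq ht, lintegral_avgK_mul hd hq ht]

set_option maxHeartbeats 400000 in
/-- The analysis of the bad part. -/
lemma hn_opx_bad_le (hp : 1 < p) (hη : Ker A η) (hF : Dec2 F) (k : ℤ) (z : ℝ) :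
    hn p (opx (kA η k) fun x y => F x y - goodPart Q F x y) z ≤
      PP 6 k (fun t => ofReal (2 ^ 8 * A) * badH Q k (hn p F) t) z := by
  have hkm : Measurable (kA η k z) := 
    (measurable_dil hη.meas k).comp (measurable_const.sub measurable_id)
  have hAm : Measurable fun w : ℝ × ℝ => avgC Q w.1 w.2 := measurable_avgC Q
  obtain ⟨M, hM0, hM⟩ : ∃ M : ℝ, 0 ≤ M ∧ ∀ a, ‖kA η k z a‖ ≤ M := by
    refine ⟨2 ^ 8 * A * 2 ^ k, mul_nonneg (mul_nonneg (by norm_num) hη.nonneg) (by positivity),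
      fun a => (norm_kA_le hη k z a).trans ?_⟩
    refine mul_le_mul_of_nonneg_left ?_ (mul_nonneg (by norm_num) hη.nonneg)
    exact mul_le_of_le_one_right (by positivity) (wt_le_one _ _)
  have hMe : ∀ a, ‖kA η k z a‖ₑ ≤ ofReal M := fun a => by
    rw [← ofReal_norm]; exact ofReal_le_ofReal (hM a)
  have hA1 : ∀ t, ∫⁻ x, ‖avgC Q x t‖ₑ ≤ 1 := fun t => by
    simp only [enorm_avgC hd, avgK_comm Q _ t]
    exact lintegral_avgK_le_one hd t
  have hI : ∀ t (c : ℝ → ℂ), Measurable c → (∀ x, ‖c x‖ₑ ≤ ofReal M) →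
      Integrable fun x => avgC Q x t * c x := fun t c hc hcM => by
    refine ⟨((hAm.comp measurable_prodMk_right).mul hc).aestronglyMeasurable, ?_⟩
    refine lt_of_le_of_lt (lintegral_mono (g := fun x => ofReal M * ‖avgC Q x t‖ₑ) fun x => ?_) ?_
    · rw [enorm_mul, mul_comm]
      exact mul_le_mul' (hcM x) le_rfl
    · rw [lint_const_mul ofReal_ne_top]
      exact (mul_lt_top ofReal_lt_top ((hA1 t).trans_lt one_lt_top))
  set κ : ℝ → ℝ → ℂ := fun z t =>
    (cup Q).indicator (kA η k z) t - ∫ x, avgC Q x t * kA η k z x with hκ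
  have hκm : Measurable (κ z) := by
    refine (hkm.indicator (measurableSet_cup Q)).sub ?_
    have : StronglyMeasurable fun w : ℝ × ℝ => avgC Q w.2 w.1 * kA η k z w.2 :=
      ((hAm.comp measurable_swap).mul (hkm.comp measurable_snd)).stronglyMeasurable
    exact this.integral_prod_right.measurable
  -- the kernel bound
  set D := ofReal (2 ^ 8 * A) with hD
  set W : ℝ → ℝ≥0∞ := fun t => 2 ^ k * ofReal (wt 6 (2 ^ k * (z - t))) with hW
  have hWm : Measurable W := (((measurable_wt 6).comp
    ((measurable_const.sub measurable_id).const_mul _)).ennreal_ofReal).const_mul _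
  have hκ0 : ∀ t, t ∉ cup Q → κ z t = 0 := fun t ht => by
    have : ∀ x, avgC Q x t = 0 := fun x => by
      rw [avgC, avgK_comm, avgK_of_notMem fun q hq h => ht (mem_cup.2 ⟨q, hq, h⟩)]; simp
    simp [hκ, ht, this]
  have hκe : ∀ t, t ∈ cup Q → κ z t = ∫ x, avgC Q x t * (kA η k z t - kA η k z x) := by
    intro t ht
    obtain ⟨q, hq, hqt⟩ := mem_cup.1 ht
    have e1 : ∫ x, avgC Q x t = 1 := by
      have e : (fun x => avgC Q x t) = fun x => (((avgK Q t x).toReal : ℝ) : ℂ) := by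
        funext x; rw [avgC, avgK_comm]
      have hm : Measurable fun x => avgK Q t x := measurable_slice (measurable_avgK Q) t
      rw [e, integral_complex_ofReal, integral_toReal
        hm.aemeasurable (.of_forall fun x => (avgK_ne_top hd t x).lt_top),
        lintegral_avgK_eq_one hd hq hqt]
      simp
    simp only [mul_sub]
    rw [integral_sub (hI t _ measurable_const fun _ => hMe t) (hI t _ hkm hMe),
      integral_mul_const, e1, one_mul, hκ]
    simp only [indicator_of_mem ht]
  have hκb : ∀ t, ‖κ z t‖ₑ ≤ D * (gain Q k t * W t + ∫⁻ x, avgK Q x t * (gain Q k x * W x)) := by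
    intro t
    by_cases ht : t ∈ cup Q
    swap
    · rw [hκ0 t ht]; simp
    obtain ⟨q, hq, hqt⟩ := mem_cup.1 ht
    rw [hκe t ht]
    refine (enorm_integral_le_lintegral_enorm _).trans ?_
    calc ∫⁻ x, ‖avgC Q x t * (kA η k z t - kA η k z x)‖ₑ
        ≤ ∫⁻ x, (D * (gain Q k t * W t) * avgK Q x t + D * (avgK Q x t * (gain Q k x * W x))) := by
          refine lintegral_mono fun x => ?_
          rw [enorm_mul, enorm_avgC hd]
          by_cases hx : x ∈ cell q.1 q.2
          · refine (mul_mono (enorm_kA_sub_le hη k hqt hx z)).trans (le_of_eq ?_)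
            rw [gain_of_mem hd k hq hqt, gain_of_mem hd k hq hx]
            ring
          · have : avgK Q x t = 0 := by
              rw [avgK_comm, avgK_of_mem hd hq hqt, indicator_of_notMem hx]
            simp [this]
      _ ≤ _ := by
          have hm1 : Measurable fun x => avgK Q x t :=
            (measurable_avgK Q).comp measurable_prodMk_right
          rw [lintegral_add_left (hm1.const_mul _), lintegral_const_mul _ hm1,
            lint_const_mul ofReal_ne_top, mul_add]
          refine add_le_add ?_ le_rfl
          have := hA1 t
          simp only [enorm_avgC hd] at this
          exact (mul_mono this).trans (mul_one _).le
  -- the operator identity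
  have hop : opx (kA η k) (fun x y => F x y - goodPart Q F x y) z = opx κ F z := by
    funext y
    have hu := hF.right y
    have hi1 : Integrable fun t => (cup Q).indicator (kA η k z) t * F t y :=
      op_integrable (κ := fun _ t => (cup Q).indicator (kA η k z) t)
        ((hkm.indicator (measurableSet_cup Q)).comp measurable_snd) (x := z)
        (fun a => (norm_indicator_le_norm_self _ _).trans (hM a)) hu
    have hi3 : Integrable (uncurry fun x t => kA η k z x * (avgC Q x t * F t y)) := by
      refine ⟨((hkm.comp measurable_fst).mul (hAm.mul
        (hu.1.measurable.comp measurable_snd))).aestronglyMeasurable, ?_⟩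
      have hm : Measurable fun w : ℝ × ℝ => ‖kA η k z w.1 * (avgC Q w.1 w.2 * F w.2 y)‖ₑ :=
        ((hkm.comp measurable_fst).mul (hAm.mul (hu.1.measurable.comp measurable_snd))).enorm
      refine lt_of_eq_of_lt (lintegral_prod_symm' _ hm) ?_
      refine lt_of_le_of_lt (lintegral_mono (g := fun t => ofReal M * ‖F t y‖ₑ) fun t => ?_) ?_
      · refine (lintegral_mono (g := fun x => ofReal M * ‖F t y‖ₑ * ‖avgC Q x t‖ₑ)
          fun x => ?_).trans ?_
        · simp only [uncurry, enorm_mul]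
          rw [mul_comm ‖avgC Q x t‖ₑ, ← mul_assoc]
          exact mul_le_mul' (mul_le_mul' (hMe x) le_rfl) le_rfl
        · rw [lint_const_mul (mul_ne_top ofReal_ne_top enorm_ne_top)]
          exact (mul_mono (hA1 t)).trans (mul_one _).le
      · rw [lint_const_mul ofReal_ne_top]
        exact mul_lt_top ofReal_lt_top hu.integrable.2
    have e1 : ∀ x, kA η k z x • (F x y - goodPart Q F x y) =
        (cup Q).indicator (kA η k z) x * F x y - ∫ t, kA η k z x * (avgC Q x t * F t y) := by
      intro x
      rw [integral_const_mul]
      show _ = _ - kA η k z x * opx (avgC Q) F x y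
      by_cases hx : x ∈ cup Q
      · rw [goodPart, indicator_of_notMem (by simpa using hx), indicator_of_mem hx, smul_eq_mul]
        ring
      · rw [goodPart, indicator_of_mem (by simpa using hx), indicator_of_notMem hx, smul_eq_mul]
        ring
    have e2 : ∀ t, κ z t • F t y = (cup Q).indicator (kA η k z) t * F t y -
        ∫ x, kA η k z x * (avgC Q x t * F t y) := by
      intro t
      rw [smul_eq_mul, hκ]
      simp only [sub_mul]
      rw [← integral_mul_const]
      congr 2
      funext x
      ring
    show ∫ x, kA η k z x • (F x y - goodPart Q F x y) = ∫ t, κ z t • F t y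
    simp only [e1, e2]
    have hi4 : Integrable fun x => ∫ t, kA η k z x * (avgC Q x t * F t y) := hi3.integral_prod_left
    have hi5 : Integrable fun t => ∫ x, kA η k z x * (avgC Q x t * F t y) := hi3.integral_prod_right
    rw [integral_sub hi1 hi4, integral_sub hi1 hi5, integral_integral_swap hi3]
  rw [hn, hop]
  have hbd : ∀ t, ‖κ z t‖ₑ ≤ ((ofReal M + ofReal M).toNNReal : ℝ≥0) := fun t => by
    rw [coe_toNNReal (by finiteness)]
    refine enorm_sub_le.trans (add_le_add ?_ ?_)
    · exact (enorm_indicator_le_enorm_self _ _).trans (hMe t)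
    · refine (enorm_integral_le_lintegral_enorm _).trans ((lintegral_mono
        (g := fun x => ofReal M * ‖avgC Q x t‖ₑ) fun x => ?_).trans ?_)
      · rw [enorm_mul, mul_comm]; exact mul_le_mul' (hMe x) le_rfl
      · rw [lint_const_mul ofReal_ne_top]
        exact (mul_mono (hA1 t)).trans (mul_one _).le
  refine (hn_opx_le hp hκm hbd hF).trans ?_
  have hh := hF.measurable_hn p
  have hg := measurable_gain Q k
  have hm1 : Measurable fun t => gain Q k t * W t * hn p F t := (hg.mul hWm).mul hh
  have hm2 : Measurable (uncurry fun t x => avgK Q x t * (gain Q k x * W x) * hn p F t) :=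
    ((((measurable_avgK Q).comp measurable_swap).mul
      ((hg.mul hWm).comp measurable_snd)).mul (hh.comp measurable_fst))
  calc ∫⁻ t, ‖κ z t‖ₑ * hn p F t
      ≤ ∫⁻ t, (D * (gain Q k t * W t * hn p F t) +
          D * ∫⁻ x, avgK Q x t * (gain Q k x * W x) * hn p F t) := by
        refine lintegral_mono fun t => (mul_le_mul' (hκb t) le_rfl).trans (le_of_eq ?_)
        have hm : Measurable fun x => avgK Q x t * (gain Q k x * W x) :=
          Measurable.mul ((measurable_avgK Q).comp measurable_prodMk_right) (hg.mul hWm)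
        rw [lintegral_mul_const _ hm]
        ring
    _ = D * (∫⁻ t, gain Q k t * W t * hn p F t) +
          D * ∫⁻ x, ∫⁻ t, avgK Q x t * (gain Q k x * W x) * hn p F t := by
        rw [lintegral_add_left (hm1.const_mul D), lint_const_mul ofReal_ne_top,
          lint_const_mul ofReal_ne_top, lintegral_lintegral_swap hm2.aemeasurable]
    _ = _ := by
        rw [PP_eq, ← mul_add, ← lintegral_add_left hm1, ← lint_const_mul ofReal_ne_top]
        refine lintegral_congr fun x => ?_
        have : ∫⁻ t, avgK Q x t * (gain Q k x * W x) * hn p F t =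
            gain Q k x * W x * ∫⁻ t, avgK Q x t * hn p F t := by
          have hm : Measurable fun t => avgK Q x t * hn p F t :=
            Measurable.mul (measurable_slice (measurable_avgK Q) x) hh
          rw [← lintegral_const_mul _ hm]
          exact lintegral_congr fun t => by ring
        rw [this, badH]
        ring

end

section bilinear
variable {A : ℝ} {κ : ℤ → ℝ → ℝ → ℂ}

lemma opx_add (hκ : KerOp A κ) (k : ℤ) (hF : Dec2 F) (hG : Dec2 G) :
    opx (κ k) (fun x y => F x y + G x y) = fun x y => opx (κ k) F x y + opx (κ k) G x y :=
  funext fun x => funext fun y => hκ.op_add k (hF.right y) (hG.right y) x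

lemma opy_add (hκ : KerOp A κ) (k : ℤ) (hF : Dec2 F) (hG : Dec2 G) :
    opy (κ k) (fun x y => F x y + G x y) = fun x y => opy (κ k) F x y + opy (κ k) G x y :=
  funext fun x => funext fun y => hκ.op_add k (hF.left x) (hG.left x) y

lemma ana_add (hη : Ker A η) (hθ : Ker A θ) (k l : ℤ) (hF : Dec2 F) (hG : Dec2 G) :
    ana η θ k l (fun x y => F x y + G x y) = fun x y => ana η θ k l F x y + ana η θ k l G x y := by
  rw [ana, opx_add hη.kA k hF hG, opy_add hθ.kA l (hF.opx hη.kA k) (hG.opx hη.kA k)]; rfl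

lemma syn_add (hη : Ker A η) (hθ : Ker A θ) (k l : ℤ) (hF : Dec2 F) (hG : Dec2 G) :
    syn η θ k l (fun x y => F x y + G x y) = fun x y => syn η θ k l F x y + syn η θ k l G x y := by
  rw [syn, opy_add hθ.kS l hF hG, opx_add hη.kS k (hF.opy hθ.kS l) (hG.opy hθ.kS l)]; rfl

lemma TT_add_left (hX : X.Ok A) (hY : Y.Ok A) (σ : ℤ → ℤ → ℂ) {f' : ℝ → ℝ → ℂ} (hf : Dec2 f)
    (hf' : Dec2 f') (hg : Dec2 g) (x y : ℝ) :
    TT X Y σ (fun x y => f x y + f' x y) g x y = TT X Y σ f g x y + TT X Y σ f' g x y := by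
  simp only [TT, ← Finset.sum_add_distrib]
  refine sum_congr rfl fun k _ => sum_congr rfl fun l _ => ?_
  rw [← congrFun (congrFun (syn_add hX.psi' hY.psi' k l (hf.mid hX hY σ hg k l)
    (hf'.mid hX hY σ hg k l)) x) y]
  congr 1
  funext a b
  simp only [mid, ana_add hX.phi hY.phi k l hf hf']
  ring

lemma TT_add_right (hX : X.Ok A) (hY : Y.Ok A) (σ : ℤ → ℤ → ℂ) {g' : ℝ → ℝ → ℂ} (hf : Dec2 f)
    (hg : Dec2 g) (hg' : Dec2 g') (x y : ℝ) :
    TT X Y σ f (fun x y => g x y + g' x y) x y = TT X Y σ f g x y + TT X Y σ f g' x y := by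
  simp only [TT, ← Finset.sum_add_distrib]
  refine sum_congr rfl fun k _ => sum_congr rfl fun l _ => ?_
  rw [← congrFun (congrFun (syn_add hX.psi' hY.psi' k l (hf.mid hX hY σ hg k l)
    (hf.mid hX hY σ hg' k l)) x) y]
  congr 1
  funext a b
  simp only [mid, ana_add hX.psi hY.psi k l hg hg']
  ring

lemma ana_const_mul (η θ : ℝ → ℂ) (k l : ℤ) (c : ℂ) (F : ℝ → ℝ → ℂ) (x y : ℝ) :
    ana η θ k l (fun x y => c * F x y) x y = c * ana η θ k l F x y := by
  simp only [ana, opx, opy, op, smul_eq_mul, mul_left_comm _ c, integral_const_mul]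

lemma TT_scale (X Y : Sys) (σ : ℤ → ℤ → ℂ) {c d : ℂ} (h : c * d = 1) (f g : ℝ → ℝ → ℂ) :
    TT X Y σ (fun x y => c * f x y) (fun x y => d * g x y) = TT X Y σ f g := by
  have : ∀ k l, mid X Y σ (fun x y => c * f x y) (fun x y => d * g x y) k l =
      mid X Y σ f g k l := fun k l => by
    funext a b
    simp only [mid, ana_const_mul]
    linear_combination (σ k l * (ana X.phi Y.phi k l f a b * ana X.psi Y.psi k l g a b)) * h
  funext x y
  simp only [TT, this]

end bilinear

lemma nrm2_le_of_hn_le (hp : 1 < p) {e : ℝ} (hpe : p = ∞ ∨ e ≤ p.toReal) {u : ℝ → ℝ → ℂ}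
    (hu : Dec2 u) {G : ℝ → ℝ≥0∞} {L : ℝ≥0∞} (hLt : L ≠ ∞) (hG : ∀ᵐ x, hn p u x ≤ G x)
    (hGL : ∀ x, G x ≤ L) : nrm2 p u ≤ L ^ (1 - e * p⁻¹.toReal) * (∫⁻ x, G x ^ e) ^ p⁻¹.toReal := by
  by_cases hpt : p = ∞
  · subst hpt
    simp only [inv_top, toReal_zero, mul_zero, sub_zero, rpow_one,
      rpow_zero, mul_one]
    rw [nrm2, LqNorm_top]
    refine essSup_le_of_ae_le _ ?_
    have hm : MeasurableSet {z : ℝ × ℝ | ‖u z.1 z.2‖ₑ ≤ L} :=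
      measurableSet_le hu.measurable_enorm measurable_const
    have := (Measure.ae_prod_mem_iff_ae_ae_mem (μ := volume) (ν := volume) hm).2 (by
      filter_upwards [hG] with x hx
      have h1 : hn ∞ u x ≤ L := hx.trans (hGL x)
      rw [hn, LqNorm_top] at h1
      filter_upwards [ENNReal.ae_le_essSup fun y => ‖u x y‖ₑ] with y hy
      exact hy.trans h1)
    exact this
  have hpe' := hpe.resolve_left hpt
  have hp0 : 0 < p.toReal := by linarith [one_lt_toReal hp hpt]
  have hp1 : p ≠ 0 := (zero_lt_one.trans hp).ne'
  have hinv : p⁻¹.toReal = 1 / p.toReal := by rw [toReal_inv, one_div]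
  rw [nrm2, LqNorm_of_ne_top hpt, hinv, lintegral_plane (F := fun x y => ‖u x y‖ₑ ^ p.toReal)
    (hu.measurable_enorm.pow_const _)]
  have e1 : ∫⁻ x, ∫⁻ y, ‖u x y‖ₑ ^ p.toReal ≤ L ^ (p.toReal - e) * ∫⁻ x, G x ^ e := by
    rw [← lint_const_mul (rpow_ne_top_of_nonneg (by linarith) hLt)]
    refine lintegral_mono_ae ?_
    filter_upwards [hG] with x hx
    rw [← LqNorm_rpow hp1 hpt]
    refine (rpow_le_rpow hx hp0.le).trans ?_
    rcases eq_or_ne (G x) 0 with h0 | h0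
    · rw [h0, zero_rpow_of_pos hp0]; exact zero_le
    · calc G x ^ p.toReal = G x ^ (p.toReal - e) * G x ^ e := by
            rw [← rpow_add _ _ h0 (ne_top_of_le_ne_top hLt (hGL x)), sub_add_cancel]
        _ ≤ _ := mul_le_mul' (rpow_le_rpow (hGL x) (by linarith)) le_rfl
  refine (rpow_le_rpow e1 (by positivity)).trans (le_of_eq ?_)
  rw [mul_rpow (by positivity), ← rpow_mul]
  congr 2
  field_simp

lemma lintegral_TT_le (hE : Expo s p q ρ) {e : ℝ} (hpe : p = ∞ ∨ e ≤ p.toReal)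
    (hqe : q = ∞ ∨ e ≤ q.toReal) (A : ℝ) : Unif A fun C X Y σ u v =>
    ∀ {G : ℝ → ℝ≥0∞} {L : ℝ≥0∞}, L ≠ 0 → L ≠ ∞ →
    (∀ᵐ x, hn p u x ≤ G x) → (∀ᵐ x, hn q v x ≤ G x) → (∀ x, G x ≤ L) →
    ∫⁻ x, qn s ρ (fun y => ‖TT X Y σ u v x y‖ₑ) ^ (s.toReal / ρ) ≤
      C * (L ^ (2 * s.toReal - e) * ∫⁻ x, G x ^ e) := by
  obtain ⟨C, hC⟩ := diag hE.holder hE.hp hE.hq hE.hst A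
  have hs := half_lt_toReal hE.holder hE.hp hE.hq hE.hst
  have hs0 : 0 < s.toReal := by linarith
  have hρ := hE.pos
  refine ⟨C ^ s.toReal, fun {X Y} hX hY {σ} hlam {u v} hu hv {G L} hL hLt hGu hGv hGL => ?_⟩
  have hm := (hu.TT hX hY σ hv).measurable_enorm
  have e1 : ∀ x, qn s ρ (fun y => ‖TT X Y σ u v x y‖ₑ) ^ (s.toReal / ρ) =
      ∫⁻ y, ‖TT X Y σ u v x y‖ₑ ^ s.toReal := fun x => by
    rw [qn_eq hE.hst, ← rpow_mul]
    rw [show ρ / s.toReal * (s.toReal / ρ) = 1 by field_simp, rpow_one]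
  simp only [e1]
  rw [← lintegral_plane (F := fun x y => ‖TT X Y σ u v x y‖ₑ ^ s.toReal) (hm.pow_const _),
    ← LqNorm_rpow (F := fun z : ℝ × ℝ => ‖TT X Y σ u v z.1 z.2‖ₑ) hE.s_ne_zero hE.hst]
  have hi : p⁻¹.toReal + q⁻¹.toReal = 1 / s.toReal := by
    rw [← toReal_add, ← hE.holder, toReal_inv, one_div]
    · exact inv_ne_top.2 (zero_lt_one.trans hE.hp).ne'
    · exact inv_ne_top.2 (zero_lt_one.trans hE.hq).ne'
  set i := p⁻¹.toReal
  set j := q⁻¹.toReal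
  have e2 : nrm2 s (TT X Y σ u v) ≤ C * (L ^ (2 - e / s.toReal) * (∫⁻ x, G x ^ e) ^ (1 / s.toReal)) := by
    refine (hC hX hY hlam hu hv).trans (mul_mono ((mul_le_mul'
      (nrm2_le_of_hn_le hE.hp hpe hu hLt hGu hGL)
      (nrm2_le_of_hn_le hE.hq hqe hv hLt hGv hGL)).trans (le_of_eq ?_)))
    rw [mul_mul_mul_comm, ← rpow_add _ _ hL hLt,
      ← rpow_add_of_nonneg _ _ toReal_nonneg toReal_nonneg, hi]
    congr 2
    rw [div_eq_mul_one_div, ← hi]; ring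
  refine (rpow_le_rpow e2 hs0.le).trans (le_of_eq ?_)
  rw [mul_rpow hs0.le, mul_rpow hs0.le,
    ← rpow_mul, ← rpow_mul, one_div_mul_cancel hs0.ne', rpow_one,
    coe_rpow_of_nonneg _ hs0.le]
  congr 3
  field_simp

lemma setLIntegral_TT_le (hE : Expo s p q ρ) (A : ℝ) : Unif A fun C X Y σ u v =>
    ∀ {h₁ h₂ V : ℤ → ℝ → ℝ≥0∞} {B : ℝ≥0∞} {S : Set ℝ},
    B ≠ ∞ → MeasurableSet S → (∀ k a, hn p (opx (kA X.phi k) u) a ≤ PP 6 k (h₁ k) a) →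
    (∀ k a, hn q (opx (kA X.psi k) v) a ≤ PP 6 k (h₂ k) a) →
    (∀ k, ∀ x ∈ S, PP 6 k (h₁ k) x * PP 6 k (h₂ k) x ≤ B * V k x) →
    ∫⁻ x in S, qn s ρ (fun y => ‖TT X Y σ u v x y‖ₑ) ≤
      C * (B ^ ρ * ∫⁻ x in S, ∑ k ∈ X.K, V k x ^ ρ) := by
  obtain ⟨C, hC⟩ := UU_le hE A
  have hρ := hE.pos
  refine ⟨C, fun {X Y} hX hY {σ} hlam {u v} hu hv {h₁ h₂ V B S} hB hS H₁ H₂ hV => ?_⟩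
  rw [← mul_assoc, ← lint_const_mul (by finiteness)]
  refine setLIntegral_mono' hS fun x hx => ?_
  have hUm : ∀ k, Measurable fun y => ‖UU X Y σ u v k x y‖ₑ := fun k =>
    measurable_slice (hu.UU hX hY σ hv k).measurable_enorm x
  refine (qn_mono hρ.le (w' := fun y => ∑ k ∈ X.K, ‖UU X Y σ u v k x y‖ₑ) fun y => ?_).trans
    ((qn_sum_le hE.hst hρ hE.le_one.le hE.le_s _ fun k _ => hUm k).trans ?_)
  · rw [TT_eq_sum hX hY σ hu hv]; exact enorm_sum_le _ _
  · rw [mul_sum]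
    refine sum_le_sum fun k _ => ((hC hX hY hlam hu hv (H₁ k) (H₂ k) x).1).trans ?_
    rw [mul_assoc, ← mul_rpow hρ.le]
    exact mul_mono (rpow_le_rpow (hV k x hx) hρ.le)

lemma exists_cz {H : ℝ → ℝ≥0∞} (hm : Measurable H) (hfin : ∫⁻ x, H x ≠ ∞) {σ : ℝ≥0∞}
    (hl : σ ≠ 0) : ∃ (Q : Set (ℤ × ℤ)) (k₀ : ℤ), Q.PairwiseDisjoint (fun q => cell q.1 q.2) ∧
      (∀ q ∈ Q, k₀ ≤ q.1) ∧ (∀ q ∈ Q, ∫⁻ x in cell q.1 q.2, H x ≤ 2 * σ * 2 ^ (-q.1)) ∧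
      (⋃ q ∈ Q, cell3 q.1 q.2) ⊆ {x | σ < MM H x} ∧
      ∑' q : Q, (2 : ℝ≥0∞) ^ (-q.1.1) ≤ volume {x | σ < MM H x} ∧
      ∀ᵐ x, x ∉ cup Q → H x ≤ σ := by
  obtain ⟨Q, h1, h2, h3, h4⟩ := exists_cz_cells hfin hl
  obtain ⟨k₀, hk₀⟩ := exists_scale_bound hfin hl
  have h5 : (⋃ q ∈ Q, cell3 q.1 q.2) ⊆ {x | σ < MM H x} := by
    refine Set.iUnion₂_subset fun q hq x hx => (h1 q hq).trans_le (le_trans ?_ (avg3_le_MM q.1 H x))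
    refine mul_mono (lintegral_mono_set fun t ht => ?_)
    rw [mem_cell3] at hx ⊢
    rw [mem_cell.1 ht, abs_sub_comm]; exact hx
  refine ⟨Q, k₀, h2, fun q hq => hk₀ _ ((h1 q hq).trans_le (mul_mono
    (setLIntegral_le_lintegral _ _))), fun q hq => ?_, h5, ?_, ?_⟩
  · obtain ⟨x, hx⟩ := cell_nonempty q.1 q.2
    have h := h4 q hq (q.1 - 1) (by omega) x hx
    have hsub : cell q.1 q.2 ⊆ cell (q.1 - 1) (dix (q.1 - 1) x) := fun t ht =>
      dix_congr (by omega) (ht.trans hx.symm)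
    have e : (2 : ℝ≥0∞) * 2 ^ (-q.1) * 2 ^ (q.1 - 1) = 1 := by
      have : (2 : ℝ≥0∞) * 2 ^ (-q.1) = 2 ^ (-(q.1 - 1)) := by
        rw [neg_sub, sub_eq_add_neg, two_zpow_add, zpow_one]
      rw [this, mul_comm, two_zpow_mul_neg]
    calc ∫⁻ x in cell q.1 q.2, H x
        ≤ ∫⁻ x in cell (q.1 - 1) (dix (q.1 - 1) x), H x := lintegral_mono_set hsub
      _ = 2 * 2 ^ (-q.1) * avg1 (q.1 - 1) H x := by rw [avg1, ← mul_assoc, e, one_mul]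
      _ ≤ 2 * 2 ^ (-q.1) * σ := mul_mono h
      _ = _ := by ring
  · calc ∑' q : Q, (2 : ℝ≥0∞) ^ (-q.1.1) = ∑' q : Q, volume (cell q.1.1 q.1.2) := by
          simp only [volume_cell]
      _ = volume (cup Q) := (measure_biUnion (Set.to_countable Q) h2
          fun q _ => measurableSet_cell _ _).symm
      _ ≤ _ := measure_mono ((Set.iUnion₂_mono fun q _ => cell_subset_cell3 _ _).trans h5)
  · filter_upwards [ae_le_Md hm hfin] with x hx hn
    refine hx.trans (iSup_le fun k => ?_)
    by_contra! hc
    obtain ⟨q, hq, -, hs⟩ := h3 k _ hc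
    exact hn (mem_cup.2 ⟨q, hq, hs rfl⟩)

lemma bad_level_le (hE : Expo s p q ρ) (A : ℝ) : Unif A fun C X Y σ u v =>
    ∀ {w : ℝ → ℝ≥0∞}, Measurable w →
    ∀ {Q : Set (ℤ × ℤ)} {t : ℝ≥0∞} {S : Set ℝ} {h₁ h₂ : ℤ → ℝ → ℝ≥0∞},
    Q.PairwiseDisjoint (fun q => cell q.1 q.2) → t ≠ ∞ → MeasurableSet S →
    S ⊆ (⋃ q ∈ Q, cell3 q.1 q.2)ᶜ → (∀ q ∈ Q, ∫⁻ x in cell q.1 q.2, w x ≤ 2 * t * 2 ^ (-q.1)) →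
    (∀ k a, hn p (opx (kA X.phi k) u) a ≤ PP 6 k (h₁ k) a) →
    (∀ k a, hn q (opx (kA X.psi k) v) a ≤ PP 6 k (h₂ k) a) →
    (∀ k, ∀ x ∈ S, PP 6 k (h₁ k) x * PP 6 k (h₂ k) x ≤ 48 * ofReal (2 ^ 20 * A) * t *
      PP 6 k (fun t => ofReal (2 ^ 8 * A) * badH Q k w t) x) →
    ∫⁻ x in S, qn s ρ (fun y => ‖TT X Y σ u v x y‖ₑ) ≤
      C * (t ^ (2 * ρ) * ∑' q : Q, (2 : ℝ≥0∞) ^ (-q.1.1)) := by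
  obtain ⟨C, hC⟩ := setLIntegral_TT_le hE A
  obtain ⟨C', hC'⟩ := bad_tail_le hE.half hE.le_one
  have hρ := hE.pos
  set D := ofReal (2 ^ 20 * A) with hD
  set E := ofReal (2 ^ 8 * A) with hEE
  refine ⟨C * C' * ((48 * D * (4 * E)) ^ ρ).toNNReal, fun {X Y} hX hY {σ} hlam {u v} hu hv {w} hw
    {Q t S h₁ h₂} hd ht hS hSQ hwQ H₁ H₂ hV => ?_⟩
  refine (hC hX hY hlam hu hv (by finiteness) hS H₁ H₂ hV).trans ?_
  have hmin : ∀ k, ∀ q ∈ Q, ∫⁻ x in cell q.1 q.2, E * badH Q k w x ≤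
      min 1 (2 ^ (k - q.1)) * (4 * E * t * 2 ^ (-q.1)) := fun k q hq => by
    rw [lint_const_mul ofReal_ne_top, setLIntegral_badH hd k hw hq]
    calc E * (min 1 (2 ^ (k - q.1)) * (2 * ∫⁻ t in cell q.1 q.2, w t))
        ≤ E * (min 1 (2 ^ (k - q.1)) * (2 * (2 * t * 2 ^ (-q.1)))) :=
          mul_mono (mul_mono (mul_mono (hwQ q hq)))
      _ = _ := by ring
  have := hC' (Q := Q) (L := 4 * E * t) (h := fun k x => E * badH Q k w x)
    (fun k => (measurable_badH Q k hw).const_mul _)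
    (fun k x hx => badH_ne_zero (right_ne_zero_of_mul hx))
    (fun k q hq => (hmin k q hq).trans ((mul_le_mul' (min_le_left _ _) le_rfl).trans
      (one_mul _).le))
    (fun k q hq _ => (hmin k q hq).trans (mul_le_mul' (min_le_right _ _) le_rfl)) X.K
  calc _ ≤ C * ((48 * D * t) ^ ρ * (C' * (4 * E * t) ^ ρ * ∑' q : Q, (2 : ℝ≥0∞) ^ (-q.1.1))) :=
        mul_mono (mul_mono ((lintegral_mono_set hSQ).trans this))
    _ = C * C' * ((48 * D * t * (4 * E * t)) ^ ρ) * ∑' q : Q, (2 : ℝ≥0∞) ^ (-q.1.1) := by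
        rw [mul_rpow_of_nonneg (48 * D * t) _ hρ.le]; ring
    _ = _ := by
        rw [show 48 * D * t * (4 * E * t) = 48 * D * (4 * E) * (t ^ (2 : ℝ)) by
          rw [rpow_two]; ring, mul_rpow hρ.le, ← rpow_mul]
        push_cast
        rw [coe_toNNReal (by finiteness)]
        ring

lemma level_le (hE : Expo s p q ρ) {e : ℝ} (he : 0 < e) (hpe : p = ∞ ∨ e ≤ p.toReal)
    (hqe : q = ∞ ∨ e ≤ q.toReal) (A : ℝ) : Unif A fun C X Y σ f g => ∀ {t : ℝ≥0∞}, t ≠ 0 → t ≠ ∞ →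
    t ^ e * volume {x | t ^ (2 * ρ) < qn s ρ (fun y => ‖TT X Y σ f g x y‖ₑ)} ≤
      C * ∫⁻ x, min t (MM (fun a => hn p f a + hn q g a) x) ^ e := by
  obtain ⟨C₁, hC₁⟩ := lintegral_TT_le hE hpe hqe A
  obtain ⟨C₂, hC₂⟩ := bad_level_le hE A
  have hρ := hE.pos
  have hs0 : 0 < s.toReal := hρ.trans_le hE.le_s
  refine ⟨1 + 2 ^ (s.toReal / ρ) * C₁ * (2 ^ (2 * s.toReal - e) * 2 ^ e) + 4 * C₂,
    fun {X Y} hX hY {σ} hlam {f g} hf hg {t} ht htt => ?_⟩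
  set H : ℝ → ℝ≥0∞ := fun a => hn p f a + hn q g a
  have hmf := hf.measurable_hn p
  have hmg := hg.measurable_hn q
  have hHm : Measurable H := hmf.add hmg
  have hfin : ∫⁻ x, H x ≠ ∞ := by
    rw [lintegral_add_left hmf]
    exact add_ne_top.2 ⟨hf.lintegral_hn_ne_top hE.hp, hg.lintegral_hn_ne_top hE.hq⟩
  obtain ⟨Q, k₀, hd, hk₀, hQ, hΩ, hvol, hae⟩ := exists_cz hHm hfin ht
  set Ω := {x | t < MM H x} with hΩd
  have hΩm : MeasurableSet Ω := measurableSet_lt measurable_const (measurable_MM H)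
  set I := ∫⁻ x, min t (MM H x) ^ e
  have hIΩ : t ^ e * volume Ω ≤ I := by
    rw [← setLIntegral_const]
    refine (setLIntegral_mono' hΩm fun x hx => ?_).trans (setLIntegral_le_lintegral Ω _)
    rw [min_eq_left (le_of_lt hx)]
  have hfg := dec2_goodPart hd hk₀ hf
  have hgg := dec2_goodPart hd hk₀ hg
  have hfb := hf.sub hfg
  have hgb := hg.sub hgg
  have hle : ∀ x ∈ Ωᶜ, MM H x ≤ t := fun x hx => not_lt.1 hx
  have hHf : ∀ x, hn p f x ≤ H x := fun x => le_self_add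
  have hHg : ∀ x, hn q g x ≤ H x := fun x => le_add_self
  have hQf : ∀ {p : ℝ≥0∞} {F : ℝ → ℝ → ℂ}, (∀ x, hn p F x ≤ H x) → ∀ r ∈ Q,
      ∫⁻ x in cell r.1 r.2, hn p F x ≤ 2 * t * 2 ^ (-r.1) := fun h r hr =>
    (lintegral_mono h).trans (hQ r hr)
  have hgood : ∀ {p : ℝ≥0∞} {F : ℝ → ℝ → ℂ}, 1 < p → Dec2 F → (∀ x, hn p F x ≤ H x) →
      ∀ᵐ x, hn p (goodPart Q F) x ≤ min (2 * t) (MM H x) := fun {p F} hp hF hFH => by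
    filter_upwards [hae, ae_le_Md hHm hfin] with x hx hx'
    by_cases hc : x ∈ cup Q
    · obtain ⟨r, hr, hxr⟩ := mem_cup.1 hc
      have h1 := hn_goodPart_le hd hp hF hr hxr
      refine le_min (h1.trans ?_) (h1.trans ?_)
      · refine (mul_mono (hQf hFH r hr)).trans (le_of_eq ?_)
        rw [mul_comm, mul_assoc, mul_comm (2 ^ (-r.1)), two_zpow_mul_neg, mul_one]
      · refine (mul_mono (lintegral_mono hFH)).trans
          (le_trans ?_ ((avg1_le_Md r.1 H x).trans (Md_le_MM H x)))
        rw [avg1, mem_cell.1 hxr]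
    · rw [hn_goodPart_of_notMem p F hc]
      refine le_min ((hFH x).trans ((hx hc).trans ?_)) ((hFH x).trans (hx'.trans (Md_le_MM H x)))
      exact le_mul_of_one_le_left' one_le_two
  set N := fun u v : ℝ → ℝ → ℂ => fun x => qn s ρ (fun y => ‖TT X Y σ u v x y‖ₑ) with hN
  have hNm : ∀ {u v}, Dec2 u → Dec2 v → Measurable (N u v) := fun {u v} hu hv =>
    (measurable_LqNorm_slice s (hu.TT hX hY σ hv).measurable_enorm).pow_const ρ
  have hadd : ∀ x, N f g x ≤ N (goodPart Q f) (goodPart Q g) x +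
      (N (fun x y => f x y - goodPart Q f x y) g x +
        N (goodPart Q f) (fun x y => g x y - goodPart Q g x y) x) := fun x => by
    have hT : ∀ {u v}, Dec2 u → Dec2 v → Measurable fun y => ‖TT X Y σ u v x y‖ₑ :=
      fun hu hv => measurable_slice (hu.TT hX hY σ hv).measurable_enorm x
    refine (qn_mono hρ.le fun y => ?_).trans ((qn_add_le hE.hst hρ hE.le_one.le hE.le_s
      (hT hfg hgg) ((hT hfb hg).add (hT hfg hgb))).trans (add_le_add le_rfl
      (qn_add_le hE.hst hρ hE.le_one.le hE.le_s (hT hfb hg) (hT hfg hgb))))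
    have e1 := TT_add_left hX hY σ hfg hfb hg x y
    have e2 := TT_add_right hX hY σ hfg hgg hgb x y
    simp only [add_sub_cancel] at e1 e2
    rw [e1, e2, add_assoc]
    exact (enorm_add_le _ _).trans (add_le_add le_rfl ((enorm_add_le _ _).trans (add_comm _ _).le))
  set N₁ := N (goodPart Q f) (goodPart Q g)
  set N₂ := N (fun x y => f x y - goodPart Q f x y) g
  set N₃ := N (goodPart Q f) (fun x y => g x y - goodPart Q g x y)
  have hS : Ωᶜ ⊆ (⋃ r ∈ Q, cell3 r.1 r.2)ᶜ := Set.compl_subset_compl.2 hΩ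
  have hb₂ : ∫⁻ x in Ωᶜ, N₂ x ≤ C₂ * (t ^ (2 * ρ) * ∑' q : Q, (2 : ℝ≥0∞) ^ (-q.1.1)) := by
    refine hC₂ hX hY hlam hfb hg hmf hd htt hΩm.compl hS (hQf hHf)
      (fun k a => hn_opx_bad_le hd hE.hp hX.phi hf k a)
      (fun k a => hn_ana_le hE.hq hX.psi hg k a) fun k x hx => ?_
    rw [mul_comm]
    refine mul_le_mul' ?_ le_rfl
    rw [PP_lintegral_const ofReal_ne_top]
    calc _ ≤ ofReal (2 ^ 20 * A) * (8 * t) := mul_mono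
            ((PP_le_MM (by norm_num) k hmg x).trans (mul_mono
              ((MM_mono hHg x).trans (hle x hx))))
      _ ≤ ofReal (2 ^ 20 * A) * (48 * t) := by gcongr; norm_num
      _ = _ := by ring
  have hb₃ : ∫⁻ x in Ωᶜ, N₃ x ≤ C₂ * (t ^ (2 * ρ) * ∑' q : Q, (2 : ℝ≥0∞) ^ (-q.1.1)) := by
    refine hC₂ hX hY hlam hfg hgb hmg hd htt hΩm.compl hS (hQf hHg)
      (fun k a => hn_ana_le hE.hp hX.phi hfg k a)
      (fun k a => hn_opx_bad_le hd hE.hq hX.psi hg k a) fun k x hx => ?_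
    refine mul_le_mul' ?_ le_rfl
    rw [PP_lintegral_const ofReal_ne_top]
    have h2 : essSup (hn p (goodPart Q f)) volume ≤ 2 * t := essSup_le_of_ae_le _ <| by
      filter_upwards [hgood hE.hp hf hHf] with x hx using hx.trans (min_le_left _ _)
    calc _ ≤ ofReal (2 ^ 20 * A) * (8 * (3 * (2 * t))) := mul_mono
            ((PP_le_MM (by norm_num) k (hfg.measurable_hn p) x).trans (mul_mono
              ((MM_le_essSup _ x).trans (mul_mono h2))))
      _ = _ := by ring
  have hsub : {x | t ^ (2 * ρ) < N f g x} ⊆ Ω ∪ {x | t ^ (2 * ρ) ≤ 2 * N₁ x} ∪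
      {x | t ^ (2 * ρ) ≤ Ωᶜ.indicator (fun x => 2 * (N₂ x + N₃ x)) x} := fun x hx => by
    by_cases h1 : x ∈ Ω
    · exact Or.inl (Or.inl h1)
    by_cases h2 : t ^ (2 * ρ) ≤ 2 * N₁ x
    · exact Or.inl (Or.inr h2)
    refine Or.inr ?_
    rw [mem_ofPred_eq, indicator_of_mem (show x ∈ Ωᶜ from h1)]
    by_contra! h3
    have h4 := (hx : t ^ (2 * ρ) < N f g x).trans_le (hadd x)
    push Not at h2
    have h5 := ENNReal.add_lt_add h2 h3
    rw [← mul_add, ← two_mul] at h5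
    exact absurd (h5.trans ((ENNReal.mul_lt_mul_iff_right (by norm_num) (by norm_num)).2 h4))
      (lt_irrefl _)
  have hv₁ : t ^ e * volume {x | t ^ (2 * ρ) ≤ 2 * N₁ x} ≤
      2 ^ (s.toReal / ρ) * C₁ * (2 ^ (2 * s.toReal - e) * 2 ^ e) * I := by
    have h1 := hC₁ hX hY hlam hfg hgg (G := fun x => min (2 * t) (MM H x)) (L := 2 * t)
      (by simp [ht]) (by finiteness) (hgood hE.hp hf hHf) (hgood hE.hq hg hHg)
      fun x => min_le_left _ _
    have h2 : ∫⁻ x, min (2 * t) (MM H x) ^ e ≤ 2 ^ e * I := by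
      rw [← lint_const_mul (by finiteness)]
      refine lintegral_mono fun x => ?_
      rw [← mul_rpow he.le]
      refine rpow_le_rpow ?_ he.le
      rw [mul_min]
      exact min_le_min le_rfl (le_mul_of_one_le_left' one_le_two)
    have h3 : t ^ (2 * s.toReal) * volume {x | t ^ (2 * ρ) ≤ 2 * N₁ x} ≤
        ∫⁻ x, (2 * N₁ x) ^ (s.toReal / ρ) := by
      refine le_trans (mul_mono (measure_mono fun x hx => ?_))
        (mul_meas_ge_le_lintegral (((hNm hfg hgg).const_mul 2).pow_const _) _)
      have := rpow_le_rpow (z := s.toReal / ρ) hx (by positivity)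
      rwa [← rpow_mul, show 2 * ρ * (s.toReal / ρ) = 2 * s.toReal by field_simp] at this
    have h4 : ∫⁻ x, (2 * N₁ x) ^ (s.toReal / ρ) ≤ 2 ^ (s.toReal / ρ) *
        (C₁ * (2 ^ (2 * s.toReal - e) * t ^ (2 * s.toReal - e) * (2 ^ e * I))) := by
      simp only [mul_rpow (show 0 ≤ s.toReal / ρ by positivity)]
      rw [lint_const_mul (by finiteness)]
      refine mul_mono (h1.trans (mul_mono (mul_le_mul' (le_of_eq ?_) h2)))
      rw [mul_rpow_of_ne_top (by norm_num) htt]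
    calc t ^ e * volume {x | t ^ (2 * ρ) ≤ 2 * N₁ x}
        = t ^ (e - 2 * s.toReal) * (t ^ (2 * s.toReal) * volume {x | t ^ (2 * ρ) ≤ 2 * N₁ x}) := by
          rw [← mul_assoc, ← rpow_add _ _ ht htt, sub_add_cancel]
      _ ≤ t ^ (e - 2 * s.toReal) * (2 ^ (s.toReal / ρ) *
        (C₁ * (2 ^ (2 * s.toReal - e) * t ^ (2 * s.toReal - e) * (2 ^ e * I)))) :=
          mul_mono (h3.trans h4)
      _ = (t ^ (e - 2 * s.toReal) * t ^ (2 * s.toReal - e)) *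
          (2 ^ (s.toReal / ρ) * C₁ * (2 ^ (2 * s.toReal - e) * 2 ^ e) * I) := by ring
      _ = _ := by
          rw [← rpow_add _ _ ht htt]
          simp
  have hv₂ : t ^ e * volume {x | t ^ (2 * ρ) ≤ Ωᶜ.indicator (fun x => 2 * (N₂ x + N₃ x)) x} ≤
      4 * C₂ * I := by
    have h1 : t ^ (2 * ρ) * volume {x | t ^ (2 * ρ) ≤ Ωᶜ.indicator (fun x => 2 * (N₂ x + N₃ x)) x} ≤
        t ^ (2 * ρ) * (4 * C₂ * volume Ω) := by
      refine (mul_meas_ge_le_lintegral ((((hNm hfb hg).add (hNm hfg hgb)).const_mul 2).indicator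
        hΩm.compl) _).trans ?_
      rw [lintegral_indicator hΩm.compl, lint_const_mul (by norm_num)]
      show 2 * ∫⁻ x in Ωᶜ, (N₂ x + N₃ x) ≤ _
      rw [lintegral_add_left (show Measurable N₂ from hNm hfb hg)]
      calc _ ≤ 2 * (C₂ * (t ^ (2 * ρ) * volume Ω) + C₂ * (t ^ (2 * ρ) * volume Ω)) :=
            mul_mono (add_le_add
              (hb₂.trans (mul_mono (mul_mono hvol)))
              (hb₃.trans (mul_mono (mul_mono hvol))))
        _ = _ := by ring
    have h2 := (ENNReal.mul_le_mul_iff_right (by simp [ht, htt]) (by finiteness)).1 h1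
    calc _ ≤ t ^ e * (4 * C₂ * volume Ω) := mul_mono h2
      _ = 4 * C₂ * (t ^ e * volume Ω) := by ring
      _ ≤ _ := mul_mono hIΩ
  calc _ ≤ t ^ e * (volume Ω + volume {x | t ^ (2 * ρ) ≤ 2 * N₁ x} +
        volume {x | t ^ (2 * ρ) ≤ Ωᶜ.indicator (fun x => 2 * (N₂ x + N₃ x)) x}) :=
        mul_mono ((measure_mono hsub).trans ((measure_union_le _ _).trans
          (add_le_add (measure_union_le _ _) le_rfl)))
    _ ≤ I + 2 ^ (s.toReal / ρ) * C₁ * (2 ^ (2 * s.toReal - e) * 2 ^ e) * I + 4 * C₂ * I := by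
        rw [mul_add, mul_add]
        exact add_le_add (add_le_add hIΩ hv₁) hv₂
    _ = _ := by
        push_cast
        rw [coe_rpow_of_ne_zero (by norm_num), coe_rpow_of_ne_zero (by norm_num),
          coe_rpow_of_ne_zero (by norm_num)]
        push_cast
        ring

lemma min_layers_le {r e : ℝ} (hr : 0 < r) (he : r < e) (M : ℝ≥0∞) :
    ∑' j : ℤ, ((2 : ℝ≥0∞) ^ j) ^ (r - e) * min (2 ^ j) M ^ e ≤
      (geo r * 2 ^ r + geo (e - r)) * M ^ r := by
  have hd : 0 < e - r := sub_pos.2 he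
  have h1 : ∀ j : ℤ, ((2 : ℝ≥0∞) ^ j) ^ (r - e) * min (2 ^ j) M ^ e ≤
      (2 ^ j) ^ r * (if 2 ^ j < 2 * M then 1 else 0) +
        M ^ e * ((2 ^ (-j)) ^ (e - r) * (if (2 : ℝ≥0∞) ^ (-j) < M⁻¹ then 1 else 0)) := fun j => by
    have h0 := two_zpow_ne_zero j
    have h0' := two_zpow_ne_top j
    rcases le_or_gt (2 ^ j) M with h | h
    · have : (2 : ℝ≥0∞) ^ j < 2 * M := by
        rcases eq_or_ne M ∞ with rfl | hM
        · simpa using h0'.lt_top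
        · refine h.trans_lt ?_
          rw [two_mul]
          exact lt_add_right hM (ne_bot_of_le_ne_bot h0 h)
      rw [if_pos this, min_eq_left h, ← rpow_add _ _ h0 h0', sub_add_cancel, mul_one]
      exact le_self_add
    · have : (2 : ℝ≥0∞) ^ (-j) < M⁻¹ := by
        rw [ENNReal.zpow_neg]
        exact ENNReal.inv_lt_inv.2 h
      rw [if_pos this, min_eq_right h.le, ENNReal.zpow_neg, inv_rpow, ← rpow_neg,
        neg_sub, mul_one, mul_comm (M ^ e)]
      exact le_add_self
  have h2 : M ^ e * (M⁻¹) ^ (e - r) ≤ M ^ r := by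
    rcases eq_or_ne M 0 with rfl | h0
    · simp [hr.trans he]
    rcases eq_or_ne M ∞ with rfl | hM
    · simp [hd]
    rw [inv_rpow, ← rpow_neg, ← rpow_add _ _ h0 hM]
    simp
  calc _ ≤ _ := ENNReal.tsum_le_tsum h1
    _ = _ + M ^ e * ∑' j : ℤ, ((2 : ℝ≥0∞) ^ j) ^ (e - r) * (if 2 ^ j < M⁻¹ then 1 else 0) := by
      rw [ENNReal.tsum_add, ENNReal.tsum_mul_left]
      congr 2
      exact (Equiv.neg ℤ).tsum_eq fun j : ℤ =>
        ((2 : ℝ≥0∞) ^ j) ^ (e - r) * (if 2 ^ j < M⁻¹ then 1 else 0)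
    _ ≤ geo r * (2 * M) ^ r + M ^ e * (geo (e - r) * (M⁻¹) ^ (e - r)) :=
      add_le_add (tsum_layers_le _ hr) (mul_mono (tsum_layers_le _ hd))
    _ = geo r * 2 ^ r * M ^ r + geo (e - r) * (M ^ e * (M⁻¹) ^ (e - r)) := by
      rw [mul_rpow hr.le]
      ring
    _ ≤ _ := by
      rw [add_mul]
      exact add_le_add le_rfl (mul_mono h2)

lemma le_sqrt_of_forall_scale {T C a b : ℝ≥0} (h : ∀ u : ℝ≥0, 0 < u → T ≤ C * (u * a + u⁻¹ * b)) :
    T ≤ 2 * C * (a * b) ^ (1 / 2 : ℝ) := by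
  have e {a b : ℝ≥0} (ha : 0 < a) : (b / a) ^ (1 / 2 : ℝ) * a = (a * b) ^ (1 / 2 : ℝ) := by
    rw [NNReal.div_rpow, NNReal.mul_rpow, ← NNReal.sqrt_eq_rpow, ← NNReal.sqrt_eq_rpow]
    nth_rw 2 [← NNReal.mul_self_sqrt a]
    have := (NNReal.sqrt_pos.2 ha).ne'
    field_simp
  have h1 : ∀ ε : ℝ≥0, 0 < ε → T ≤ 2 * C * ((a + ε) * (b + ε)) ^ (1 / 2 : ℝ) := fun ε hε => by
    have ha : 0 < a + ε := by positivity
    have hb : 0 < b + ε := by positivity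
    calc T ≤ _ := h (((b + ε) / (a + ε)) ^ (1 / 2 : ℝ)) (by positivity)
      _ ≤ C * (((b + ε) / (a + ε)) ^ (1 / 2 : ℝ) * (a + ε) +
          (((b + ε) / (a + ε)) ^ (1 / 2 : ℝ))⁻¹ * (b + ε)) := by gcongr <;> exact le_self_add
      _ = _ := by
        rw [e ha, ← NNReal.inv_rpow, inv_div, e hb, mul_comm (b + ε)]
        ring
  have hc : Continuous fun ε : ℝ≥0 => 2 * C * ((a + ε) * (b + ε)) ^ (1 / 2 : ℝ) :=
    continuous_const.mul ((NNReal.continuous_rpow_const (by norm_num)).comp (by fun_prop))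
  have h2 := (hc.tendsto 0).mono_left (nhdsWithin_le_nhds (s := Ioi 0))
  simp only [add_zero] at h2
  exact ge_of_tendsto h2 (eventually_nhdsWithin_of_forall h1)

lemma hn_const_mul (hp : p ≠ 0) (c : ℂ) (F : ℝ → ℝ → ℂ) (x : ℝ) :
    hn p (fun x y => c * F x y) x = ‖c‖ₑ * hn p F x := by
  simp only [hn, enorm_mul]
  exact LqNorm_const_mul hp (by finiteness) _

lemma lintegral_TT_le_sqrt (hE : Expo s p q ρ) {e : ℝ} (he : 2 * ρ < e) (hpe : p = ∞ ∨ e ≤ p.toReal)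
    (hqe : q = ∞ ∨ e ≤ q.toReal) (A : ℝ) : Unif A fun C X Y σ f g =>
    ∫⁻ x, qn s ρ (fun y => ‖TT X Y σ f g x y‖ₑ) ≤
      C * ((∫⁻ x, hn p f x ^ (2 * ρ)) * ∫⁻ x, hn q g x ^ (2 * ρ)) ^ (1 / 2 : ℝ) := by
  have hρ := hE.pos
  set r := 2 * ρ with hr
  have hr1 : 1 < r := by linarith [hE.half]
  have hr0 : 0 < r := by linarith
  obtain ⟨C₁, hC₁⟩ := level_le hE (hr0.trans he) hpe hqe A
  obtain ⟨C₂, hC₂⟩ := lintegral_MM_rpow_le hr1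
  have hgeo : geo r * 2 ^ r + geo (e - r) ≠ ∞ := by
    have := geo_ne_top hr0
    have := geo_ne_top (sub_pos.2 he)
    finiteness
  lift geo r * 2 ^ r + geo (e - r) to ℝ≥0 using hgeo with K hK
  set D : ℝ≥0 := 2 ^ r * C₁ * K * C₂ * 2 ^ (r - 1) with hD
  refine ⟨2 * D, fun {X Y} hX hY {σ} hlam {f g} hf hg => ?_⟩
  have hp0 : p ≠ 0 := (zero_lt_one.trans hE.hp).ne'
  have hq0 : q ≠ 0 := (zero_lt_one.trans hE.hq).ne'
  have hmain : ∀ {f g : ℝ → ℝ → ℂ}, Dec2 f → Dec2 g →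
      ∫⁻ x, qn s ρ (fun y => ‖TT X Y σ f g x y‖ₑ) ≤
      D * ((∫⁻ x, hn p f x ^ r) + ∫⁻ x, hn q g x ^ r) := fun {f g} hf hg => by
    have hm : Measurable fun x => qn s ρ (fun y => ‖TT X Y σ f g x y‖ₑ) :=
      (measurable_LqNorm_slice s (hf.TT hX hY σ hg).measurable_enorm).pow_const ρ
    have hH : Measurable fun a => hn p f a + hn q g a :=
      (hf.measurable_hn p).add (hg.measurable_hn q)
    have hMm := measurable_MM fun a => hn p f a + hn q g a
    set N := fun x => qn s ρ (fun y => ‖TT X Y σ f g x y‖ₑ)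
    have h1 := lintegral_rpow_le_layers (hm.pow_const (1 / r)) hr0 (μ := volume)
    simp only [← rpow_mul, one_div_mul_cancel hr0.ne', rpow_one] at h1
    have h2 : ∀ j : ℤ, ((2 : ℝ≥0∞) ^ j) ^ r * volume {x | 2 ^ j < N x ^ (1 / r)} ≤
        C₁ * ∫⁻ x, (2 ^ j) ^ (r - e) * min (2 ^ j) (MM (fun a => hn p f a + hn q g a) x) ^ e :=
      fun j => by
      have h0 := two_zpow_ne_zero j
      have h0' := two_zpow_ne_top j
      have hset : {x | 2 ^ j < N x ^ (1 / r)} = {x | ((2 : ℝ≥0∞) ^ j) ^ r < N x} := by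
        ext x
        rw [mem_ofPred_eq, mem_ofPred_eq, one_div, lt_rpow_inv_iff hr0]
      rw [hset, lint_const_mul (rpow_ne_top_of_ne_zero h0 h0')]
      calc _ = ((2 : ℝ≥0∞) ^ j) ^ (r - e) * ((2 ^ j) ^ e * volume {x | ((2 : ℝ≥0∞) ^ j) ^ r < N x}) := by
            rw [← mul_assoc, ← rpow_add _ _ h0 h0', sub_add_cancel]
        _ ≤ _ := mul_mono (hC₁ hX hY hlam hf hg h0 h0')
        _ = _ := by ring
    calc ∫⁻ x, N x ≤ _ := h1
      _ ≤ 2 ^ r * (C₁ * ∫⁻ x, K * MM (fun a => hn p f a + hn q g a) x ^ r) := by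
        refine mul_mono ((ENNReal.tsum_le_tsum h2).trans ?_)
        rw [ENNReal.tsum_mul_left, ← lintegral_tsum fun j =>
          (((measurable_const.min hMm).pow_const e).const_mul _).aemeasurable]
        refine mul_mono (lintegral_mono fun x => ?_)
        rw [hK]
        exact min_layers_le hr0 he _
      _ ≤ 2 ^ r * (C₁ * (K * (C₂ * ∫⁻ x, 2 ^ (r - 1) * (hn p f x ^ r + hn q g x ^ r)))) := by
        rw [lint_const_mul (by finiteness)]
        refine mul_mono (mul_mono (mul_mono ((hC₂ _ hH).trans
          (mul_mono (lintegral_mono fun x => rpow_add_le_mul_rpow_add_rpow _ _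
            hr1.le)))))
      _ = _ := by
        rw [lint_const_mul (by finiteness),
          lintegral_add_left ((hf.measurable_hn p).pow_const r), hD]
        push_cast
        rw [coe_rpow_of_ne_zero (by norm_num), coe_rpow_of_ne_zero (by norm_num)]
        push_cast
        ring
  have ha := hf.lintegral_hn_rpow_ne_top hE.hp hr1.le
  have hb := hg.lintegral_hn_rpow_ne_top hE.hq hr1.le
  have hT : ∫⁻ x, qn s ρ (fun y => ‖TT X Y σ f g x y‖ₑ) ≠ ∞ :=
    ne_top_of_le_ne_top (by finiteness) (hmain hf hg)
  have hsc : ∀ u : ℝ≥0, 0 < u → ∫⁻ x, qn s ρ (fun y => ‖TT X Y σ f g x y‖ₑ) ≤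
      D * (u * (∫⁻ x, hn p f x ^ r) + (u⁻¹ : ℝ≥0) * ∫⁻ x, hn q g x ^ r) := fun u hu => by
    set v : ℝ≥0 := u ^ (1 / r)
    have hv : v ≠ 0 := (NNReal.rpow_pos hu).ne'
    have hvr : v ^ r = u := by
      rw [← NNReal.rpow_mul, one_div_mul_cancel hr0.ne', NNReal.rpow_one]
    have hen : ∀ w : ℝ≥0, ‖((w : ℝ) : ℂ)‖ₑ = w := fun w => by
      rw [← ofReal_norm, norm_real, norm_of_nonneg w.coe_nonneg, ofReal_coe_nnreal]
    have hvi : v⁻¹ ^ r = u⁻¹ := by rw [NNReal.inv_rpow, hvr]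
    have h1 := hmain (hf.const_mul ((v : ℝ) : ℂ)) (hg.const_mul (((v⁻¹ : ℝ≥0) : ℝ) : ℂ))
    rw [TT_scale X Y σ (by
      rw [← Complex.ofReal_mul, ← NNReal.coe_mul, mul_inv_cancel₀ hv]; simp)] at h1
    simp only [hn_const_mul hp0, hn_const_mul hq0, hen, mul_rpow hr0.le] at h1
    rwa [lint_const_mul (by finiteness), lint_const_mul (by finiteness),
      ← coe_rpow_of_nonneg _ hr0.le, ← coe_rpow_of_nonneg _ hr0.le, hvr, hvi] at h1
  lift ∫⁻ x, qn s ρ (fun y => ‖TT X Y σ f g x y‖ₑ) to ℝ≥0 using hT with T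
  lift ∫⁻ x, hn p f x ^ r to ℝ≥0 using ha with a
  lift ∫⁻ x, hn q g x ^ r to ℝ≥0 using hb with b
  rw [← coe_mul, ← coe_rpow_of_nonneg _ (by norm_num)]
  exact_mod_cast le_sqrt_of_forall_scale fun u hu => by exact_mod_cast hsc u hu

lemma LqNorm_MM_rpow_le {r : ℝ} (hr : 0 < r) (hp : p = ∞ ∨ r < p.toReal) :
    ∃ C : ℝ≥0, ∀ h : ℝ → ℝ≥0∞, Measurable h →
      LqNorm volume p (fun x => MM (fun a => h a ^ r) x ^ (1 / r)) ≤ C * LqNorm volume p h := by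
  rcases eq_or_ne p ∞ with rfl | hpt
  · refine ⟨3 ^ (1 / r), fun h hh => ?_⟩
    rw [LqNorm_top, LqNorm_top]
    refine essSup_le_of_ae_le _ (.of_forall fun x => ?_)
    have h1 : essSup (fun a => h a ^ r) volume ≤ essSup h volume ^ r := essSup_le_of_ae_le _ <| by
      filter_upwards [ENNReal.ae_le_essSup h] with a ha using rpow_le_rpow ha hr.le
    refine (rpow_le_rpow ((MM_le_essSup _ x).trans (mul_mono h1))
      (by positivity : (0 : ℝ) ≤ 1 / r)).trans (le_of_eq ?_)
    rw [mul_rpow (by positivity), ← rpow_mul,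
      mul_one_div_cancel hr.ne', rpow_one, coe_rpow_of_nonneg _ (by positivity)]
    rfl
  · have hrp := hp.resolve_left hpt
    have hp0 : 0 < p.toReal := hr.trans hrp
    obtain ⟨C, hC⟩ := lintegral_MM_rpow_le (p := p.toReal / r) ((one_lt_div hr).2 hrp)
    refine ⟨C ^ (1 / p.toReal), fun h hh => ?_⟩
    rw [coe_rpow_of_nonneg _ (by positivity)]
    refine LqNorm_le_of_lintegral hpt ?_
    have := hC _ (hh.pow_const r)
    simp only [← rpow_mul, mul_div_cancel₀ _ hr.ne'] at this
    simpa only [← rpow_mul, one_div_mul_eq_div] using this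

lemma lintegral_MM_mul_le (hs : s⁻¹ = p⁻¹ + q⁻¹) (hs0 : s ≠ 0) (hst : s ≠ ∞) {r : ℝ} (hr : 0 < r)
    (hp : p = ∞ ∨ r < p.toReal) (hq : q = ∞ ∨ r < q.toReal) :
    ∃ C : ℝ≥0, ∀ h₁ h₂ : ℝ → ℝ≥0∞, Measurable h₁ → Measurable h₂ →
      ∫⁻ x, (MM (fun a => h₁ a ^ r) x * MM (fun a => h₂ a ^ r) x) ^ (s.toReal / r) ≤
        C * (LqNorm volume p h₁ * LqNorm volume q h₂) ^ s.toReal := by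
  obtain ⟨C₁, hC₁⟩ := LqNorm_MM_rpow_le hr hp
  obtain ⟨C₂, hC₂⟩ := LqNorm_MM_rpow_le hr hq
  refine ⟨(C₁ * C₂) ^ s.toReal, fun h₁ h₂ hm₁ hm₂ => ?_⟩
  have h0 := toReal_nonneg (a := s)
  have h3 := rpow_le_rpow ((LqNorm_mul_le (μ := volume) hs hs0 hst
    ((measurable_MM (fun a => h₁ a ^ r)).pow_const (1 / r)).aemeasurable
    ((measurable_MM (fun a => h₂ a ^ r)).pow_const (1 / r)).aemeasurable).trans
    (mul_le_mul' (hC₁ h₁ hm₁) (hC₂ h₂ hm₂))) h0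
  rw [LqNorm_rpow hs0 hst, mul_mul_mul_comm, mul_rpow_of_nonneg (C₁ * C₂ : ℝ≥0∞) _ h0] at h3
  rw [coe_rpow_of_nonneg _ h0, coe_mul]
  refine le_trans (le_of_eq (lintegral_congr fun x => ?_)) h3
  rw [← mul_rpow (by positivity), ← rpow_mul, one_div_mul_eq_div]

lemma Dec2.indicator (hF : Dec2 F) {S : Set ℝ} (hS : MeasurableSet S) : Dec2 (S.indicator F) := by
  refine hF.of_norm_le (D := 1) ?_ fun x y => ?_
  · have e : uncurry (S.indicator F) = (Prod.fst ⁻¹' S).indicator (uncurry F) := by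
      ext ⟨x, y⟩
      by_cases hx : x ∈ S <;> simp [uncurry, hx]
    rw [e]
    exact hF.1.indicator (measurable_fst hS)
  · by_cases hx : x ∈ S <;> simp [hx]

lemma hn_indicator (hp : p ≠ 0) (S : Set ℝ) (F : ℝ → ℝ → ℂ) :
    hn p (S.indicator F) = S.indicator (hn p F) := by
  funext x
  by_cases hx : x ∈ S
  · simp [hn, hx]
  · have := LqNorm_const_mul (μ := (volume : Measure ℝ)) hp zero_ne_top fun _ => 0
    simp only [zero_mul] at this
    simp [hn, hx, this]

/-- Passage from the diagonal-type bound to an arbitrary outer exponent. -/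
lemma mixed_TT_le {s₂ p₂ q₂ : ℝ≥0∞} (hE : Expo s₂ p₂ q₂ ρ) {e : ℝ} (he : 2 * ρ < e)
    (hpe : p₂ = ∞ ∨ e ≤ p₂.toReal) (hqe : q₂ = ∞ ∨ e ≤ q₂.toReal) (hs : s⁻¹ = p⁻¹ + q⁻¹)
    (hst : s ≠ ∞) (hρs : ρ < s.toReal) (hp : p = ∞ ∨ 2 * ρ < p.toReal)
    (hq : q = ∞ ∨ 2 * ρ < q.toReal) (A : ℝ) : Unif A fun C X Y σ f g =>
    LqNorm volume s (fun x => LqNorm volume s₂ fun y => ‖TT X Y σ f g x y‖ₑ) ≤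
      C * (LqNorm volume p (hn p₂ f) * LqNorm volume q (hn q₂ g)) := by
  have hρ := hE.pos
  have hr1 : 1 < 2 * ρ := by linarith [hE.half]
  have hs0' : 0 < s.toReal := hρ.trans hρs
  have hs0 : s ≠ 0 := (toReal_pos_iff.1 hs0').1.ne'
  have hp0 : p₂ ≠ 0 := (zero_lt_one.trans hE.hp).ne'
  have hq0 : q₂ ≠ 0 := (zero_lt_one.trans hE.hq).ne'
  set t := s.toReal / ρ with ht
  have ht1 : 1 < t := (one_lt_div hρ).2 hρs
  obtain ⟨C₀, hC₀⟩ := fefferman_stein ht1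
  obtain ⟨C₁, hC₁⟩ := lintegral_MM_rpow_le ht1
  obtain ⟨C₂, hC₂⟩ := UU_le hE A
  obtain ⟨C₃, hC₃⟩ := lintegral_TT_le_sqrt hE he hpe hqe A
  obtain ⟨C₄, hC₄⟩ := lintegral_MM_mul_le hs hs0 hst one_pos (hp.imp_right hr1.trans)
    (hq.imp_right hr1.trans)
  obtain ⟨C₅, hC₅⟩ := lintegral_MM_mul_le hs hs0 hst (zero_lt_one.trans hr1) hp hq
  simp only [rpow_one, div_one] at hC₄
  have hgeo := geo_ne_top hρ
  set D := ofReal (2 ^ 20 * A) with hD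
  set B : ℝ≥0∞ := C₂ * (D * 512 * (D * 512)) ^ ρ * geo ρ with hB
  have hBt : B ≠ ∞ := by finiteness
  set W : ℝ≥0∞ := C₀ * (2 ^ (t - 1) * ((B * 3) ^ t * (C₁ * C₄) + (C₃ : ℝ≥0∞) ^ t * C₅)) with hW
  have hWt : W ≠ ∞ := by finiteness
  refine ⟨(W ^ (1 / s.toReal)).toNNReal, fun {X Y} hX hY {σ} hlam {f g} hf hg => ?_⟩
  beta_reduce
  rw [coe_toNNReal (by finiteness)]
  have hT : ∀ {X : Sys}, X.Ok A → ∀ {f g : ℝ → ℝ → ℂ}, Dec2 f → Dec2 g →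
      Measurable fun x => qn s₂ ρ fun y => ‖TT X Y σ f g x y‖ₑ := fun {X} hX {f g} hf hg =>
    (measurable_LqNorm_slice s₂ (hf.TT hX hY σ hg).measurable_enorm).pow_const ρ
  have hmf := hf.measurable_hn p₂
  have hmg := hg.measurable_hn q₂
  set hf' := hn p₂ f with hhf
  set hg' := hn q₂ g with hhg
  set M : ℝ → ℝ≥0∞ := fun x => MM hf' x * MM hg' x with hM
  have hMm : Measurable M := (measurable_MM _).mul (measurable_MM _)
  set G : ℝ → ℝ≥0∞ := fun y => B * 3 * MM (fun x => M x ^ ρ) y +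
    C₃ * (MM (fun a => hf' a ^ (2 * ρ)) y * MM (fun a => hg' a ^ (2 * ρ)) y) ^ (1 / 2 : ℝ) with hG
  have hGm : Measurable G := ((measurable_MM _).const_mul _).add
    ((((measurable_MM _).mul (measurable_MM _)).pow_const _).const_mul _)
  have hUm : ∀ {f g : ℝ → ℝ → ℂ}, Dec2 f → Dec2 g → ∀ k x,
      Measurable fun y => ‖UU X Y σ f g k x y‖ₑ := fun hf hg k x =>
    measurable_slice (hf.UU hX hY σ hg k).measurable_enorm x
  have hfin : ∫⁻ x, qn s₂ ρ (fun y => ‖TT X Y σ f g x y‖ₑ) ≠ ∞ := by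
    have h1 := hf.lintegral_hn_rpow_ne_top hE.hp hr1.le
    have h2 := hg.lintegral_hn_rpow_ne_top hE.hq hr1.le
    exact ne_top_of_le_ne_top (by finiteness) (hC₃ hX hY hlam hf hg)
  have hmain : ∫⁻ x, (qn s₂ ρ fun y => ‖TT X Y σ f g x y‖ₑ) ^ t ≤ C₀ * ∫⁻ x, G x ^ t := by
    refine hC₀ _ G (hT hX hf hg) hGm hfin fun k₀ n => ?_
    obtain ⟨x₀, hx₀⟩ := cell_nonempty k₀ n
    set S := cell3 k₀ n with hS
    have hSm : MeasurableSet S := measurableSet_cell3 k₀ n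
    have hf₁ := hf.indicator hSm
    have hf₂ := hf.indicator hSm.compl
    have hg₁ := hg.indicator hSm
    have hg₂ := hg.indicator hSm.compl
    set Z : Sys := { X with K := X.K.filter (¬ · < k₀) } with hZ
    have hZo : Z.Ok A := ⟨hX.phi, hX.psi, hX.psi', hX.orth.mono (filter_subset _ _),
      hX.orth'.mono (filter_subset _ _)⟩
    have hPf : ∀ {f : ℝ → ℝ → ℂ}, Dec2 f → ∀ k a, hn p₂ (opx (kA X.phi k) f) a ≤
        PP 6 k (fun a => D * hn p₂ f a) a := fun hf k a => hn_ana_le hE.hp hX.phi hf k a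
    have hPg : ∀ {g : ℝ → ℝ → ℂ}, Dec2 g → ∀ k a, hn q₂ (opx (kA X.psi k) g) a ≤
        PP 6 k (fun a => D * hn q₂ g a) a := fun hg k a => hn_ana_le hE.hq hX.psi hg k a
    have hDt : D ≠ ∞ := ofReal_ne_top
    have hfar : ∀ {h : ℝ → ℝ≥0∞}, Measurable h → ∀ {k x}, x ∈ cell k₀ n → k₀ ≤ k →
        PP 6 k (Sᶜ.indicator h) x ≤ 2 ^ (k₀ - k) * (512 * MM h x) := fun {h} hm {k x} hx hk => by
      have h1 := PP_fine_far (N := 2) (by norm_num) 3 hk rfl (x := x) (y := x)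
        (hm.indicator hSm.compl) fun a ha => by
          rw [mem_cell.1 hx] at ha
          rw [indicator_of_notMem (by simpa using ha)]
      have h2 : (2 : ℝ≥0∞) ^ (k₀ - k) ≤ 1 := by
        rw [← zpow_zero (2 : ℝ≥0∞)]
        exact zpow_le_of_le one_le_two (by lia)
      refine h1.trans (mul_le_mul' (pow_le_of_le_one zero_le h2 (by norm_num))
        (mul_le_mul' (by norm_num) (MM_indicator_le h _ x)))
    have hnear : ∀ {h : ℝ → ℝ≥0∞}, Measurable h → ∀ k x, PP 6 k h x ≤ 512 * MM h x :=
      fun {h} hm k x => (PP_le_MM (by norm_num) k hm x).trans (mul_le_mul' (by norm_num) le_rfl)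
    have hc1 : ∀ {k x}, x ∈ cell k₀ n → k < k₀ →
        qn s₂ ρ (fun y => ‖UU X Y σ f g k x y - UU X Y σ f g k x₀ y‖ₑ) ≤
          C₂ * (D * 512 * (D * 512) * M x) ^ ρ * ((2 : ℝ≥0∞) ^ (k - k₀)) ^ ρ := fun {k x} hx hk => by
      refine ((hC₂ hX hY hlam hf hg (hPf hf k) (hPg hg k) x).2 hk.le (hx.trans hx₀.symm)).trans ?_
      rw [mul_right_comm]
      refine mul_le_mul' (mul_mono (rpow_le_rpow ?_ hρ.le)) le_rfl
      rw [PP_lintegral_const hDt, PP_lintegral_const hDt]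
      refine (mul_le_mul' (mul_mono (hnear hmf k x))
        (mul_mono (hnear hmg k x))).trans (le_of_eq ?_)
      rw [hM]; ring
    have hc2 : ∀ {f g : ℝ → ℝ → ℂ}, Dec2 f → Dec2 g → ∀ {k x}, k₀ ≤ k →
        PP 6 k (hn p₂ f) x * PP 6 k (hn q₂ g) x ≤ 2 ^ (k₀ - k) * (512 * 512 * M x) →
        qn s₂ ρ (fun y => ‖UU X Y σ f g k x y‖ₑ) ≤
          C₂ * (D * 512 * (D * 512) * M x) ^ ρ * ((2 : ℝ≥0∞) ^ (k₀ - k)) ^ ρ :=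
      fun {f g} hf hg {k x} hk h => by
      refine ((hC₂ hX hY hlam hf hg (hPf hf k) (hPg hg k) x).1).trans ?_
      rw [mul_assoc, ← mul_rpow hρ.le]
      refine mul_mono (rpow_le_rpow ?_ hρ.le)
      rw [PP_lintegral_const hDt, PP_lintegral_const hDt, mul_mul_mul_comm]
      refine (mul_mono h).trans (le_of_eq ?_)
      ring
    set E : ℝ → ℝ≥0∞ := fun x => B * 3 * M x ^ ρ +
      qn s₂ ρ fun y => ‖TT Z Y σ (S.indicator f) (S.indicator g) x y‖ₑ with hEdef
    have key : ∀ x ∈ cell k₀ n, qn s₂ ρ (fun y => ‖TT X Y σ f g x y -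
        ∑ k ∈ X.K with k < k₀, UU X Y σ f g k x₀ y‖ₑ) ≤ E x := fun x hx => by
      have hBM : ∀ {c}, c ≤ geo ρ → C₂ * (D * 512 * (D * 512) * M x) ^ ρ * c ≤ B * M x ^ ρ :=
        fun {c} hc => by
        rw [mul_rpow hρ.le, hB]
        refine (mul_mono hc).trans (le_of_eq ?_)
        ring
      have id : ∀ y, TT X Y σ f g x y - ∑ k ∈ X.K with k < k₀, UU X Y σ f g k x₀ y =
          ∑ k ∈ X.K with k < k₀, (UU X Y σ f g k x y - UU X Y σ f g k x₀ y) +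
          (∑ k ∈ X.K with ¬ k < k₀, UU X Y σ (Sᶜ.indicator f) g k x y +
          (∑ k ∈ X.K with ¬ k < k₀, UU X Y σ (S.indicator f) (Sᶜ.indicator g) k x y +
            TT Z Y σ (S.indicator f) (S.indicator g) x y)) := fun y => by
        have e1 := TT_add_left hZo hY σ hf₂ hf₁ hg x y
        have e2 := TT_add_right hZo hY σ hf₁ hg₂ hg₁ x y
        have a1 : ∀ F : ℝ → ℝ → ℂ, (fun x y => Sᶜ.indicator F x y + S.indicator F x y) = F :=
          fun F => Set.indicator_compl_add_self S F
        rw [a1] at e1 e2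
        have e3 := TT_eq_sum hX hY σ hf hg x y
        rw [← Finset.sum_filter_add_sum_filter_not X.K (fun k => k < k₀)] at e3
        have e4 := TT_eq_sum hZo hY σ hf hg x y
        rw [e1, e2, TT_eq_sum hZo hY σ hf₂ hg, TT_eq_sum hZo hY σ hf₁ hg₂] at e4
        rw [e3, Finset.sum_sub_distrib]
        rw [add_sub_right_comm]
        exact congrArg _ e4.symm
      have hsum : ∀ (K : Finset ℤ) {w : ℤ → ℝ → ℂ} {c : ℤ → ℝ≥0∞},
          (∀ k, Measurable fun y => ‖w k y‖ₑ) → (∀ k ∈ K, qn s₂ ρ (fun y => ‖w k y‖ₑ) ≤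
            C₂ * (D * 512 * (D * 512) * M x) ^ ρ * c k) → ∑ k ∈ K, c k ≤ geo ρ →
          qn s₂ ρ (fun y => ∑ k ∈ K, ‖w k y‖ₑ) ≤ B * M x ^ ρ := fun K {w c} hw h hc => by
        refine (qn_sum_le hE.hst hρ hE.le_one.le hE.le_s K fun k _ => hw k).trans
          ((sum_le_sum h).trans ?_)
        rw [← mul_sum]
        exact hBM hc
      have hadd : ∀ {v w : ℝ → ℝ≥0∞}, Measurable v → Measurable w →
          qn s₂ ρ (fun y => v y + w y) ≤ qn s₂ ρ v + qn s₂ ρ w := fun hv hw =>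
        qn_add_le hE.hst hρ hE.le_one.le hE.le_s hv hw
      have m0 : Measurable fun y => ‖TT Z Y σ (S.indicator f) (S.indicator g) x y‖ₑ :=
        measurable_slice (hf₁.TT hZo hY σ hg₁).measurable_enorm x
      have m3 := (measurable_sum (X.K.filter (¬ · < k₀)) fun k _ => hUm hf₁ hg₂ k x).add m0
      have m2 := (measurable_sum (X.K.filter (¬ · < k₀)) fun k _ => hUm hf₂ hg k x).add m3
      have d1 : ∀ k, Measurable fun y => ‖UU X Y σ f g k x y - UU X Y σ f g k x₀ y‖ₑ :=
        fun k => ((((hf.UU hX hY σ hg k).1.comp_measurable (g := fun y => (x, y))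
          (by fun_prop)).sub ((hf.UU hX hY σ hg k).1.comp_measurable (g := fun y => (x₀, y))
          (by fun_prop)))).enorm
      have m1 := measurable_sum (X.K.filter (· < k₀)) fun k _ => d1 k
      refine (qn_mono hρ.le fun y => ?_).trans ((hadd m1 m2).trans (add_le_add le_rfl
        ((hadd (measurable_sum _ fun k _ => hUm hf₂ hg k x) m3).trans (add_le_add le_rfl
        (hadd (measurable_sum _ fun k _ => hUm hf₁ hg₂ k x) m0)))) |>.trans ?_)
      · rw [id]
        exact (enorm_add_le _ _).trans (add_le_add (enorm_sum_le _ _) ((enorm_add_le _ _).trans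
          (add_le_add (enorm_sum_le _ _) ((enorm_add_le _ _).trans
            (add_le_add (enorm_sum_le _ _) le_rfl)))))
      · change _ ≤ B * 3 * M x ^ ρ + _
        rw [show B * 3 * M x ^ ρ = B * M x ^ ρ + (B * M x ^ ρ + B * M x ^ ρ) by ring,
          add_assoc, add_assoc]
        refine add_le_add (hsum _ d1 (fun k hk => hc1 hx (mem_filter.1 hk).2)
          (sum_coarse_le X.K k₀ ρ)) (add_le_add
          (hsum _ (fun k => hUm hf₂ hg k x) (fun k hk => ?_) (sum_fine_le X.K k₀ ρ)) (add_le_add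
          (hsum _ (fun k => hUm hf₁ hg₂ k x) (fun k hk => ?_) (sum_fine_le X.K k₀ ρ)) le_rfl))
        · have hk' := not_lt.1 (mem_filter.1 hk).2
          refine hc2 hf₂ hg hk' ?_
          rw [hn_indicator hp0]
          exact (mul_le_mul' (hfar hmf hx hk') (hnear hmg k x)).trans (le_of_eq (by rw [hM]; ring))
        · have hk' := not_lt.1 (mem_filter.1 hk).2
          refine hc2 hf₁ hg₂ hk' ?_
          rw [hn_indicator hp0, hn_indicator hq0]
          refine (mul_le_mul' ((PP_mono (Set.indicator_le_self S _) x).trans (hnear hmf k x))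
            (hfar hmg hx hk')).trans (le_of_eq (by rw [hM]; ring))
    refine ⟨qn s₂ ρ fun y => ‖∑ k ∈ X.K with k < k₀, UU X Y σ f g k x₀ y‖ₑ, E,
      ((hMm.pow_const ρ).const_mul _).add (hT hZo hf₁ hg₁), fun x hx => ?_, fun y hy => ?_⟩
    · have hTx : StronglyMeasurable fun y => TT X Y σ f g x y :=
        (hf.TT hX hY σ hg).1.comp_measurable (g := fun y => (x, y)) (by fun_prop)
      have hUx : StronglyMeasurable fun y => ∑ k ∈ X.K with k < k₀, UU X Y σ f g k x₀ y :=
        Finset.stronglyMeasurable_fun_sum _ fun k _ =>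
          (hf.UU hX hY σ hg k).1.comp_measurable (g := fun y => (x₀, y)) (by fun_prop)
      have hk := key x hx
      refine ⟨?_, ?_⟩
      · exact (qn_mono hρ.le fun y => enorm_le_add_sub _ _).trans ((qn_add_le hE.hst hρ
          hE.le_one.le hE.le_s hUx.enorm (hTx.sub hUx).enorm).trans (add_le_add le_rfl hk))
      · refine (qn_mono hρ.le fun y => ?_).trans ((qn_add_le hE.hst hρ
          hE.le_one.le hE.le_s hTx.enorm (hTx.sub hUx).enorm).trans (add_le_add le_rfl hk))
        exact (enorm_le_add_sub _ _).trans (add_le_add le_rfl (enorm_sub_rev _ _).le)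
    · have hm1 : Measurable fun x => B * 3 * M x ^ ρ := (hMm.pow_const ρ).const_mul _
      rw [hEdef, lintegral_add_left hm1, mul_add, hG]
      refine add_le_add ?_ ?_
      · rw [lint_const_mul (by finiteness), mul_left_comm]
        refine mul_mono (le_trans (le_of_eq ?_)
          ((avg1_le_Md k₀ (fun x => M x ^ ρ) y).trans (Md_le_MM _ y)))
        rw [avg1, mem_cell.1 hy]
      · have hI : ∀ h : ℝ → ℝ≥0∞, 2 ^ k₀ * ∫⁻ x, S.indicator h x ^ (2 * ρ) ≤
            MM (fun a => h a ^ (2 * ρ)) y := fun h => by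
          refine le_trans (le_of_eq ?_) (avg3_le_MM k₀ (fun a => h a ^ (2 * ρ)) y)
          rw [avg3, mem_cell.1 hy, ← lintegral_indicator hSm]
          congr 1
          refine lintegral_congr fun x => ?_
          by_cases hx : x ∈ S
          · simp [hx]
          · simp [hx, hρ]
        have h2 : (2 : ℝ≥0∞) ^ k₀ = (2 ^ k₀ * 2 ^ k₀) ^ (1 / 2 : ℝ) := by
          rw [← sq, ← rpow_two, ← rpow_mul]
          norm_num
        calc _ ≤ 2 ^ k₀ * (C₃ * ((∫⁻ x, hn p₂ (S.indicator f) x ^ (2 * ρ)) *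
              ∫⁻ x, hn q₂ (S.indicator g) x ^ (2 * ρ)) ^ (1 / 2 : ℝ)) :=
              mul_mono ((setLIntegral_le_lintegral _ _).trans (hC₃ hZo hY hlam hf₁ hg₁))
          _ = C₃ * ((2 ^ k₀ * ∫⁻ x, S.indicator hf' x ^ (2 * ρ)) *
              (2 ^ k₀ * ∫⁻ x, S.indicator hg' x ^ (2 * ρ))) ^ (1 / 2 : ℝ) := by
            rw [hn_indicator hp0, hn_indicator hq0, mul_left_comm, mul_mul_mul_comm,
              mul_rpow_of_nonneg (2 ^ k₀ * 2 ^ k₀) _ (by norm_num), ← h2]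
          _ ≤ _ := mul_mono (rpow_le_rpow (mul_le_mul' (hI _) (hI _))
              (by norm_num))
  have hfinal : ∫⁻ x, (LqNorm volume s₂ fun y => ‖TT X Y σ f g x y‖ₑ) ^ s.toReal ≤
      W * (LqNorm volume p hf' * LqNorm volume q hg') ^ s.toReal := by
    have ht0 : 0 ≤ t := by linarith
    have e0 : ρ * t = s.toReal := by rw [ht]; field_simp
    simp only [qn, ← rpow_mul, e0] at hmain
    refine hmain.trans ?_
    rw [hW, mul_assoc]
    refine mul_mono ?_
    have h4 := hC₄ hf' hg' hmf hmg
    have h5 := hC₅ hf' hg' hmf hmg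
    set R := (LqNorm volume p hf' * LqNorm volume q hg') ^ s.toReal
    calc ∫⁻ x, G x ^ t ≤ ∫⁻ x, 2 ^ (t - 1) * ((B * 3) ^ t * MM (fun x => M x ^ ρ) x ^ t +
          (C₃ : ℝ≥0∞) ^ t * (MM (fun a => hf' a ^ (2 * ρ)) x *
            MM (fun a => hg' a ^ (2 * ρ)) x) ^ (s.toReal / (2 * ρ))) := by
          refine lintegral_mono fun x => (rpow_add_le_mul_rpow_add_rpow _ _
            ht1.le).trans (le_of_eq ?_)
          rw [mul_rpow ht0, mul_rpow_of_nonneg (C₃ : ℝ≥0∞) _ ht0,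
            ← rpow_mul, show 1 / 2 * t = s.toReal / (2 * ρ) by rw [ht]; field_simp]
      _ = 2 ^ (t - 1) * ((B * 3) ^ t * (∫⁻ x, MM (fun x => M x ^ ρ) x ^ t) +
          (C₃ : ℝ≥0∞) ^ t * ∫⁻ x, (MM (fun a => hf' a ^ (2 * ρ)) x *
            MM (fun a => hg' a ^ (2 * ρ)) x) ^ (s.toReal / (2 * ρ))) := by
          rw [lint_const_mul (by finiteness), lintegral_add_left
            (((measurable_MM _).pow_const _).const_mul _),
            lint_const_mul (by finiteness), lint_const_mul (by finiteness)]
      _ ≤ 2 ^ (t - 1) * ((B * 3) ^ t * (C₁ * (C₄ * R)) + (C₃ : ℝ≥0∞) ^ t * (C₅ * R)) := by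
          refine mul_mono (add_le_add (mul_mono ((hC₁ _
            (hMm.pow_const ρ)).trans (mul_mono (le_trans (le_of_eq ?_) h4))))
            (mul_mono h5))
          simp only [← rpow_mul, e0, hM]
      _ = _ := by ring
  have := rpow_le_rpow hfinal (by positivity : 0 ≤ 1 / s.toReal)
  rwa [mul_rpow_of_nonneg W _ (by positivity), ← rpow_mul _ s.toReal,
    mul_one_div_cancel hs0'.ne', rpow_one, ← LqNorm_of_ne_top hst] at this

open scoped FourierTransform SchwartzMap

lemma fourier_eq_ft1 (f : ℝ → ℂ) (ξ : ℝ) : 𝓕 f ξ = ft1 f ξ := by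
  rw [Real.fourier_real_eq_integral_exp_smul, ft1]
  refine int_congr fun x => ?_
  simp only [smul_eq_mul]
  rw [mul_comm]

/-- Affine changes of variables act on Schwartz functions and on their frequencies. -/
lemma exists_affine (u : 𝓢(ℝ, ℂ)) {s : ℝ} (hs : s ≠ 0) (b : ℝ) (c : ℂ) :
    ∃ v : 𝓢(ℝ, ℂ), (∀ t, v t = c * u (s * t + b)) ∧
      ∀ ξ, ft1 v ξ = |s⁻¹| • (c * exp ((2 * pi * b * (ξ / s) : ℝ) * I) *
        ft1 u (ξ / s)) := by
  have ha : AntilipschitzWith ‖s⁻¹‖₊ fun t : ℝ => s * t + b := by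
    refine AntilipschitzWith.of_le_mul_dist fun x y => le_of_eq ?_
    rw [Real.dist_eq, Real.dist_eq, coe_nnnorm, Real.norm_eq_abs, ← abs_mul]
    congr 1
    field_simp
    ring
  refine ⟨c • SchwartzMap.compCLMOfAntilipschitz ℂ (by fun_prop) ha u, fun t => rfl, fun ξ => ?_⟩
  have e : ft1 (⇑(c • SchwartzMap.compCLMOfAntilipschitz ℂ (by fun_prop) ha u)) ξ =
      ∫ x, (fun y => c * exp ((2 * pi * b * (ξ / s) : ℝ) * I) *
        (u y * exp ((-2 * pi * y * (ξ / s) : ℝ) * I))) (s * x + b) := by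
    refine int_congr fun x => ?_
    have e1 : exp ((-2 * pi * x * ξ : ℝ) * I) =
        exp ((2 * pi * b * (ξ / s) : ℝ) * I) *
        exp ((-2 * pi * (s * x + b) * (ξ / s) : ℝ) * I) := by
      rw [← Complex.exp_add, ← add_mul, ← Complex.ofReal_add]
      congr 3
      field_simp
      ring
    change c * u (s * x + b) * _ = _
    rw [e1]
    ring
  rw [e, Measure.integral_comp_mul_left (fun y => (fun y => c * exp
    ((2 * pi * b * (ξ / s) : ℝ) * I) * (u y * exp
    ((-2 * pi * y * (ξ / s) : ℝ) * I))) (y + b)) s,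
    integral_add_right_eq_self (fun y => c * exp ((2 * pi * b * (ξ / s) : ℝ) *
    I) * (u y * exp ((-2 * pi * y * (ξ / s) : ℝ) * I))) b,
    integral_const_mul]
  rfl

lemma exists_affine_support (u : 𝓢(ℝ, ℂ)) {s : ℝ} (hs : s ≠ 0) (b : ℝ) (c : ℂ) :
    ∃ v : 𝓢(ℝ, ℂ), (∀ t, v t = c * u (s * t + b)) ∧ ∀ ξ, ft1 u (ξ / s) = 0 → ft1 v ξ = 0 :=
  (exists_affine u hs b c).imp fun v hv => ⟨hv.1, fun ξ h => by
    rw [hv.2, h, mul_zero, smul_zero]⟩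

lemma exists_mul (u v : 𝓢(ℝ, ℂ)) {R S : ℝ} (hu : ∀ ξ, R ≤ |ξ| → ft1 u ξ = 0)
    (hv : ∀ ξ, S ≤ |ξ| → ft1 v ξ = 0) :
    ∃ w : 𝓢(ℝ, ℂ), (∀ t, w t = u t * v t) ∧ ∀ ξ, R + S ≤ |ξ| → ft1 w ξ = 0 := by
  refine ⟨SchwartzMap.pairing (ContinuousLinearMap.mul ℂ ℂ) u v, fun t => rfl, fun ξ hξ => ?_⟩
  have e : 𝓕⁻ (SchwartzMap.pairing (ContinuousLinearMap.mul ℂ ℂ) u v) =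
      SchwartzMap.convolution (ContinuousLinearMap.mul ℂ ℂ) (𝓕⁻ u) (𝓕⁻ v) := by
    rw [SchwartzMap.convolution]
    simp
  have hi (w : 𝓢(ℝ, ℂ)) (t : ℝ) : 𝓕⁻ w t = ft1 w (-t) := by
    rw [← fourier_eq_ft1, ← Real.fourierInv_eq_fourier_neg, SchwartzMap.fourierInv_coe]
  have := congrArg (fun w : 𝓢(ℝ, ℂ) => w (-ξ)) e
  simp only [hi, neg_neg] at this
  rw [this, SchwartzMap.convolution_apply]
  refine integral_eq_zero_of_ae (.of_forall fun t => ?_)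
  change 𝓕⁻ u t * 𝓕⁻ v (-ξ - t) = 0
  rw [hi, hi]
  by_cases ht : R ≤ |t|
  · rw [hu _ (by rwa [abs_neg]), zero_mul]
  · rw [hv _ ?_, mul_zero]
    have : |ξ| ≤ |t| + |-(-ξ - t)| := by
      have := abs_sub (-(-ξ - t)) t
      rw [show -(-ξ - t) - t = ξ by ring] at this
      linarith
    linarith

lemma exists_schwartz_le {E : Type*} [NormedAddCommGroup E] [NormedSpace ℝ E] (u : 𝓢(E, ℂ))
    (N n : ℕ) : ∃ C : ℝ, 0 ≤ C ∧ ∀ x, ‖iteratedFDeriv ℝ n u x‖ ≤ C * ((1 + ‖x‖) ^ N)⁻¹ := by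
  refine ⟨2 ^ N * (Finset.Iic (N, n)).sup (fun m => SchwartzMap.seminorm ℝ m.1 m.2) u,
    mul_nonneg (by positivity) (apply_nonneg _ _), fun x => ?_⟩
  rw [← div_eq_mul_inv, le_div_iff₀' (by positivity)]
  exact SchwartzMap.one_add_le_sup_seminorm_apply (𝕜 := ℝ) (m := (N, n)) le_rfl le_rfl u x

lemma exists_ker (u : 𝓢(ℝ, ℂ)) : ∃ A, Ker A u := by
  obtain ⟨C, hC0, hC⟩ := exists_schwartz_le u 16 0
  obtain ⟨D, hD0, hD⟩ := exists_schwartz_le u 16 1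
  refine ⟨C + 2 ^ 16 * D, u.continuous.measurable, fun x => ?_, fun x x' h => ?_⟩
  · have := hC x
    rw [norm_iteratedFDeriv_zero] at this
    exact this.trans (mul_le_mul_of_nonneg_right (by linarith) (wt_nonneg 16 x))
  · have hb : ∀ z ∈ Metric.closedBall x 1, ‖fderiv ℝ u z‖ ≤ D * (2 ^ 16 * wt 16 x) := by
      intro z hz
      have := hD z
      rw [norm_iteratedFDeriv_one] at this
      exact this.trans (mul_le_mul_of_nonneg_left (wt_shift_le 16 hz) hD0)
    have := Convex.norm_image_sub_le_of_norm_fderiv_le (𝕜 := ℝ)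
      (fun z _ => u.differentiable.differentiableAt) hb (convex_closedBall x 1)
      (x := x') (y := x) (by rwa [Metric.mem_closedBall, dist_comm]) (by simp)
    refine this.trans (le_trans (le_of_eq ?_) (mul_le_mul_of_nonneg_right
      (mul_le_mul_of_nonneg_right (le_add_of_nonneg_left hC0) (abs_nonneg _)) (wt_nonneg 16 x)))
    rw [Real.norm_eq_abs]
    ring

lemma integral_floor (u : 𝓢(ℝ, ℂ)) (hu : ∀ ξ, 1 ≤ |ξ| → ft1 u ξ = 0) :
    ∫ t : ℝ, u ⌊t⌋ = ∫ t, u t := by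
  have hm : Measurable fun t : ℝ => u ⌊t⌋ :=
    u.continuous.measurable.comp ((measurable_from_top (f := Int.cast)).comp Int.measurable_floor)
  obtain ⟨A, hA⟩ := exists_ker u
  have hI : Integrable fun t : ℝ => u ⌊t⌋ := by
    refine ((integrable_wt (N := 16) (by norm_num)).const_mul (A * 2 ^ 16)).mono'
      hm.aestronglyMeasurable (.of_forall fun t => (hA.size _).trans ?_)
    rw [mul_assoc]
    refine mul_le_mul_of_nonneg_left (wt_shift_le 16 ?_) hA.nonneg
    rw [abs_sub_comm, Int.self_sub_floor, abs_of_nonneg (Int.fract_nonneg t)]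
    exact (Int.fract_lt_one t).le
  have h := hasSum_integral_iUnion (f := fun t : ℝ => u ⌊t⌋) (μ := volume)
    (fun n : ℤ => measurableSet_Ico) (Set.pairwise_disjoint_Ico_intCast ℝ) hI.integrableOn
  rw [iUnion_Ico_intCast, setIntegral_univ] at h
  have hp := SchwartzMap.tsum_eq_tsum_fourier u 0
  rw [tsum_eq_single (f := fun n : ℤ => 𝓕 u n * _) 0] at hp
  · rw [← h.tsum_eq]
    have e (n : ℤ) : ∫ t in Set.Ico (n : ℝ) (n + 1), u ⌊t⌋ = u (0 + n) := by
      rw [setIntegral_congr_fun (g := fun _ => u n) measurableSet_Ico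
        fun t ht => by simp only [Int.floor_eq_iff.mpr ht]]
      simp
    simp only [e]
    rw [hp, SchwartzMap.fourier_coe, fourier_eq_ft1, ft1]
    simp
  · intro n hn
    rw [SchwartzMap.fourier_coe, fourier_eq_ft1, hu, zero_mul]
    rw [← Int.cast_abs]
    exact_mod_cast Int.one_le_abs hn

lemma integral_comp_zz (u : 𝓢(ℝ, ℂ)) (hu : ∀ ξ, 2 ^ (k + 3) ≤ |ξ| → ft1 u ξ = 0) :
    ∫ t, u (zz k t) = ∫ t, u t := by
  have h2 : (0 : ℝ) < 2 ^ (k + 3) := by positivity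
  obtain ⟨v, hv, hv'⟩ := exists_affine_support u (s := 2 ^ (-(k + 3))) (by positivity) 0 1
  have := integral_floor v fun ξ hξ => hv' ξ (hu _ ?_)
  · have e1 := Measure.integral_comp_mul_left (fun t => v t) (2 ^ (k + 3) : ℝ)
    have e2 := Measure.integral_comp_mul_left (fun t : ℝ => v ⌊t⌋) (2 ^ (k + 3) : ℝ)
    rw [this, ← e1] at e2
    simp only [hv, one_mul, add_zero] at e2
    refine e2.trans (int_congr fun t => ?_)
    simp only [← mul_assoc, ← zpow_add₀ (two_ne_zero' ℝ)]
    simp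
  · rw [_root_.zpow_neg, div_inv_eq_mul, abs_mul, abs_of_pos h2]
    exact le_mul_of_one_le_left h2.le hξ

lemma integral_dil_sampling {u v w : 𝓢(ℝ, ℂ)} (hu : ∀ ξ, 2 ≤ |ξ| → ft1 u ξ = 0)
    (hv : ∀ ξ, 2 ≤ |ξ| → ft1 v ξ = 0) (hw : ∀ ξ, 2 ≤ |ξ| → ft1 w ξ = 0) (k : ℤ) (x a b : ℝ) :
    ∫ t, dil u k (x - t) * (dil v k (t - a) * dil w k (t - b)) =
      ∫ t, dil u k (x - zz k t) * (dil v k (zz k t - a) * dil w k (zz k t - b)) := by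
  have h2 : (0 : ℝ) < 2 ^ k := by positivity
  have key (s : ℝ) (hs : |s| = 2 ^ k) (ξ : ℝ) (hξ : 2 * 2 ^ k ≤ |ξ|) : 2 ≤ |ξ / s| := by
    rwa [abs_div, hs, le_div_iff₀ h2]
  obtain ⟨u', hu1, hu2⟩ := exists_affine_support u (s := -2 ^ k) (neg_ne_zero.mpr h2.ne') (2 ^ k * x) (2 ^ k)
  obtain ⟨v', hv1, hv2⟩ := exists_affine_support v h2.ne' (-(2 ^ k * a)) (2 ^ k)
  obtain ⟨w', hw1, hw2⟩ := exists_affine_support w h2.ne' (-(2 ^ k * b)) (2 ^ k)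
  obtain ⟨m, hm1, hm2⟩ := exists_mul v' w' (fun ξ hξ => hv2 ξ (hv _ (key _ (abs_of_pos h2) ξ hξ)))
    fun ξ hξ => hw2 ξ (hw _ (key _ (abs_of_pos h2) ξ hξ))
  obtain ⟨n, hn1, hn2⟩ := exists_mul u' m
    (fun ξ hξ => hu2 ξ (hu _ (key _ (by rw [abs_neg, abs_of_pos h2]) ξ hξ))) hm2
  have e (t : ℝ) : dil u k (x - t) * (dil v k (t - a) * dil w k (t - b)) = n t := by
    rw [hn1, hm1, hu1, hv1, hw1, dil, dil, dil]
    ring_nf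
  simp only [e]
  refine (integral_comp_zz n fun ξ hξ => hn2 ξ (le_trans ?_ hξ)).symm
  rw [zpow_add₀ two_ne_zero]
  norm_num
  linarith

lemma KerOp.integral_op_mul_op {B C : ℝ} {κ₁ κ₂ κ₃ : ℤ → ℝ → ℝ → ℂ} (h₁ : KerOp A κ₁)
    (h₂ : KerOp B κ₂) (h₃ : KerOp C κ₃) (k : ℤ) {F G : ℝ → ℂ} (hF : Dec F) (hG : Dec G) (x : ℝ) :
    op (κ₁ k) (fun t => op (κ₂ k) F t * op (κ₃ k) G t) x =
      ∫ p : ℝ × ℝ, F p.1 * G p.2 * ∫ t, κ₁ k x t * (κ₂ k t p.1 * κ₃ k t p.2) := by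
  have h1 : Integrable fun t => κ₁ k x t := by
    have hw : Integrable fun t => wt 8 (2 ^ k * (x - t)) :=
      ((integrable_wt (N := 8) (by norm_num)).comp_mul_left' (by positivity)).comp_sub_left x
    exact ((hw.const_mul _).const_mul A).mono'
      ((h₁.meas k).comp measurable_prodMk_left).aestronglyMeasurable (.of_forall (h₁.size k x))
  have hm : Measurable fun q : ℝ × (ℝ × ℝ) => κ₂ k q.1 q.2.1 * κ₃ k q.1 q.2.2 :=
    ((h₂.meas k).comp (measurable_fst.prodMk measurable_snd.fst)).mul
      ((h₃.meas k).comp (measurable_fst.prodMk measurable_snd.snd))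
  have hI := (h1.mul_prod (hF.integrable.mul_prod hG.integrable)).bdd_mul
    (f := fun q : ℝ × (ℝ × ℝ) => κ₂ k q.1 q.2.1 * κ₃ k q.1 q.2.2)
    (c := B * 2 ^ k * (C * 2 ^ k)) hm.aestronglyMeasurable (.of_forall fun q => by
      rw [norm_mul]
      exact mul_le_mul (h₂.norm_le k _ _) (h₃.norm_le k _ _) (norm_nonneg _)
        ((norm_nonneg _).trans (h₂.norm_le k 0 0)))
  calc _ = ∫ t, ∫ p : ℝ × ℝ, κ₂ k t p.1 * κ₃ k t p.2 * (κ₁ k x t * (F p.1 * G p.2)) := by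
        refine int_congr fun t => ?_
        simp only [op, smul_eq_mul]
        rw [← integral_prod_mul, ← integral_const_mul]
        refine int_congr fun p => ?_
        ring
    _ = _ := by
        rw [integral_integral_swap hI]
        refine int_congr fun p => ?_
        rw [← integral_const_mul]
        refine int_congr fun t => ?_
        ring

/-- The sampling identity: band-limited products may be integrated over a dyadic grid. -/
lemma op_sampling {u v w : 𝓢(ℝ, ℂ)} (hu : ∀ ξ, 2 ≤ |ξ| → ft1 u ξ = 0)
    (hv : ∀ ξ, 2 ≤ |ξ| → ft1 v ξ = 0) (hw : ∀ ξ, 2 ≤ |ξ| → ft1 w ξ = 0) (k : ℤ) {F G : ℝ → ℂ}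
    (hF : Dec F) (hG : Dec G) (x : ℝ) :
    op (fun x a => dil u k (x - a)) (fun t => op (fun x a => dil v k (x - a)) F t *
      op (fun x a => dil w k (x - a)) G t) x =
      op (kS u k) (fun t => op (kA v k) F t * op (kA w k) G t) x := by
  obtain ⟨A, hA⟩ := exists_ker u
  obtain ⟨B, hB⟩ := exists_ker v
  obtain ⟨C, hC⟩ := exists_ker w
  rw [hA.kC.integral_op_mul_op hB.kC hC.kC k hF hG, hA.kS.integral_op_mul_op hB.kA hC.kA k hF hG]
  simp only [integral_dil_sampling hu hv hw, BiPara.kS, BiPara.kA]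

lemma orth_of_fourier {u : 𝓢(ℝ, ℂ)} (h1 : ∀ ξ, |ξ| ≤ 1 / 2 → ft1 u ξ = 0)
    (h2 : ∀ ξ, 2 ≤ |ξ| → ft1 u ξ = 0) (K : Finset ℤ) : Orth u K := by
  intro j _ k _ hjk z w
  obtain ⟨v, hv, hv'⟩ := exists_affine_support u (s := 2 ^ k) (by positivity) (-(2 ^ k * z)) (2 ^ k)
  obtain ⟨v', hw, hw'⟩ := exists_affine_support u (s := 2 ^ j) (by positivity) (-(2 ^ j * w)) (2 ^ j)
  have := SchwartzMap.integral_inner_fourier_fourier v' v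
  rw [integral_eq_zero_of_ae (.of_forall fun ξ => ?_)] at this
  · refine Eq.trans (int_congr fun x => ?_) this.symm
    simp only [RCLike.inner_apply, hv, hw, dil]
    ring_nf
  · simp only [SchwartzMap.fourier_coe, fourier_eq_ft1, RCLike.inner_apply]
    have key {i l : ℤ} (hil : i + 2 ≤ l) : ft1 u (ξ / 2 ^ i) = 0 ∨ ft1 u (ξ / 2 ^ l) = 0 := by
      refine (le_total 2 |ξ / 2 ^ i|).imp (h2 _) fun h => h1 _ ?_
      rw [abs_div, abs_of_pos (by positivity : (0 : ℝ) < 2 ^ i), div_le_iff₀ (by positivity)] at h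
      rw [abs_div, abs_of_pos (by positivity : (0 : ℝ) < 2 ^ l), div_le_iff₀ (by positivity)]
      have : (2 : ℝ) ^ (i + 2) ≤ 2 ^ l := zpow_le_zpow_right₀ (by norm_num) hil
      rw [zpow_add₀ two_ne_zero] at this
      norm_num at this
      linarith
    rcases le_abs.mp hjk with h | h
    · rcases key (i := k) (l := j) (by omega) with h | h
      · simp [hv' ξ h]
      · simp [hw' ξ h]
    · rcases key (i := j) (l := k) (by omega) with h | h
      · simp [hw' ξ h]
      · simp [hv' ξ h]

lemma exists_psiOf (φ : 𝓢(ℝ, ℂ)) (h1 : ∀ ξ : ℝ, |ξ| ≤ 1 / 2 → ft1 φ ξ = 1)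
    (h2 : ∀ ξ : ℝ, 1 ≤ |ξ| → ft1 φ ξ = 0) :
    ∃ ψ : 𝓢(ℝ, ℂ), (ψ : ℝ → ℂ) = psiOf φ ∧ (∀ ξ, |ξ| ≤ 1 / 2 → ft1 ψ ξ = 0) ∧
      ∀ ξ, 2 ≤ |ξ| → ft1 ψ ξ = 0 := by
  obtain ⟨v, hv, hv'⟩ := exists_affine φ (s := 2) two_ne_zero 0 2
  have e (ξ : ℝ) : ft1 (⇑(v - φ)) ξ = ft1 φ (ξ / 2) - ft1 φ ξ := by
    have hs : ft1 (⇑(v - φ)) ξ = ft1 v ξ - ft1 φ ξ := by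
      have := congrArg (fun w : 𝓢(ℝ, ℂ) => w ξ) (show 𝓕 (v - φ) = 𝓕 v - 𝓕 φ by
        simp [sub_eq_add_neg])
      simpa only [SchwartzMap.fourier_coe, fourier_eq_ft1, sub_apply] using this
    rw [hs, hv']
    simp
  have a2 (ξ : ℝ) : |ξ / 2| = |ξ| / 2 := by rw [abs_div, abs_two]
  refine ⟨v - φ, ?_, fun ξ hξ => ?_, fun ξ hξ => ?_⟩
  · ext x
    change v x - φ x = _
    rw [hv, add_zero, psiOf]
  · rw [e, h1 _ hξ, h1 _ (by rw [a2]; linarith [abs_nonneg ξ]), sub_self]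
  · rw [e, h2 ξ (by linarith), h2 _ (by rw [a2]; linarith), sub_self]

lemma dec2_schwartz (f : 𝓢(ℝ × ℝ, ℂ)) : Dec2 fun x y => f (x, y) := by
  obtain ⟨C, hC, h⟩ := exists_schwartz_le f 4 0
  refine ⟨f.continuous.stronglyMeasurable, C, fun x y => (le_of_eq ?_).trans ((h (x, y)).trans
    (mul_le_mul_of_nonneg_left ?_ hC))⟩
  · rw [norm_iteratedFDeriv_zero]
  · rw [wt, wt, ← mul_inv]
    refine inv_anti₀ (by positivity) ?_
    have hx : 1 + |x| ≤ 1 + ‖(x, y)‖ := by simp [Prod.norm_def]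
    have hy : 1 + |y| ≤ 1 + ‖(x, y)‖ := by simp [Prod.norm_def]
    calc _ ≤ (1 + ‖(x, y)‖) ^ 2 * (1 + ‖(x, y)‖) ^ 2 := by gcongr
      _ = _ := by ring

lemma conv2_tens (hη : Ker A η) (hθ : Ker A θ) (k l : ℤ) (hF : Dec2 F) (x y : ℝ) :
    conv2 (fun z => F z.1 z.2) (tens (dil η k) (dil θ l)) (x, y) =
      opx (fun x a => dil η k (x - a)) (opy (fun x a => dil θ l (x - a)) F) x y := by
  have hm : Measurable fun t : ℝ × ℝ => dil η k (x - t.1) * dil θ l (y - t.2) :=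
    ((measurable_dil hη.meas k).comp (measurable_const.sub measurable_fst)).mul
      ((measurable_dil hθ.meas l).comp (measurable_const.sub measurable_snd))
  have hI := hF.integrable.bdd_mul (c := 2 ^ 8 * A * 2 ^ k * (2 ^ 8 * A * 2 ^ l))
    hm.aestronglyMeasurable (.of_forall fun q => by
      rw [norm_mul]
      exact mul_le_mul (hη.kC.norm_le k x _) (hθ.kC.norm_le l y _) (norm_nonneg _)
        ((norm_nonneg _).trans (hη.kC.norm_le k 0 0)))
  have e : conv2 (fun z => F z.1 z.2) (tens (dil η k) (dil θ l)) (x, y) =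
      ∫ t : ℝ × ℝ, dil η k (x - t.1) * dil θ l (y - t.2) * uncurry F t :=
    int_congr fun t => mul_comm _ _
  rw [e, Measure.volume_eq_prod, integral_prod _ hI]
  refine int_congr fun a => ?_
  simp only [opy, op, smul_eq_mul, uncurry, mul_assoc]
  rw [integral_const_mul]

lemma syn_sampling {u v w : 𝓢(ℝ, ℂ)} (hu : ∀ ξ, 2 ≤ |ξ| → ft1 u ξ = 0)
    (hv : ∀ ξ, 2 ≤ |ξ| → ft1 v ξ = 0) (hw : ∀ ξ, 2 ≤ |ξ| → ft1 w ξ = 0) (k l : ℤ) (hF : Dec2 F)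
    (hG : Dec2 G) : opx (fun x a => dil u k (x - a)) (opy (fun x a => dil u l (x - a)) fun a b =>
      opx (fun x a => dil v k (x - a)) (opy (fun x a => dil v l (x - a)) F) a b *
      opx (fun x a => dil w k (x - a)) (opy (fun x a => dil w l (x - a)) G) a b) =
    syn u u k l fun a b => ana v v k l F a b * ana w w k l G a b := by
  obtain ⟨A, hA⟩ := exists_ker u
  obtain ⟨B, hB⟩ := exists_ker v
  obtain ⟨C, hC⟩ := exists_ker w
  have hF1 := hF.opy hB.kC l
  have hG1 := hG.opy hC.kC l
  rw [opx_opy_comm hA.kC hA.kC k l ((hF1.opx hB.kC k).mul (hG1.opx hC.kC k))]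
  have e1 : (opx (fun x a => dil u k (x - a)) fun a b =>
      opx (fun x a => dil v k (x - a)) (opy (fun x a => dil v l (x - a)) F) a b *
      opx (fun x a => dil w k (x - a)) (opy (fun x a => dil w l (x - a)) G) a b) =
      opx (kS u k) fun a b => opx (kA v k) (opy (fun x a => dil v l (x - a)) F) a b *
        opx (kA w k) (opy (fun x a => dil w l (x - a)) G) a b := by
    ext x b
    exact op_sampling hu hv hw k (hF1.right b) (hG1.right b) x
  rw [e1, ← opx_opy_comm hA.kS hA.kC k l ((hF1.opx hB.kA k).mul (hG1.opx hC.kA k)),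
    opx_opy_comm hB.kA hB.kC k l hF, opx_opy_comm hC.kA hC.kC k l hG]
  refine congrArg (opx (kS u k)) ?_
  ext a y
  exact op_sampling hu hv hw l ((hF.opx hB.kA k).left a) ((hG.opx hC.kA k).left a) y

lemma biPara_eq_TT {φ ψ : 𝓢(ℝ, ℂ)} (hψ : (ψ : ℝ → ℂ) = psiOf φ) (h1 : ∀ ξ, 2 ≤ |ξ| → ft1 φ ξ = 0)
    (h2 : ∀ ξ, 2 ≤ |ξ| → ft1 ψ ξ = 0) (Λ : Finset (ℤ × ℤ)) (f g : 𝓢(ℝ × ℝ, ℂ)) (x y : ℝ) :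
    biPara φ Λ f g (x, y) = TT ⟨φ, ψ, ψ, Λ.image Prod.fst⟩ ⟨φ, ψ, ψ, Λ.image Prod.snd⟩
      (fun k l => if (k, l) ∈ Λ then 1 else 0) (fun x y => f (x, y)) (fun x y => g (x, y)) x y := by
  obtain ⟨A, hA⟩ := exists_ker φ
  obtain ⟨B, hB⟩ := exists_ker ψ
  have hf := dec2_schwartz f
  have hg := dec2_schwartz g
  rw [TT, ← Finset.sum_product', ← Finset.sum_subset (s₁ := Λ)]
  · rw [biPara]
    refine sum_congr rfl fun kl hkl => ?_
    have e1 (w : ℝ × ℝ) := conv2_tens hA hA kl.1 kl.2 hf w.1 w.2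
    have e2 (w : ℝ × ℝ) := conv2_tens hB hB kl.1 kl.2 hg w.1 w.2
    simp only [Prod.mk.eta] at e1 e2
    rw [← hψ]
    simp only [e1, e2]
    rw [conv2_tens hB hB kl.1 kl.2
      (((hf.opy hA.kC kl.2).opx hA.kC kl.1).mul ((hg.opy hB.kC kl.2).opx hB.kC kl.1)),
      syn_sampling h2 h1 h2 kl.1 kl.2 hf hg]
    unfold mid
    simp only [Prod.mk.eta, if_pos hkl, one_mul]
  · exact fun kl h => Finset.mem_product.2 ⟨Finset.mem_image_of_mem _ h, Finset.mem_image_of_mem _ h⟩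
  · intro kl _ h
    unfold mid
    simp [if_neg h, syn, opx, opy, op]

end

end BiPara

open BiPara MeasureTheory ENNReal NNReal

/-- Mixed norm estimates for the model biparameter paraproduct:
`Π ⊗ Π : L^{p₁}_x L^{p₂}_y × L^{q₁}_x L^{q₂}_y → L^{s₁}_x L^{s₂}_y`. -/
theorem biparameter_paraproduct_mixed_norm (φ : SchwartzMap ℝ ℂ)
    (hφ₁ : ∀ ξ : ℝ, |ξ| ≤ 1 / 2 → ft1 (⇑φ) ξ = 1) (hφ₂ : ∀ ξ : ℝ, 1 ≤ |ξ| → ft1 (⇑φ) ξ = 0)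
    (p₁ p₂ q₁ q₂ s₁ s₂ : ℝ≥0∞) (hp₁ : 1 < p₁) (hp₂ : 1 < p₂) (hq₁ : 1 < q₁) (hq₂ : 1 < q₂)
    (hs₁ : 1 / 2 < s₁) (hs₁' : s₁ < ∞) (hs₂ : 1 / 2 < s₂) (hs₂' : s₂ < ∞)
    (hH₁ : s₁⁻¹ = p₁⁻¹ + q₁⁻¹) (hH₂ : s₂⁻¹ = p₂⁻¹ + q₂⁻¹) :
    ∃ C : ℝ≥0, ∀ (Λ : Finset (ℤ × ℤ)) (f g : SchwartzMap (ℝ × ℝ) ℂ),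
      mixedNorm s₁ s₂ (biPara (⇑φ) Λ (⇑f) (⇑g)) ≤
        (C : ℝ≥0∞) * mixedNorm p₁ p₂ (⇑f) * mixedNorm q₁ q₂ (⇑g) := by
  have hr {t : ℝ} (ht : 1 < t) : ∀ᶠ M in nhdsWithin (1 : ℝ) (Set.Ioi 1), M ≤ t :=
    nhdsWithin_le_nhds (eventually_le_nhds ht)
  have hx {t : ℝ≥0∞} (ht : 1 < t) : ∀ᶠ M in nhdsWithin (1 : ℝ) (Set.Ioi 1), t = ∞ ∨ M ≤ t.toReal := by
    by_cases h : t = ∞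
    · simp [h]
    · exact (hr (by simpa using toReal_strict_mono h ht)).mono fun M => Or.inr
  have hh {s : ℝ≥0∞} (h : 1 / 2 < s) (h' : s < ∞) : 1 < 2 * s.toReal := by
    have := toReal_strict_mono h'.ne h
    simp at this
    linarith
  obtain ⟨M, ⟨⟨⟨⟨⟨⟨⟨m1, m2⟩, m3⟩, m4⟩, m5⟩, m6⟩, m7⟩, m8⟩⟩ := ((((((((hx hp₁).and (hx hp₂)).and
    (hx hq₁)).and (hx hq₂)).and (hr (hh hs₁ hs₁'))).and (hr (hh hs₂ hs₂'))).and
    (hr one_lt_two)).and self_mem_nhdsWithin).exists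
  obtain ⟨ψ, hψ, ψ1, ψ2⟩ := exists_psiOf φ hφ₁ hφ₂
  obtain ⟨A, hA⟩ := exists_ker φ
  obtain ⟨B, hB⟩ := exists_ker ψ
  have hE : Expo s₂ p₂ q₂ ((1 + M) / 4) :=
    ⟨hH₂, hp₂, hq₂, hs₂'.ne, by linarith, by linarith, by linarith⟩
  obtain ⟨C, hC⟩ := mixed_TT_le hE (e := M) (by linarith) m2 m4 hH₁ hs₁'.ne (by linarith)
    (m1.imp_right fun h => by linarith) (m3.imp_right fun h => by linarith) (max A B)
  refine ⟨C, fun Λ f g => ?_⟩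
  have ok (K : Finset ℤ) : Sys.Ok (max A B) ⟨φ, ψ, ψ, K⟩ :=
    ⟨hA.mono (le_max_left _ _), hB.mono (le_max_right _ _), hB.mono (le_max_right _ _),
      orth_of_fourier ψ1 ψ2 K, orth_of_fourier ψ1 ψ2 K⟩
  have := hC (ok (Λ.image Prod.fst)) (ok (Λ.image Prod.snd))
    (σ := fun k l => if (k, l) ∈ Λ then 1 else 0) (fun k l => by split_ifs <;> simp)
    (dec2_schwartz f) (dec2_schwartz g)
  simp only [← biPara_eq_TT hψ (fun ξ h => hφ₂ ξ (by linarith)) ψ2] at this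
  rw [mul_assoc]
  exact this
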